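/- (Decay at a corner point on the symmetry hyperplane.) Let D ⊂ ℝ^d, d ≥ 2, be an open bounded set with C² boundary and let u be a viscosity solution of Ψ(−Δ)u = 1 in D with u = 0 in ℝ^d∖D and tr_V(u) = c on ∂D for a constant c ∈ ℝ. Assume (after translation and rotation) that 0 ∈ ∂D, that the hyperplane T = {x₁ = 0} is orthogonal to ∂D at 0, and that e₂ is the interior unit normal to ∂D at 0. Set v(x) = u(x) − u(R(x)), where R(x₁,x') = (−x₁,x'), and η̄ = e₂ − e₁ = (−1,1,0,…,0). Then v(tη̄) = o(V(t)·t) as t → 0⁺. -/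

import Mathlib

open MeasureTheory Set Filter Metric Asymptotics
open scoped RealInnerProductSpace ENNReal Topology NNReal

noncomputable section

abbrev Rd (d : ℕ) := EuclideanSpace ℝ (Fin d)

/-- The data of a Bernstein function `Ψ` vanishing at `0`, its Lévy measure `𝔪`,
and the weak scaling conditions. -/
structure PsiSetting (d : ℕ) where
  Ψ : ℝ → ℝ
  m : Measure ℝ
  m_onIoi : m (Set.Iic 0) = 0
  smooth : ContDiffOn ℝ (⊤ : ℕ∞) Ψ (Set.Ioi 0)
  nonneg : ∀ x > (0:ℝ), 0 ≤ Ψ x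
  deriv_alt : ∀ n : ℕ, ∀ x > (0:ℝ),
    (-1 : ℝ) ^ (n + 1) * iteratedDerivWithin (n + 1) Ψ (Set.Ioi 0) x ≤ 0
  zero_lim : Filter.Tendsto Ψ (nhdsWithin 0 (Set.Ioi 0)) (nhds 0)
  levy_rep : ∀ lam > (0:ℝ), Ψ lam = ∫ t, (1 - Real.exp (-lam * t)) ∂m
  a₁ : ℝ
  a₂ : ℝ
  b₁ : ℝ
  b₂ : ℝ
  ha₁ : 0 < a₁
  ha₁₂ : a₁ ≤ a₂
  ha₂ : a₂ < 1
  hb₁ : 1 ≤ b₁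
  hb₂ : 1 < b₂
  scaling_lower : ∀ r R : ℝ, 1 ≤ r → r ≤ R → (1 / b₁) * (R / r) ^ a₁ ≤ Ψ R / Ψ r
  scaling_upper : ∀ r R : ℝ, 1 ≤ r → r ≤ R → Ψ R / Ψ r ≤ b₁ * (R / r) ^ a₂

/-- The jump kernel `j(r) = ∫_0^∞ (4πt)^{-d/2} e^{-r²/(4t)} 𝔪(dt)`. -/
def PsiSetting.j {d : ℕ} (S : PsiSetting d) (r : ℝ) : ℝ :=
  ∫ t, (4 * Real.pi * t) ^ (-(d : ℝ) / 2) * Real.exp (-(r ^ 2) / (4 * t)) ∂S.m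

/-- The condition `j(r) ≤ b₂ j(r+1)` for `r ≥ 1`. -/
def PsiSetting.kernelCond {d : ℕ} (S : PsiSetting d) : Prop :=
  ∀ r : ℝ, 1 ≤ r → S.j r ≤ S.b₂ * S.j (r + 1)

/-- The nonlocal operator `Ψ(−Δ)` applied to a test function. -/
def psiOp {d : ℕ} (S : PsiSetting d) (φ : Rd d → ℝ) (x : Rd d) : ℝ :=
  ∫ z : Rd d,
    (φ x - φ (x + z) + (if ‖z‖ ≤ 1 then ⟪z, gradient φ x⟫ else 0)) * S.j ‖z‖

/-- Admissible test functions at `x`: bounded continuous and C² near `x`. -/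
def TestAt {d : ℕ} (x : Rd d) (φ : Rd d → ℝ) : Prop :=
  (∃ M, ∀ y, |φ y| ≤ M) ∧ Continuous φ ∧ ∃ U ∈ nhds x, ContDiffOn ℝ 2 φ U

/-- Viscosity supersolution of `Ψ(−Δ)u + c·u = g` in `Ω`. -/
def IsSuperSol {d : ℕ} (S : PsiSetting d) (Ω : Set (Rd d)) (c g u : Rd d → ℝ) : Prop :=
  LowerSemicontinuous u ∧
    ∀ x ∈ Ω, ∀ φ : Rd d → ℝ, TestAt x φ → φ x = u x → (∀ y, y ≠ x → φ y < u y) →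
      g x ≤ psiOp S φ x + c x * u x

/-- Viscosity subsolution of `Ψ(−Δ)u + c·u = g` in `Ω`. -/
def IsSubSol {d : ℕ} (S : PsiSetting d) (Ω : Set (Rd d)) (c g u : Rd d → ℝ) : Prop :=
  UpperSemicontinuous u ∧
    ∀ x ∈ Ω, ∀ φ : Rd d → ℝ, TestAt x φ → φ x = u x → (∀ y, y ≠ x → u y < φ y) →
      psiOp S φ x + c x * u x ≤ g x

/-- Viscosity solution of `Ψ(−Δ)u + c·u = g` in `Ω`. -/
def IsSol {d : ℕ} (S : PsiSetting d) (Ω : Set (Rd d)) (c g u : Rd d → ℝ) : Prop :=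
  IsSubSol S Ω c g u ∧ IsSuperSol S Ω c g u

/-- `V` is the renewal function of the ascending ladder-height process associated with `Ψ`. -/
structure IsRenewal (Ψ V : ℝ → ℝ) : Prop where
  nonneg : ∀ x, 0 ≤ V x
  zero : ∀ x ≤ (0:ℝ), V x = 0
  cont : ContinuousOn V (Set.Ioi 0)
  mono : StrictMonoOn V (Set.Ioi 0)
  laplace : ∀ s : ℝ, 0 < s →
    (∫ x in Set.Ioi (0 : ℝ), V x * Real.exp (-s * x)) =
      1 / (s * Real.exp ((1 / Real.pi) *
        ∫ y in Set.Ioi (0 : ℝ), Real.log (Ψ (s * y)) / (1 + y ^ 2)))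

/-- `tr_V(u)(x) = t`: the `V`-trace of `u` at the boundary point `x` of `D`. -/
def HasVTrace {d : ℕ} (V : ℝ → ℝ) (D : Set (Rd d)) (u : Rd d → ℝ)
    (x : Rd d) (t : ℝ) : Prop :=
  Filter.Tendsto (fun z => u z / V (Metric.infDist z Dᶜ)) (nhdsWithin x D) (nhds t)

/-- An open set has C² boundary. -/
def HasC2Boundary {d : ℕ} (D : Set (Rd d)) : Prop :=
  ∀ x ∈ frontier D, ∃ (U : Set (Rd d)) (f : Rd d → ℝ),
    IsOpen U ∧ x ∈ U ∧ ContDiffOn ℝ 2 f U ∧ (∀ y ∈ U, fderiv ℝ f y ≠ 0) ∧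
      D ∩ U = {y ∈ U | f y < 0}

/-- A closed set has C² boundary. -/
def HasC2BoundaryClosed {d : ℕ} (G : Set (Rd d)) : Prop :=
  ∀ x ∈ frontier G, ∃ (U : Set (Rd d)) (f : Rd d → ℝ),
    IsOpen U ∧ x ∈ U ∧ ContDiffOn ℝ 2 f U ∧ (∀ y ∈ U, fderiv ℝ f y ≠ 0) ∧
      G ∩ U = {y ∈ U | f y ≤ 0}

/-- Reflection `R_{λ,e}` across the hyperplane `{x·e = λ}`. -/
def reflAt {d : ℕ} (e : Rd d) (lam : ℝ) (x : Rd d) : Rd d :=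
  x - (2 * ⟪x, e⟫ - 2 * lam) • e

/-- The open half-space `H_{λ,e} = {x·e > λ}`. -/
def halfSpace {d : ℕ} (e : Rd d) (lam : ℝ) : Set (Rd d) := {x | lam < ⟪x, e⟫}

/-- A function is antisymmetric with respect to the half-space `H_{λ,e}`. -/
def AntiSym {d : ℕ} (e : Rd d) (lam : ℝ) (u : Rd d → ℝ) : Prop :=
  ∀ x, u x = - u (reflAt e lam x)

section

open scoped Real
open Real (exp log norm_of_nonneg norm_eq_abs sqrt_pos sq_sqrt exp_pos rpow_natCast rpow_mul)
open ENNReal (ofReal ofReal_le_ofReal ofReal_mul ofReal_add ofReal_lt_top)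

variable {d : ℕ}

/-- Convolution of a function with an even kernel. -/
def convJ (J w : Rd d → ℝ) (x : Rd d) : ℝ := ∫ z, w (x + z) * J z

/-- The bounded nonlocal operator with integrable jump kernel `J`. -/
def Lop (J w : Rd d → ℝ) (x : Rd d) : ℝ := (∫ z, J z) * w x - convJ J w x

/-- Measurable and bounded functions. -/
def BddMeas (w : Rd d → ℝ) : Prop := Measurable w ∧ ∃ M, ∀ x, |w x| ≤ M

/-- Nonnegative, integrable, measurable kernels that are radially nonincreasing. -/
structure GoodKer (J : Rd d → ℝ) : Prop where
  nonneg : ∀ z, 0 ≤ J z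
  meas : Measurable J
  int : Integrable J
  anti : ∀ x y, ‖x‖ ≤ ‖y‖ → J y ≤ J x

namespace BddMeas

lemma add {f g : Rd d → ℝ} (hf : BddMeas f) (hg : BddMeas g) : BddMeas (fun x => f x + g x) := by
  obtain ⟨hf, M, hM⟩ := hf
  obtain ⟨hg, N, hN⟩ := hg
  exact ⟨hf.add hg, M + N, fun x => (abs_add_le _ _).trans (add_le_add (hM x) (hN x))⟩

lemma const_mul {f : Rd d → ℝ} (c : ℝ) (hf : BddMeas f) : BddMeas (fun x => c * f x) := by
  obtain ⟨hf, M, hM⟩ := hf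
  refine ⟨hf.const_mul c, |c| * M, fun x => ?_⟩
  rw [abs_mul]
  exact mul_le_mul_of_nonneg_left (hM x) (abs_nonneg _)

lemma sub {f g : Rd d → ℝ} (hf : BddMeas f) (hg : BddMeas g) : BddMeas (fun x => f x - g x) := by
  have := hf.add (hg.const_mul (-1))
  simpa [sub_eq_add_neg] using this

lemma mul {f g : Rd d → ℝ} (hf : BddMeas f) (hg : BddMeas g) : BddMeas (fun x => f x * g x) := by
  obtain ⟨hf, M, hM⟩ := hf
  obtain ⟨hg, N, hN⟩ := hg
  refine ⟨hf.mul hg, M * N, fun x => ?_⟩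
  rw [abs_mul]
  exact mul_le_mul (hM x) (hN x) (abs_nonneg _) ((abs_nonneg _).trans (hM x))

lemma const (c : ℝ) : BddMeas (fun _ : Rd d => c) := ⟨measurable_const, |c|, fun _ => le_rfl⟩

lemma comp {f : Rd d → ℝ} (hf : BddMeas f) {T : Rd d → Rd d} (hT : Measurable T) :
    BddMeas (fun x => f (T x)) :=
  ⟨hf.1.comp hT, hf.2.imp fun _ h x => h _⟩

lemma indicator {f : Rd d → ℝ} (hf : BddMeas f) {A : Set (Rd d)} (hA : MeasurableSet A) :
    BddMeas (A.indicator f) := by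
  obtain ⟨hf, M, hM⟩ := hf
  refine ⟨hf.indicator hA, M, fun x => ?_⟩
  by_cases hx : x ∈ A
  · simpa [hx] using hM x
  · simpa [hx] using (abs_nonneg _).trans (hM x)

lemma mul_integrable {f J : Rd d → ℝ} (hf : BddMeas f) (hJ : Integrable J) :
    Integrable (fun z => f z * J z) := by
  obtain ⟨hf, M, hM⟩ := hf
  exact hJ.bdd_mul (c := M) hf.aestronglyMeasurable (Eventually.of_forall fun z => by simpa using hM z)

end BddMeas

namespace GoodKer

variable {J : Rd d → ℝ}

lemma even (hJ : GoodKer J) (z : Rd d) : J (-z) = J z :=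
  le_antisymm (hJ.anti _ _ (by simp)) (hJ.anti _ _ (by simp))

lemma mass_nonneg (hJ : GoodKer J) : 0 ≤ ∫ z, J z := integral_nonneg hJ.nonneg

lemma integrable_shift (hJ : GoodKer J) {w : Rd d → ℝ} (hw : BddMeas w) (x : Rd d) :
    Integrable (fun z => w (x + z) * J z) :=
  (hw.comp (T := fun z => x + z) (by fun_prop)).mul_integrable hJ.int

lemma conv_mono (hJ : GoodKer J) {f g : Rd d → ℝ} (hf : BddMeas f) (hg : BddMeas g)
    (h : ∀ x, f x ≤ g x) (x : Rd d) : convJ J f x ≤ convJ J g x :=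
  integral_mono (hJ.integrable_shift hf x) (hJ.integrable_shift hg x)
    fun z => mul_le_mul_of_nonneg_right (h _) (hJ.nonneg z)

lemma conv_const (c : ℝ) (x : Rd d) : convJ J (fun _ => c) x = (∫ z, J z) * c := by
  simp [convJ, integral_const_mul, mul_comm]

lemma conv_nonneg (hJ : GoodKer J) {f : Rd d → ℝ} (h : ∀ x, 0 ≤ f x) (x : Rd d) :
    0 ≤ convJ J f x := integral_nonneg fun z => mul_nonneg (h _) (hJ.nonneg z)

lemma conv_add (hJ : GoodKer J) {f g : Rd d → ℝ} (hf : BddMeas f) (hg : BddMeas g) (x : Rd d) :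
    convJ J (fun y => f y + g y) x = convJ J f x + convJ J g x := by
  simp only [convJ, add_mul]
  exact integral_add (hJ.integrable_shift hf x) (hJ.integrable_shift hg x)

lemma conv_const_mul (c : ℝ) (f : Rd d → ℝ) (x : Rd d) :
    convJ J (fun y => c * f y) x = c * convJ J f x := by
  simp only [convJ, mul_assoc]
  exact integral_const_mul _ _

lemma conv_sub (hJ : GoodKer J) {f g : Rd d → ℝ} (hf : BddMeas f) (hg : BddMeas g) (x : Rd d) :
    convJ J (fun y => f y - g y) x = convJ J f x - convJ J g x := by
  simp only [convJ, sub_mul]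
  exact integral_sub (hJ.integrable_shift hf x) (hJ.integrable_shift hg x)

lemma Lop_add (hJ : GoodKer J) {f g : Rd d → ℝ} (hf : BddMeas f) (hg : BddMeas g) (x : Rd d) :
    Lop J (fun y => f y + g y) x = Lop J f x + Lop J g x := by
  simp only [Lop, hJ.conv_add hf hg]; ring

lemma Lop_sub (hJ : GoodKer J) {f g : Rd d → ℝ} (hf : BddMeas f) (hg : BddMeas g) (x : Rd d) :
    Lop J (fun y => f y - g y) x = Lop J f x - Lop J g x := by
  simp only [Lop, hJ.conv_sub hf hg]; ring

lemma Lop_const_mul (c : ℝ) (f : Rd d → ℝ) (x : Rd d) :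
    Lop J (fun y => c * f y) x = c * Lop J f x := by
  simp only [Lop, conv_const_mul]; ring

lemma Lop_translate (f : Rd d → ℝ) (a x : Rd d) :
    Lop J (fun y => f (y + a)) x = Lop J f (x + a) := by
  simp only [Lop, convJ]
  congr 2
  ext z
  rw [show x + z + a = x + a + z by abel]

lemma conv_measurable (hJ : GoodKer J) {w : Rd d → ℝ} (hw : Measurable w) :
    Measurable (convJ J w) := by
  have : StronglyMeasurable (fun p : Rd d × Rd d => w (p.1 + p.2) * J p.2) := by
    apply Measurable.stronglyMeasurable
    exact (hw.comp (by fun_prop)).mul (hJ.meas.comp measurable_snd)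
  exact (this.integral_prod_right (ν := volume)).measurable

lemma conv_bddMeas (hJ : GoodKer J) {w : Rd d → ℝ} (hw : BddMeas w) : BddMeas (convJ J w) := by
  refine ⟨hJ.conv_measurable hw.1, ?_⟩
  obtain ⟨hm, M, hM⟩ := id hw
  refine ⟨(∫ z, J z) * M, fun x => abs_le.2 ⟨?_, ?_⟩⟩
  · rw [← mul_neg, ← conv_const (-M) x]
    exact hJ.conv_mono (BddMeas.const _) hw (fun y => (abs_le.1 (hM y)).1) x
  · rw [← conv_const M x]
    exact hJ.conv_mono hw (BddMeas.const _) (fun y => (abs_le.1 (hM y)).2) x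

lemma Lop_bddMeas (hJ : GoodKer J) {w : Rd d → ℝ} (hw : BddMeas w) : BddMeas (Lop J w) :=
  (hw.const_mul _).sub (hJ.conv_bddMeas hw)

/-- The kernel mass escaping from `A` when jumping from `x`. -/
def esc (J : Rd d → ℝ) (A : Set (Rd d)) (x : Rd d) : ℝ := convJ J (Aᶜ.indicator fun _ => 1) x

lemma esc_nonneg (hJ : GoodKer J) (A : Set (Rd d)) (x : Rd d) : 0 ≤ esc J A x :=
  hJ.conv_nonneg (fun _ => indicator_nonneg (fun _ _ => zero_le_one) _) x

lemma conv_le_of_le (hJ : GoodKer J) {w : Rd d → ℝ} (hw : BddMeas w) {A : Set (Rd d)}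
    (hA : MeasurableSet A) {s : ℝ} (h1 : ∀ x ∈ A, w x ≤ s) (h0 : ∀ x ∉ A, w x ≤ 0) (x : Rd d) :
    convJ J w x ≤ s * ((∫ z, J z) - esc J A x) := by
  have hb : BddMeas (fun y => s * (1 - (Aᶜ.indicator (fun _ => (1:ℝ)) y))) :=
    ((BddMeas.const 1).sub ((BddMeas.const 1).indicator hA.compl)).const_mul s
  refine (hJ.conv_mono hw hb (fun y => ?_) x).trans (le_of_eq ?_)
  · by_cases hy : y ∈ A
    · simpa [hy] using h1 y hy
    · simpa [hy] using h0 y hy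
  · rw [conv_const_mul, hJ.conv_sub (BddMeas.const 1) ((BddMeas.const 1).indicator hA.compl),
      conv_const, mul_one, esc]

/-- Maximum principle for `Lop J + κ`. -/
theorem max_principle (hJ : GoodKer J) {w : Rd d → ℝ} (hw : BddMeas w) {A : Set (Rd d)}
    (hA : MeasurableSet A) {κ c : ℝ} (hκ : 0 ≤ κ) (hc : 0 < c)
    (hesc : ∀ x ∈ A, c ≤ κ + esc J A x) (hoff : ∀ x ∉ A, w x ≤ 0)
    (hsub : ∀ x ∈ A, Lop J w x + κ * w x ≤ 0) (x : Rd d) : w x ≤ 0 := by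
  by_contra! hx
  obtain ⟨hm, M, hM⟩ := id hw
  have hbdd : BddAbove (range w) := ⟨M, by rintro _ ⟨y, rfl⟩; exact (abs_le.1 (hM y)).2⟩
  set s := ⨆ y, w y with hs
  have hle : ∀ y, w y ≤ s := fun y => le_ciSup hbdd y
  have hs0 : 0 < s := hx.trans_le (hle x)
  set L := ∫ z, J z with hL
  have hL0 : 0 ≤ L := hJ.mass_nonneg
  set ε := min (s / 2) (s * c / (2 * (L + κ + 1))) with hε
  have hεpos : 0 < ε := by
    apply lt_min <;> positivity
  obtain ⟨y, hy⟩ := exists_lt_of_lt_ciSup (show s - ε < ⨆ y, w y by rw [← hs]; linarith)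
  have hε2 : ε ≤ s / 2 := min_le_left _ _
  have hyA : y ∈ A := by
    by_contra h
    have := hoff y h
    linarith
  have h1 := hJ.conv_le_of_le hw hA (fun z _ => hle z) hoff y
  have h2 := hsub y hyA
  have h3 := hesc y hyA
  simp only [Lop] at h2
  rw [← hL] at h1 h2
  have h4 : ε * (2 * (L + κ + 1)) ≤ s * c := by
    have : ε ≤ s * c / (2 * (L + κ + 1)) := min_le_right _ _
    rwa [le_div_iff₀ (by positivity)] at this
  have h5 : (L + κ) * (s - ε) ≤ (L + κ) * w y := mul_le_mul_of_nonneg_left hy.le (by positivity)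
  have h6 : s * c ≤ s * (κ + esc J A y) := mul_le_mul_of_nonneg_left h3 hs0.le
  have h7 : 0 ≤ ε * (L + κ) := by positivity
  nlinarith

/-- Comparison principle for `Lop J + κ`. -/
theorem comparison (hJ : GoodKer J) {w b : Rd d → ℝ} (hw : BddMeas w) (hb : BddMeas b)
    {A : Set (Rd d)} (hA : MeasurableSet A) {κ c : ℝ} (hκ : 0 ≤ κ) (hc : 0 < c)
    (hesc : ∀ x ∈ A, c ≤ κ + esc J A x) (hoff : ∀ x ∉ A, w x ≤ b x)
    (hsub : ∀ x ∈ A, Lop J w x + κ * w x ≤ Lop J b x + κ * b x) (x : Rd d) : w x ≤ b x := by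
  have := hJ.max_principle (hw.sub hb) hA hκ hc hesc (fun y hy => by
      have := hoff y hy; linarith) (fun y hy => by
      have := hsub y hy
      rw [hJ.Lop_sub hw hb]
      linarith) x
  linarith

end GoodKer

namespace GoodKer

variable {J : Rd d → ℝ}

lemma esc_le_mass (hJ : GoodKer J) {A : Set (Rd d)} (hA : MeasurableSet A) (x : Rd d) :
    esc J A x ≤ ∫ z, J z := by
  have := hJ.conv_mono ((BddMeas.const 1).indicator hA.compl) (BddMeas.const 1)
    (fun y => indicator_le_self' (fun _ _ => zero_le_one) y) x
  rw [conv_const, mul_one] at this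
  exact this

lemma integrable_prod_shift (hJ : GoodKer J) {g : Rd d → ℝ} (hg : Integrable g) :
    Integrable (fun p : Rd d × Rd d => g (p.1 + p.2) * J p.2) (volume.prod volume) := by
  have h1 : Integrable (fun p : Rd d × Rd d => g p.1 * J p.2) (volume.prod volume) :=
    hg.mul_prod hJ.int
  exact ((measurePreserving_add_prod (volume : Measure (Rd d))
    (volume : Measure (Rd d))).integrable_comp_of_integrable h1)

lemma conv_integrable (hJ : GoodKer J) {g : Rd d → ℝ} (hg : Integrable g) :
    Integrable (convJ J g) :=
  (hJ.integrable_prod_shift hg).integral_prod_left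

lemma integral_conv (hJ : GoodKer J) {g : Rd d → ℝ} (hg : Integrable g) :
    ∫ x, convJ J g x = (∫ z, J z) * ∫ x, g x := by
  simp only [convJ]
  rw [integral_integral_swap (hJ.integrable_prod_shift hg)]
  simp only [integral_mul_const, integral_add_right_eq_self (fun x => g x)]
  rw [integral_const_mul, mul_comm]

/-- Symmetry of the convolution with an even kernel. -/
lemma integral_mul_conv (hJ : GoodKer J) {f g : Rd d → ℝ} (hf : BddMeas f) (hg : Integrable g) :
    ∫ x, f x * convJ J g x = ∫ x, g x * convJ J f x := by
  have hF : Integrable (fun p : Rd d × Rd d => f p.1 * (g (p.1 + p.2) * J p.2))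
      (volume.prod volume) := by
    obtain ⟨hfm, M, hM⟩ := hf
    exact (hJ.integrable_prod_shift hg).bdd_mul (c := M)
      (hfm.comp measurable_fst).aestronglyMeasurable (Eventually.of_forall fun p => hM p.1)
  have e1 : ∀ x, f x * convJ J g x = ∫ z, f x * (g (x + z) * J z) := fun x =>
    (integral_const_mul _ _).symm
  have e2 : ∀ x, g x * convJ J f x = ∫ z, g x * (f (x + z) * J z) := fun x =>
    (integral_const_mul _ _).symm
  have hG : Integrable (fun p : Rd d × Rd d => g p.1 * (f (p.1 + p.2) * J p.2))
      (volume.prod volume) := by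
    obtain ⟨hfm, M, hM⟩ := hf
    have h1 : Integrable (fun p : Rd d × Rd d => g p.1 * J p.2) (volume.prod volume) :=
      hg.mul_prod hJ.int
    have := h1.bdd_mul (f := fun p : Rd d × Rd d => f (p.1 + p.2)) (c := M)
      (hfm.comp (by fun_prop)).aestronglyMeasurable (Eventually.of_forall fun p => hM _)
    refine this.congr (Eventually.of_forall fun p => ?_)
    simp only
    ring
  simp only [e1, e2]
  have hsw : ∫ x, ∫ z, g x * (f (x + z) * J z) = ∫ z, ∫ x, g x * (f (x + z) * J z) :=
    integral_integral_swap hG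
  rw [integral_integral_swap hF, hsw]
  rw [← integral_neg_eq_self (fun z => ∫ x, g x * (f (x + z) * J z))]
  congr 1
  ext z
  rw [← integral_add_right_eq_self (fun x => g x * (f (x + -z) * J (-z))) z]
  congr 1
  ext x
  rw [hJ.even, add_neg_cancel_right]
  ring

lemma integral_mul_Lop (hJ : GoodKer J) {f g : Rd d → ℝ} (hf : BddMeas f)
    (hgi : Integrable g) : ∫ x, f x * Lop J g x = ∫ x, g x * Lop J f x := by
  have h := hJ.integral_mul_conv hf hgi
  have i1 : Integrable (fun x => f x * g x) := by
    simpa [mul_comm] using hf.mul_integrable hgi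
  have i2 : Integrable (fun x => f x * convJ J g x) := by
    simpa [mul_comm] using hf.mul_integrable (hJ.conv_integrable hgi)
  have i3 : Integrable (fun x => g x * convJ J f x) := by
    simpa [mul_comm] using (hJ.conv_bddMeas hf).mul_integrable hgi
  have e1 : ∀ x, f x * Lop J g x = (∫ z, J z) * (f x * g x) - f x * convJ J g x := fun x => by
    simp only [Lop]; ring
  have e2 : ∀ x, g x * Lop J f x = (∫ z, J z) * (f x * g x) - g x * convJ J f x := fun x => by
    simp only [Lop]; ring
  simp only [e1, e2]
  rw [integral_sub (i1.const_mul _) i2, integral_sub (i1.const_mul _) i3, h]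

/-- The energy identity. -/
lemma energy_eq (hJ : GoodKer J) {f : Rd d → ℝ} (hf : BddMeas f) (hfi : Integrable f) :
    Integrable (fun p : Rd d × Rd d => (f p.1 - f (p.1 + p.2)) ^ 2 * J p.2)
      (volume.prod volume) ∧
    ∫ x, f x * Lop J f x = (1 / 2) * ∫ x, ∫ z, (f x - f (x + z)) ^ 2 * J z := by
  have hff : Integrable (fun x => f x * f x) := hf.mul_integrable hfi
  have i1 : Integrable (fun p : Rd d × Rd d => (f p.1 * f p.1) * J p.2) (volume.prod volume) :=
    hff.mul_prod hJ.int
  have i2 := hJ.integrable_prod_shift hff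
  have i3 : Integrable (fun p : Rd d × Rd d => f p.1 * (f (p.1 + p.2) * J p.2))
      (volume.prod volume) := by
    obtain ⟨hfm, M, hM⟩ := hf
    exact (hJ.integrable_prod_shift hfi).bdd_mul (c := M)
      (hfm.comp measurable_fst).aestronglyMeasurable (Eventually.of_forall fun p => hM p.1)
  have hi : Integrable (fun p : Rd d × Rd d => (f p.1 - f (p.1 + p.2)) ^ 2 * J p.2)
      (volume.prod volume) := by
    refine ((i1.add i2).sub (i3.const_mul 2)).congr (Eventually.of_forall fun p => ?_)
    simp only [Pi.add_apply, Pi.sub_apply]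
    ring
  refine ⟨hi, ?_⟩
  have e1 : ∫ x, ∫ z, (f x - f (x + z)) ^ 2 * J z
      = ∫ p : Rd d × Rd d, ((f p.1 * f p.1) * J p.2 + (f (p.1 + p.2) * f (p.1 + p.2)) * J p.2
        - 2 * (f p.1 * (f (p.1 + p.2) * J p.2))) ∂(volume.prod volume) := by
    rw [integral_integral hi]
    congr 1
    ext p
    ring
  have e2 : ∫ p : Rd d × Rd d, (f p.1 * f p.1) * J p.2 ∂(volume.prod volume)
      = (∫ x, f x * f x) * ∫ z, J z := integral_prod_mul (fun x => f x * f x) J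
  have e3 : ∫ p : Rd d × Rd d, (f (p.1 + p.2) * f (p.1 + p.2)) * J p.2 ∂(volume.prod volume)
      = (∫ z, J z) * ∫ x, f x * f x := by
    rw [← hJ.integral_conv hff, integral_prod _ i2]
    rfl
  have e4 : ∫ p : Rd d × Rd d, f p.1 * (f (p.1 + p.2) * J p.2) ∂(volume.prod volume)
      = ∫ x, f x * convJ J f x := by
    rw [integral_prod _ i3]
    simp only [integral_const_mul]
    rfl
  have i5 : Integrable (fun x => f x * convJ J f x) := by
    simpa [mul_comm] using hf.mul_integrable (hJ.conv_integrable hfi)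
  have i12 : Integrable (fun p : Rd d × Rd d => (f p.1 * f p.1) * J p.2
      + (f (p.1 + p.2) * f (p.1 + p.2)) * J p.2) (volume.prod volume) := i1.add i2
  rw [e1, integral_sub i12 (i3.const_mul 2), integral_add i1 i2, e2, e3,
    integral_const_mul, e4]
  have e6 : ∀ x, f x * Lop J f x = (∫ z, J z) * (f x * f x) - f x * convJ J f x := fun x => by
    simp only [Lop]; ring
  simp only [e6]
  rw [integral_sub (hff.const_mul _) i5, integral_const_mul]
  ring

/-- One step of the monotone iteration solving `Lop J u + κ u = f` on `Ω`. -/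
def greenStep (J : Rd d → ℝ) (κ : ℝ) (Ω : Set (Rd d)) (f u : Rd d → ℝ) : Rd d → ℝ :=
  Ω.indicator fun x => ((∫ z, J z) + κ)⁻¹ * (f x + convJ J u x)

/-- The monotone iteration solving `Lop J u + κ u = f` on `Ω`. -/
def greenIter (J : Rd d → ℝ) (κ : ℝ) (Ω : Set (Rd d)) (f : Rd d → ℝ) : ℕ → Rd d → ℝ
  | 0 => fun _ => 0
  | k + 1 => greenStep J κ Ω f (greenIter J κ Ω f k)

lemma greenStep_bddMeas (hJ : GoodKer J) {κ : ℝ} {Ω : Set (Rd d)} (hΩ : MeasurableSet Ω)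
    {f u : Rd d → ℝ} (hf : BddMeas f) (hu : BddMeas u) : BddMeas (greenStep J κ Ω f u) :=
  ((hf.add (hJ.conv_bddMeas hu)).const_mul _).indicator hΩ

lemma greenIter_bddMeas (hJ : GoodKer J) {κ : ℝ} {Ω : Set (Rd d)} (hΩ : MeasurableSet Ω)
    {f : Rd d → ℝ} (hf : BddMeas f) (k : ℕ) : BddMeas (greenIter J κ Ω f k) := by
  induction k with
  | zero => exact BddMeas.const 0
  | succ k ih => exact hJ.greenStep_bddMeas hΩ hf ih

lemma greenStep_mono (hJ : GoodKer J) {κ : ℝ} (hκ : 0 ≤ κ) {Ω : Set (Rd d)}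
    {f u w : Rd d → ℝ} (hu : BddMeas u) (hw : BddMeas w) (h : ∀ x, u x ≤ w x) (x : Rd d) :
    greenStep J κ Ω f u x ≤ greenStep J κ Ω f w x := by
  have := hJ.mass_nonneg
  simp only [greenStep]
  refine indicator_le_indicator ?_
  exact mul_le_mul_of_nonneg_left (by linarith [hJ.conv_mono hu hw h x]) (by positivity)

lemma greenIter_mono (hJ : GoodKer J) {κ : ℝ} (hκ : 0 ≤ κ) {Ω : Set (Rd d)}
    (hΩ : MeasurableSet Ω) {f : Rd d → ℝ} (hf : BddMeas f) (hf0 : ∀ x, 0 ≤ f x) (x : Rd d) :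
    Monotone fun k => greenIter J κ Ω f k x := by
  have key : ∀ k, ∀ x, greenIter J κ Ω f k x ≤ greenIter J κ Ω f (k + 1) x := by
    intro k
    induction k with
    | zero =>
      intro x
      have := hJ.mass_nonneg
      simp only [greenIter, greenStep]
      refine indicator_nonneg (fun y _ => ?_) x
      exact mul_nonneg (by positivity)
        (add_nonneg (hf0 y) (hJ.conv_nonneg (fun _ => le_rfl) y))
    | succ k ih =>
      exact hJ.greenStep_mono hκ (hJ.greenIter_bddMeas hΩ hf k)
        (hJ.greenIter_bddMeas hΩ hf (k + 1)) ih
  exact monotone_nat_of_le_succ fun k => key k x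

lemma greenIter_nonneg (hJ : GoodKer J) {κ : ℝ} (hκ : 0 ≤ κ) {Ω : Set (Rd d)}
    (hΩ : MeasurableSet Ω) {f : Rd d → ℝ} (hf : BddMeas f) (hf0 : ∀ x, 0 ≤ f x) (k : ℕ)
    (x : Rd d) : 0 ≤ greenIter J κ Ω f k x :=
  hJ.greenIter_mono hκ hΩ hf hf0 x (Nat.zero_le k)

lemma greenIter_off {κ : ℝ} {Ω : Set (Rd d)} {f : Rd d → ℝ} (k : ℕ) {x : Rd d} (hx : x ∉ Ω) :
    greenIter J κ Ω f k x = 0 := by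
  cases k with
  | zero => rfl
  | succ k => simp only [greenIter, greenStep, indicator_of_notMem hx]

lemma greenIter_le (hJ : GoodKer J) {κ c F : ℝ} (hκ : 0 ≤ κ) (hc : 0 < c) {Ω : Set (Rd d)}
    (hΩ : MeasurableSet Ω) (hesc : ∀ x ∈ Ω, c ≤ κ + esc J Ω x) {f : Rd d → ℝ} (hf : BddMeas f)
    (hf0 : ∀ x, 0 ≤ f x) (hfF : ∀ x, f x ≤ F) (k : ℕ) (x : Rd d) :
    greenIter J κ Ω f k x ≤ F / c := by
  have hF : 0 ≤ F := (hf0 0).trans (hfF 0)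
  have hL := hJ.mass_nonneg
  induction k generalizing x with
  | zero => simp only [greenIter]; positivity
  | succ k ih =>
    by_cases hx : x ∈ Ω
    · simp only [greenIter, greenStep, indicator_of_mem hx]
      have h1 := hJ.conv_le_of_le (hJ.greenIter_bddMeas (κ := κ) hΩ hf k) hΩ (s := F / c)
        (fun y _ => ih y) (fun y hy => (greenIter_off k hy).le) x
      have h2 := hesc x hx
      have h3 := hJ.esc_le_mass hΩ x
      have hpos : 0 < (∫ z, J z) + κ := by linarith
      rw [inv_mul_le_iff₀ hpos]
      have h4 : F / c * c ≤ F / c * (κ + esc J Ω x) :=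
        mul_le_mul_of_nonneg_left h2 (by positivity)
      rw [div_mul_cancel₀ _ hc.ne'] at h4
      nlinarith [hfF x]
    · rw [greenIter_off _ hx]; positivity

/-- Existence of bounded solutions of `Lop J u + κ u = f` on `Ω` vanishing off `Ω`. -/
theorem exists_green (hJ : GoodKer J) {κ c F : ℝ} (hκ : 0 ≤ κ) (hc : 0 < c) {Ω : Set (Rd d)}
    (hΩ : MeasurableSet Ω) (hesc : ∀ x ∈ Ω, c ≤ κ + esc J Ω x) {f : Rd d → ℝ} (hf : BddMeas f)
    (hf0 : ∀ x, 0 ≤ f x) (hfF : ∀ x, f x ≤ F) :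
    ∃ u : Rd d → ℝ, BddMeas u ∧ (∀ x, 0 ≤ u x) ∧ (∀ x, u x ≤ F / c) ∧ (∀ x ∉ Ω, u x = 0) ∧
      (∀ x ∈ Ω, Lop J u x + κ * u x = f x) ∧ (0 < κ → Integrable f → Integrable u) := by
  have hL := hJ.mass_nonneg
  have hF : 0 ≤ F := (hf0 0).trans (hfF 0)
  set U := greenIter J κ Ω f with hU
  have hUb : ∀ k, BddMeas (U k) := fun k => hJ.greenIter_bddMeas hΩ hf k
  have hUle : ∀ k x, U k x ≤ F / c := fun k x => hJ.greenIter_le hκ hc hΩ hesc hf hf0 hfF k x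
  have hU0 : ∀ k x, 0 ≤ U k x := fun k x => hJ.greenIter_nonneg hκ hΩ hf hf0 k x
  have hUmono : ∀ x, Monotone fun k => U k x := fun x => hJ.greenIter_mono hκ hΩ hf hf0 x
  have hbdd : ∀ x, BddAbove (range fun k => U k x) := fun x =>
    ⟨F / c, by rintro _ ⟨k, rfl⟩; exact hUle k x⟩
  set u : Rd d → ℝ := fun x => ⨆ k, U k x with hu
  have hlim : ∀ x, Tendsto (fun k => U k x) atTop (𝓝 (u x)) := fun x =>
    tendsto_atTop_ciSup (hUmono x) (hbdd x)
  have hum : Measurable u := measurable_of_tendsto_metrizable (fun k => (hUb k).1)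
    (tendsto_pi_nhds.2 hlim)
  have hu0 : ∀ x, 0 ≤ u x := fun x => ge_of_tendsto' (hlim x) fun k => hU0 k x
  have huF : ∀ x, u x ≤ F / c := fun x => le_of_tendsto' (hlim x) fun k => hUle k x
  have hub : BddMeas u := ⟨hum, F / c, fun x => by rw [abs_of_nonneg (hu0 x)]; exact huF x⟩
  refine ⟨u, hub, hu0, huF, ?_, ?_, ?_⟩
  · intro x hx
    refine tendsto_nhds_unique (hlim x) ?_
    simp only [hU, greenIter_off _ hx]
    exact tendsto_const_nhds
  · intro x hx
    have hconv : Tendsto (fun k => convJ J (U k) x) atTop (𝓝 (convJ J u x)) := by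
      refine tendsto_integral_of_dominated_convergence (fun z => F / c * J z) ?_
        (hJ.int.const_mul _) ?_ ?_
      · exact fun k => (hJ.integrable_shift (hUb k) x).aestronglyMeasurable
      · intro k
        refine Eventually.of_forall fun z => ?_
        rw [norm_mul, norm_of_nonneg (hU0 k _), norm_of_nonneg (hJ.nonneg z)]
        exact mul_le_mul_of_nonneg_right (hUle k _) (hJ.nonneg z)
      · exact Eventually.of_forall fun z => (hlim (x + z)).mul_const _
    have h1 : Tendsto (fun k => U (k + 1) x) atTop
        (𝓝 (((∫ z, J z) + κ)⁻¹ * (f x + convJ J u x))) := by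
      have : ∀ k, U (k + 1) x = ((∫ z, J z) + κ)⁻¹ * (f x + convJ J (U k) x) := fun k => by
        simp only [hU, greenIter, greenStep, indicator_of_mem hx]
      simp only [this]
      exact (hconv.const_add _).const_mul _
    have h2 := tendsto_nhds_unique ((tendsto_add_atTop_iff_nat 1).2 (hlim x)) h1
    have h3 := hJ.esc_le_mass hΩ x
    have hpos : 0 < (∫ z, J z) + κ := by linarith [hesc x hx]
    have h4 : ((∫ z, J z) + κ) * u x = f x + convJ J u x := by
      rw [h2, mul_inv_cancel_left₀ hpos.ne']
    simp only [Lop]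
    linarith
  · intro hκ0 hfi
    have hpos : 0 < (∫ z, J z) + κ := by linarith
    have hint : ∀ k, Integrable (U k) ∧ ∫ x, U k x ≤ (∫ x, f x) / κ := by
      intro k
      have hfi0 : 0 ≤ ∫ x, f x := integral_nonneg hf0
      induction k with
      | zero =>
        refine ⟨integrable_zero _ _ _, ?_⟩
        simp only [hU, greenIter, integral_zero]
        positivity
      | succ k ih =>
        have hci := hJ.conv_integrable ih.1
        have hcv := hJ.integral_conv ih.1
        have hi : Integrable (fun x => ((∫ z, J z) + κ)⁻¹ * (f x + convJ J (U k) x)) :=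
          (hfi.add hci).const_mul _
        refine ⟨hi.indicator hΩ, ?_⟩
        calc ∫ x, U (k + 1) x ≤ ∫ x, ((∫ z, J z) + κ)⁻¹ * (f x + convJ J (U k) x) := by
              refine integral_mono (hi.indicator hΩ) hi fun x => ?_
              show Ω.indicator (fun y => ((∫ z, J z) + κ)⁻¹ * (f y + convJ J (U k) y)) x ≤ _
              refine indicator_le_self' (fun y _ => ?_) x
              exact mul_nonneg (inv_nonneg.2 hpos.le)
                (add_nonneg (hf0 y) (hJ.conv_nonneg (hU0 k) y))
          _ = ((∫ z, J z) + κ)⁻¹ * ((∫ x, f x) + (∫ z, J z) * ∫ x, U k x) := by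
              rw [integral_const_mul, integral_add hfi hci, hcv]
          _ ≤ ((∫ z, J z) + κ)⁻¹ * ((∫ x, f x) + (∫ z, J z) * ((∫ x, f x) / κ)) := by
              gcongr
              exact ih.2
          _ = (∫ x, f x) / κ := by field_simp; ring
    have hl : ∫⁻ x, ofReal (u x) ≤ ofReal ((∫ x, f x) / κ) := by
      have : ∫⁻ x, ofReal (u x)
          ≤ liminf (fun k => ∫⁻ x, ofReal (U k x)) atTop := by
        refine le_trans (lintegral_mono fun x => ?_)
          (lintegral_liminf_le fun k => (hUb k).1.ennreal_ofReal)
        exact ((ENNReal.continuous_ofReal.tendsto _).comp (hlim x)).liminf_eq.ge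
      refine this.trans (liminf_le_of_le (by isBoundedDefault) fun b hb => ?_)
      obtain ⟨k, hk⟩ := hb.exists
      refine hk.trans ?_
      rw [← ofReal_integral_eq_lintegral_ofReal (hint k).1 (Eventually.of_forall (hU0 k))]
      exact ofReal_le_ofReal (hint k).2
    refine ⟨hum.aestronglyMeasurable, ?_⟩
    rw [hasFiniteIntegral_iff_ofReal (Eventually.of_forall hu0)]
    exact hl.trans_lt ofReal_lt_top

end GoodKer

/-- A Lévy measure on the half line together with its scale function. -/
structure Core where
  m : Measure ℝ
  v : ℝ → ℝ
  K : ℝ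
  a : ℝ
  b : ℝ
  s₀ : ℝ
  m_nonpos : m (Iic 0) = 0
  one_le_K : 1 ≤ K
  a_lt : a < 1
  b_pos : 0 < b
  s₀_pos : 0 < s₀
  s₀_le : s₀ ≤ 1
  v_pos : ∀ r, 0 < r → 0 < v r
  mono : ∀ r s, 0 < r → r ≤ s → v r ≤ v s
  lin : ∀ k r, 1 ≤ k → 0 < r → v (k * r) ≤ k * v r
  up : ∀ k r, 1 ≤ k → 0 < r → v (k * r) ≤ K * k ^ a * v r
  low : ∀ k r, 1 ≤ k → 0 < r → k * r ≤ 1 → k ^ b * v r ≤ K * v (k * r)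
  const : ∀ r, 1 ≤ r → v r = v 1
  tail : ∀ s, 0 < s → ∫⁻ t, ofReal (min 1 (t / s ^ 2)) ∂m ≤ ofReal (K / v s ^ 2)
  tail_low : ∀ s, 0 < s → s ≤ s₀ → ofReal (1 / (K * v s ^ 2)) ≤ m (Ici (s ^ 2))

/-- The Gaussian heat kernel of the Laplacian. -/
def heat (t : ℝ) (z : Rd d) : ℝ :=
  (4 * π * t) ^ (-(d : ℝ) / 2) * exp (-(‖z‖ ^ 2) / (4 * t))

lemma heat_eq {t : ℝ} (ht : 0 < t) (z : Rd d) :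
    heat t z = (√(4 * π * t) ^ d)⁻¹ * exp (-(‖z‖ / (2 * √t)) ^ 2) := by
  have hp : 0 < 4 * π * t := by positivity
  have h1 : (4 * π * t) ^ (-(d : ℝ) / 2) = (√(4 * π * t) ^ d)⁻¹ := by
    rw [Real.sqrt_eq_rpow, ← rpow_natCast, ← rpow_mul hp.le, ← Real.rpow_neg hp.le]
    congr 1; ring
  have h2 : -(‖z‖ ^ 2) / (4 * t) = -(‖z‖ / (2 * √t)) ^ 2 := by
    rw [div_pow, mul_pow, sq_sqrt ht.le]; ring
  rw [heat, h1, h2]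

lemma heat_pos {t : ℝ} (ht : 0 < t) (z : Rd d) : 0 < heat t z := by
  rw [heat_eq ht]; positivity

lemma heat_anti {t : ℝ} (ht : 0 < t) {x y : Rd d} (h : ‖x‖ ≤ ‖y‖) : heat t y ≤ heat t x := by
  rw [heat_eq ht, heat_eq ht]
  gcongr

lemma heat_measurable : Measurable (fun p : ℝ × Rd d => heat p.1 p.2) := by
  unfold heat
  have h1 : Measurable fun p : ℝ × Rd d => (4 * π * p.1) ^ (-(d : ℝ) / 2) := by fun_prop
  have h2 : Measurable fun p : ℝ × Rd d => exp (-(‖p.2‖ ^ 2) / (4 * p.1)) := by fun_prop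
  exact h1.mul h2

lemma integrable_gauss {b : ℝ} (hb : 0 < b) :
    Integrable (fun z : Rd d => exp (-b * ‖z‖ ^ 2)) := by
  have := GaussianFourier.integrable_cexp_neg_mul_sq_norm_add (V := Rd d) (b := (b : ℂ))
    (by simpa using hb) 0 0
  refine (this.norm).congr (Eventually.of_forall fun z => ?_)
  simp [Complex.norm_exp, ← Complex.ofReal_pow]

lemma integral_gauss {b : ℝ} (hb : 0 < b) :
    ∫ z : Rd d, exp (-b * ‖z‖ ^ 2) = (π / b) ^ ((d : ℝ) / 2) := by
  simpa using GaussianFourier.integral_rexp_neg_mul_sq_norm (V := Rd d) hb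

lemma heat_eq' (t : ℝ) (z : Rd d) : heat t z =
    (4 * π * t) ^ (-(d : ℝ) / 2) * exp (-(4 * t)⁻¹ * ‖z‖ ^ 2) := by
  rw [heat]; congr 2; ring

lemma heat_integrable {t : ℝ} (ht : 0 < t) : Integrable (heat t : Rd d → ℝ) := by
  have := (integrable_gauss (d := d) (b := (4 * t)⁻¹) (by positivity)).const_mul
    ((4 * π * t) ^ (-(d : ℝ) / 2))
  refine this.congr (Eventually.of_forall fun z => ?_)
  simp only [heat_eq']

lemma integral_heat {t : ℝ} (ht : 0 < t) : ∫ z : Rd d, heat t z = 1 := by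
  simp only [heat_eq', integral_const_mul, integral_gauss (d := d) (b := (4 * t)⁻¹) (by positivity)]
  rw [show π / (4 * t)⁻¹ = 4 * π * t by field_simp, neg_div,
    Real.rpow_neg (by positivity)]
  exact inv_mul_cancel₀ (by positivity)

lemma heat_good {t : ℝ} (ht : 0 < t) : GoodKer (heat t : Rd d → ℝ) where
  nonneg z := (heat_pos ht z).le
  meas := heat_measurable.comp (measurable_const.prodMk measurable_id)
  int := heat_integrable ht
  anti _ _ h := heat_anti ht h

/-- Chapman–Kolmogorov for the heat kernel. -/
lemma heat_heat {s t : ℝ} (hs : 0 < s) (ht : 0 < t) (y : Rd d) :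
    ∫ z, heat s z * heat t (y - z) = heat (s + t) y := by
  have hst : 0 < s + t := by positivity
  have key : ∀ z : Rd d, heat s z * heat t (y - z) =
      (4 * π * s) ^ (-(d : ℝ) / 2) * (4 * π * t) ^ (-(d : ℝ) / 2) *
      exp (-(4 * (s + t))⁻¹ * ‖y‖ ^ 2) *
        exp (-((s + t) / (4 * s * t)) * ‖z - (s / (s + t)) • y‖ ^ 2) := by
    intro z
    rw [heat_eq', heat_eq']
    have : -(4 * s)⁻¹ * ‖z‖ ^ 2 + -(4 * t)⁻¹ * ‖y - z‖ ^ 2 =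
        -(4 * (s + t))⁻¹ * ‖y‖ ^ 2 + -((s + t) / (4 * s * t)) * ‖z - (s / (s + t)) • y‖ ^ 2 := by
      rw [norm_sub_sq_real, norm_sub_sq_real, norm_smul, inner_smul_right, real_inner_comm,
        mul_pow, norm_eq_abs, sq_abs]
      field_simp
      ring
    calc _ = (4 * π * s) ^ (-(d : ℝ) / 2) * (4 * π * t) ^ (-(d : ℝ) / 2) *
        exp (-(4 * s)⁻¹ * ‖z‖ ^ 2 + -(4 * t)⁻¹ * ‖y - z‖ ^ 2) := by
          rw [Real.exp_add]; ring
      _ = _ := by rw [this, Real.exp_add]; ring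
  simp only [key, integral_const_mul]
  rw [integral_sub_right_eq_self
    (fun z : Rd d => exp (-((s + t) / (4 * s * t)) * ‖z‖ ^ 2)) ((s / (s + t)) • y),
    integral_gauss (by positivity), heat_eq']
  have h1 : (4 * π * s) ^ (-(d : ℝ) / 2) * (4 * π * t) ^ (-(d : ℝ) / 2) *
      (π / ((s + t) / (4 * s * t))) ^ ((d : ℝ) / 2)
      = (4 * π * (s + t)) ^ (-(d : ℝ) / 2) := by
    rw [neg_div, Real.rpow_neg (by positivity), Real.rpow_neg (by positivity),
      Real.rpow_neg (by positivity), ← Real.inv_rpow (by positivity), ← Real.inv_rpow (by positivity),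
      ← Real.inv_rpow (by positivity), ← Real.mul_rpow (by positivity) (by positivity),
      ← Real.mul_rpow (by positivity) (by positivity)]
    congr 1
    field_simp
  rw [← h1]; ring

lemma heat_semigroup {s t : ℝ} (hs : 0 < s) (ht : 0 < t) {w : Rd d → ℝ} (hw : BddMeas w)
    (x : Rd d) : convJ (heat s) (convJ (heat t) w) x = convJ (heat (s + t)) w x := by
  obtain ⟨hm, M, hM⟩ := id hw
  have e1 : ∀ z : Rd d, convJ (heat t) w (x + z) * heat s z =
      ∫ y, w (x + y) * (heat s z * heat t (y - z)) := by
    intro z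
    rw [convJ, ← integral_mul_const, ← integral_sub_right_eq_self _ z]
    congr 1; ext y
    rw [show x + z + (y - z) = x + y by abel]; ring
  have hint : Integrable (fun p : Rd d × Rd d => w (x + p.2) * (heat s p.1 * heat t (p.2 - p.1)))
      (volume.prod volume) := by
    have h1 : Integrable (fun p : Rd d × Rd d => heat s p.1 * heat t p.2)
        (volume.prod volume) := (heat_integrable hs).mul_prod (heat_integrable ht)
    have h2 := (measurePreserving_prod_sub (volume : Measure (Rd d))
      (volume : Measure (Rd d))).integrable_comp_of_integrable h1
    exact h2.bdd_mul (f := fun p : Rd d × Rd d => w (x + p.2)) (c := M)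
      (hm.comp (by fun_prop)).aestronglyMeasurable (Eventually.of_forall fun p => hM _)
  calc _ = ∫ z, ∫ y, w (x + y) * (heat s z * heat t (y - z)) := by
        rw [convJ]; simp only [e1]
    _ = ∫ y, ∫ z, w (x + y) * (heat s z * heat t (y - z)) := integral_integral_swap hint
    _ = _ := by
        simp only [integral_const_mul, heat_heat hs ht]
        rfl

lemma heat_le_one {t : ℝ} (ht : 0 < t) (z : Rd d) : heat t z ≤ (√t ^ d)⁻¹ := by
  have h4 : t ≤ 4 * π * t := by nlinarith [Real.pi_gt_three]
  have hs : 0 < √t := by positivity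
  rw [heat_eq ht]
  calc _ ≤ (√t ^ d)⁻¹ * 1 := by
        gcongr
        rw [Real.exp_le_one_iff]
        nlinarith [sq_nonneg (‖z‖ / (2 * √t))]
    _ = _ := mul_one _

lemma exp_neg_sq_le (n : ℕ) (u : ℝ) :
    u ^ n * exp (-u ^ 2) ≤ 1 + n.factorial := by
  have h1 : u ^ n ≤ 1 + (u ^ 2) ^ n := by
    rw [← pow_mul, mul_comm, pow_mul]
    nlinarith [sq_nonneg (u ^ n - 1)]
  have h2 : (u ^ 2) ^ n ≤ n.factorial * exp (u ^ 2) := by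
    have := Real.pow_div_factorial_le_exp (u ^ 2) (by positivity) n
    rwa [div_le_iff₀' (by positivity)] at this
  have h3 : 1 ≤ exp (u ^ 2) := Real.one_le_exp (by positivity)
  rw [Real.exp_neg, ← div_eq_mul_inv, div_le_iff₀ (by positivity)]
  linarith

/-- Off-diagonal decay of the heat kernel. -/
lemma heat_decay (d : ℕ) : ∃ C : ℝ, 1 ≤ C ∧ ∀ t : ℝ, 0 < t → ∀ z : Rd d, z ≠ 0 →
    heat t z ≤ C * (t / ‖z‖ ^ 2) * (‖z‖ ^ d)⁻¹ := by
  refine ⟨2 ^ (d + 2) * (1 + (d + 2).factorial), ?_, fun t ht z hz => ?_⟩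
  · have : (1:ℝ) ≤ 2 ^ (d + 2) := one_le_pow₀ (by norm_num)
    have h2 : (0:ℝ) ≤ (d + 2).factorial := by positivity
    nlinarith
  · have hz' : 0 < ‖z‖ := norm_pos_iff.2 hz
    have hs : 0 < √t := by positivity
    have h4 : t ≤ 4 * π * t := by nlinarith [Real.pi_gt_three]
    have h := exp_neg_sq_le (d + 2) (‖z‖ / (2 * √t))
    rw [heat_eq ht]
    calc _ ≤ (√t ^ d)⁻¹ * exp (-(‖z‖ / (2 * √t)) ^ 2) := by gcongr
      _ = 2 ^ (d + 2) * ((‖z‖ / (2 * √t)) ^ (d + 2) * exp (-(‖z‖ / (2 * √t)) ^ 2))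
            * (√t ^ 2 / ‖z‖ ^ 2) * (‖z‖ ^ d)⁻¹ := by
          generalize exp (-(‖z‖ / (2 * √t)) ^ 2) = E
          rw [div_pow, mul_pow]
          field_simp
          ring
      _ ≤ 2 ^ (d + 2) * (1 + (d + 2).factorial) * (√t ^ 2 / ‖z‖ ^ 2) * (‖z‖ ^ d)⁻¹ := by
          gcongr
      _ = _ := by rw [sq_sqrt ht.le]

/-- Near-diagonal lower bound of the heat kernel. -/
lemma heat_ge (d : ℕ) : ∃ c : ℝ, 0 < c ∧ ∀ t : ℝ, 0 < t → ∀ z : Rd d, ‖z‖ ^ 2 ≤ t →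
    c * (√t ^ d)⁻¹ ≤ heat t z := by
  refine ⟨(√(4 * π) ^ d)⁻¹ * exp (-1), by positivity, fun t ht z hz => ?_⟩
  rw [heat_eq ht, Real.sqrt_mul (x := 4 * π) (by positivity) t, mul_pow, mul_inv]
  have hs : 0 < √t := by positivity
  have : (‖z‖ / (2 * √t)) ^ 2 ≤ 1 := by
    rw [div_pow, div_le_one (by positivity), mul_pow, sq_sqrt ht.le]; linarith
  calc _ = (√(4 * π) ^ d)⁻¹ * (√t ^ d)⁻¹ * exp (-1) := by ring
    _ ≤ _ := by gcongr

/-- Second moment of the heat kernel. -/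
lemma heat_moment (d : ℕ) : ∃ C : ℝ, 1 ≤ C ∧ ∀ t : ℝ, 0 < t → ∀ s : ℝ, 0 < s →
    ∫ z : Rd d, min 1 (‖z‖ ^ 2 / s ^ 2) * heat t z ≤ C * min 1 (t / s ^ 2) := by
  refine ⟨8 * √2 ^ d, ?_, fun t ht s hs => ?_⟩
  · have : (1:ℝ) ≤ √2 ^ d := one_le_pow₀ (by rw [Real.one_le_sqrt]; norm_num)
    linarith
  have h1 : (1:ℝ) ≤ √2 ^ d := one_le_pow₀ (by rw [Real.one_le_sqrt]; norm_num)
  have hbm : BddMeas (fun z : Rd d => min 1 (‖z‖ ^ 2 / s ^ 2)) := by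
    refine ⟨by fun_prop, 1, fun z => ?_⟩
    rw [abs_of_nonneg (by positivity)]
    exact min_le_left _ _
  have hi := hbm.mul_integrable (heat_integrable (d := d) ht)
  have hpt : ∀ z : Rd d, ‖z‖ ^ 2 * heat t z ≤ 8 * √2 ^ d * t * heat (2 * t) z := by
    intro z
    have ht2 : 0 < 2 * t := by positivity
    have hst : 0 < √t := by positivity
    rw [heat_eq ht, heat_eq ht2]
    set y := (‖z‖ / (2 * √t)) ^ 2 with hy
    have e1 : ‖z‖ ^ 2 = 4 * t * y := by
      rw [hy, div_pow, mul_pow, sq_sqrt ht.le]; field_simp; norm_num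
    have e2 : (‖z‖ / (2 * √(2 * t))) ^ 2 = y / 2 := by
      rw [hy, div_pow, mul_pow, sq_sqrt ht2.le, div_pow, mul_pow, sq_sqrt ht.le]
      field_simp
    have e3 : √(4 * π * (2 * t)) = √2 * √(4 * π * t) := by
      rw [← Real.sqrt_mul (by norm_num)]; congr 1; ring
    have h5 : y / 2 ≤ exp (y / 2) := by linarith [Real.add_one_le_exp (y / 2)]
    have h6 : y * exp (-y) ≤ 2 * exp (-(y / 2)) := by
      have : exp (-y) = exp (-(y / 2)) * exp (-(y/2)) := by
        rw [← Real.exp_add]; congr 1; ring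
      rw [this]
      have h7 : exp (y / 2) * exp (-(y / 2)) = 1 := by
        rw [← Real.exp_add]; simp
      have := mul_le_mul_of_nonneg_right h5 (exp_pos (-(y/2))).le
      nlinarith [exp_pos (-(y/2))]
    rw [e1, e2, e3, mul_pow]
    calc _ = 4 * t * (√(4 * π * t) ^ d)⁻¹ * (y * exp (-y)) := by ring
      _ ≤ 4 * t * (√(4 * π * t) ^ d)⁻¹ * (2 * exp (-(y / 2))) := by gcongr
      _ = _ := by field_simp; norm_num
  have hA : ∫ z : Rd d, min 1 (‖z‖ ^ 2 / s ^ 2) * heat t z ≤ 1 := by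
    refine le_of_le_of_eq (integral_mono hi (heat_integrable ht) fun z => ?_)
      (integral_heat (d := d) ht)
    have := (heat_pos ht z).le
    exact mul_le_of_le_one_left this (min_le_left _ _)
  have hB : ∫ z : Rd d, min 1 (‖z‖ ^ 2 / s ^ 2) * heat t z ≤ 8 * √2 ^ d * (t / s ^ 2) := by
    have := (heat_integrable (d := d) (t := 2 * t) (by positivity)).const_mul (8 * √2 ^ d * (t / s ^ 2))
    calc _ ≤ ∫ z : Rd d, 8 * √2 ^ d * (t / s ^ 2) * heat (2 * t) z := by
          refine integral_mono hi this fun z => ?_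
          calc _ ≤ ‖z‖ ^ 2 / s ^ 2 * heat t z := by
                have := (heat_pos ht z).le
                exact mul_le_mul_of_nonneg_right (min_le_right _ _) this
            _ = ‖z‖ ^ 2 * heat t z / s ^ 2 := by ring
            _ ≤ 8 * √2 ^ d * t * heat (2 * t) z / s ^ 2 :=
                div_le_div_of_nonneg_right (hpt z) (by positivity)
            _ = _ := by ring
      _ = _ := by rw [integral_const_mul, integral_heat (by positivity), mul_one]
  rcases min_cases 1 (t / s ^ 2) with h | h
  · rw [h.1]; linarith
  · rw [h.1]; exact hB

namespace Core

variable (Q : Core)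

/-- The Lévy measure with the small jumps removed. -/
def μ (e : ℝ) : Measure ℝ := Q.m.restrict (Ioi e)

/-- The truncated jump kernel. -/
def J (e : ℝ) (z : Rd d) : ℝ := ∫ t, heat t z ∂(Q.μ e)

lemma K_pos : 0 < Q.K := one_pos.trans_le Q.one_le_K

lemma tail_Ici {s : ℝ} (hs : 0 < s) : Q.m (Ici (s ^ 2)) ≤ ofReal (Q.K / Q.v s ^ 2) := by
  refine le_trans ?_ (Q.tail s hs)
  rw [← setLIntegral_one]
  refine le_trans (setLIntegral_mono' measurableSet_Ici (g := fun t => ofReal (min 1 (t / s ^ 2)))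
    fun t ht => ?_) (setLIntegral_le_lintegral _ _)
  rw [min_eq_left, ENNReal.ofReal_one]
  rw [one_le_div (by positivity)]
  exact ht

lemma finite_Ioi {e : ℝ} (he : 0 < e) : Q.m (Ioi e) < ∞ := by
  have h := Q.tail_Ici (s := √e) (by positivity)
  rw [sq_sqrt he.le] at h
  exact (measure_mono Ioi_subset_Ici_self).trans_lt (h.trans_lt ofReal_lt_top)

lemma isFinite_μ {e : ℝ} (he : 0 < e) : IsFiniteMeasure (Q.μ e) :=
  ⟨by simpa [μ] using Q.finite_Ioi he⟩

lemma ae_μ (e : ℝ) : ∀ᵐ t ∂(Q.μ e), e < t := by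
  unfold μ
  exact ae_restrict_mem measurableSet_Ioi

lemma μ_le (e : ℝ) : Q.μ e ≤ Q.m := Measure.restrict_le_self

lemma heat_prod_integrable {e : ℝ} (he : 0 < e) :
    Integrable (fun p : ℝ × Rd d => heat p.1 p.2) ((Q.μ e).prod volume) := by
  have := Q.isFinite_μ he
  rw [integrable_prod_iff heat_measurable.aestronglyMeasurable]
  constructor
  · filter_upwards [Q.ae_μ e] with t ht using heat_integrable (he.trans ht)
  · refine (integrable_const (1:ℝ)).congr ?_
    filter_upwards [Q.ae_μ e] with t ht
    rw [← integral_heat (d := d) (he.trans ht)]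
    congr 1; ext z
    rw [norm_of_nonneg (heat_pos (he.trans ht) z).le]

lemma heat_integrable_μ {e : ℝ} (he : 0 < e) (z : Rd d) :
    Integrable (fun t => heat t z) (Q.μ e) := by
  have := Q.isFinite_μ he
  refine Integrable.of_bound (C := (√e ^ d)⁻¹)
    (heat_measurable.comp (measurable_id.prodMk measurable_const)).aestronglyMeasurable ?_
  filter_upwards [Q.ae_μ e] with t ht
  have ht0 := he.trans ht
  rw [norm_of_nonneg (heat_pos ht0 z).le]
  refine (heat_le_one ht0 z).trans ?_
  have : 0 < √e := by positivity
  gcongr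

lemma J_good {e : ℝ} (he : 0 < e) : GoodKer (Q.J e : Rd d → ℝ) where
  nonneg z := integral_nonneg_of_ae (by
    filter_upwards [Q.ae_μ e] with t ht using (heat_pos (he.trans ht) z).le)
  meas := by
    have := Q.isFinite_μ he
    exact (heat_measurable.stronglyMeasurable.integral_prod_left (μ := Q.μ e)).measurable
  int := by
    have := Q.isFinite_μ he
    exact (Q.heat_prod_integrable he).integral_prod_right
  anti x y h := integral_mono_ae (Q.heat_integrable_μ he y) (Q.heat_integrable_μ he x) (by
    filter_upwards [Q.ae_μ e] with t ht using heat_anti (he.trans ht) h)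

lemma conv_J {e : ℝ} (he : 0 < e) {w : Rd d → ℝ} (hw : BddMeas w) (x : Rd d) :
    Integrable (fun t => convJ (heat t) w x) (Q.μ e) ∧
    convJ (Q.J e) w x = ∫ t, convJ (heat t) w x ∂(Q.μ e) := by
  have := Q.isFinite_μ he
  obtain ⟨hm, M, hM⟩ := hw
  have hint : Integrable (fun p : ℝ × Rd d => w (x + p.2) * heat p.1 p.2)
      ((Q.μ e).prod volume) :=
    (Q.heat_prod_integrable he).bdd_mul (f := fun p : ℝ × Rd d => w (x + p.2)) (c := M)
      (hm.comp (by fun_prop)).aestronglyMeasurable (Eventually.of_forall fun p => hM _)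
  refine ⟨hint.integral_prod_left, ?_⟩
  simp only [convJ, J, ← integral_const_mul]
  exact (integral_integral_swap hint).symm

lemma mass_J {e : ℝ} (he : 0 < e) : ∫ z : Rd d, Q.J e z = (Q.μ e).real univ := by
  have h := (Q.conv_J (d := d) he (BddMeas.const 1) 0).2
  simp only [convJ, one_mul] at h
  rw [h, integral_congr_ae (g := fun _ => (1:ℝ)), integral_const, smul_eq_mul, mul_one]
  filter_upwards [Q.ae_μ e] with t ht using integral_heat (he.trans ht)

lemma min_integrable {e : ℝ} (he : 0 < e) (s : ℝ) :
    Integrable (fun t => min 1 (t / s ^ 2)) (Q.μ e) := by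
  have := Q.isFinite_μ he
  refine Integrable.of_bound (C := 1) (by fun_prop) ?_
  filter_upwards [Q.ae_μ e] with t ht
  have ht0 := he.trans ht
  rw [norm_of_nonneg (by positivity)]
  exact min_le_left _ _

lemma tail_integral {e : ℝ} (he : 0 < e) {s : ℝ} (hs : 0 < s) :
    ∫ t, min 1 (t / s ^ 2) ∂(Q.μ e) ≤ Q.K / Q.v s ^ 2 := by
  have hv := Q.v_pos s hs
  have hK := Q.K_pos
  have h0 : 0 ≤ᵐ[Q.μ e] fun t => min 1 (t / s ^ 2) := by
    filter_upwards [Q.ae_μ e] with t ht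
    have ht0 := he.trans ht
    simp only [Pi.zero_apply]; positivity
  have h1 : ofReal (∫ t, min 1 (t / s ^ 2) ∂(Q.μ e)) ≤ ofReal (Q.K / Q.v s ^ 2) := by
    rw [ofReal_integral_eq_lintegral_ofReal (Q.min_integrable he s) h0]
    exact (lintegral_mono' (Q.μ_le e) le_rfl).trans (Q.tail s hs)
  exact (ENNReal.ofReal_le_ofReal_iff (by positivity)).1 h1

lemma mass_le {e : ℝ} (he : 0 < e) : (Q.μ e).real univ ≤ Q.K / Q.v (√e) ^ 2 := by
  have := Q.isFinite_μ he
  refine le_trans (le_of_eq ?_) (Q.tail_integral he (s := √e) (by positivity))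
  rw [integral_congr_ae (g := fun _ => (1:ℝ)), integral_const, smul_eq_mul, mul_one]
  filter_upwards [Q.ae_μ e] with t ht
  rw [sq_sqrt he.le, min_eq_left]
  rw [one_le_div he]; exact ht.le

end Core

lemma lintegral_iUnion_geom {X : Type*} [MeasurableSpace X] {M : Measure X} {A : ℕ → Set X}
    {F : X → ℝ≥0∞} {B q : ℝ} (hB : 0 ≤ B) (hq0 : 0 ≤ q) (hq : q < 1)
    (h : ∀ k, ∫⁻ x in A k, F x ∂M ≤ ofReal (B * q ^ k)) :
    ∫⁻ x in ⋃ k, A k, F x ∂M ≤ ofReal (B / (1 - q)) := by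
  refine (lintegral_iUnion_le _ _).trans ((ENNReal.tsum_le_tsum h).trans ?_)
  rw [← ENNReal.ofReal_tsum_of_nonneg (fun k => by positivity)
    ((summable_geometric_of_lt_one hq0 hq).mul_left B), tsum_mul_left,
    tsum_geometric_of_lt_one hq0 hq, div_eq_mul_inv]

/-- Every number at least `ρ` lies in a dyadic block. -/
lemma exists_dyadic {ρ x : ℝ} (hρ : 0 < ρ) (hx : ρ ≤ x) :
    ∃ k : ℕ, 2 ^ k * ρ ≤ x ∧ x < 2 ^ (k + 1) * ρ := by
  obtain ⟨k, h1, h2⟩ := exists_nat_pow_near (one_le_div hρ |>.2 hx) (one_lt_two)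
  exact ⟨k, by rwa [le_div_iff₀ hρ] at h1, by rwa [div_lt_iff₀ hρ] at h2⟩

namespace Core

variable (Q : Core)

lemma one_le_two_pow (k : ℕ) : (1:ℝ) ≤ 2 ^ k := one_le_pow₀ (by norm_num)

lemma q_lt : (2:ℝ) ^ (-Q.b) < 1 := Real.rpow_lt_one_of_one_lt_of_neg (by norm_num) (by linarith [Q.b_pos])

/-- Integrals of the scale function against a measure with the tails of the Lévy measure. -/
lemma lintegral_v_tail : ∃ C : ℝ, 1 ≤ C ∧ ∀ {X : Type} [MeasurableSpace X] (M : Measure X)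
    (τ : X → ℝ) (_ : Measurable τ) (A : ℝ) (_ : 0 ≤ A)
    (_ : ∀ s, 0 < s → M {x | s ≤ τ x} ≤ ofReal (A / Q.v s ^ 2)) (ρ : ℝ) (_ : 0 < ρ),
    ∫⁻ x in {x | ρ ≤ τ x}, ofReal (Q.v (4 * τ x)) ∂M
      ≤ ofReal (C * A / Q.v ρ) := by
  have hK := Q.K_pos
  set q : ℝ := 2 ^ (-Q.b) with hq
  have hq0 : 0 < q := by positivity
  have hq1 : q < 1 := Q.q_lt
  refine ⟨1 + 8 * Q.K / (1 - q), ?_, fun {X} _ M τ hτ A hA hM ρ hρ => ?_⟩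
  · have : 0 < 8 * Q.K / (1 - q) := div_pos (by positivity) (by linarith)
    linarith
  have hvρ := Q.v_pos ρ hρ
  set T : Set X := {x | max 1 ρ ≤ τ x} with hT
  set B : ℕ → Set X := fun k => {x | 2 ^ k * ρ ≤ τ x ∧ τ x < 2 ^ (k + 1) * ρ ∧ τ x < 1} with hB
  have hsub : {x | ρ ≤ τ x} ⊆ T ∪ ⋃ k, B k := by
    intro x hx
    by_cases h1 : 1 ≤ τ x
    · exact Or.inl (max_le h1 hx)
    · obtain ⟨k, hk⟩ := exists_dyadic hρ hx
      exact Or.inr (mem_iUnion.2 ⟨k, hk.1, hk.2, not_le.1 h1⟩)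
  have e1 : ∫⁻ x in T, ofReal (Q.v (4 * τ x)) ∂M ≤ ofReal (A / Q.v ρ) := by
    have hm : 0 < max 1 ρ := by positivity
    have hvm := Q.v_pos _ hm
    calc _ ≤ ∫⁻ x in T, ofReal (Q.v (max 1 ρ)) ∂M := by
          refine setLIntegral_mono' (measurableSet_le measurable_const hτ) fun x hx => ?_
          have hx1 : 1 ≤ τ x := (le_max_left 1 ρ).trans hx
          rw [Q.const (4 * τ x) (by linarith), Q.const (max 1 ρ) (le_max_left _ _)]
      _ = ofReal (Q.v (max 1 ρ)) * M T := by rw [setLIntegral_const]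
      _ ≤ ofReal (Q.v (max 1 ρ)) * ofReal (A / Q.v (max 1 ρ) ^ 2) := by
          gcongr; exact hM _ hm
      _ = ofReal (A / Q.v (max 1 ρ)) := by
          rw [← ofReal_mul hvm.le]; congr 1; field_simp
      _ ≤ _ := by
          have := Q.mono ρ (max 1 ρ) hρ (le_max_right _ _)
          gcongr
  have e2 : ∫⁻ x in ⋃ k, B k, ofReal (Q.v (4 * τ x)) ∂M
      ≤ ofReal ((8 * A * Q.K / Q.v ρ) / (1 - q)) := by
    refine lintegral_iUnion_geom (by positivity) hq0.le hq1 fun k => ?_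
    have hk0 : 0 < 2 ^ k * ρ := by positivity
    have hvk := Q.v_pos _ hk0
    by_cases hk : 2 ^ k * ρ ≤ 1
    · have hlow := Q.low (2 ^ k) ρ (one_le_two_pow k) hρ hk
      calc _ ≤ ∫⁻ x in B k, ofReal (8 * Q.v (2 ^ k * ρ)) ∂M := by
            refine setLIntegral_mono' ((measurableSet_le measurable_const hτ).inter
              ((measurableSet_lt hτ measurable_const).inter
                (measurableSet_lt hτ measurable_const))) fun x hx => ?_
            have h0 : 0 < τ x := hk0.trans_le hx.1
            refine ofReal_le_ofReal ((Q.mono _ _ (by positivity) ?_).trans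
              (Q.lin 8 _ (by norm_num) hk0))
            have := hx.2.1
            rw [pow_succ] at this
            linarith
        _ = ofReal (8 * Q.v (2 ^ k * ρ)) * M (B k) := by rw [setLIntegral_const]
        _ ≤ ofReal (8 * Q.v (2 ^ k * ρ)) * ofReal (A / Q.v (2 ^ k * ρ) ^ 2) := by
            gcongr
            exact (measure_mono fun x hx => hx.1).trans (hM _ hk0)
        _ = ofReal (8 * A / Q.v (2 ^ k * ρ)) := by
            rw [← ofReal_mul (by positivity)]; congr 1; field_simp
        _ ≤ _ := by
            refine ofReal_le_ofReal ?_
            have h2 : q ^ k = ((2 ^ k : ℝ) ^ Q.b)⁻¹ := by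
              rw [hq, ← rpow_natCast, ← rpow_natCast, ← rpow_mul (by norm_num),
                ← rpow_mul (by norm_num), ← Real.rpow_neg (by norm_num)]
              congr 1; ring
            have h3 : 0 < (2 ^ k : ℝ) ^ Q.b := by positivity
            rw [h2, div_le_iff₀ hvk]
            calc 8 * A = 8 * A / Q.v ρ * ((2 ^ k : ℝ) ^ Q.b)⁻¹ * ((2 ^ k : ℝ) ^ Q.b * Q.v ρ) := by
                  field_simp
              _ ≤ 8 * A / Q.v ρ * ((2 ^ k : ℝ) ^ Q.b)⁻¹ * (Q.K * Q.v (2 ^ k * ρ)) := by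
                  gcongr
              _ = _ := by ring
    · have : B k = ∅ := by
        ext x
        simp only [hB, mem_ofPred_eq, mem_empty_iff_false, iff_false]
        rintro ⟨h1, _, h3⟩
        linarith
      rw [this]; simp
  have hq2 : 0 < 1 - q := by linarith
  calc _ ≤ ∫⁻ x in T ∪ ⋃ k, B k, ofReal (Q.v (4 * τ x)) ∂M := lintegral_mono_set hsub
    _ ≤ _ := lintegral_union_le _ _ _
    _ ≤ ofReal (A / Q.v ρ) + ofReal ((8 * A * Q.K / Q.v ρ) / (1 - q)) :=
        add_le_add e1 e2
    _ = _ := by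
        rw [← ofReal_add (by positivity) (by positivity)]
        congr 1; field_simp

/-- Truncated second moments of the jump kernel. -/
lemma J_moment (d : ℕ) : ∃ C : ℝ, 1 ≤ C ∧ ∀ e, 0 < e → ∀ s, 0 < s →
    ∫ z : Rd d, min 1 (‖z‖ ^ 2 / s ^ 2) * Q.J e z ≤ C / Q.v s ^ 2 := by
  obtain ⟨C, hC, h⟩ := heat_moment d
  refine ⟨C * Q.K, ?_, fun e he s hs => ?_⟩
  · nlinarith [Q.one_le_K]
  have hbm : BddMeas (fun z : Rd d => min 1 (‖z‖ ^ 2 / s ^ 2)) := by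
    refine ⟨by fun_prop, 1, fun z => ?_⟩
    rw [abs_of_nonneg (by positivity)]
    exact min_le_left _ _
  obtain ⟨h1, h2⟩ := Q.conv_J he hbm 0
  simp only [convJ, zero_add] at h1 h2
  rw [h2]
  calc _ ≤ ∫ t, C * min 1 (t / s ^ 2) ∂(Q.μ e) := by
        refine integral_mono_ae h1 ((Q.min_integrable he s).const_mul C) ?_
        filter_upwards [Q.ae_μ e] with t ht using h t (he.trans ht) s hs
    _ ≤ C * (Q.K / Q.v s ^ 2) := by
        rw [integral_const_mul]
        have := Q.tail_integral he hs
        gcongr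
    _ = _ := by ring

/-- Tails of the jump kernel. -/
lemma J_tail (d : ℕ) : ∃ C : ℝ, 1 ≤ C ∧ ∀ e, 0 < e → ∀ s, 0 < s →
    ∫ z : Rd d in {z | s ≤ ‖z‖}, Q.J e z ≤ C / Q.v s ^ 2 := by
  obtain ⟨C, hC, h⟩ := Q.J_moment d
  refine ⟨C, hC, fun e he s hs => le_trans ?_ (h e he s hs)⟩
  have hJ := Q.J_good (d := d) he
  have hbm : BddMeas (fun z : Rd d => min 1 (‖z‖ ^ 2 / s ^ 2)) := by
    refine ⟨by fun_prop, 1, fun z => ?_⟩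
    rw [abs_of_nonneg (by positivity)]
    exact min_le_left _ _
  have hi := hbm.mul_integrable hJ.int
  calc _ ≤ ∫ z : Rd d in {z | s ≤ ‖z‖}, min 1 (‖z‖ ^ 2 / s ^ 2) * Q.J e z := by
        refine setIntegral_mono_on hJ.int.integrableOn hi.integrableOn
          (measurableSet_le measurable_const measurable_norm) fun z hz => ?_
        rw [min_eq_left, one_mul]
        rw [one_le_div (by positivity)]
        exact pow_le_pow_left₀ hs.le hz 2
    _ ≤ _ := setIntegral_le_integral hi (Eventually.of_forall fun z =>
        mul_nonneg (by positivity) (hJ.nonneg z))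

lemma J_upper (d : ℕ) : ∃ C : ℝ, 1 ≤ C ∧ ∀ e, 0 < e → ∀ z : Rd d, z ≠ 0 →
    Q.J e z ≤ C * (‖z‖ ^ d)⁻¹ / Q.v ‖z‖ ^ 2 := by
  obtain ⟨C, hC, h⟩ := heat_decay d
  refine ⟨C * Q.K, by nlinarith [Q.one_le_K], fun e he z hz => ?_⟩
  have hz' : 0 < ‖z‖ := norm_pos_iff.2 hz
  calc Q.J e z ≤ ∫ t, C * (‖z‖ ^ d)⁻¹ * min 1 (t / ‖z‖ ^ 2) ∂(Q.μ e) := by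
        refine integral_mono_ae (Q.heat_integrable_μ he z)
          ((Q.min_integrable he _).const_mul _) ?_
        filter_upwards [Q.ae_μ e] with t ht
        have ht0 := he.trans ht
        rcases min_cases 1 (t / ‖z‖ ^ 2) with hm | hm
        · rw [hm.1, mul_one]
          have h1 := hm.2
          rw [one_le_div (by positivity)] at h1
          refine (heat_le_one ht0 z).trans ?_
          have h2 : ‖z‖ ≤ √t := Real.le_sqrt_of_sq_le h1
          calc (√t ^ d)⁻¹ ≤ 1 * (‖z‖ ^ d)⁻¹ := by rw [one_mul]; gcongr
            _ ≤ _ := by gcongr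
        · rw [hm.1]
          refine (h t ht0 z hz).trans (le_of_eq ?_)
          ring
    _ ≤ C * (‖z‖ ^ d)⁻¹ * (Q.K / Q.v ‖z‖ ^ 2) := by
        rw [integral_const_mul]
        have := Q.tail_integral he hz'
        gcongr
    _ = _ := by ring

/-- A window of the Lévy measure with mass comparable to the full tail. -/
lemma exists_window : ∃ M : ℝ, 1 ≤ M ∧ ∀ ρ, 0 < ρ → ρ ≤ Q.s₀ → M * ρ ≤ 1 →
    ofReal (1 / (2 * Q.K * Q.v ρ ^ 2)) ≤ Q.m (Ico (ρ ^ 2) ((M * ρ) ^ 2)) := by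
  have hK := Q.K_pos
  have hb := Q.b_pos
  obtain ⟨M, hM1, hM⟩ : ∃ M : ℝ, 1 ≤ M ∧ 2 * Q.K ^ 4 ≤ (M ^ Q.b) ^ 2 := by
    have := ((tendsto_pow_atTop (α := ℝ) two_ne_zero).comp (tendsto_rpow_atTop hb)).eventually_ge_atTop
      (2 * Q.K ^ 4)
    obtain ⟨M, h1, h2⟩ := (this.and (eventually_ge_atTop 1)).exists
    exact ⟨M, h2, h1⟩
  refine ⟨M, hM1, fun ρ hρ hρ0 hMρ => ?_⟩
  have hMρ0 : 0 < M * ρ := by positivity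
  have hv := Q.v_pos ρ hρ
  have hvM := Q.v_pos _ hMρ0
  have h1 := Q.tail_low ρ hρ hρ0
  have h2 := Q.tail_Ici hMρ0
  have h3 : Q.K / Q.v (M * ρ) ^ 2 ≤ 1 / (2 * Q.K * Q.v ρ ^ 2) := by
    have hl := Q.low M ρ hM1 hρ hMρ
    rw [div_le_div_iff₀ (by positivity) (by positivity), one_mul]
    have hl2 : (M ^ Q.b * Q.v ρ) ^ 2 ≤ (Q.K * Q.v (M * ρ)) ^ 2 :=
      pow_le_pow_left₀ (by positivity) hl 2
    have : 2 * Q.K ^ 4 * Q.v ρ ^ 2 ≤ (Q.K * Q.v (M * ρ)) ^ 2 := by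
      refine le_trans ?_ hl2
      rw [mul_pow]; gcongr
    have h5 : Q.K ^ 2 * (Q.K * (2 * Q.K * Q.v ρ ^ 2)) ≤ Q.K ^ 2 * Q.v (M * ρ) ^ 2 := by
      nlinarith
    exact le_of_mul_le_mul_left h5 (by positivity)
  have hsub : ρ ^ 2 ≤ (M * ρ) ^ 2 := pow_le_pow_left₀ hρ.le (by nlinarith) 2
  have h4 : Q.m (Ici (ρ ^ 2)) ≤ Q.m (Ico (ρ ^ 2) ((M * ρ) ^ 2)) + Q.m (Ici ((M * ρ) ^ 2)) := by
    rw [← Ico_union_Ici_eq_Ici hsub]; exact measure_union_le _ _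
  have h5 : ofReal (1 / (Q.K * Q.v ρ ^ 2)) = ofReal (1 / (2 * Q.K * Q.v ρ ^ 2))
      + ofReal (1 / (2 * Q.K * Q.v ρ ^ 2)) := by
    rw [← ofReal_add (by positivity) (by positivity)]
    congr 1; field_simp; norm_num
  have h6 : ofReal (1 / (2 * Q.K * Q.v ρ ^ 2)) + ofReal (1 / (2 * Q.K * Q.v ρ ^ 2))
      ≤ Q.m (Ico (ρ ^ 2) ((M * ρ) ^ 2)) + ofReal (1 / (2 * Q.K * Q.v ρ ^ 2)) := by
    rw [← h5]
    exact h1.trans (h4.trans (add_le_add le_rfl (h2.trans (ofReal_le_ofReal h3))))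
  exact (ENNReal.add_le_add_iff_right ENNReal.ofReal_ne_top).1 h6

lemma J_lower (d : ℕ) : ∃ c r₀ : ℝ, 0 < c ∧ 0 < r₀ ∧ r₀ ≤ 1 ∧ r₀ ≤ Q.s₀ ∧ ∀ e, 0 < e → ∀ z : Rd d,
    e < ‖z‖ ^ 2 → ‖z‖ ≤ r₀ → c * (‖z‖ ^ d)⁻¹ / Q.v ‖z‖ ^ 2 ≤ Q.J e z := by
  obtain ⟨M, hM, h⟩ := Q.exists_window
  obtain ⟨c, hc, hg⟩ := heat_ge d
  have hK := Q.K_pos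
  refine ⟨c * (M ^ d)⁻¹ * (1 / (2 * Q.K)), min Q.s₀ (1 / M), by positivity,
    lt_min Q.s₀_pos (by positivity), (min_le_left _ _).trans Q.s₀_le, min_le_left _ _,
    fun e he z hez hz => ?_⟩
  have hρ : 0 < ‖z‖ := by
    by_contra h0
    have : ‖z‖ = 0 := le_antisymm (not_lt.1 h0) (norm_nonneg _)
    rw [this] at hez; norm_num at hez; linarith
  have hMz : M * ‖z‖ ≤ 1 := by
    have := hz.trans (min_le_right _ _)
    rwa [le_div_iff₀' (by positivity)] at this
  have hv := Q.v_pos _ hρ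
  have hw := h ‖z‖ hρ (hz.trans (min_le_left _ _)) hMz
  have := Q.isFinite_μ he
  set I := Ico (‖z‖ ^ 2) ((M * ‖z‖) ^ 2) with hI
  have hμI : 1 / (2 * Q.K * Q.v ‖z‖ ^ 2) ≤ (Q.μ e).real I := by
    rw [Measure.real, ← ENNReal.ofReal_le_iff_le_toReal (measure_ne_top _ _), μ,
      Measure.restrict_apply measurableSet_Ico, inter_eq_left.2]
    · exact hw
    · intro t ht; exact hez.trans_le ht.1
  calc _ = c * ((M * ‖z‖) ^ d)⁻¹ * (1 / (2 * Q.K * Q.v ‖z‖ ^ 2)) := by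
        rw [mul_pow, mul_inv]; field_simp
    _ ≤ c * ((M * ‖z‖) ^ d)⁻¹ * (Q.μ e).real I := by gcongr
    _ = ∫ t in I, c * ((M * ‖z‖) ^ d)⁻¹ ∂(Q.μ e) := by
        rw [setIntegral_const, smul_eq_mul]; ring
    _ ≤ ∫ t in I, heat t z ∂(Q.μ e) := by
        refine setIntegral_mono_on integrableOn_const (Q.heat_integrable_μ he z).integrableOn
          measurableSet_Ico fun t ht => ?_
        have ht0 : 0 < t := (by positivity : 0 < ‖z‖ ^ 2).trans_le ht.1
        refine le_trans ?_ (hg t ht0 z ht.1)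
        have h1 : √t ≤ M * ‖z‖ := Real.sqrt_le_iff.2 ⟨by positivity, ht.2.le⟩
        have : 0 < √t := by positivity
        gcongr
    _ ≤ _ := setIntegral_le_integral (Q.heat_integrable_μ he z) (by
        filter_upwards [Q.ae_μ e] with t ht using (heat_pos (he.trans ht) z).le)

/-- The jump kernel charges the complement of any ball, uniformly in the truncation. -/
lemma J_far (hd : 0 < d) (L : ℝ) : ∃ c e₀ : ℝ, 0 < c ∧ 0 < e₀ ∧ ∀ e, 0 < e → e ≤ e₀ →
    c ≤ ∫ z : Rd d in {z | L ≤ ‖z‖}, Q.J e z := by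
  set e₀ := Q.s₀ ^ 2 / 2 with he₀
  have hs := Q.s₀_pos
  have he₀0 : 0 < e₀ := by positivity
  have := Q.isFinite_μ he₀0
  have hμ : Q.μ e₀ ≠ 0 := by
    intro h0
    have h1 := Q.tail_low Q.s₀ hs le_rfl
    have h2 : Q.μ e₀ (Ici (Q.s₀ ^ 2)) = Q.m (Ici (Q.s₀ ^ 2)) := by
      rw [μ, Measure.restrict_apply measurableSet_Ici, inter_eq_left.2]
      intro t ht
      have : Q.s₀ ^ 2 ≤ t := ht
      show e₀ < t
      have : 0 < Q.s₀ ^ 2 := by positivity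
      linarith
    rw [h0] at h2
    rw [← h2] at h1
    simp only [Measure.coe_zero, Pi.zero_apply, nonpos_iff_eq_zero, ENNReal.ofReal_eq_zero] at h1
    have hv := Q.v_pos _ hs
    have hK := Q.K_pos
    exact absurd h1 (not_le.2 (by positivity))
  have hpos : ∀ z : Rd d, 0 < Q.J e₀ z := by
    intro z
    refine (integral_pos_iff_support_of_nonneg_ae (by
        filter_upwards [Q.ae_μ e₀] with t ht using (heat_pos (he₀0.trans ht) z).le)
      (Q.heat_integrable_μ he₀0 z)).2 ?_
    rw [pos_iff_ne_zero]
    intro h0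
    have h1 : ∀ᵐ t ∂(Q.μ e₀), heat t z = 0 := by
      rw [ae_iff]; exact h0
    have h2 : ∀ᵐ t ∂(Q.μ e₀), False := by
      filter_upwards [h1, Q.ae_μ e₀] with t h1 h2
      exact (heat_pos (he₀0.trans h2) z).ne' h1
    exact hμ (by simpa using h2)
  refine ⟨∫ z : Rd d in {z | L ≤ ‖z‖}, Q.J e₀ z, e₀, ?_, he₀0, fun e he hee => ?_⟩
  · rw [setIntegral_pos_iff_support_of_nonneg_ae (Eventually.of_forall fun z => (hpos z).le)
      (Q.J_good he₀0).int.integrableOn]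
    have : Nontrivial (Rd d) := by
      have : Nonempty (Fin d) := ⟨⟨0, hd⟩⟩
      infer_instance
    obtain ⟨z, hz⟩ := NormedSpace.exists_lt_norm ℝ (Rd d) L
    have ho : IsOpen {z : Rd d | L < ‖z‖} := isOpen_lt continuous_const continuous_norm
    refine (ho.measure_pos volume ⟨z, hz⟩).trans_le (measure_mono fun y hy => ⟨(hpos y).ne', ?_⟩)
    have hy' : L < ‖y‖ := hy
    exact hy'.le
  · refine setIntegral_mono (Q.J_good he₀0).int.integrableOn (Q.J_good he).int.integrableOn
      fun z => ?_
    refine integral_mono_measure ?_ ?_ (Q.heat_integrable_μ he z)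
    · exact Measure.restrict_mono (Ioi_subset_Ioi hee) le_rfl
    · filter_upwards [Q.ae_μ e] with t ht using (heat_pos (he.trans ht) z).le

end Core

lemma heat_le_max (d : ℕ) : ∃ C : ℝ, 1 ≤ C ∧ ∀ t : ℝ, 0 < t → ∀ z : Rd d,
    heat t z ≤ C * (t / max (√t) ‖z‖ ^ 2) * (max (√t) ‖z‖ ^ d)⁻¹ := by
  obtain ⟨C, hC, h⟩ := heat_decay d
  refine ⟨C, hC, fun t ht z => ?_⟩
  have hs : 0 < √t := sqrt_pos.2 ht
  rcases le_total ‖z‖ (√t) with h1 | h1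
  · rw [max_eq_left h1, sq_sqrt ht.le, div_self ht.ne', mul_one]
    calc heat t z ≤ 1 * (√t ^ d)⁻¹ := by rw [one_mul]; exact heat_le_one ht z
      _ ≤ _ := by gcongr
  · rw [max_eq_right h1]
    refine h t ht z ?_
    rw [← norm_pos_iff]; linarith

lemma GoodKer.conv_comm {J₁ J₂ : Rd d → ℝ} (h₁ : GoodKer J₁) (h₂ : GoodKer J₂) {w : Rd d → ℝ}
    (hw : BddMeas w) (x : Rd d) : convJ J₁ (convJ J₂ w) x = convJ J₂ (convJ J₁ w) x := by
  have hint : Integrable (fun p : Rd d × Rd d => w (x + p.1 + p.2) * (J₁ p.1 * J₂ p.2))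
      (volume.prod volume) := by
    obtain ⟨hm, M, hM⟩ := hw
    refine (h₁.int.mul_prod h₂.int).bdd_mul (c := M) ?_ (Eventually.of_forall fun p => hM _)
    exact (hm.comp (by fun_prop)).aestronglyMeasurable
  have e1 : convJ J₁ (convJ J₂ w) x = ∫ y, ∫ z, w (x + y + z) * (J₁ y * J₂ z) := by
    unfold convJ
    refine integral_congr_ae (Eventually.of_forall fun y => ?_)
    simp only
    rw [← integral_mul_const]
    exact integral_congr_ae (Eventually.of_forall fun z => by simp only; ring)
  have e2 : convJ J₂ (convJ J₁ w) x = ∫ z, ∫ y, w (x + y + z) * (J₁ y * J₂ z) := by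
    unfold convJ
    refine integral_congr_ae (Eventually.of_forall fun z => ?_)
    simp only
    rw [← integral_mul_const]
    refine integral_congr_ae (Eventually.of_forall fun y => ?_)
    simp only
    rw [add_right_comm]; ring
  rw [e1, e2, integral_integral_swap hint]

/-- The heat flow of `w` at the point `x`, extended by `w x` at time zero. -/
def flow (w : Rd d → ℝ) (x : Rd d) (s : ℝ) : ℝ := if 0 < s then convJ (heat s) w x else w x

lemma flow_pos {w : Rd d → ℝ} {x : Rd d} {s : ℝ} (hs : 0 < s) :
    flow w x s = convJ (heat s) w x := if_pos hs

lemma flow_zero {w : Rd d → ℝ} {x : Rd d} : flow w x 0 = w x := if_neg (lt_irrefl _)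

lemma flow_const_le {f : Rd d → ℝ} (hf : BddMeas f) {B : ℝ} (h : ∀ x, f x ≤ B) (x : Rd d) (s : ℝ) :
    flow f x s ≤ B := by
  unfold flow
  split_ifs with hs
  · have := (heat_good hs).conv_mono hf (BddMeas.const B) h x
    rwa [GoodKer.conv_const, integral_heat hs, one_mul] at this
  · exact h x

namespace Core
variable (Q : Core)

lemma flow_evolution {e : ℝ} (he : 0 < e) {w f : Rd d → ℝ} (hw : BddMeas w) (hf : BddMeas f)
    (h : ∀ x, Lop (Q.J e) w x ≤ f x) (x : Rd d) {s : ℝ} (hs : 0 ≤ s) :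
    Integrable (fun t => flow w x (s + t)) (Q.μ e) ∧
      (Q.μ e).real univ * flow w x s ≤ flow f x s + ∫ t, flow w x (s + t) ∂(Q.μ e) := by
  rcases hs.eq_or_lt with rfl | hs
  · have h1 := Q.conv_J he hw x
    have h2 : (fun t => convJ (heat t) w x) =ᵐ[Q.μ e] fun t => flow w x (0 + t) := by
      filter_upwards [Q.ae_μ e] with t ht
      rw [zero_add, flow_pos (he.trans ht)]
    refine ⟨h1.1.congr h2, ?_⟩
    rw [← integral_congr_ae h2, ← h1.2, flow_zero, flow_zero, ← Q.mass_J (d := d) he]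
    have := h x
    unfold Lop at this
    linarith
  · have h1 := Q.conv_J he ((heat_good hs).conv_bddMeas hw) x
    have h2 : (fun t => convJ (heat t) (convJ (heat s) w) x) =ᵐ[Q.μ e]
        fun t => flow w x (s + t) := by
      filter_upwards [Q.ae_μ e] with t ht
      have ht := he.trans ht
      rw [heat_semigroup ht hs hw, flow_pos (by linarith), add_comm]
    refine ⟨h1.1.congr h2, ?_⟩
    rw [← integral_congr_ae h2, ← h1.2, flow_pos hs, flow_pos hs, ← Q.mass_J (d := d) he,
      ← (heat_good hs).conv_comm (Q.J_good he) hw]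
    have h3 := (heat_good hs).conv_mono ((Q.J_good he).Lop_bddMeas hw) hf h x
    have h4 : convJ (heat s) (Lop (Q.J e) w) x = (∫ z : Rd d, Q.J e z) * convJ (heat s) w x
        - convJ (heat s) (convJ (Q.J e) w) x := by
      rw [← GoodKer.conv_const_mul]
      exact (heat_good hs).conv_sub (hw.const_mul _) ((Q.J_good he).conv_bddMeas hw) x
    linarith

lemma scalar_comparison {e : ℝ} (he : 0 < e) {b : ℝ} {φ ψ F : ℝ → ℝ}
    (hpos : 0 < (Q.μ e).real univ)
    (hφi : ∀ s, 0 ≤ s → Integrable (fun t => φ (s + t)) (Q.μ e))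
    (hψi : ∀ s, 0 ≤ s → Integrable (fun t => ψ (s + t)) (Q.μ e))
    (hφ : ∀ s, 0 ≤ s → s < b →
      (Q.μ e).real univ * φ s ≤ F s + ∫ t, φ (s + t) ∂(Q.μ e))
    (hψ : ∀ s, 0 ≤ s → s < b →
      F s + ∫ t, ψ (s + t) ∂(Q.μ e) ≤ (Q.μ e).real univ * ψ s)
    (hb : ∀ s, 0 ≤ s → b ≤ s → φ s ≤ ψ s) (s : ℝ) (hs : 0 ≤ s) : φ s ≤ ψ s := by
  have key : ∀ n : ℕ, ∀ s, 0 ≤ s → b - n * e ≤ s → φ s ≤ ψ s := by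
    intro n
    induction n with
    | zero => intro s hs h; exact hb s hs (by simpa using h)
    | succ n ih =>
      intro s hs h
      by_cases hsb : b ≤ s
      · exact hb s hs hsb
      push Not at hsb
      have h1 : ∫ t, φ (s + t) ∂(Q.μ e) ≤ ∫ t, ψ (s + t) ∂(Q.μ e) := by
        refine integral_mono_ae (hφi s hs) (hψi s hs) ?_
        filter_upwards [Q.ae_μ e] with t ht
        refine ih _ (by linarith) ?_
        push_cast at h
        linarith
      exact le_of_mul_le_mul_left ((hφ s hs hsb).trans ((add_le_add le_rfl h1).trans (hψ s hs hsb)))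
        hpos
  obtain ⟨n, hn⟩ := exists_nat_gt (b / e)
  refine key n s hs ?_
  rw [div_lt_iff₀ he] at hn
  linarith

lemma v_le_one {r : ℝ} (hr : 0 < r) : Q.v r ≤ Q.v 1 := by
  rcases le_total r 1 with h | h
  · exact Q.mono _ _ hr h
  · exact (Q.const _ h).le

lemma μ_Ici {e : ℝ} {s : ℝ} (hs : 0 < s) (hes : e < s ^ 2) (hss : s ≤ Q.s₀) (he : 0 < e) :
    1 / (Q.K * Q.v s ^ 2) ≤ (Q.μ e).real (Ici (s ^ 2)) := by
  have := Q.isFinite_μ he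
  rw [Measure.real, ← ENNReal.ofReal_le_iff_le_toReal (measure_ne_top _ _), μ,
    Measure.restrict_apply measurableSet_Ici, inter_eq_left.2]
  · exact Q.tail_low s hs hss
  · intro t ht; exact hes.trans_le ht

lemma v_sqrt_monotone {b : ℝ} (hb : 0 < b) : Monotone fun s => Q.v (√(max s b)) := by
  intro s t h
  exact Q.mono _ _ (sqrt_pos.2 (lt_max_of_lt_right hb))
    (Real.sqrt_le_sqrt (max_le_max h le_rfl))

lemma v_sqrt_integrable {e b : ℝ} (he : 0 < e) (hb : 0 < b) (s : ℝ) :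
    Integrable (fun t => Q.v (√(max (s + t) b))) (Q.μ e) := by
  have := Q.isFinite_μ he
  refine Integrable.of_bound (C := Q.v 1) ?_ (Eventually.of_forall fun t => ?_)
  · exact ((Q.v_sqrt_monotone hb).measurable.comp (measurable_const_add s)).aestronglyMeasurable
  · have h : 0 < √(max (s + t) b) := sqrt_pos.2 (lt_max_of_lt_right hb)
    rw [norm_of_nonneg (Q.v_pos _ h).le]
    exact Q.v_le_one h

/-- The function `v(√·)` varies slowly along the jump measure. -/
lemma v_variation : ∃ C : ℝ, 1 ≤ C ∧ ∀ e, 0 < e → ∀ ρ, 0 < ρ →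
    ∫ t, (Q.v (√(max (ρ ^ 2 + t) (ρ ^ 2))) - Q.v ρ) ∂(Q.μ e) ≤ C / Q.v ρ := by
  obtain ⟨C, hC, h⟩ := Q.lintegral_v_tail
  have hK := Q.one_le_K
  refine ⟨Q.K + C * Q.K, by nlinarith, fun e he ρ hρ => ?_⟩
  have hv := Q.v_pos _ hρ
  have hf := Q.isFinite_μ he
  have hρ2 : 0 < ρ ^ 2 := by positivity
  set G : ℝ → ℝ := fun t => Q.v (√(max (ρ ^ 2 + t) (ρ ^ 2))) with hG
  have hGi : Integrable G (Q.μ e) := Q.v_sqrt_integrable he hρ2 _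
  set A := {t : ℝ | ρ ≤ √t} with hA
  have hAm : MeasurableSet A := measurableSet_le measurable_const Real.continuous_sqrt.measurable
  have h2 : ∫ t in A, G t ∂(Q.μ e) ≤ C * Q.K / Q.v ρ := by
    have h3 := h (Q.μ e) (fun t => √t) Real.continuous_sqrt.measurable Q.K Q.K_pos.le
      (fun s hs => ((Q.μ_le e) _).trans ((measure_mono fun t ht => ?_).trans (Q.tail_Ici hs))) ρ hρ
    · rw [← ENNReal.ofReal_le_ofReal_iff (by have := Q.K_pos; positivity),
        ofReal_integral_eq_lintegral_ofReal hGi.integrableOn]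
      · refine le_trans (setLIntegral_mono_ae ?_ ?_) h3
        · have : Measurable fun t => Q.v (4 * max (√t) ρ) := by
            have hm : Monotone fun t => Q.v (4 * max (√t) ρ) := fun s t hst =>
              Q.mono _ _ (by positivity) (by gcongr)
            exact hm.measurable
          have h5 : AEMeasurable (fun t => ofReal (Q.v (4 * max (√t) ρ)))
            ((Q.μ e).restrict A) := this.ennreal_ofReal.aemeasurable
          refine h5.congr ?_
          filter_upwards [ae_restrict_mem hAm] with t ht
          have : ρ ≤ √t := ht
          rw [max_eq_left this]
        · filter_upwards with t ht
          have ht : ρ ≤ √t := ht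
          have ht0 : 0 < t := sqrt_pos.1 (hρ.trans_le ht)
          have ht2 : ρ ^ 2 ≤ t := by
            have := sq_sqrt ht0.le
            nlinarith
          refine ofReal_le_ofReal (Q.mono _ _ (sqrt_pos.2 (lt_max_of_lt_right hρ2)) ?_)
          rw [max_eq_left (by linarith), Real.sqrt_le_left (by positivity), mul_pow,
            sq_sqrt ht0.le]
          linarith
      · exact Eventually.of_forall fun t => (Q.v_pos _ (sqrt_pos.2 (lt_max_of_lt_right hρ2))).le
    · have ht : s ≤ √t := ht
      have ht0 : 0 < t := sqrt_pos.1 (hs.trans_le ht)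
      show s ^ 2 ≤ t
      have := sq_sqrt ht0.le
      nlinarith
  have hpt : ∀ᵐ t ∂(Q.μ e), G t - Q.v ρ ≤ Q.v ρ * min 1 (t / ρ ^ 2) + A.indicator G t := by
    filter_upwards [Q.ae_μ e] with t ht
    have ht0 := he.trans ht
    have hm : 0 ≤ min 1 (t / ρ ^ 2) := le_min zero_le_one (by positivity)
    by_cases htA : t ∈ A
    · rw [indicator_of_mem htA]
      nlinarith
    · rw [indicator_of_notMem htA, add_zero]
      have htA : √t < ρ := not_le.1 htA
      have htl : t < ρ ^ 2 := by
        have := sq_sqrt ht0.le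
        have := Real.sqrt_nonneg t
        nlinarith
      rw [min_eq_right ((div_le_one hρ2).2 htl.le)]
      have h1 : 1 ≤ 1 + t / ρ ^ 2 := by
        have : 0 ≤ t / ρ ^ 2 := by positivity
        linarith
      have h3 := Q.lin (1 + t / ρ ^ 2) ρ h1 hρ
      have h4 : G t ≤ Q.v ((1 + t / ρ ^ 2) * ρ) := by
        refine Q.mono _ _ (sqrt_pos.2 (lt_max_of_lt_right hρ2)) ?_
        rw [max_eq_left (by linarith), Real.sqrt_le_left (by positivity), mul_pow]
        have : ρ ^ 2 + t = (1 + t / ρ ^ 2) * ρ ^ 2 := by field_simp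
        rw [this]
        have : 0 < ρ ^ 2 := hρ2
        gcongr
        nlinarith
      linarith
  have hmi : Integrable (fun t => Q.v ρ * min 1 (t / ρ ^ 2)) (Q.μ e) :=
    (Q.min_integrable he ρ).const_mul _
  calc ∫ t, (G t - Q.v ρ) ∂(Q.μ e)
      ≤ ∫ t, (Q.v ρ * min 1 (t / ρ ^ 2) + A.indicator G t) ∂(Q.μ e) :=
        integral_mono_ae (hGi.sub (integrable_const _)) (hmi.add (hGi.indicator hAm)) hpt
    _ = Q.v ρ * ∫ t, min 1 (t / ρ ^ 2) ∂(Q.μ e) + ∫ t in A, G t ∂(Q.μ e) := by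
        rw [integral_add hmi (hGi.indicator hAm), integral_const_mul, integral_indicator hAm]
    _ ≤ Q.v ρ * (Q.K / Q.v ρ ^ 2) + C * Q.K / Q.v ρ := by
        gcongr
        exact Q.tail_integral he hρ
    _ = (Q.K + C * Q.K) / Q.v ρ := by field_simp

end Core

lemma BddMeas.comp_add {w : Rd d → ℝ} (hw : BddMeas w) (x : Rd d) : BddMeas fun z => w (x + z) :=
  ⟨hw.1.comp (measurable_const_add x), hw.2.imp fun _ h _ => h _⟩

lemma BddMeas.integrableOn {w : Rd d → ℝ} (hw : BddMeas w) {A : Set (Rd d)} (hA : volume A ≠ ∞) :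
    IntegrableOn w A := by
  obtain ⟨hm, M, hM⟩ := hw
  exact IntegrableOn.of_bound (lt_top_iff_ne_top.2 hA) hm.aestronglyMeasurable M
    (Eventually.of_forall fun x => hM x)

lemma setIntegral_ball_shift (w : Rd d → ℝ) (x : Rd d) (ρ : ℝ) :
    ∫ z in ball (0 : Rd d) ρ, w (x + z) = ∫ y in ball x ρ, w y := by
  rw [← integral_indicator measurableSet_ball, ← integral_indicator measurableSet_ball,
    ← integral_add_left_eq_self ((ball x ρ).indicator w) x]
  congr 1
  ext z
  simp only [indicator, mem_ball, dist_eq_norm, sub_zero, add_sub_cancel_left]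

namespace Core
variable (Q : Core)

lemma flow_growth (d : ℕ) : ∃ C : ℝ, 1 ≤ C ∧ ∀ {w : Rd d → ℝ} (_ : BddMeas w) (_ : ∀ x, 0 ≤ w x)
    (x : Rd d) {ρ₀ A : ℝ} (_ : 0 < ρ₀) (_ : 0 ≤ A)
    (_ : ∀ ρ, ρ₀ ≤ ρ → ∫ y in ball x ρ, w y ≤ A * ρ ^ d * Q.v ρ) {s : ℝ} (_ : ρ₀ ^ 2 ≤ s),
    convJ (heat s) w x ≤ C * A * Q.v (√s) := by
  obtain ⟨C, hC, hheat⟩ := heat_le_max d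
  have h2d : (1:ℝ) ≤ 2 ^ d := one_le_pow₀ (by norm_num)
  refine ⟨4 * (C * 2 ^ d), by nlinarith, fun {w} hw hw0 x {ρ₀ A} hρ₀ hA h {s} hs => ?_⟩
  have hs0 : 0 < s := (by positivity : 0 < ρ₀ ^ 2).trans_le hs
  set σ := √s with hσ
  have hσ0 : 0 < σ := sqrt_pos.2 hs0
  have hσρ : ρ₀ ≤ σ := Real.le_sqrt_of_sq_le hs
  have hv := Q.v_pos _ hσ0
  set F : Rd d → ℝ := fun z => w (x + z) * heat s z with hF
  have hF0 : ∀ z, 0 ≤ F z := fun z => mul_nonneg (hw0 _) (heat_pos hs0 z).le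
  have hFi : Integrable F := (hw.comp_add x).mul_integrable (heat_good hs0).int
  set S : ℕ → Set (Rd d) := fun k => {z | 2 ^ k * σ ≤ max σ ‖z‖ ∧ max σ ‖z‖ < 2 ^ (k + 1) * σ}
    with hS
  have hU : ⋃ k, S k = univ := by
    ext z
    simp only [mem_iUnion, mem_univ, iff_true]
    exact exists_dyadic hσ0 (le_max_left _ _)
  have hSm : ∀ k, MeasurableSet (S k) := fun k =>
    (measurableSet_le measurable_const (measurable_const.max measurable_norm)).inter
      (measurableSet_lt (measurable_const.max measurable_norm) measurable_const)
  have hstep : ∀ k, ∫⁻ z in S k, ofReal (F z) ≤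
      ofReal ((2 * (C * 2 ^ d) * A * Q.v σ) * (1 / 2) ^ k) := by
    intro k
    rw [← ofReal_integral_eq_lintegral_ofReal hFi.integrableOn (Eventually.of_forall hF0)]
    refine ofReal_le_ofReal ?_
    set R := 2 ^ k * σ with hR
    have h1k := one_le_two_pow k
    have hR0 : 0 < R := by positivity
    have hsub : S k ⊆ ball 0 (2 * R) := by
      intro z hz
      rw [mem_ball_zero_iff]
      have := hz.2
      rw [pow_succ] at this
      calc ‖z‖ ≤ max σ ‖z‖ := le_max_right _ _
        _ < _ := by rw [hR]; linarith
    have hb := h (2 * R) (by nlinarith)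
    have hwi : IntegrableOn (fun z => w (x + z)) (ball 0 (2 * R)) :=
      (hw.comp_add x).integrableOn measure_ball_lt_top.ne
    have hsig : s / R ^ 2 = (1 / 2) ^ k * (1 / 2) ^ k := by
      rw [hR, mul_pow, hσ, sq_sqrt hs0.le, one_div, inv_pow]
      field_simp
    calc ∫ z in S k, F z ≤ ∫ z in S k, w (x + z) * (C * (s / R ^ 2) * (R ^ d)⁻¹) := by
          refine setIntegral_mono_on hFi.integrableOn
            ((hwi.mono_set hsub).mul_const _) (hSm k) fun z hz => ?_
          refine mul_le_mul_of_nonneg_left ?_ (hw0 _)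
          refine (hheat s hs0 z).trans ?_
          have := hz.1
          gcongr
      _ = (∫ z in S k, w (x + z)) * (C * (s / R ^ 2) * (R ^ d)⁻¹) := integral_mul_const _ _
      _ ≤ (∫ z in ball 0 (2 * R), w (x + z)) * (C * (s / R ^ 2) * (R ^ d)⁻¹) := by
          gcongr
          · exact Eventually.of_forall fun z => hw0 _
          
      _ ≤ (A * (2 * R) ^ d * Q.v (2 * R)) * (C * (s / R ^ 2) * (R ^ d)⁻¹) := by
          rw [setIntegral_ball_shift]; gcongr
      _ ≤ (A * (2 * R) ^ d * (2 * 2 ^ k * Q.v σ)) * (C * (s / R ^ 2) * (R ^ d)⁻¹) := by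
          have := Q.lin (2 * 2 ^ k) σ (by nlinarith) hσ0
          rw [mul_assoc] at this
          gcongr
      _ = _ := by
          rw [hsig, mul_pow]
          field_simp
          rw [one_div, inv_pow]; field_simp
  have := lintegral_iUnion_geom (by positivity) (by norm_num) (by norm_num) hstep
  rw [hU, Measure.restrict_univ, ← ofReal_integral_eq_lintegral_ofReal hFi
    (Eventually.of_forall hF0), ENNReal.ofReal_le_ofReal_iff (by norm_num; positivity)] at this
  refine this.trans (le_of_eq ?_)
  ring

/-- Mean value inequality for bounded-right-hand-side subsolutions. -/
theorem mean_value (d : ℕ) : ∃ C : ℝ, 1 ≤ C ∧ ∀ {e : ℝ} (_ : 0 < e) {w : Rd d → ℝ} (_ : BddMeas w)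
    (_ : ∀ x, 0 ≤ w x) {B : ℝ} (_ : 0 ≤ B) (_ : ∀ x, Lop (Q.J e) w x ≤ B)
    (x : Rd d) {ρ₀ A : ℝ} (_ : 0 < ρ₀) (_ : e < ρ₀ ^ 2) (_ : ρ₀ ≤ Q.s₀) (_ : 0 ≤ A)
    (_ : ∀ ρ, ρ₀ ≤ ρ → ∫ y in ball x ρ, w y ≤ A * ρ ^ d * Q.v ρ),
    w x ≤ C * (A * Q.v ρ₀ + B * Q.v ρ₀ ^ 2) := by
  obtain ⟨C₁, hC₁, hgr⟩ := Q.flow_growth d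
  obtain ⟨C₂, hC₂, hvar⟩ := Q.v_variation
  have hK := Q.one_le_K
  refine ⟨C₁ + Q.K + C₁ * C₂ * Q.K, by
      have : 0 ≤ C₁ * C₂ * Q.K := by positivity
      linarith,
    fun {e} he {w} hw hw0 {B} hB hL x {ρ₀ A} hρ₀ heρ hρs hA h => ?_⟩
  have hv := Q.v_pos _ hρ₀
  have hf := Q.isFinite_μ he
  have hb : 0 < ρ₀ ^ 2 := by positivity
  set K' := (B + C₁ * A * (C₂ / Q.v ρ₀)) * (Q.K * Q.v ρ₀ ^ 2) with hK'
  have hK'0 : 0 ≤ K' := by positivity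
  have hmass := Q.μ_Ici hρ₀ heρ hρs he
  have hpos : 0 < (Q.μ e).real univ := by
    refine lt_of_lt_of_le ?_ (hmass.trans (measureReal_mono (subset_univ _)))
    positivity
  set G : ℝ → ℝ := fun s => Q.v (√(max s (ρ₀ ^ 2))) with hG
  set I : ℝ → ℝ := (Iio (ρ₀ ^ 2)).indicator (fun _ => K') with hI
  have hIi : ∀ s, Integrable (fun t => I (s + t)) (Q.μ e) := by
    intro s
    refine Integrable.of_bound (C := K') ?_ (Eventually.of_forall fun t => ?_)
    · exact ((measurable_const.indicator measurableSet_Iio).comp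
        (measurable_const_add s)).aestronglyMeasurable
    · rw [hI, norm_eq_abs]
      by_cases hm : s + t ∈ Iio (ρ₀ ^ 2)
      · rw [indicator_of_mem hm, abs_of_nonneg hK'0]
      · rw [indicator_of_notMem hm, abs_zero]; exact hK'0
  have hGi : ∀ s, Integrable (fun t => G (s + t)) (Q.μ e) := fun s => Q.v_sqrt_integrable he hb s
  have hfl := fun s hs => Q.flow_evolution he hw (BddMeas.const B) hL x (s := s) hs
  have key := Q.scalar_comparison he (b := ρ₀ ^ 2) (φ := flow w x)
    (ψ := fun s => C₁ * A * G s + I s) (F := fun _ => B) hpos (fun s hs => (hfl s hs).1)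
    (fun s _ => ((hGi s).const_mul _).add (hIi s))
    (fun s hs hsb => (hfl s hs).2.trans (add_le_add
      (flow_const_le (BddMeas.const B) (fun _ => le_rfl) x s) le_rfl)) ?_ ?_ 0 le_rfl
  · rw [flow_zero] at key
    refine key.trans ?_
    have h1 : G 0 = Q.v ρ₀ := by rw [hG]; simp only; rw [max_eq_right hb.le, Real.sqrt_sq hρ₀.le]
    have h2 : I 0 = K' := indicator_of_mem (mem_Iio.2 hb) _
    simp only [h1, h2, hK']
    have h3 : C₁ * A * (C₂ / Q.v ρ₀) * (Q.K * Q.v ρ₀ ^ 2) = C₁ * C₂ * Q.K * (A * Q.v ρ₀) := by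
      field_simp
    have h4 : 0 ≤ A * Q.v ρ₀ := by positivity
    have h5 : 0 ≤ B * Q.v ρ₀ ^ 2 := by positivity
    have h6 : 0 ≤ C₁ * C₂ * Q.K := by positivity
    nlinarith [mul_nonneg h6 h5, mul_nonneg Q.K_pos.le h4, mul_nonneg (by linarith : 0 ≤ C₁) h5]
  · intro s hs hsb
    have h1 : G s = Q.v ρ₀ := by
      rw [hG]; simp only; rw [max_eq_right hsb.le, Real.sqrt_sq hρ₀.le]
    have h2 : I s = K' := indicator_of_mem (mem_Iio.2 hsb) _
    simp only [h1, h2]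
    rw [integral_add ((hGi s).const_mul _) (hIi s), integral_const_mul]
    have h3 : ∫ t, G (s + t) ∂(Q.μ e) ≤ C₂ / Q.v ρ₀ + (Q.μ e).real univ * Q.v ρ₀ := by
      have := hvar e he ρ₀ hρ₀
      rw [integral_sub (hGi (ρ₀ ^ 2)) (integrable_const _), integral_const, smul_eq_mul] at this
      have h4 : ∫ t, G (s + t) ∂(Q.μ e) ≤ ∫ t, G (ρ₀ ^ 2 + t) ∂(Q.μ e) :=
        integral_mono (hGi _) (hGi _) fun t => Q.v_sqrt_monotone hb (by linarith)
      linarith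
    have h5 : ∫ t, I (s + t) ∂(Q.μ e) ≤ K' * ((Q.μ e).real univ - (Q.μ e).real (Ici (ρ₀ ^ 2))) := by
      have : ∀ t, I (s + t) ≤ K' - (Ici (ρ₀ ^ 2)).indicator (fun _ => K') t := by
        intro t
        by_cases ht : t ∈ Ici (ρ₀ ^ 2)
        · have ht' : ρ₀ ^ 2 ≤ t := ht
          rw [indicator_of_mem ht, hI, indicator_of_notMem]
          · simp
          · rw [mem_Iio]; linarith
        · rw [indicator_of_notMem ht, sub_zero, hI]
          exact indicator_le_self' (fun _ _ => hK'0) _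
      refine (integral_mono (hIi s) ((integrable_const _).sub
        ((integrable_const _).indicator measurableSet_Ici)) this).trans (le_of_eq ?_)
      change ∫ t, (K' - (Ici (ρ₀ ^ 2)).indicator (fun _ => K') t) ∂(Q.μ e) = _
      rw [integral_sub (integrable_const K') ((integrable_const K').indicator measurableSet_Ici),
        integral_indicator measurableSet_Ici, integral_const, setIntegral_const]
      simp only [smul_eq_mul]; ring
    have h6 : B + C₁ * A * (C₂ / Q.v ρ₀) ≤ K' * (Q.μ e).real (Ici (ρ₀ ^ 2)) := by
      calc _ = K' * (1 / (Q.K * Q.v ρ₀ ^ 2)) := by rw [hK']; have := Q.K_pos; field_simp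
        _ ≤ _ := by gcongr
    have h7 : C₁ * A * ∫ t, G (s + t) ∂(Q.μ e) ≤
        C₁ * A * (C₂ / Q.v ρ₀ + (Q.μ e).real univ * Q.v ρ₀) := by gcongr
    nlinarith
  · intro s hs hsb
    have h0 : 0 ≤ I s := indicator_nonneg (fun _ _ => hK'0) _
    rw [flow_pos (hb.trans_le hsb)]
    have := hgr hw hw0 x hρ₀ hA h hsb
    have h1 : G s = Q.v (√s) := by rw [hG]; simp only; rw [max_eq_left hsb]
    simp only [h1]
    linarith

end Core

namespace Core
variable (Q : Core)

/-- The size of the potential of a unit mass at distance `r`. -/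
def pot (d : ℕ) (r : ℝ) : ℝ := (r ^ d)⁻¹ * Q.v r ^ 2

lemma pot_pos {r : ℝ} (hr : 0 < r) : 0 < Q.pot d r := by
  have := Q.v_pos r hr
  unfold pot; positivity

lemma pot_anti (hd : 2 ≤ d) {r s : ℝ} (hr : 0 < r) (hrs : r ≤ s) : Q.pot d s ≤ Q.pot d r := by
  have hv := Q.v_pos r hr
  set k := s / r with hk
  have hk1 : 1 ≤ k := (one_le_div hr).2 hrs
  have hs : s = k * r := by rw [hk]; field_simp
  have h1 := Q.lin k r hk1 hr
  have hv2 := Q.v_pos (k * r) (by positivity)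
  have h2 : k ^ 2 ≤ k ^ d := pow_le_pow_right₀ hk1 hd
  unfold pot
  rw [hs]
  calc ((k * r) ^ d)⁻¹ * Q.v (k * r) ^ 2 ≤ ((k * r) ^ d)⁻¹ * (k * Q.v r) ^ 2 := by gcongr
    _ = k ^ 2 * (k ^ d)⁻¹ * ((r ^ d)⁻¹ * Q.v r ^ 2) := by rw [mul_pow, mul_inv]; ring
    _ ≤ 1 * ((r ^ d)⁻¹ * Q.v r ^ 2) := by
        gcongr
        rw [← div_eq_mul_inv]
        exact (div_le_one (by positivity)).2 h2
    _ = _ := one_mul _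

lemma pot_drop (hd : 2 ≤ d) : ∃ M : ℝ, 1 ≤ M ∧ ∀ r s, 0 < r → M * r ≤ s →
    Q.pot d s ≤ 1 / 2 * Q.pot d r := by
  have hK := Q.one_le_K
  have ha := Q.a_lt
  set M := (2 * Q.K ^ 2) ^ (1 / (2 - 2 * Q.a)) with hM
  have hM1 : 1 ≤ M := Real.one_le_rpow (by nlinarith) (by
    have : 0 < 2 - 2 * Q.a := by linarith
    positivity)
  refine ⟨M, hM1, fun r s hr hs => ?_⟩
  set k := s / r with hk
  have hk1 : M ≤ k := (le_div_iff₀ hr).2 hs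
  have hk0 : 1 ≤ k := hM1.trans hk1
  have hs : s = k * r := by rw [hk]; field_simp
  have h1 := Q.up k r hk0 hr
  have hv := Q.v_pos r hr
  have hv2 := Q.v_pos (k * r) (by positivity)
  have hkp : 0 < k := by linarith
  have h2 : k ^ 2 ≤ k ^ d := pow_le_pow_right₀ hk0 hd
  have h3 : 2 * Q.K ^ 2 * (k ^ Q.a) ^ 2 ≤ k ^ 2 := by
    have h4 : 2 * Q.K ^ 2 ≤ k ^ (2 - 2 * Q.a) := by
      calc 2 * Q.K ^ 2 = M ^ (2 - 2 * Q.a) := by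
            rw [hM, ← rpow_mul (by positivity), one_div,
              inv_mul_cancel₀ (by linarith), Real.rpow_one]
        _ ≤ _ := Real.rpow_le_rpow (by linarith) hk1 (by linarith)
    have h5 : k ^ (2 - 2 * Q.a) * (k ^ Q.a) ^ 2 = k ^ 2 := by
      rw [← rpow_natCast, ← rpow_mul hkp.le, ← Real.rpow_add hkp, ← rpow_natCast]
      congr 1; push_cast; ring
    rw [← h5]; gcongr
  unfold pot
  rw [hs]
  calc ((k * r) ^ d)⁻¹ * Q.v (k * r) ^ 2 ≤ ((k * r) ^ d)⁻¹ * (Q.K * k ^ Q.a * Q.v r) ^ 2 := by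
        gcongr
    _ = (Q.K ^ 2 * (k ^ Q.a) ^ 2) * (k ^ d)⁻¹ * ((r ^ d)⁻¹ * Q.v r ^ 2) := by
        rw [mul_pow, mul_inv]; ring
    _ ≤ 1 / 2 * ((r ^ d)⁻¹ * Q.v r ^ 2) := by
        gcongr
        rw [← div_eq_mul_inv, div_le_iff₀ (by positivity)]
        linarith

lemma flow_le_integral {w : Rd d → ℝ} (hw0 : ∀ x, 0 ≤ w x) (hwi : Integrable w)
    {b s : ℝ} (hb : 0 < b) (hs : b ^ 2 ≤ s) (x : Rd d) :
    convJ (heat s) w x ≤ (b ^ d)⁻¹ * ∫ y, w y := by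
  have hs0 : 0 < s := (by positivity : 0 < b ^ 2).trans_le hs
  have h1 : Integrable (fun z => w (x + z)) := hwi.comp_add_left x
  have h2 : ∀ z : Rd d, heat s z ≤ (b ^ d)⁻¹ := by
    intro z
    refine (heat_le_one hs0 z).trans ?_
    have : b ≤ √s := Real.le_sqrt_of_sq_le hs
    gcongr
  calc convJ (heat s) w x ≤ ∫ z, w (x + z) * (b ^ d)⁻¹ := by
        refine integral_mono_of_nonneg (Eventually.of_forall fun z =>
          mul_nonneg (hw0 _) (heat_pos hs0 z).le) (h1.mul_const _) (Eventually.of_forall fun z => ?_)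
        exact mul_le_mul_of_nonneg_left (h2 z) (hw0 _)
    _ = _ := by rw [integral_mul_const, integral_add_left_eq_self w x, mul_comm]

/-- Pointwise bound for potentials of functions whose heat flow is small at `x`. -/
theorem potential_bound (hd : 2 ≤ d) : ∃ C ρ₁ : ℝ, 1 ≤ C ∧ 0 < ρ₁ ∧ ρ₁ ≤ Q.s₀ ∧
    ∀ {e : ℝ} (_ : 0 < e) {w f : Rd d → ℝ} (_ : BddMeas w) (_ : BddMeas f) (_ : ∀ x, 0 ≤ w x)
    (_ : Integrable w) (_ : ∀ x, Lop (Q.J e) w x ≤ f x) (x : Rd d) {ρ H : ℝ} (_ : 0 < ρ)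
    (_ : e < ρ ^ 2) (_ : ρ ≤ ρ₁) (_ : 0 ≤ H)
    (_ : ∀ s, 0 ≤ s → flow f x s ≤ H * (√(s + ρ ^ 2) ^ d)⁻¹),
    w x ≤ C * (H * Q.pot d ρ + ∫ y, w y) := by
  obtain ⟨M, hM1, hdrop⟩ := Q.pot_drop hd
  have hK := Q.one_le_K
  have hs₀ := Q.s₀_pos
  have hs₀' := Q.s₀_le
  set ρ₁ := Q.s₀ / (2 * M) with hρ₁
  have hρ₁0 : 0 < ρ₁ := by positivity
  have hρ₁s : ρ₁ ≤ Q.s₀ := div_le_self hs₀.le (by linarith)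
  set cb := (ρ₁ ^ d)⁻¹ with hcb
  have hcb0 : 0 < cb := by positivity
  have hcb1 : 1 ≤ cb := by
    rw [hcb]
    exact (one_le_inv₀ (by positivity)).2 (pow_le_one₀ hρ₁0.le (hρ₁s.trans hs₀'))
  set C₂ := 2 * Q.K * M ^ 2 with hC₂
  have hC₂0 : 0 < C₂ := by positivity
  refine ⟨cb + C₂, ρ₁, by linarith, hρ₁0, hρ₁s,
    fun {e} he {w f} hw hf hw0 hwi hL x {ρ H} hρ heρ hρρ hH hfl => ?_⟩
  have hfin := Q.isFinite_μ he
  have hρ2 : 0 < ρ ^ 2 := by positivity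
  set G : ℝ → ℝ := fun s => Q.pot d (√(max s 0 + ρ ^ 2)) with hG
  have hrt : ∀ s, 0 < √(max s 0 + ρ ^ 2) := fun s =>
    sqrt_pos.2 (add_pos_of_nonneg_of_pos (le_max_right _ _) hρ2)
  have hGanti : Antitone G := fun s t h => Q.pot_anti hd (hrt s) (by gcongr)
  have hGle : ∀ s, G s ≤ Q.pot d ρ := fun s => Q.pot_anti hd hρ
    (Real.le_sqrt_of_sq_le (le_add_of_nonneg_left (le_max_right _ _)))
  have hG0 : ∀ s, 0 ≤ G s := fun s => (Q.pot_pos (hrt s)).le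
  have hGi : ∀ s, Integrable (fun t => G (s + t)) (Q.μ e) := by
    intro s
    refine Integrable.of_bound (C := Q.pot d ρ) ?_ (Eventually.of_forall fun t => ?_)
    · exact (hGanti.measurable.comp (measurable_const_add s)).aestronglyMeasurable
    · rw [norm_of_nonneg (hG0 _)]; exact hGle _
  set I := ∫ y, w y with hI
  have hI0 : 0 ≤ I := integral_nonneg hw0
  have hpos : 0 < (Q.μ e).real univ := by
    refine lt_of_lt_of_le ?_ ((Q.μ_Ici hρ heρ (hρρ.trans hρ₁s) he).trans
      (measureReal_mono (subset_univ _)))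
    have := Q.v_pos ρ hρ
    positivity
  have hev := fun s hs => Q.flow_evolution he hw hf hL x (s := s) hs
  have key := Q.scalar_comparison he (b := ρ₁ ^ 2) (φ := flow w x)
    (ψ := fun s => C₂ * H * G s + cb * I) (F := flow f x) hpos (fun s hs => (hev s hs).1)
    (fun s _ => ((hGi s).const_mul _).add (integrable_const _)) (fun s hs _ => (hev s hs).2)
    ?_ ?_ 0 le_rfl
  · rw [flow_zero] at key
    refine key.trans ?_
    have h1 : G 0 ≤ Q.pot d ρ := hGle 0
    have h2 : C₂ * H * G 0 ≤ C₂ * H * Q.pot d ρ := by gcongr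
    have h3 : 0 ≤ H * Q.pot d ρ := mul_nonneg hH (Q.pot_pos hρ).le
    nlinarith [mul_nonneg hcb0.le h3, mul_nonneg hC₂0.le hI0]
  · intro s hs hsb
    rw [integral_add ((hGi s).const_mul _) (integrable_const _), integral_const_mul, integral_const,
      smul_eq_mul]
    set r := √(s + ρ ^ 2) with hr
    have hGs : G s = Q.pot d r := by rw [hG]; simp only; rw [max_eq_left hs]
    have hr0 : 0 < r := sqrt_pos.2 (by linarith)
    have hr2 : r ^ 2 = s + ρ ^ 2 := sq_sqrt (by linarith)
    have hrs : M * r ≤ Q.s₀ := by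
      have h1 : r ≤ 2 * ρ₁ := by
        refine abs_le_of_sq_le_sq' ?_ (by positivity) |>.2
        nlinarith
      calc M * r ≤ M * (2 * ρ₁) := by gcongr
        _ = Q.s₀ := by rw [hρ₁]; field_simp
    have hmass := Q.μ_Ici (e := e) (s := M * r) (by positivity)
      (by rw [mul_pow, hr2]; nlinarith [one_le_pow₀ hM1 (n := 2)]) hrs he
    have hvr := Q.v_pos r hr0
    have hvM := Q.v_pos (M * r) (by positivity)
    have hvl := Q.lin M r hM1 hr0
    have h5 : ∫ t, G (s + t) ∂(Q.μ e) ≤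
        G s * ((Q.μ e).real univ - 1 / 2 * (Q.μ e).real (Ici ((M * r) ^ 2))) := by
      have : ∀ᵐ t ∂(Q.μ e), G (s + t) ≤
          G s - (Ici ((M * r) ^ 2)).indicator (fun _ => 1 / 2 * G s) t := by
        filter_upwards [Q.ae_μ e] with t ht
        have ht0 := he.trans ht
        by_cases hm : t ∈ Ici ((M * r) ^ 2)
        · have hm' : (M * r) ^ 2 ≤ t := hm
          rw [indicator_of_mem hm, hGs]
          have h7 := hdrop r (√(max (s + t) 0 + ρ ^ 2)) hr0 (Real.le_sqrt_of_sq_le (by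
            rw [max_eq_left (by linarith)]; linarith))
          have h8 : G (s + t) ≤ 1 / 2 * Q.pot d r := h7
          linarith
        · rw [indicator_of_notMem hm, sub_zero]
          exact hGanti (by linarith)
      refine (integral_mono_ae (hGi s) ((integrable_const _).sub
        ((integrable_const _).indicator measurableSet_Ici)) this).trans (le_of_eq ?_)
      change ∫ t, (G s - (Ici ((M * r) ^ 2)).indicator (fun _ => 1 / 2 * G s) t) ∂(Q.μ e) = _
      rw [integral_sub (integrable_const (G s))
        ((integrable_const (1 / 2 * G s)).indicator measurableSet_Ici),
        integral_indicator measurableSet_Ici, integral_const, setIntegral_const]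
      simp only [smul_eq_mul]; ring
    have h6 : H * (r ^ d)⁻¹ ≤ C₂ * H * (G s * (1 / 2 * (Q.μ e).real (Ici ((M * r) ^ 2)))) := by
      calc H * (r ^ d)⁻¹ = C₂ * H * (G s * (1 / 2 * (1 / (Q.K * (M * Q.v r) ^ 2)))) := by
            rw [hGs, hC₂]; unfold pot
            have := Q.K_pos
            field_simp
        _ ≤ C₂ * H * (G s * (1 / 2 * (1 / (Q.K * Q.v (M * r) ^ 2)))) := by
            have := hG0 s
            have := Q.K_pos
            gcongr
        _ ≤ _ := by
            have := hG0 s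
            gcongr
    have h7 := hfl s hs
    have h8 : C₂ * H * ∫ t, G (s + t) ∂(Q.μ e) ≤ C₂ * H * (G s *
      ((Q.μ e).real univ - 1 / 2 * (Q.μ e).real (Ici ((M * r) ^ 2)))) := by gcongr
    nlinarith
  · intro s hs hsb
    rw [flow_pos ((by positivity : 0 < ρ₁ ^ 2).trans_le hsb)]
    have h1 := flow_le_integral hw0 hwi hρ₁0 hsb x
    have h2 : 0 ≤ C₂ * H * G s := mul_nonneg (mul_nonneg hC₂0.le hH) (hG0 s)
    linarith

/-- Potential at `x` of a set at distance at least `ρ` from `x`. -/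
lemma flow_indicator_far (d : ℕ) : ∃ C : ℝ, 1 ≤ C ∧ ∀ {B : Set (Rd d)} (_ : MeasurableSet B)
    (_ : volume B ≠ ∞) (x : Rd d) {ρ : ℝ} (_ : 0 < ρ) (_ : ∀ y ∈ B, ρ ≤ dist y x) {s : ℝ}
    (_ : 0 ≤ s), flow (B.indicator fun _ => 1) x s ≤
      C * volume.real B * (√(s + ρ ^ 2) ^ d)⁻¹ := by
  obtain ⟨C, hC, hheat⟩ := heat_le_max d
  refine ⟨C * 2 ^ d, by
    have : (1:ℝ) ≤ 2 ^ d := one_le_pow₀ (by norm_num)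
    nlinarith, fun {B} hB hBf x {ρ} hρ hfar {s} hs => ?_⟩
  set D := C * 2 ^ d * (√(s + ρ ^ 2) ^ d)⁻¹ with hD
  have hD0 : 0 ≤ D := by positivity
  have hgoal : C * 2 ^ d * volume.real B * (√(s + ρ ^ 2) ^ d)⁻¹ = volume.real B * D := by
    rw [hD]; ring
  rw [hgoal]
  rcases hs.eq_or_lt with rfl | hs
  · rw [flow_zero, indicator_of_notMem]
    · positivity
    · intro hx
      have := hfar x hx
      rw [dist_self] at this
      linarith
  · rw [flow_pos hs]
    have hpt : ∀ z : Rd d, B.indicator (fun _ => (1:ℝ)) (x + z) * heat s z ≤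
        (B.indicator (fun _ => D)) (x + z) := by
      intro z
      by_cases hz : x + z ∈ B
      · rw [indicator_of_mem hz, indicator_of_mem hz, one_mul]
        have h1 := hfar _ hz
        rw [dist_eq_norm, add_sub_cancel_left] at h1
        refine (hheat s hs z).trans ?_
        set N := max (√s) ‖z‖ with hN
        have hsN : √s ≤ N := le_max_left _ _
        have hρN : ρ ≤ N := h1.trans (le_max_right _ _)
        have hN0 : 0 < N := hρ.trans_le hρN
        have h2 : s / N ^ 2 ≤ 1 := by
          rw [div_le_one (by positivity)]
          calc s = √s ^ 2 := (sq_sqrt hs.le).symm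
            _ ≤ _ := by gcongr
        have h3 : √(s + ρ ^ 2) ≤ 2 * N := by
          rw [Real.sqrt_le_left (by positivity)]
          have : s ≤ N ^ 2 := by rwa [div_le_one (by positivity)] at h2
          nlinarith
        have hr : 0 < √(s + ρ ^ 2) := sqrt_pos.2 (by positivity)
        calc C * (s / N ^ 2) * (N ^ d)⁻¹ ≤ C * 1 * (N ^ d)⁻¹ := by gcongr
          _ = C * 2 ^ d * ((2 * N) ^ d)⁻¹ := by rw [mul_pow]; field_simp
          _ ≤ _ := by rw [hD]; gcongr
      · rw [indicator_of_notMem hz, indicator_of_notMem hz, zero_mul]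
    have hint : Integrable (B.indicator fun _ => D) := by
      rw [integrable_indicator_iff hB]
      exact integrableOn_const hBf
    calc convJ (heat s) (B.indicator fun _ => 1) x ≤ ∫ z, (B.indicator (fun _ => D)) (x + z) := by
          refine integral_mono_of_nonneg (Eventually.of_forall fun z => mul_nonneg
            (indicator_nonneg (fun _ _ => zero_le_one) _) (heat_pos hs z).le)
            (hint.comp_add_left x) (Eventually.of_forall hpt)
      _ = _ := by
          rw [integral_add_left_eq_self (B.indicator fun _ => D) x, integral_indicator hB,
            setIntegral_const, smul_eq_mul]

lemma flow_indicator_near (d : ℕ) : ∃ C : ℝ, 1 ≤ C ∧ ∀ {B : Set (Rd d)} (_ : MeasurableSet B)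
    (_ : volume B ≠ ∞) (x : Rd d) {ρ : ℝ} (_ : 0 < ρ) {s : ℝ}
    (_ : 0 ≤ s), flow (B.indicator fun _ => 1) x s ≤
      C * (volume.real B + ρ ^ d) * (√(s + ρ ^ 2) ^ d)⁻¹ := by
  refine ⟨2 ^ d, one_le_pow₀ (by norm_num), fun {B} hB hBf x {ρ} hρ {s} hs => ?_⟩
  have hr : 0 < √(s + ρ ^ 2) := sqrt_pos.2 (by positivity)
  have hV : 0 ≤ volume.real B := measureReal_nonneg
  have h01 : ∀ x, B.indicator (fun _ => (1:ℝ)) x ≤ 1 := fun x =>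
    indicator_le_self' (fun _ _ => zero_le_one) _
  by_cases hsρ : s < ρ ^ 2
  · have h1 : √(s + ρ ^ 2) ≤ 2 * ρ := by
      rw [Real.sqrt_le_left (by positivity)]
      nlinarith
    refine (flow_const_le ((BddMeas.const 1).indicator hB) h01 x s).trans ?_
    rw [← div_eq_mul_inv, one_le_div (by positivity)]
    calc √(s + ρ ^ 2) ^ d ≤ (2 * ρ) ^ d := by gcongr
      _ = 2 ^ d * (0 + ρ ^ d) := by rw [mul_pow]; ring
      _ ≤ _ := by gcongr
  · push Not at hsρ
    have hs0 : 0 < s := (by positivity : 0 < ρ ^ 2).trans_le hsρ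
    have hq : 0 < √s := sqrt_pos.2 hs0
    have hint : Integrable (B.indicator fun _ => (1:ℝ)) := by
      rw [integrable_indicator_iff hB]
      exact integrableOn_const hBf
    rw [flow_pos hs0]
    have h1 := flow_le_integral (fun y => indicator_nonneg (fun _ _ => zero_le_one) y) hint hq
      (sq_sqrt hs0.le).le x
    rw [integral_indicator hB, setIntegral_const, smul_eq_mul, mul_one] at h1
    refine h1.trans ?_
    have h2 : √(s + ρ ^ 2) ≤ 2 * √s := by
      rw [Real.sqrt_le_left (by positivity), mul_pow, sq_sqrt hs0.le]
      linarith
    calc (√s ^ d)⁻¹ * volume.real B = 2 ^ d * volume.real B * ((2 * √s) ^ d)⁻¹ := by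
          rw [mul_pow]; field_simp
      _ ≤ _ := by
          gcongr
          have : 0 ≤ ρ ^ d := by positivity
          linarith

end Core

namespace GoodKer
variable {J : Rd d → ℝ}

lemma conv_isometry (hJ : GoodKer J) (w : Rd d → ℝ) (ℓ : Rd d ≃ₗᵢ[ℝ] Rd d) (c x : Rd d) :
    convJ J (fun y => w (c + ℓ (y - c))) x = convJ J w (c + ℓ (x - c)) := by
  have hJℓ : ∀ z, J (ℓ z) = J z := fun z =>
    le_antisymm (hJ.anti _ _ (ℓ.norm_map z).ge) (hJ.anti _ _ (ℓ.norm_map z).le)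
  unfold convJ
  have h := ℓ.measurePreserving.integral_comp ℓ.toHomeomorph.toMeasurableEquiv.measurableEmbedding
    (fun z => w (c + ℓ (x - c) + z) * J z)
  rw [← h]
  congr 1
  ext z
  show w (c + ℓ (x + z - c)) * J z = w (c + ℓ (x - c) + ℓ z) * J (ℓ z)
  rw [hJℓ, add_sub_right_comm, map_add, add_assoc]

lemma Lop_isometry (hJ : GoodKer J) (w : Rd d → ℝ) (ℓ : Rd d ≃ₗᵢ[ℝ] Rd d) (c x : Rd d) :
    Lop J (fun y => w (c + ℓ (y - c))) x = Lop J w (c + ℓ (x - c)) := by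
  unfold Lop
  rw [hJ.conv_isometry]

lemma integral_odd (J : Rd d → ℝ) {g : Rd d → ℝ} (h : ∀ z, g (-z) * J (-z) = -(g z * J z)) :
    ∫ z, g z * J z = 0 := by
  have h1 := integral_neg_eq_self (fun z => g z * J z) volume
  simp only [h, integral_neg] at h1
  linarith

end GoodKer

/-- The quadratic bump supported in `ball x₀ R`. -/
def bump (x₀ : Rd d) (R : ℝ) (y : Rd d) : ℝ := max 0 (1 - ‖y - x₀‖ ^ 2 / R ^ 2)

lemma bump_bddMeas (x₀ : Rd d) (R : ℝ) : BddMeas (bump x₀ R) := by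
  refine ⟨by unfold bump; fun_prop, 1, fun y => ?_⟩
  unfold bump
  rw [abs_of_nonneg (le_max_left _ _)]
  exact max_le zero_le_one (by have : 0 ≤ ‖y - x₀‖ ^ 2 / R ^ 2 := by positivity
                               linarith)

lemma bump_le (x₀ : Rd d) (R : ℝ) (y : Rd d) : bump x₀ R y ≤ 1 :=
  max_le zero_le_one (by have : 0 ≤ ‖y - x₀‖ ^ 2 / R ^ 2 := by positivity
                         linarith)

lemma bump_nonneg (x₀ : Rd d) (R : ℝ) (y : Rd d) : 0 ≤ bump x₀ R y := le_max_left _ _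

lemma bump_off {x₀ : Rd d} {R : ℝ} (hR : 0 < R) {y : Rd d} (hy : y ∉ ball x₀ R) :
    bump x₀ R y = 0 := by
  rw [mem_ball, dist_eq_norm, not_lt] at hy
  refine max_eq_left ?_
  rw [sub_nonpos, one_le_div (by positivity)]
  gcongr

lemma Lop_bump_le {J : Rd d → ℝ} (hJ : GoodKer J) (x₀ : Rd d) {R : ℝ} (hR : 0 < R) {x : Rd d}
    (hx : x ∈ ball x₀ R) :
    Lop J (bump x₀ R) x ≤ ∫ z : Rd d, min 1 (‖z‖ ^ 2 / R ^ 2) * J z := by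
  have hR2 : 0 < R ^ 2 := by positivity
  have hb := bump_bddMeas x₀ R
  set g : Rd d → ℝ := fun z => (ball 0 R).indicator (fun z => 2 * ⟪x - x₀, z⟫ / R ^ 2) z with hg
  have hgm : BddMeas g := by
    refine ⟨(by fun_prop : Measurable fun z : Rd d => 2 * ⟪x - x₀, z⟫ / R ^ 2).indicator
      measurableSet_ball, 2 * (‖x - x₀‖ * R) / R ^ 2, fun z => ?_⟩
    by_cases hz : z ∈ ball (0 : Rd d) R
    · simp only [hg, indicator_of_mem hz]
      rw [abs_div, abs_mul, abs_two, abs_of_pos hR2]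
      have := abs_real_inner_le_norm (x - x₀) z
      rw [mem_ball_zero_iff] at hz
      gcongr
      exact this.trans (by gcongr)
    · simp only [hg, indicator_of_notMem hz, abs_zero]; positivity
  have hmin : BddMeas (fun z : Rd d => min 1 (‖z‖ ^ 2 / R ^ 2)) := by
    refine ⟨by fun_prop, 1, fun z => ?_⟩
    rw [abs_of_nonneg (le_min zero_le_one (by positivity))]
    exact min_le_left _ _
  have hodd : ∫ z, g z * J z = 0 := by
    refine GoodKer.integral_odd J fun z => ?_
    rw [hJ.even]
    by_cases hz : z ∈ ball (0 : Rd d) R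
    · have hz' : -z ∈ ball (0 : Rd d) R := by simpa using hz
      simp only [hg, indicator_of_mem hz, indicator_of_mem hz', inner_neg_right]; ring
    · have hz' : -z ∉ ball (0 : Rd d) R := by simpa using hz
      simp only [hg, indicator_of_notMem hz, indicator_of_notMem hz']; ring
  have hpx : bump x₀ R x = 1 - ‖x - x₀‖ ^ 2 / R ^ 2 := by
    rw [mem_ball, dist_eq_norm] at hx
    refine max_eq_right ?_
    rw [sub_nonneg, div_le_one hR2]
    gcongr
  have h1 : Lop J (bump x₀ R) x = ∫ z, (bump x₀ R x - bump x₀ R (x + z)) * J z := by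
    unfold Lop convJ
    rw [← integral_mul_const, ← integral_sub (hJ.int.mul_const _) (hJ.integrable_shift hb x)]
    congr 1; ext z; ring
  rw [h1, ← add_zero (∫ z : Rd d, min 1 (‖z‖ ^ 2 / R ^ 2) * J z), ← hodd,
    ← integral_add (hmin.mul_integrable hJ.int) (hgm.mul_integrable hJ.int)]
  refine integral_mono ?_ ((hmin.mul_integrable hJ.int).add (hgm.mul_integrable hJ.int)) fun z => ?_
  · exact ((BddMeas.const _).sub (hb.comp_add x)).mul_integrable hJ.int
  · simp only
    rw [← add_mul]
    refine mul_le_mul_of_nonneg_right ?_ (hJ.nonneg z)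
    by_cases hz : z ∈ ball (0 : Rd d) R
    · simp only [hg, indicator_of_mem hz]
      rw [mem_ball_zero_iff] at hz
      rw [min_eq_right ((div_le_one hR2).2 (by gcongr)), hpx]
      have h2 : 1 - ‖x + z - x₀‖ ^ 2 / R ^ 2 ≤ bump x₀ R (x + z) := le_max_right _ _
      have h3 : ‖x + z - x₀‖ ^ 2 = ‖x - x₀‖ ^ 2 + 2 * ⟪x - x₀, z⟫ + ‖z‖ ^ 2 := by
        rw [add_sub_right_comm, norm_add_sq_real]
      rw [h3] at h2
      have h4 : (‖x - x₀‖ ^ 2 + 2 * ⟪x - x₀, z⟫ + ‖z‖ ^ 2) / R ^ 2 = ‖x - x₀‖ ^ 2 / R ^ 2 +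
        2 * ⟪x - x₀, z⟫ / R ^ 2 + ‖z‖ ^ 2 / R ^ 2 := by ring
      rw [h4] at h2
      linarith
    · simp only [hg, indicator_of_notMem hz, add_zero]
      rw [mem_ball_zero_iff, not_lt] at hz
      rw [min_eq_left ((one_le_div hR2).2 (by gcongr))]
      linarith [bump_le x₀ R x, bump_nonneg x₀ R (x + z)]

namespace Core
variable (Q : Core)

/-- `b` is the barrier for the exterior of `ball c R`. -/
structure IsBarrier (e : ℝ) (c : Rd d) (R : ℝ) (b : Rd d → ℝ) : Prop where
  bm : BddMeas b
  nonneg : ∀ x, 0 ≤ b x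
  le : ∀ x, b x ≤ Q.v R ^ 2
  off : ∀ x ∈ ball c R, b x = 0
  eqn : ∀ x ∉ ball c R, Lop (Q.J e) b x + (Q.v R ^ 2)⁻¹ * b x =
    (ball c (4 * R)).indicator (fun _ => 1) x
  int : Integrable b

lemma exists_barrier {e : ℝ} (he : 0 < e) (c : Rd d) {R : ℝ} (hR : 0 < R) :
    ∃ b, Q.IsBarrier e c R b := by
  have hv := Q.v_pos R hR
  have hκ : 0 < (Q.v R ^ 2)⁻¹ := by positivity
  have hJ := Q.J_good (d := d) he
  obtain ⟨b, h1, h2, h3, h4, h5, h6⟩ := hJ.exists_green (κ := (Q.v R ^ 2)⁻¹) (c := (Q.v R ^ 2)⁻¹)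
    (F := 1) hκ.le hκ (Ω := (ball c R)ᶜ) measurableSet_ball.compl
    (fun x _ => le_add_of_nonneg_right (hJ.esc_nonneg _ _))
    (f := (ball c (4 * R)).indicator fun _ => 1)
    ((BddMeas.const 1).indicator measurableSet_ball)
    (fun x => indicator_nonneg (fun _ _ => zero_le_one) x)
    (fun x => indicator_le_self' (fun _ _ => zero_le_one) x)
  refine ⟨b, h1, h2, fun x => by simpa using h3 x, fun x hx => h4 x (by simpa using hx),
    fun x hx => h5 x hx, h6 hκ ?_⟩
  rw [integrable_indicator_iff measurableSet_ball]
  exact integrableOn_const measure_ball_lt_top.ne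

namespace IsBarrier
variable {Q} {e : ℝ} {c : Rd d} {R : ℝ} {b : Rd d → ℝ}

lemma Lop_le (hb : Q.IsBarrier e c R b) (he : 0 < e) (x : Rd d) : Lop (Q.J e) b x ≤ 1 := by
  by_cases hx : x ∈ ball c R
  · unfold Lop
    rw [hb.off x hx]
    linarith [(Q.J_good he).conv_nonneg hb.nonneg x]
  · have h1 := hb.eqn x hx
    have h2 : (ball c (4 * R)).indicator (fun _ => (1:ℝ)) x ≤ 1 :=
      indicator_le_self' (fun _ _ => zero_le_one) x
    have h3 : 0 ≤ (Q.v R ^ 2)⁻¹ * b x := mul_nonneg (by positivity) (hb.nonneg x)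
    linarith

lemma invariant (hb : Q.IsBarrier e c R b) (he : 0 < e) (hR : 0 < R) (ℓ : Rd d ≃ₗᵢ[ℝ] Rd d)
    (x : Rd d) : b (c + ℓ (x - c)) = b x := by
  have hv := Q.v_pos R hR
  have hκ : 0 < (Q.v R ^ 2)⁻¹ := by positivity
  have hJ := Q.J_good (d := d) he
  have hT : ∀ x r, c + ℓ (x - c) ∈ ball c r ↔ x ∈ ball c r := fun x r => by
    rw [mem_ball, mem_ball, dist_eq_norm, dist_eq_norm, add_sub_cancel_left, ℓ.norm_map]
  have hb' : BddMeas (fun y => b (c + ℓ (y - c))) :=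
    hb.bm.comp (T := fun y => c + ℓ (y - c)) (by fun_prop)
  have hoff : ∀ y ∉ (ball c R)ᶜ, b y = 0 ∧ b (c + ℓ (y - c)) = 0 := fun y hy => by
    rw [notMem_compl_iff] at hy
    exact ⟨hb.off y hy, hb.off _ ((hT y R).2 hy)⟩
  have heq : ∀ y ∈ (ball c R)ᶜ, Lop (Q.J e) (fun y => b (c + ℓ (y - c))) y
      + (Q.v R ^ 2)⁻¹ * b (c + ℓ (y - c)) = Lop (Q.J e) b y + (Q.v R ^ 2)⁻¹ * b y := by
    intro y hy
    rw [hJ.Lop_isometry, hb.eqn _ (fun h => hy ((hT y R).1 h)), hb.eqn y hy]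
    by_cases h : y ∈ ball c (4 * R)
    · rw [indicator_of_mem h, indicator_of_mem ((hT y _).2 h)]
    · rw [indicator_of_notMem h, indicator_of_notMem (fun h' => h ((hT y _).1 h'))]
  refine le_antisymm ?_ ?_
  · exact hJ.comparison hb' hb.bm measurableSet_ball.compl hκ.le hκ
      (fun x _ => le_add_of_nonneg_right (hJ.esc_nonneg _ _))
      (fun y hy => ((hoff y hy).2.trans (hoff y hy).1.symm).le) (fun y hy => (heq y hy).le) x
  · exact hJ.comparison hb.bm hb' measurableSet_ball.compl hκ.le hκ
      (fun x _ => le_add_of_nonneg_right (hJ.esc_nonneg _ _))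
      (fun y hy => ((hoff y hy).1.trans (hoff y hy).2.symm).le) (fun y hy => (heq y hy).ge) x

end IsBarrier

lemma barrier_lower (d : ℕ) : ∃ C : ℝ, 1 ≤ C ∧ ∀ {e : ℝ} (_ : 0 < e) {c : Rd d} {R : ℝ}
    (_ : 0 < R) {b : Rd d → ℝ} (_ : Q.IsBarrier e c R b) (x : Rd d) (_ : 2 * R ≤ dist x c)
    (_ : dist x c < 3 * R), Q.v R ^ 2 ≤ C * b x := by
  obtain ⟨C, hC, hmom⟩ := Q.J_moment d
  refine ⟨C + 1, by linarith, fun {e} he {c R} hR {b} hb x₀ h2 h3 => ?_⟩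
  have hv := Q.v_pos R hR
  have hκ : 0 < (Q.v R ^ 2)⁻¹ := by positivity
  have hJ := Q.J_good (d := d) he
  have key := hJ.comparison (w := fun y => Q.v R ^ 2 * bump x₀ R y) (b := fun y => (C + 1) * b y)
    ((bump_bddMeas x₀ R).const_mul _) (hb.bm.const_mul _) (A := ball x₀ R) measurableSet_ball
    hκ.le hκ (fun x _ => le_add_of_nonneg_right (hJ.esc_nonneg _ _))
    (fun y hy => by
      simp only [bump_off hR hy, mul_zero]
      exact mul_nonneg (by linarith) (hb.nonneg y))
    (fun y hy => ?_) x₀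
  · have : bump x₀ R x₀ = 1 := by unfold bump; simp
    simpa [this] using key
  · have hyc : y ∉ ball c R := by
      rw [mem_ball, not_lt]
      rw [mem_ball] at hy
      linarith [dist_triangle x₀ y c, dist_comm x₀ y]
    have hy4 : y ∈ ball c (4 * R) := by
      rw [mem_ball] at hy ⊢
      linarith [dist_triangle y x₀ c]
    have h1 := hb.eqn y hyc
    rw [indicator_of_mem hy4] at h1
    rw [GoodKer.Lop_const_mul, GoodKer.Lop_const_mul]
    have h4 := (Lop_bump_le hJ x₀ hR hy).trans (hmom e he R hR)
    have h5 := bump_le x₀ R y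
    calc Q.v R ^ 2 * Lop (Q.J e) (bump x₀ R) y + (Q.v R ^ 2)⁻¹ * (Q.v R ^ 2 * bump x₀ R y)
        ≤ Q.v R ^ 2 * (C / Q.v R ^ 2) + (Q.v R ^ 2)⁻¹ * (Q.v R ^ 2 * 1) := by gcongr
      _ = C + 1 := by field_simp
      _ = (C + 1) * (Lop (Q.J e) b y + (Q.v R ^ 2)⁻¹ * b y) := by rw [h1, mul_one]
      _ = _ := by ring

end Core

/-- The homothety with centre `c` and ratio `l`. -/
def homothety (c : Rd d) (l : ℝ) (x : Rd d) : Rd d := c + l • (x - c)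

lemma homothety_measurable (c : Rd d) (l : ℝ) : Measurable (homothety c l) := by
  unfold homothety; fun_prop

lemma integral_homothety (g : Rd d → ℝ) (c : Rd d) {l : ℝ} (hl : 0 < l) :
    ∫ x, g (homothety c l x) = (l ^ d)⁻¹ * ∫ x, g x := by
  unfold homothety
  rw [integral_sub_right_eq_self (fun x => g (c + l • x)) c,
    Measure.integral_comp_smul volume (fun x => g (c + x)) l, integral_add_left_eq_self g c]
  simp [abs_of_pos (pow_pos hl d)]

lemma integrable_homothety {g : Rd d → ℝ} (hg : Integrable g) (c : Rd d) {l : ℝ} (hl : 0 < l) :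
    Integrable fun x => g (homothety c l x) :=
  (((hg.comp_add_left c).comp_smul hl.ne').comp_sub_right c)

lemma homothety_mem_ball {c x : Rd d} {l r : ℝ} (hl : 0 < l) :
    homothety c l x ∈ ball c (l * r) ↔ x ∈ ball c r := by
  rw [homothety, mem_ball, mem_ball, dist_eq_norm, dist_eq_norm, add_sub_cancel_left, norm_smul,
    norm_of_nonneg hl.le, mul_lt_mul_iff_right₀ hl]

lemma GoodKer.energy_homothety {J : Rd d → ℝ} (hJ : GoodKer J) {b : Rd d → ℝ} (hb : BddMeas b)
    (hbi : Integrable b) (c : Rd d) {l : ℝ} (hl : 0 < l) (hl1 : l ≤ 1) :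
    ∫ x, ∫ z, (b (homothety c l x) - b (homothety c l (x + z))) ^ 2 * J z
      ≤ (l ^ d)⁻¹ * ((l ^ d)⁻¹ * ∫ x, ∫ z, (b x - b (x + z)) ^ 2 * J z) := by
  have hE := (hJ.energy_eq hb hbi).1
  have hG : Integrable fun x => ∫ z, (b x - b (x + z)) ^ 2 * J z := hE.integral_prod_left
  have hsq : ∀ y, Integrable fun z => (b y - b (y + z)) ^ 2 * J z := fun y => by
    have h1 : BddMeas fun z => b y - b (y + z) :=
      (BddMeas.const (b y)).sub (hb.comp (T := fun z => y + z) (by fun_prop))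
    have := (h1.mul h1).mul_integrable hJ.int
    simpa only [sq] using this
  have hS : ∀ x z, homothety c l (x + z) = homothety c l x + l • z := fun x z => by
    simp only [homothety]; module
  have hpt : ∀ x, ∫ z, (b (homothety c l x) - b (homothety c l (x + z))) ^ 2 * J z
      ≤ (l ^ d)⁻¹ * ∫ z, (b (homothety c l x) - b (homothety c l x + z)) ^ 2 * J z := by
    intro x
    set y := homothety c l x with hy
    have h1 := Measure.integral_comp_smul volume
      (fun z => (b y - b (y + z)) ^ 2 * J z) l
    have h2 : ∫ z, (b y - b (y + l • z)) ^ 2 * J (l • z)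
        = (l ^ d)⁻¹ * ∫ z, (b y - b (y + z)) ^ 2 * J z := by
      rw [h1]; simp [abs_of_pos (pow_pos hl d)]
    rw [← h2]
    refine integral_mono_of_nonneg (ae_of_all _ fun z => mul_nonneg (sq_nonneg _) (hJ.nonneg z))
      ((hsq y).comp_smul hl.ne') (ae_of_all _ fun z => ?_)
    show (b y - b (homothety c l (x + z))) ^ 2 * J z ≤ (b y - b (y + l • z)) ^ 2 * J (l • z)
    rw [hS, ← hy]
    refine mul_le_mul_of_nonneg_left (hJ.anti _ _ ?_) (sq_nonneg _)
    rw [norm_smul, norm_of_nonneg hl.le]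
    exact mul_le_of_le_one_left (norm_nonneg z) hl1
  rw [← integral_homothety (fun x => ∫ z, (b x - b (x + z)) ^ 2 * J z) c hl,
    ← integral_const_mul]
  exact integral_mono_of_nonneg
    (ae_of_all _ fun x => integral_nonneg fun z => mul_nonneg (sq_nonneg _) (hJ.nonneg z))
    ((integrable_homothety hG c hl).const_mul _) (ae_of_all _ hpt)

lemma volume_real_ball (c : Rd d) {r : ℝ} (hr : 0 < r) :
    volume.real (ball c r) = r ^ d * volume.real (ball (0 : Rd d) 1) := by
  rw [Measure.real, Measure.addHaar_ball_of_pos _ _ hr]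
  simp [Measure.real, ENNReal.toReal_ofReal (pow_nonneg hr.le d)]

lemma unitBall_pos (d : ℕ) : 0 < volume.real (ball (0 : Rd d) 1) :=
  ENNReal.toReal_pos (measure_ball_pos _ _ one_pos).ne' measure_ball_lt_top.ne

lemma setIntegral_le_const {w : Rd d → ℝ} (hw : BddMeas w) {A : Set (Rd d)}
    (hA : MeasurableSet A) (hfin : volume A ≠ ∞) {M : ℝ} (h : ∀ x ∈ A, w x ≤ M) :
    ∫ x in A, w x ≤ M * volume.real A := by
  calc ∫ x in A, w x ≤ ∫ x in A, M :=
        setIntegral_mono_on (hw.integrableOn hfin) (integrableOn_const hfin) hA h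
    _ = _ := by rw [setIntegral_const, smul_eq_mul, mul_comm]

lemma shell_volume {c : Rd d} {r s : ℝ} (hr : 0 < r) (hrs : r ≤ s) :
    volume.real (ball c s \ ball c r) = (s ^ d - r ^ d) * volume.real (ball (0 : Rd d) 1) := by
  rw [measureReal_sdiff (ball_subset_ball hrs) measurableSet_ball measure_ball_lt_top.ne,
    volume_real_ball c (hr.trans_le hrs), volume_real_ball c hr]
  ring

namespace Core
variable (Q : Core)
namespace IsBarrier
variable {Q} {e : ℝ} {c : Rd d} {R : ℝ} {b : Rd d → ℝ}

set_option maxHeartbeats 800000 in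
/-- The energy of the difference between a barrier and its dilation is controlled. -/
lemma energy_sub_le (hb : Q.IsBarrier e c R b) (he : 0 < e) (hR : 0 < R) {l : ℝ}
    (hl : 1 / 2 ≤ l) (hl1 : l ≤ 1) :
    ∫ x, ∫ z, ((b x - b (homothety c l x)) - (b (x + z) - b (homothety c l (x + z)))) ^ 2 * Q.J e z
      ≤ (2 * ((4 ^ d * (2 * d) + 2 * d) * 4 ^ d * volume.real (ball (0 : Rd d) 1)))
        * ((1 - l) * R ^ d * Q.v R ^ 2) := by
  have hl0 : 0 < l := by linarith
  have hv := Q.v_pos R hR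
  have hJ := Q.J_good (d := d) he
  set κ := (Q.v R ^ 2)⁻¹ with hκ
  have hκ0 : 0 < κ := by positivity
  set b' := fun x => b (homothety c l x) with hb'
  set ω := volume.real (ball (0 : Rd d) 1) with hω
  have hω0 := unitBall_pos d
  have b'm : BddMeas b' := hb.bm.comp (homothety_measurable c l)
  have b'i : Integrable b' := integrable_homothety hb.int c hl0
  have b'0 : ∀ x ∈ ball c R, b' x = 0 := fun x hx => by
    refine hb.off _ (ball_subset_ball ?_ ((homothety_mem_ball hl0).2 hx))
    exact mul_le_of_le_one_left hR.le hl1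
  have mulint : ∀ {f g : Rd d → ℝ}, BddMeas f → Integrable g → Integrable fun x => g x * f x :=
    fun hf hg => (hf.mul_integrable hg).congr (ae_of_all _ fun x => mul_comm _ _)
  have isub : ∀ {f g : Rd d → ℝ}, Integrable f → Integrable g → Integrable fun x => f x - g x :=
    fun hf hg => hf.sub hg
  have Lb := hJ.Lop_bddMeas hb.bm
  have Lb' := hJ.Lop_bddMeas b'm
  -- testing the equation
  have test : ∀ {g : Rd d → ℝ}, Integrable g → (∀ x ∈ ball c R, g x = 0) →
      (∫ x, g x * Lop (Q.J e) b x) + κ * ∫ x, g x * b x = ∫ x in ball c (4 * R), g x := by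
    intro g hg h0
    rw [← integral_const_mul, ← integral_add (mulint Lb hg) ((mulint hb.bm hg).const_mul κ),
      ← integral_indicator measurableSet_ball]
    congr 1
    ext x
    by_cases hx : x ∈ ball c R
    · rw [h0 x hx]
      simp only [zero_mul, mul_zero, add_zero]
      by_cases h4 : x ∈ ball c (4 * R)
      · rw [indicator_of_mem h4, h0 x hx]
      · rw [indicator_of_notMem h4]
    · have := hb.eqn x hx
      calc g x * Lop (Q.J e) b x + κ * (g x * b x)
          = g x * (Lop (Q.J e) b x + (Q.v R ^ 2)⁻¹ * b x) := by rw [hκ]; ring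
        _ = _ := by
          rw [this]
          by_cases h4 : x ∈ ball c (4 * R)
          · rw [indicator_of_mem h4, indicator_of_mem h4, mul_one]
          · rw [indicator_of_notMem h4, indicator_of_notMem h4, mul_zero]
  have t1 := test hb.int hb.off
  have t2 := test b'i b'0
  -- energies
  have e1 := (hJ.energy_eq hb.bm hb.int).2
  have e2 := (hJ.energy_eq b'm b'i).2
  have e3 := (hJ.energy_eq (hb.bm.sub b'm) (hb.int.sub b'i)).2
  have e4 := hJ.energy_homothety hb.bm hb.int c hl0 hl1
  have sym : ∫ x, b x * Lop (Q.J e) b' x = ∫ x, b' x * Lop (Q.J e) b x :=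
    hJ.integral_mul_Lop hb.bm b'i
  have expand : ∫ x, (b x - b' x) * Lop (Q.J e) (fun y => b y - b' y) x
      = (∫ x, b x * Lop (Q.J e) b x) - 2 * (∫ x, b' x * Lop (Q.J e) b x)
        + ∫ x, b' x * Lop (Q.J e) b' x := by
    have : ∀ x, (b x - b' x) * Lop (Q.J e) (fun y => b y - b' y) x
        = (b x * Lop (Q.J e) b x - b' x * Lop (Q.J e) b x)
          - (b x * Lop (Q.J e) b' x - b' x * Lop (Q.J e) b' x) := fun x => by
      rw [hJ.Lop_sub hb.bm b'm]; ring
    simp_rw [this]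
    rw [integral_sub (isub (mulint Lb hb.int) (mulint Lb b'i))
      (isub (mulint Lb' hb.int) (mulint Lb' b'i)), integral_sub (mulint Lb hb.int) (mulint Lb b'i),
      integral_sub (mulint Lb' hb.int) (mulint Lb' b'i), sym]
    ring
  -- masses
  have q1 : ∫ x, b' x * b' x = (l ^ d)⁻¹ * ∫ x, b x * b x :=
    integral_homothety (fun x => b x * b x) c hl0
  have q2 : 0 ≤ ∫ x, (b x - b' x) * (b x - b' x) := integral_nonneg fun x => mul_self_nonneg _
  have q3 : ∫ x, (b x - b' x) * (b x - b' x)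
      = (∫ x, b x * b x) - 2 * (∫ x, b' x * b x) + ∫ x, b' x * b' x := by
    have : ∀ x, (b x - b' x) * (b x - b' x) = (b x * b x - 2 * (b' x * b x)) + b' x * b' x :=
      fun x => by ring
    simp_rw [this]
    rw [integral_add (isub (mulint hb.bm hb.int) ((mulint hb.bm b'i).const_mul 2)) (mulint b'm b'i),
      integral_sub (mulint hb.bm hb.int) ((mulint hb.bm b'i).const_mul 2), integral_const_mul]
  -- right-hand sides
  have hbon : ∀ {A : Set (Rd d)}, IntegrableOn b A := hb.int.integrableOn
  have I1 : ∫ x in ball c (4 * R), b x ≤ Q.v R ^ 2 * ((4 * R) ^ d * ω) := by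
    rw [← volume_real_ball c (by positivity)]
    exact setIntegral_le_const hb.bm measurableSet_ball measure_ball_lt_top.ne fun x _ => hb.le x
  have I0 : 0 ≤ ∫ x in ball c (4 * R), b x := integral_nonneg fun x => hb.nonneg x
  have I2 : ∫ x in ball c (4 * R), b' x = (l ^ d)⁻¹ * ∫ x in ball c (l * (4 * R)), b x := by
    rw [← integral_indicator measurableSet_ball, ← integral_indicator measurableSet_ball,
      ← integral_homothety _ c hl0]
    congr 1
    ext x
    by_cases h : x ∈ ball c (4 * R)
    · rw [indicator_of_mem h, indicator_of_mem ((homothety_mem_ball hl0).2 h)]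
    · rw [indicator_of_notMem h, indicator_of_notMem fun h' => h ((homothety_mem_ball hl0).1 h')]
  have hll : l * (4 * R) ≤ 4 * R := mul_le_of_le_one_left (by positivity) hl1
  have I3 : (∫ x in ball c (4 * R), b x) - Q.v R ^ 2 * ((1 - l ^ d) * (4 * R) ^ d * ω)
      ≤ ∫ x in ball c (l * (4 * R)), b x := by
    have h1 : ∫ x in ball c (4 * R) \ ball c (l * (4 * R)), b x
        ≤ Q.v R ^ 2 * (((4 * R) ^ d - (l * (4 * R)) ^ d) * ω) := by
      rw [hω, ← shell_volume (c := c) (by positivity) hll]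
      exact setIntegral_le_const hb.bm (measurableSet_ball.diff measurableSet_ball)
        (measure_ne_top_of_subset sdiff_subset measure_ball_lt_top.ne) fun x _ => hb.le x
    rw [setIntegral_sdiff measurableSet_ball hbon (ball_subset_ball hll)] at h1
    rw [mul_pow l] at h1
    linarith
  -- numerics
  have hb1 : 1 - l ^ d ≤ d * (1 - l) := by
    have := one_add_mul_le_pow (a := l - 1) (by linarith) d
    rw [add_sub_cancel] at this
    linarith
  set p := l ^ d with hp
  have hp0 : 0 < p := by positivity
  have hp1 : p ≤ 1 := pow_le_one₀ hl0.le hl1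
  have hpi : 1 ≤ p⁻¹ := (one_le_inv₀ hp0).2 hp1
  have hp2 : p⁻¹ ≤ 2 ^ d := by
    rw [hp, ← inv_pow]
    refine pow_le_pow_left₀ (by positivity) ?_ d
    rw [inv_le_comm₀ hl0 two_pos]; linarith
  have hd4 : (2 : ℝ) ^ d * 2 ^ d = 4 ^ d := by rw [← mul_pow]; norm_num
  have h21 : (1 : ℝ) ≤ 2 ^ d := one_le_pow₀ (by norm_num)
  set Ib := ∫ x in ball c (4 * R), b x
  set bb := ∫ x, b x * b x
  have hbb : 0 ≤ bb := integral_nonneg fun x => mul_self_nonneg _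
  set LL := ∫ x, b x * Lop (Q.J e) b x
  have hLL : 0 ≤ LL := by
    rw [e1]
    exact mul_nonneg (by norm_num) (integral_nonneg fun x => integral_nonneg fun z =>
      mul_nonneg (sq_nonneg _) (hJ.nonneg z))
  have hL'L' : ∫ x, b' x * Lop (Q.J e) b' x ≤ p⁻¹ * (p⁻¹ * LL) := by
    rw [e2, e1]
    calc _ ≤ (1 / 2 : ℝ) * _ := mul_le_mul_of_nonneg_left e4 (by norm_num)
      _ = _ := by ring
  have hfin : (1 / 2 : ℝ) * ∫ x, ∫ z, ((b x - b (homothety c l x))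
      - (b (x + z) - b (homothety c l (x + z)))) ^ 2 * Q.J e z
      ≤ (p⁻¹ * p⁻¹ - 1) * Ib + 2 * (Q.v R ^ 2 * ((1 - p) * (4 * R) ^ d * ω)) := by
    have h5 : p⁻¹ * bb ≤ p⁻¹ * (p⁻¹ * bb) :=
      mul_le_mul_of_nonneg_left (le_mul_of_one_le_left hbb hpi) (by positivity)
    have h6 : Ib - Q.v R ^ 2 * ((1 - p) * (4 * R) ^ d * ω) ≤ ∫ x in ball c (4 * R), b' x := by
      rw [I2]
      refine I3.trans (le_mul_of_one_le_left (integral_nonneg fun x => hb.nonneg x) hpi)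
    have h7 : (1 / 2 : ℝ) * (∫ x, ∫ z, ((b x - b (homothety c l x))
      - (b (x + z) - b (homothety c l (x + z)))) ^ 2 * Q.J e z)
        = LL - 2 * (∫ x, b' x * Lop (Q.J e) b x) + ∫ x, b' x * Lop (Q.J e) b' x := by
      rw [← expand, e3]
    rw [h7]
    rw [q3, q1] at q2
    have h8 := mul_nonneg hκ0.le q2
    have h9 : κ * (p⁻¹ * bb) ≤ κ * (p⁻¹ * (p⁻¹ * bb)) := mul_le_mul_of_nonneg_left h5 hκ0.le
    have h10 : p⁻¹ * (p⁻¹ * Ib) = p⁻¹ * (p⁻¹ * LL) + κ * (p⁻¹ * (p⁻¹ * bb)) := by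
      rw [← t1]; ring
    linarith
  have hpp : p⁻¹ * p⁻¹ - 1 ≤ 4 ^ d * (2 * d) * (1 - l) := by
    have h1 : p⁻¹ * p⁻¹ - 1 = (p⁻¹ * p⁻¹) * ((1 - p) * (1 + p)) := by field_simp; ring
    have h2 : p⁻¹ * p⁻¹ ≤ 4 ^ d := by
      rw [← hd4]; exact mul_le_mul hp2 hp2 (by positivity) (by positivity)
    have h3 : (1 - p) * (1 + p) ≤ (d * (1 - l)) * 2 :=
      mul_le_mul hb1 (by linarith) (by linarith) (mul_nonneg (Nat.cast_nonneg d) (by linarith))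
    rw [h1]
    calc _ ≤ 4 ^ d * ((d * (1 - l)) * 2) :=
          mul_le_mul h2 h3 (mul_nonneg (by linarith) (by linarith)) (by positivity)
      _ = _ := by ring
  have h1l : 0 ≤ 1 - l := by linarith
  have g1 : (p⁻¹ * p⁻¹ - 1) * Ib
      ≤ (4 ^ d * (2 * d) * (1 - l)) * (Q.v R ^ 2 * ((4 * R) ^ d * ω)) :=
    mul_le_mul hpp I1 I0 (by positivity)
  have g2 : Q.v R ^ 2 * ((1 - p) * (4 * R) ^ d * ω)
      ≤ Q.v R ^ 2 * ((d * (1 - l)) * (4 * R) ^ d * ω) := by gcongr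
  rw [mul_pow] at g1 g2 hfin
  have key := hfin.trans (add_le_add g1 (mul_le_mul_of_nonneg_left g2 (by norm_num : (0:ℝ) ≤ 2)))
  refine le_trans (le_of_eq_of_le ?_ (mul_le_mul_of_nonneg_left key (by norm_num : (0:ℝ) ≤ 2)))
    (le_of_eq ?_)
  · ring
  · ring

end IsBarrier
end Core

namespace Core
variable (Q : Core)

lemma esc_lower (d : ℕ) : ∃ c₀ r₀ : ℝ, 0 < c₀ ∧ 0 < r₀ ∧ r₀ ≤ 1 ∧ r₀ ≤ Q.s₀ ∧
    ∀ {e : ℝ} (_ : 0 < e) {A : Set (Rd d)} (_ : MeasurableSet A) {x p : Rd d} {s : ℝ} (_ : 0 < s)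
      (_ : e < (s / 2) ^ 2) (_ : 3 * s ≤ r₀) (_ : s ≤ dist p x) (_ : dist p x ≤ 2 * s)
      (_ : ∀ y ∈ ball p (s / 2), y ∉ A), c₀ / Q.v s ^ 2 ≤ GoodKer.esc (Q.J e) A x := by
  obtain ⟨c, r₀, hc, hr₀, hr1, hrs, hlow⟩ := Q.J_lower d
  have hω := unitBall_pos d
  refine ⟨c * (3 ^ d)⁻¹ / 9 * ((2 ^ d)⁻¹ * volume.real (ball (0 : Rd d) 1)), r₀, by positivity,
    hr₀, hr1, hrs, ?_⟩
  intro e he A hA x p s hs hes h3 hpx hpx2 hball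
  have hJ := Q.J_good (d := d) he
  have hv := Q.v_pos s hs
  set L := c * (3 ^ d)⁻¹ / 9 * ((s ^ d)⁻¹ / Q.v s ^ 2) with hL
  have hpt : ∀ z ∈ ball (p - x) (s / 2), L ≤ Aᶜ.indicator (fun _ => (1:ℝ)) (x + z) * Q.J e z := by
    intro z hz
    have hmem : x + z ∈ Aᶜ := hball _ (by
      rw [mem_ball, dist_eq_norm] at hz ⊢
      rwa [show x + z - p = z - (p - x) by abel])
    rw [indicator_of_mem hmem, one_mul]
    rw [mem_ball, dist_eq_norm] at hz
    rw [dist_eq_norm] at hpx hpx2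
    have z1 : s / 2 ≤ ‖z‖ := by
      have := norm_sub_norm_le (p - x) (p - x - z)
      rw [sub_sub_cancel, norm_sub_rev (p - x) z] at this
      linarith
    have z2 : ‖z‖ ≤ 3 * s := by
      have := norm_add_le (z - (p - x)) (p - x)
      rw [sub_add_cancel] at this
      linarith
    have z0 : 0 < ‖z‖ := by linarith
    refine le_trans ?_ (hlow e he z (hes.trans_le (by gcongr)) (z2.trans h3))
    have hvz := Q.v_pos _ z0
    have hv3 : Q.v ‖z‖ ≤ 3 * Q.v s :=
      (Q.mono _ _ z0 z2).trans (Q.lin 3 s (by norm_num) hs)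
    have hq : Q.v ‖z‖ ^ 2 ≤ 9 * Q.v s ^ 2 := by
      calc Q.v ‖z‖ ^ 2 ≤ (3 * Q.v s) ^ 2 := by gcongr
        _ = _ := by ring
    have hn : (3 ^ d)⁻¹ * (s ^ d)⁻¹ ≤ (‖z‖ ^ d)⁻¹ := by
      rw [← mul_inv, ← mul_pow]
      gcongr
    rw [hL]
    calc c * (3 ^ d)⁻¹ / 9 * ((s ^ d)⁻¹ / Q.v s ^ 2)
        = c * ((3 ^ d)⁻¹ * (s ^ d)⁻¹) / (9 * Q.v s ^ 2) := by field_simp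
      _ ≤ c * (‖z‖ ^ d)⁻¹ / Q.v ‖z‖ ^ 2 := by gcongr
  have hi : Integrable fun z => Aᶜ.indicator (fun _ => (1:ℝ)) (x + z) * Q.J e z :=
    hJ.integrable_shift ((BddMeas.const 1).indicator hA.compl) x
  have h1 : L * volume.real (ball (p - x) (s / 2)) ≤ GoodKer.esc (Q.J e) A x := by
    calc L * volume.real (ball (p - x) (s / 2)) = ∫ z in ball (p - x) (s / 2), L := by
          rw [setIntegral_const, smul_eq_mul, mul_comm]
      _ ≤ ∫ z in ball (p - x) (s / 2), Aᶜ.indicator (fun _ => (1:ℝ)) (x + z) * Q.J e z :=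
          setIntegral_mono_on (integrableOn_const measure_ball_lt_top.ne) hi.integrableOn
            measurableSet_ball hpt
      _ ≤ ∫ z, Aᶜ.indicator (fun _ => (1:ℝ)) (x + z) * Q.J e z :=
          setIntegral_le_integral hi (ae_of_all _ fun z =>
            mul_nonneg (indicator_nonneg (fun _ _ => zero_le_one) _) (hJ.nonneg z))
  refine le_of_eq_of_le ?_ h1
  rw [volume_real_ball (p - x) (by positivity : 0 < s / 2), hL, div_pow]
  have : s ^ d ≠ 0 := by positivity
  field_simp

lemma shell_sq_le (d : ℕ) : ∃ C r₀ : ℝ, 1 ≤ C ∧ 0 < r₀ ∧ r₀ ≤ 1 ∧ r₀ ≤ Q.s₀ ∧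
    ∀ {e : ℝ} (_ : 0 < e) {c : Rd d} {R : ℝ} (_ : 0 < R) {b : Rd d → ℝ} (_ : Q.IsBarrier e c R b)
      {W : ℝ} (_ : 0 < W) (_ : e < (W / 2) ^ 2) (_ : 3 * W ≤ r₀) (_ : W ≤ R),
      ∫ x in ball c (R + W) \ ball c R, b x * b x
        ≤ C * (W / R) * R ^ d * (Q.v R ^ 2 * Q.v W ^ 2) := by
  obtain ⟨c₀, r₀, hc₀, hr₀, hr1, hrs, hesc⟩ := Q.esc_lower d
  set C₁ := 2 * ((4 ^ d * (2 * d) + 2 * d) * 4 ^ d * volume.real (ball (0 : Rd d) 1)) with hC₁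
  have hω := unitBall_pos d
  have hC₁0 : 0 ≤ C₁ := by positivity
  refine ⟨1 + C₁ / c₀, r₀, le_add_of_nonneg_right (by positivity), hr₀, hr1, hrs, ?_⟩
  intro e he c R hR b hb W hW heW h3 hWR
  have hJ := Q.J_good (d := d) he
  have hv := Q.v_pos R hR
  have hvW := Q.v_pos W hW
  set l := R / (R + W) with hl
  have hRW : 0 < R + W := by positivity
  have hl0 : 0 < l := by positivity
  have hl1 : l ≤ 1 := (div_le_one hRW).2 (by linarith)
  have hl2 : 1 / 2 ≤ l := by rw [hl, div_le_div_iff₀ two_pos hRW]; linarith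
  have h1l : 1 - l ≤ W / R := by
    rw [hl, one_sub_div hRW.ne', add_sub_cancel_left]
    exact div_le_div_of_nonneg_left hW.le hR (by linarith)
  have hen := hb.energy_sub_le he hR hl2 hl1
  set f := fun x => b x - b (homothety c l x) with hf
  have hfm : BddMeas f := hb.bm.sub (hb.bm.comp (homothety_measurable c l))
  have hfi : Integrable f := hb.int.sub (integrable_homothety hb.int c hl0)
  have hE := (hJ.energy_eq hfm hfi).1
  have hG : Integrable fun x => ∫ z, (f x - f (x + z)) ^ 2 * Q.J e z := hE.integral_prod_left
  have hsub : ∀ r, l * r ≤ R → ∀ x ∈ ball c r, b (homothety c l x) = 0 := fun r hr x hx =>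
    hb.off _ (ball_subset_ball hr ((homothety_mem_ball hl0).2 hx))
  have hlRW : l * (R + W) ≤ R := by rw [hl, div_mul_cancel₀ _ hRW.ne']
  set Sh := ball c (R + W) \ ball c R with hSh
  have hShm : MeasurableSet Sh := measurableSet_ball.diff measurableSet_ball
  set k := c₀ / Q.v W ^ 2 with hk
  have hk0 : 0 < k := by positivity
  have hpt : ∀ x, Sh.indicator (fun x => k * (b x * b x)) x
      ≤ ∫ z, (f x - f (x + z)) ^ 2 * Q.J e z := by
    intro x
    by_cases hx : x ∈ Sh
    · rw [indicator_of_mem hx]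
      have hfx : f x = b x := by rw [hf]; simp only; rw [hsub _ hlRW x hx.1, sub_zero]
      have hxc : R ≤ ‖x - c‖ := by
        rw [← dist_eq_norm]; exact not_lt.1 fun h => hx.2 (mem_ball.2 h)
      have hxc2 : ‖x - c‖ < R + W := by rw [← dist_eq_norm]; exact mem_ball.1 hx.1
      have hn0 : 0 < ‖x - c‖ := hR.trans_le hxc
      set p := c + ((R - W) / ‖x - c‖) • (x - c) with hp
      have hpx : dist p x = ‖x - c‖ - (R - W) := by
        have : x - p = ((‖x - c‖ - (R - W)) / ‖x - c‖) • (x - c) := by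
          rw [sub_div, div_self hn0.ne', hp]; module
        rw [dist_comm, dist_eq_norm, this, norm_smul, norm_of_nonneg
          (div_nonneg (by linarith) hn0.le), div_mul_cancel₀ _ hn0.ne']
      have hpc : dist p c = R - W := by
        rw [dist_eq_norm, hp, add_sub_cancel_left, norm_smul, norm_of_nonneg
          (div_nonneg (by linarith) hn0.le), div_mul_cancel₀ _ hn0.ne']
      have h1 := hesc he (A := (ball c R)ᶜ) measurableSet_ball.compl (x := x) (p := p) hW heW h3
        (by rw [hpx]; linarith) (by rw [hpx]; linarith) (fun y hy => by
          rw [notMem_compl_iff, mem_ball]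
          have := dist_triangle y p c
          rw [mem_ball] at hy
          linarith)
      have hsq : Integrable fun z => (f x - f (x + z)) ^ 2 * Q.J e z := by
        have h1 : BddMeas fun z => f x - f (x + z) := (BddMeas.const (f x)).sub (hfm.comp_add x)
        have := (h1.mul h1).mul_integrable hJ.int
        simpa only [sq] using this
      calc k * (b x * b x) ≤ GoodKer.esc (Q.J e) (ball c R)ᶜ x * (b x * b x) :=
            mul_le_mul_of_nonneg_right h1 (mul_self_nonneg _)
        _ = ∫ z, (b x * b x) * ((ball c R)ᶜᶜ.indicator (fun _ => (1:ℝ)) (x + z) * Q.J e z) := by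
            rw [integral_const_mul, mul_comm]; rfl
        _ ≤ _ := by
            refine integral_mono_of_nonneg (ae_of_all _ fun z => mul_nonneg (mul_self_nonneg _)
              (mul_nonneg (indicator_nonneg (fun _ _ => zero_le_one) _) (hJ.nonneg z))) hsq
              (ae_of_all _ fun z => ?_)
            simp only [compl_compl]
            by_cases hz : x + z ∈ ball c R
            · have hfz : f (x + z) = 0 := by
                rw [hf]; simp only
                rw [hb.off _ hz, hsub R (mul_le_of_le_one_left hR.le hl1) _ hz, sub_zero]
              rw [indicator_of_mem hz, hfx, hfz, one_mul, sub_zero, sq]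
            · rw [indicator_of_notMem hz, zero_mul, mul_zero]
              exact mul_nonneg (sq_nonneg _) (hJ.nonneg z)
    · rw [indicator_of_notMem hx]
      exact integral_nonneg fun z => mul_nonneg (sq_nonneg _) (hJ.nonneg z)
  have hint : k * ∫ x in Sh, b x * b x ≤ C₁ * ((1 - l) * R ^ d * Q.v R ^ 2) := by
    refine le_trans ?_ hen
    rw [← integral_const_mul, ← integral_indicator hShm]
    exact integral_mono_of_nonneg (ae_of_all _ fun x => indicator_nonneg (fun y _ =>
      mul_nonneg hk0.le (mul_self_nonneg _)) x) hG (ae_of_all _ hpt)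
  have h2 : C₁ * ((1 - l) * R ^ d * Q.v R ^ 2) ≤ C₁ * (W / R * R ^ d * Q.v R ^ 2) := by gcongr
  have h3 : ∫ x in Sh, b x * b x ≤ (C₁ * (W / R * R ^ d * Q.v R ^ 2)) / k := by
    rw [le_div_iff₀ hk0, mul_comm]; exact hint.trans h2
  refine h3.trans ?_
  rw [hk]
  calc C₁ * (W / R * R ^ d * Q.v R ^ 2) / (c₀ / Q.v W ^ 2)
      = C₁ / c₀ * (W / R) * R ^ d * (Q.v R ^ 2 * Q.v W ^ 2) := by field_simp
    _ ≤ _ := by gcongr; linarith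

end Core

lemma add_pow_sub_le (d : ℕ) {R W : ℝ} (hR : 0 < R) (hW : 0 ≤ W) (hWR : W ≤ R) :
    (R + W) ^ d - R ^ d ≤ 2 ^ d * (W / R) * R ^ d := by
  have key : ∀ n : ℕ, (1 + W / R) ^ n ≤ 1 + (2 ^ n - 1) * (W / R) := by
    intro n
    have ht : 0 ≤ W / R := by positivity
    have ht1 : W / R ≤ 1 := (div_le_one hR).2 hWR
    induction n with
    | zero => simp
    | succ n ih =>
      have h2 : (1 : ℝ) ≤ 2 ^ n := one_le_pow₀ (by norm_num)
      rw [pow_succ, pow_succ]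
      nlinarith [mul_le_mul_of_nonneg_right ih (by linarith : 0 ≤ 1 + W / R),
        mul_nonneg (mul_nonneg (sub_nonneg.2 h2) ht) (sub_nonneg.2 ht1)]
  have h1 : R + W = R * (1 + W / R) := by field_simp
  rw [h1, mul_pow]
  have hR' : 0 < R ^ d := by positivity
  nlinarith [mul_le_mul_of_nonneg_left (key d) hR'.le,
    mul_nonneg hR'.le (div_nonneg hW hR.le)]

lemma le_add_pow_sub (hd : d ≠ 0) {R r ρ : ℝ} (hR : 0 < R) (hRr : R ≤ r) (hρ : 0 ≤ ρ) :
    ρ / R * R ^ d ≤ (r + ρ) ^ d - r ^ d := by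
  obtain ⟨n, rfl⟩ := Nat.exists_eq_succ_of_ne_zero hd
  have hr : 0 < r := hR.trans_le hRr
  have h1 : ρ / R * R ^ (n + 1) = ρ * R ^ n := by rw [pow_succ]; field_simp
  have h2 : R ^ n ≤ r ^ n := by gcongr
  have h3 : r ^ n ≤ (r + ρ) ^ n := by gcongr; linarith
  simp only [Nat.succ_eq_add_one]
  rw [h1, pow_succ, pow_succ]
  nlinarith [mul_le_mul_of_nonneg_left h2 hρ, mul_le_mul_of_nonneg_right h3 (by linarith : 0 ≤ r + ρ)]

lemma exists_isometry_map {a b : Rd d} (h : ‖a‖ = ‖b‖) : ∃ ℓ : Rd d ≃ₗᵢ[ℝ] Rd d, ℓ a = b :=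
  ⟨(ℝ ∙ (a - b))ᗮ.reflection, Submodule.reflection_sub h⟩

/-- Averaging the local mass of a nonnegative function over a set of translates. -/
lemma setIntegral_ball_average {b : Rd d → ℝ} (hb : BddMeas b) (hb0 : ∀ x, 0 ≤ b x)
    (hbi : Integrable b) {S : Set (Rd d)} (hS : MeasurableSet S) (hfin : volume S ≠ ∞) {ρ : ℝ}
    {T : Set (Rd d)} (hT : MeasurableSet T) (hST : ∀ x ∈ S, ∀ z ∈ ball (0 : Rd d) ρ, x + z ∈ T)
    {I : ℝ} (hI : ∀ x ∈ S, I ≤ ∫ y in ball x ρ, b y) :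
    volume.real S * I ≤ volume.real (ball (0 : Rd d) ρ) * ∫ y in T, b y := by
  have hfin2 : volume (ball (0 : Rd d) ρ) ≠ ∞ := measure_ball_lt_top.ne
  have : IsFiniteMeasure (volume.restrict S) := ⟨by simpa using hfin.lt_top⟩
  have : IsFiniteMeasure (volume.restrict (ball (0 : Rd d) ρ)) := ⟨by simpa using hfin2.lt_top⟩
  obtain ⟨M, hM⟩ := hb.2
  have hprod : Integrable (fun p : Rd d × Rd d => b (p.1 + p.2))
      ((volume.restrict S).prod (volume.restrict (ball (0 : Rd d) ρ))) :=
    Integrable.of_bound (hb.1.comp (measurable_fst.add measurable_snd)).aestronglyMeasurable M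
      (ae_of_all _ fun p => hM _)
  have h1 : volume.real S * I ≤ ∫ x in S, ∫ z in ball (0 : Rd d) ρ, b (x + z) := by
    rw [← smul_eq_mul, ← setIntegral_const]
    refine setIntegral_mono_on (integrableOn_const hfin) hprod.integral_prod_left hS fun x hx => ?_
    rw [setIntegral_ball_shift]
    exact hI x hx
  rw [integral_integral_swap hprod] at h1
  refine h1.trans ?_
  rw [← smul_eq_mul, ← setIntegral_const]
  refine setIntegral_mono_on hprod.integral_prod_right (integrableOn_const hfin2)
    measurableSet_ball fun z hz => ?_
  rw [← integral_indicator hS, ← integral_indicator hT, ← integral_add_right_eq_self (T.indicator b) z]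
  refine integral_mono_of_nonneg (ae_of_all _ fun x => indicator_nonneg (fun y _ => hb0 _) x)
    ((hbi.indicator hT).comp_add_right z) (ae_of_all _ fun x => ?_)
  show S.indicator (fun x => b (x + z)) x ≤ T.indicator b (x + z)
  by_cases hx : x ∈ S
  · rw [indicator_of_mem hx, indicator_of_mem (hST x hx z hz)]
  · rw [indicator_of_notMem hx]; exact indicator_nonneg (fun y _ => hb0 _) _

namespace Core
variable (Q : Core)

lemma shell_le (d : ℕ) : ∃ C r₀ : ℝ, 1 ≤ C ∧ 0 < r₀ ∧ r₀ ≤ 1 ∧ r₀ ≤ Q.s₀ ∧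
    ∀ {e : ℝ} (_ : 0 < e) {c : Rd d} {R : ℝ} (_ : 0 < R) {b : Rd d → ℝ} (_ : Q.IsBarrier e c R b)
      {W : ℝ} (_ : 0 < W) (_ : e < (W / 2) ^ 2) (_ : 3 * W ≤ r₀) (_ : W ≤ R),
      ∫ x in ball c (R + W), b x ≤ C * (W / R) * R ^ d * (Q.v R * Q.v W) := by
  obtain ⟨C, r₀, hC, hr₀, hr1, hrs, h⟩ := Q.shell_sq_le d
  have hω := unitBall_pos d
  set ω := volume.real (ball (0 : Rd d) 1) with hωd
  refine ⟨C + 2 ^ d * ω, r₀, le_add_of_le_of_nonneg hC (by positivity), hr₀, hr1, hrs, ?_⟩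
  intro e he c R hR b hb W hW heW h3 hWR
  have h2 := h he hR hb hW heW h3 hWR
  have hv := Q.v_pos R hR
  have hvW := Q.v_pos W hW
  set s := Q.v R * Q.v W with hs
  have hs0 : 0 < s := by positivity
  set Sh := ball c (R + W) \ ball c R with hSh
  have hShm : MeasurableSet Sh := measurableSet_ball.diff measurableSet_ball
  have hfin : volume Sh ≠ ∞ := measure_ne_top_of_subset sdiff_subset measure_ball_lt_top.ne
  have h4 : ∫ x in ball c (R + W), b x = ∫ x in Sh, b x := by
    have : Sh = ball c (R + W) \ ball c R := rfl
    rw [this, setIntegral_sdiff measurableSet_ball hb.int.integrableOn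
      (ball_subset_ball (by linarith)), setIntegral_eq_zero_of_forall_eq_zero
      (t := ball c R) (fun x hx => hb.off x hx), sub_zero]
  have hbb : IntegrableOn (fun x => b x * b x) Sh := (hb.bm.mul hb.bm).integrableOn hfin
  have h5 : ∫ x in Sh, b x ≤ ∫ x in Sh, (s⁻¹ * (b x * b x) + s) := by
    refine setIntegral_mono_on (hb.bm.integrableOn hfin)
      ((hbb.const_mul _).add (integrableOn_const hfin)) hShm fun x _ => ?_
    have : b x * (2 * s) ≤ b x * b x + s * s := by nlinarith [sq_nonneg (b x - s)]
    have h6 : s⁻¹ * (b x * b x) + s = (b x * b x + s * s) / s := by field_simp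
    rw [h6, le_div_iff₀ hs0]
    nlinarith [hb.nonneg x]
  rw [integral_add (hbb.const_mul _) (integrableOn_const hfin), integral_const_mul,
    setIntegral_const, smul_eq_mul, hSh, shell_volume hR (by linarith), ← hSh] at h5
  rw [h4]
  refine h5.trans ?_
  have h7 := add_pow_sub_le d hR hW.le hWR
  calc _ ≤ s⁻¹ * (C * (W / R) * R ^ d * (Q.v R ^ 2 * Q.v W ^ 2))
        + 2 ^ d * (W / R) * R ^ d * ω * s := by gcongr
    _ = _ := by rw [hs]; field_simp

/-- The barrier grows at most like `v` away from the ball where it vanishes. -/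
theorem barrier_upper (hd : d ≠ 0) : ∃ C r₁ : ℝ, 1 ≤ C ∧ 0 < r₁ ∧ r₁ ≤ 1 ∧ r₁ ≤ Q.s₀ ∧
    ∀ {e : ℝ} (_ : 0 < e) {c : Rd d} {R : ℝ} (_ : 0 < R) (_ : R ≤ r₁) {b : Rd d → ℝ}
      (_ : Q.IsBarrier e c R b) {ρ₀ : ℝ} (_ : 0 < ρ₀) (_ : e < ρ₀ ^ 2) (_ : ρ₀ ≤ R) (x : Rd d)
      (_ : dist x c ≤ R + ρ₀), b x ≤ C * (Q.v R * Q.v ρ₀) := by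
  obtain ⟨C, r₀, hC, hr₀, hr1, hrs, hshell⟩ := Q.shell_le d
  obtain ⟨Cm, hCm, hmean⟩ := Q.mean_value d
  have hω := unitBall_pos d
  set ω := volume.real (ball (0 : Rd d) 1) with hωd
  have hA0 : 0 ≤ 2 ^ d * 16 * C + 8 * ω := by positivity
  refine ⟨Cm * ((2 ^ d * 16 * C + 8 * ω) + 1), r₀ / 2, ?_, by positivity, by linarith, by linarith,
    ?_⟩
  · nlinarith
  intro e he c R hR hRr b hb ρ₀ hρ₀ heρ hρR x hx
  have hv := Q.v_pos R hR
  have hvρ := Q.v_pos ρ₀ hρ₀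
  by_cases hxR : x ∈ ball c R
  · rw [hb.off x hxR]; positivity
  have hxR' : R ≤ dist x c := not_lt.1 fun h => hxR (mem_ball.2 h)
  have hball : ∀ ρ, ρ₀ ≤ ρ → ∫ y in ball x ρ, b y
      ≤ ((2 ^ d * 16 * C + 8 * ω) * Q.v R) * ρ ^ d * Q.v ρ := by
    intro ρ hρ
    have hρ0 : 0 < ρ := hρ₀.trans_le hρ
    have hvρ' := Q.v_pos ρ hρ0
    by_cases h8 : ρ ≤ R / 8
    · set r := dist x c with hr
      set S := ball c (r + ρ) \ ball c r with hS
      have hSm : MeasurableSet S := measurableSet_ball.diff measurableSet_ball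
      have hfin : volume S ≠ ∞ := measure_ne_top_of_subset sdiff_subset measure_ball_lt_top.ne
      have hr0 : 0 < r := hR.trans_le hxR'
      have hI : ∀ x' ∈ S, ∫ y in ball x ρ, b y ≤ ∫ y in ball x' (2 * ρ), b y := by
        intro x' hx'
        have h1 : r ≤ dist x' c := not_lt.1 fun h => hx'.2 (mem_ball.2 h)
        have h2 : dist x' c < r + ρ := mem_ball.1 hx'.1
        have hx'0 : 0 < ‖x' - c‖ := by rw [← dist_eq_norm]; linarith
        obtain ⟨ℓ, hℓ⟩ := exists_isometry_map (a := x - c) (b := (r / ‖x' - c‖) • (x' - c)) (by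
          rw [norm_smul, norm_of_nonneg (by positivity), div_mul_cancel₀ _ hx'0.ne', hr,
            dist_eq_norm])
        set y := c + (r / ‖x' - c‖) • (x' - c) with hy
        have hyx : dist y x' < ρ := by
          have : y - x' = -(((‖x' - c‖ - r) / ‖x' - c‖) • (x' - c)) := by
            rw [sub_div, div_self hx'0.ne', hy]; module
          rw [dist_eq_norm, this, norm_neg, norm_smul, norm_of_nonneg (div_nonneg
            (by rw [← dist_eq_norm]; linarith) hx'0.le), div_mul_cancel₀ _ hx'0.ne',
            ← dist_eq_norm]
          linarith
        have h3 : ∫ z in ball x ρ, b z = ∫ z in ball y ρ, b z := by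
          symm
          rw [← setIntegral_ball_shift b x ρ, ← setIntegral_ball_shift b y ρ,
            ← integral_indicator measurableSet_ball, ← integral_indicator measurableSet_ball,
            ← ℓ.measurePreserving.integral_comp
              ℓ.toHomeomorph.toMeasurableEquiv.measurableEmbedding]
          congr 1
          ext z
          by_cases hz : z ∈ ball (0 : Rd d) ρ
          · have hz' : ℓ z ∈ ball (0 : Rd d) ρ := by
              rw [mem_ball_zero_iff] at hz ⊢; rwa [ℓ.norm_map]
            rw [indicator_of_mem hz, indicator_of_mem hz', ← hb.invariant he hR ℓ (x + z),
              add_sub_right_comm, map_add, hℓ, ← add_assoc]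
          · have hz' : ℓ z ∉ ball (0 : Rd d) ρ := by
              rw [mem_ball_zero_iff] at hz ⊢; rwa [ℓ.norm_map]
            rw [indicator_of_notMem hz, indicator_of_notMem hz']
        rw [h3]
        refine setIntegral_mono_set hb.int.integrableOn (ae_of_all _ hb.nonneg)
          (ae_of_all _ (ball_subset_ball' ?_))
        linarith
      have havg := setIntegral_ball_average hb.bm hb.nonneg hb.int hSm hfin
        (T := ball c (R + 4 * ρ)) measurableSet_ball (fun x' hx' z hz => by
          rw [mem_ball, dist_eq_norm, add_sub_right_comm]
          have h1 := norm_add_le (x' - c) z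
          have h2 := mem_ball.1 hx'.1
          rw [dist_eq_norm] at h2
          rw [mem_ball_zero_iff] at hz
          linarith) hI
      have h2ρ : 0 < 2 * ρ := by positivity
      rw [hS, shell_volume hr0 (by linarith), volume_real_ball 0 h2ρ, ← hωd] at havg
      have hsh := hshell he hR hb (W := 4 * ρ) (by positivity)
        (heρ.trans_le (by nlinarith)) (by linarith) (by linarith)
      have hlo := le_add_pow_sub hd hR hxR' hρ0.le
      have h4 : Q.v (4 * ρ) ≤ 4 * Q.v ρ := Q.lin 4 ρ (by norm_num) hρ0
      have hI0 : 0 ≤ ∫ y in ball x ρ, b y := integral_nonneg fun y => hb.nonneg y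
      have hk : 0 < ρ / R * R ^ d * ω := by positivity
      have hchain : (ρ / R * R ^ d * ω) * ∫ y in ball x ρ, b y
          ≤ (ρ / R * R ^ d * ω) * ((2 ^ d * 16 * C * Q.v R) * ρ ^ d * Q.v ρ) := by
        calc (ρ / R * R ^ d * ω) * ∫ y in ball x ρ, b y
            ≤ (((r + ρ) ^ d - r ^ d) * ω) * ∫ y in ball x ρ, b y := by gcongr
          _ ≤ (2 * ρ) ^ d * ω * ∫ y in ball c (R + 4 * ρ), b y := havg
          _ ≤ (2 * ρ) ^ d * ω * (C * (4 * ρ / R) * R ^ d * (Q.v R * (4 * Q.v ρ))) := by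
              gcongr
              exact hsh.trans (by gcongr)
          _ = _ := by rw [mul_pow]; ring
      refine (le_of_mul_le_mul_left hchain hk).trans ?_
      gcongr
      linarith
    · push Not at h8
      have h1 : ∫ y in ball x ρ, b y ≤ Q.v R ^ 2 * (ρ ^ d * ω) := by
        rw [← volume_real_ball x hρ0]
        exact setIntegral_le_const hb.bm measurableSet_ball measure_ball_lt_top.ne
          fun y _ => hb.le y
      have h2 : Q.v R ≤ 8 * Q.v ρ :=
        (Q.mono R (8 * ρ) hR (by linarith)).trans (Q.lin 8 ρ (by norm_num) hρ0)
      calc _ ≤ Q.v R ^ 2 * (ρ ^ d * ω) := h1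
        _ = Q.v R * (ρ ^ d * ω) * Q.v R := by ring
        _ ≤ Q.v R * (ρ ^ d * ω) * (8 * Q.v ρ) := by gcongr
        _ = ((8 * ω) * Q.v R) * ρ ^ d * Q.v ρ := by ring
        _ ≤ _ := by gcongr; exact le_add_of_nonneg_left (by positivity)
  have h := hmean he hb.bm hb.nonneg zero_le_one (hb.Lop_le he) x hρ₀ heρ (by linarith)
    (by positivity) hball
  refine h.trans ?_
  have hm : Q.v ρ₀ ≤ Q.v R := Q.mono _ _ hρ₀ hρR
  have : 1 * Q.v ρ₀ ^ 2 ≤ Q.v R * Q.v ρ₀ := by nlinarith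
  calc _ ≤ Cm * ((2 ^ d * 16 * C + 8 * ω) * Q.v R * Q.v ρ₀ + Q.v R * Q.v ρ₀) := by gcongr
    _ = _ := by ring

end Core

namespace Core
variable (Q : Core)

/-- Boundary decay of a subsolution which vanishes on an exterior ball. -/
theorem boundary_decay (hd : d ≠ 0) : ∃ C r₁ : ℝ, 1 ≤ C ∧ 0 < r₁ ∧ r₁ ≤ 1 ∧ r₁ ≤ Q.s₀ ∧
    ∀ {e : ℝ} (_ : 0 < e) {c : Rd d} {R : ℝ} (_ : 0 < R) (_ : R ≤ r₁) {Ω : Set (Rd d)}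
      (_ : MeasurableSet Ω) (_ : ∀ x ∈ ball c R, x ∉ Ω) {w : Rd d → ℝ} (_ : BddMeas w)
      (_ : ∀ x, 0 ≤ w x) (_ : ∀ x ∉ Ω, w x = 0) {A τ M : ℝ} (_ : 0 ≤ A) (_ : 0 ≤ τ) (_ : 0 ≤ M)
      (_ : ∀ x ∈ Ω, x ∈ ball c (2 * R) → Lop (Q.J e) w x ≤ A)
      (_ : ∀ᵐ x, x ∈ ball c (3 * R) → w x ≤ M)
      (_ : ∀ x ∈ ball c (2 * R),
        ∫ z, (ball c (3 * R))ᶜ.indicator w (x + z) * Q.J e z ≤ τ)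
      {ρ₀ : ℝ} (_ : 0 < ρ₀) (_ : e < ρ₀ ^ 2) (_ : ρ₀ ≤ R) (x : Rd d) (_ : dist x c ≤ R + ρ₀),
      min (w x) M ≤ C * (Q.v R * Q.v ρ₀) * (A + τ + M / Q.v R ^ 2) := by
  obtain ⟨C₁, r₁, hC₁, hr₁, hr1, hrs, hup⟩ := Q.barrier_upper hd
  obtain ⟨C₂, hC₂, hlow⟩ := Q.barrier_lower d
  refine ⟨C₁ * C₂, r₁, one_le_mul_of_one_le_of_one_le hC₁ hC₂, hr₁, hr1, hrs, ?_⟩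
  intro e he c R hR hRr Ω hΩ hball w hw hw0 hoff A τ M hA hτ hM hL hwM htail ρ₀ hρ₀ heρ hρR x hx
  have hJ := Q.J_good (d := d) he
  have hv := Q.v_pos R hR
  obtain ⟨b, hb⟩ := Q.exists_barrier (d := d) he c hR
  set κ := (Q.v R ^ 2)⁻¹ with hκ
  have hκ0 : 0 < κ := by positivity
  set Λ := C₂ * (A + τ + M * κ) with hΛ
  have hS0 : 0 ≤ A + τ + M * κ := by positivity
  have hΛ0 : 0 ≤ Λ := by positivity
  set B3 := ball c (3 * R) with hB3
  set w₁ : Rd d → ℝ := B3.indicator fun y => min (w y) M with hw₁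
  have hmin : BddMeas fun y => min (w y) M := by
    obtain ⟨hm, N, hN⟩ := hw
    refine ⟨hm.min measurable_const, M, fun y => ?_⟩
    rw [abs_of_nonneg (le_min (hw0 y) hM)]
    exact min_le_right _ _
  have hw₁m : BddMeas w₁ := hmin.indicator measurableSet_ball
  have hw₂m : BddMeas (B3ᶜ.indicator w) := hw.indicator measurableSet_ball.compl
  have hconv : ∀ y, convJ (Q.J e) w y = convJ (Q.J e) w₁ y + convJ (Q.J e) (B3ᶜ.indicator w) y := by
    intro y
    rw [← hJ.conv_add hw₁m hw₂m]
    refine integral_congr_ae ?_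
    have hsh : ∀ᵐ z, y + z ∈ B3 → w (y + z) ≤ M :=
      (measurePreserving_add_left volume y).quasiMeasurePreserving.ae hwM
    filter_upwards [hsh] with z hz
    congr 1
    by_cases h : y + z ∈ B3
    · rw [hw₁, indicator_of_mem h, indicator_of_notMem (show y + z ∉ B3ᶜ from fun h' => h' h), add_zero,
        min_eq_left (hz h)]
    · rw [hw₁, indicator_of_notMem h, indicator_of_mem (show y + z ∈ B3ᶜ from h), zero_add]
  have hbΛ : BddMeas fun y => Λ * b y := hb.bm.const_mul Λ
  have hcmp : w₁ x ≤ Λ * b x := by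
    refine hJ.comparison hw₁m hbΛ (A := Ω ∩ ball c (2 * R)) (hΩ.inter measurableSet_ball)
      hκ0.le hκ0 (fun x _ => le_add_of_nonneg_right (hJ.esc_nonneg _ _)) ?_ ?_ x
    · intro y hy
      by_cases hyΩ : y ∈ Ω
      · by_cases hy3 : y ∈ B3
        · have hy2 : 2 * R ≤ dist y c := not_lt.1 fun h => hy ⟨hyΩ, mem_ball.2 h⟩
          have h1 := hlow he hR hb y hy2 (mem_ball.1 hy3)
          rw [hw₁, indicator_of_mem hy3]
          calc min (w y) M ≤ M * κ * Q.v R ^ 2 := by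
                rw [hκ, mul_assoc, inv_mul_cancel₀ (by positivity), mul_one]
                exact min_le_right _ _
            _ ≤ M * κ * (C₂ * b y) := by gcongr
            _ = C₂ * (M * κ) * b y := by ring
            _ ≤ Λ * b y := by
                rw [hΛ]
                have := hb.nonneg y
                gcongr
                linarith
        · rw [hw₁, indicator_of_notMem hy3]
          exact mul_nonneg hΛ0 (hb.nonneg y)
      · have : w₁ y = 0 := by
          rw [hw₁]
          by_cases h : y ∈ B3
          · rw [indicator_of_mem h, hoff y hyΩ, min_eq_left hM]
          · rw [indicator_of_notMem h]
        rw [this]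
        exact mul_nonneg hΛ0 (hb.nonneg y)
    · rintro y ⟨hyΩ, hy2⟩
      have hyR : y ∉ ball c R := fun h => hball y h hyΩ
      have hy3 : y ∈ B3 := ball_subset_ball (by linarith) hy2
      have hy4 : y ∈ ball c (4 * R) := ball_subset_ball (by linarith) hy2
      have heq := hb.eqn y hyR
      rw [indicator_of_mem hy4, ← hκ] at heq
      rw [GoodKer.Lop_const_mul]
      have h1 : Λ * Lop (Q.J e) b y + κ * (Λ * b y) = Λ := by
        rw [show Λ * Lop (Q.J e) b y + κ * (Λ * b y) = Λ * (Lop (Q.J e) b y + κ * b y) by ring,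
          heq, mul_one]
      rw [h1]
      have h2 : Lop (Q.J e) w₁ y ≤ A + τ := by
        have h3 := hL y hyΩ hy2
        have h4 := htail y hy2
        have h5 : convJ (Q.J e) (B3ᶜ.indicator w) y ≤ τ := h4
        have h6 : w₁ y ≤ w y := by rw [hw₁, indicator_of_mem hy3]; exact min_le_left _ _
        have h7 := mul_le_mul_of_nonneg_left h6 hJ.mass_nonneg
        unfold Lop at h3 ⊢
        rw [hconv] at h3
        linarith
      have h8 : κ * w₁ y ≤ M * κ := by
        rw [mul_comm]
        refine mul_le_mul_of_nonneg_right ?_ hκ0.le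
        rw [hw₁, indicator_of_mem hy3]
        exact min_le_right _ _
      calc Lop (Q.J e) w₁ y + κ * w₁ y ≤ A + τ + M * κ := by linarith
        _ ≤ Λ := le_mul_of_one_le_left hS0 hC₂
  have hx3 : x ∈ B3 := mem_ball.2 (by linarith)
  rw [hw₁, indicator_of_mem hx3] at hcmp
  have hbx := hup he hR hRr hb hρ₀ heρ hρR x hx
  calc min (w x) M ≤ Λ * b x := hcmp
    _ ≤ Λ * (C₁ * (Q.v R * Q.v ρ₀)) := by gcongr
    _ = _ := by rw [hΛ, hκ]; ring

/-- A nonnegative solution of the Dirichlet problem on `Ω` with source `f`. -/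
structure IsGreen (e : ℝ) (Ω : Set (Rd d)) (f u : Rd d → ℝ) : Prop where
  bm : BddMeas u
  nonneg : ∀ x, 0 ≤ u x
  off : ∀ x ∉ Ω, u x = 0
  eqn : ∀ x ∈ Ω, Lop (Q.J e) u x = f x

/-- Bounded sets are left with a uniformly positive rate. -/
lemma esc_bounded (hd : 0 < d) (L : ℝ) : ∃ c₀ e₀ : ℝ, 0 < c₀ ∧ 0 < e₀ ∧ ∀ {e : ℝ} (_ : 0 < e)
    (_ : e ≤ e₀) {Ω : Set (Rd d)} (_ : MeasurableSet Ω) (_ : Ω ⊆ ball 0 L), ∀ x ∈ Ω,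
      c₀ ≤ GoodKer.esc (Q.J e) Ω x := by
  obtain ⟨c, e₀, hc, he₀, h⟩ := Q.J_far hd (2 * L)
  refine ⟨c, e₀, hc, he₀, fun {e} he hee {Ω} hΩ hL x hx => (h e he hee).trans ?_⟩
  have hJ := Q.J_good (d := d) he
  have hm : MeasurableSet {z : Rd d | 2 * L ≤ ‖z‖} := measurableSet_le measurable_const measurable_norm
  rw [← integral_indicator hm]
  refine integral_mono_of_nonneg (ae_of_all _ fun z => indicator_nonneg (fun y _ => hJ.nonneg y) z)
    (hJ.integrable_shift ((BddMeas.const 1).indicator hΩ.compl) x) (ae_of_all _ fun z => ?_)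
  show {z : Rd d | 2 * L ≤ ‖z‖}.indicator (Q.J e) z ≤ Ωᶜ.indicator (fun _ => (1:ℝ)) (x + z) * Q.J e z
  by_cases hz : 2 * L ≤ ‖z‖
  · have hxz : x + z ∈ Ωᶜ := fun h' => by
      have h1 := mem_ball_zero_iff.1 (hL h')
      have h2 := mem_ball_zero_iff.1 (hL hx)
      have h3 := norm_sub_le (x + z) x
      rw [add_sub_cancel_left] at h3
      linarith
    rw [indicator_of_mem (show z ∈ {z : Rd d | 2 * L ≤ ‖z‖} from hz), indicator_of_mem hxz, one_mul]
  · rw [indicator_of_notMem (show z ∉ {z : Rd d | 2 * L ≤ ‖z‖} from hz)]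
    exact mul_nonneg (indicator_nonneg (fun _ _ => zero_le_one) _) (hJ.nonneg z)

namespace IsGreen
variable {Q} {e : ℝ} {Ω : Set (Rd d)} {f u f' u' : Rd d → ℝ}

lemma integrable (hu : Q.IsGreen e Ω f u) {L : ℝ} (hL : Ω ⊆ ball 0 L) : Integrable u := by
  have h := (hu.bm.integrableOn (A := ball 0 L) measure_ball_lt_top.ne).integrable_indicator
    measurableSet_ball
  refine h.congr (ae_of_all _ fun x => ?_)
  by_cases hx : x ∈ ball (0 : Rd d) L
  · rw [indicator_of_mem hx]
  · rw [indicator_of_notMem hx, hu.off x fun h => hx (hL h)]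

lemma Lop_le (hu : Q.IsGreen e Ω f u) (he : 0 < e) (hf : ∀ x, 0 ≤ f x) (x : Rd d) :
    Lop (Q.J e) u x ≤ f x := by
  by_cases hx : x ∈ Ω
  · exact (hu.eqn x hx).le
  · have := (Q.J_good (d := d) he).conv_nonneg hu.nonneg x
    unfold Lop
    rw [hu.off x hx, mul_zero]
    linarith [hf x]

lemma symm (hu : Q.IsGreen e Ω f u) (hu' : Q.IsGreen e Ω f' u') (he : 0 < e) {L : ℝ}
    (hL : Ω ⊆ ball 0 L) : ∫ x, f' x * u x = ∫ x, f x * u' x := by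
  have hJ := Q.J_good (d := d) he
  have key : ∀ {f u u' : Rd d → ℝ}, Q.IsGreen e Ω f u → (∀ x ∉ Ω, u' x = 0) →
      ∫ x, f x * u' x = ∫ x, u' x * Lop (Q.J e) u x := fun h h0 => by
    congr 1
    ext x
    by_cases hx : x ∈ Ω
    · rw [h.eqn x hx, mul_comm]
    · rw [h0 x hx, mul_zero, zero_mul]
  rw [key hu hu'.off, key hu' hu.off]
  exact hJ.integral_mul_Lop hu.bm (hu'.integrable hL)

end IsGreen

lemma exists_isGreen (hd : 0 < d) (L : ℝ) : ∃ C₀ e₀ : ℝ, 1 ≤ C₀ ∧ 0 < e₀ ∧ ∀ {e : ℝ} (_ : 0 < e)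
    (_ : e ≤ e₀) {Ω : Set (Rd d)} (_ : MeasurableSet Ω) (_ : Ω ⊆ ball 0 L) {f : Rd d → ℝ}
    (_ : BddMeas f) (_ : ∀ x, 0 ≤ f x) {F : ℝ} (_ : ∀ x, f x ≤ F),
      ∃ u, Q.IsGreen e Ω f u ∧ ∀ x, u x ≤ C₀ * F := by
  obtain ⟨c, e₀, hc, he₀, h⟩ := Q.esc_bounded hd L
  refine ⟨1 + c⁻¹, e₀, by linarith [inv_pos.2 hc], he₀,
    fun {e} he hee {Ω} hΩ hL {f} hf hf0 {F} hF => ?_⟩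
  have hJ := Q.J_good (d := d) he
  obtain ⟨u, hu, hu0, huF, hoff, heq, -⟩ := hJ.exists_green le_rfl hc hΩ
    (fun x hx => (h he hee hΩ hL x hx).trans_eq (zero_add _).symm) hf hf0 hF
  refine ⟨u, ⟨hu, hu0, hoff, fun x hx => by simpa using heq x hx⟩, fun x => (huF x).trans ?_⟩
  have hF0 : 0 ≤ F := (hf0 x).trans (hF x)
  rw [div_eq_inv_mul]
  gcongr
  linarith

end Core

namespace Core
variable (Q : Core)

/-- The jump kernel integrated against a function of controlled growth on balls. -/
lemma tail_conv (hd : d ≠ 0) : ∃ C : ℝ, 1 ≤ C ∧ ∀ {e : ℝ} (_ : 0 < e) {F : Rd d → ℝ}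
    (_ : BddMeas F) (_ : ∀ x, 0 ≤ F x) (x : Rd d) {ρ N : ℝ} (_ : 0 < ρ) (_ : 0 ≤ N)
    (_ : ∀ s, ρ ≤ s → ∫ y in ball x s, F y ≤ N * Q.v s ^ 2) {S : Set (Rd d)}
    (_ : MeasurableSet S) (_ : ∀ y ∈ S, ρ ≤ dist y x),
    ∫ z, S.indicator F (x + z) * Q.J e z ≤ C * N * (ρ ^ d)⁻¹ := by
  obtain ⟨C, hC1, hC⟩ := Q.J_upper d
  refine ⟨8 * C, by linarith, fun {e} he {F} hF hF0 x {ρ N} hρ hN hball {S} hS hSρ => ?_⟩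
  have hJ := Q.J_good (d := d) he
  have hnn : ∀ z, 0 ≤ S.indicator F (x + z) * Q.J e z := fun z =>
    mul_nonneg (indicator_nonneg (fun y _ => hF0 y) _) (hJ.nonneg z)
  have hint := hJ.integrable_shift (hF.indicator hS) x
  rw [integral_eq_lintegral_of_nonneg_ae (Eventually.of_forall hnn) hint.1]
  refine ENNReal.toReal_le_of_le_ofReal (by positivity) ?_
  set A : ℕ → Set (Rd d) := fun k => {z | 2 ^ k * ρ ≤ ‖z‖ ∧ ‖z‖ < 2 ^ (k + 1) * ρ} with hA
  have hAm : ∀ k, MeasurableSet (A k) := fun k =>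
    (measurableSet_le measurable_const measurable_norm).inter
      (measurableSet_lt measurable_norm measurable_const)
  have hzero : ∀ z, z ∉ ⋃ k, A k →
      ofReal (S.indicator F (x + z) * Q.J e z) = 0 := by
    intro z hz
    by_cases hzS : x + z ∈ S
    · have h1 := hSρ _ hzS
      rw [dist_eq_norm, add_sub_cancel_left] at h1
      obtain ⟨k, hk⟩ := exists_dyadic hρ h1
      exact absurd (mem_iUnion.2 ⟨k, hk⟩) hz
    · rw [indicator_of_notMem hzS, zero_mul, ENNReal.ofReal_zero]
  have hsum : ∫⁻ z, ofReal (S.indicator F (x + z) * Q.J e z)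
      = ∫⁻ z in ⋃ k, A k, ofReal (S.indicator F (x + z) * Q.J e z) := by
    rw [← lintegral_indicator (MeasurableSet.iUnion hAm)]
    refine lintegral_congr fun z => ?_
    by_cases hz : z ∈ ⋃ k, A k
    · rw [indicator_of_mem hz]
    · rw [indicator_of_notMem hz, hzero z hz]
  rw [hsum]
  have hgeo : ∀ k, ∫⁻ z in A k, ofReal (S.indicator F (x + z) * Q.J e z)
      ≤ ofReal (4 * C * N * (ρ ^ d)⁻¹ * (1 / 2) ^ k) := by
    intro k
    have hk0 : 0 < 2 ^ k * ρ := by positivity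
    have hvk := Q.v_pos _ hk0
    have hm1 : ∀ z ∈ A k, S.indicator F (x + z) * Q.J e z
        ≤ (C * ((2 ^ k * ρ) ^ d)⁻¹ / Q.v (2 ^ k * ρ) ^ 2) * F (x + z) := by
      intro z hz
      have hz0 : 0 < ‖z‖ := hk0.trans_le hz.1
      rw [mul_comm]
      refine mul_le_mul ?_ (indicator_le_self' (fun _ _ => hF0 _) _)
        (indicator_nonneg (fun y _ => hF0 y) _) (by positivity)
      refine (hC e he z (norm_pos_iff.1 hz0)).trans ?_
      have := Q.mono _ _ hk0 hz.1
      have h2 := hz.1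
      gcongr
    have hb := hball (2 ^ (k + 1) * ρ)
      (le_mul_of_one_le_left hρ.le (one_le_pow₀ (by norm_num)))
    have hFi : IntegrableOn (fun z => F (x + z)) (ball (0 : Rd d) (2 ^ (k + 1) * ρ)) :=
      (hF.comp (measurable_const_add x)).integrableOn measure_ball_lt_top.ne
    have hAs : A k ⊆ ball (0 : Rd d) (2 ^ (k + 1) * ρ) := fun z hz => by
      rw [mem_ball_zero_iff]; exact hz.2
    rw [← ofReal_integral_eq_lintegral_ofReal hint.integrableOn (Eventually.of_forall hnn)]
    refine ofReal_le_ofReal ?_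
    calc ∫ z in A k, S.indicator F (x + z) * Q.J e z
        ≤ ∫ z in A k, (C * ((2 ^ k * ρ) ^ d)⁻¹ / Q.v (2 ^ k * ρ) ^ 2) * F (x + z) :=
          setIntegral_mono_on hint.integrableOn ((hFi.mono_set hAs).const_mul _) (hAm k) hm1
      _ = (C * ((2 ^ k * ρ) ^ d)⁻¹ / Q.v (2 ^ k * ρ) ^ 2) * ∫ z in A k, F (x + z) :=
          integral_const_mul _ _
      _ ≤ (C * ((2 ^ k * ρ) ^ d)⁻¹ / Q.v (2 ^ k * ρ) ^ 2)
            * (N * (2 * Q.v (2 ^ k * ρ)) ^ 2) := by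
          gcongr
          have e1 : ∫ z in ball (0 : Rd d) (2 ^ (k + 1) * ρ), F (x + z)
              = ∫ y in ball x (2 ^ (k + 1) * ρ), F y := by
            have := setIntegral_ball_shift F x (2 ^ (k + 1) * ρ)
            simpa using this
          refine (setIntegral_mono_set hFi (Eventually.of_forall fun z => hF0 _)
            hAs.eventuallyLE).trans (e1.le.trans (hb.trans ?_))
          have h2 := Q.lin 2 _ (by norm_num) hk0
          rw [show 2 * (2 ^ k * ρ) = 2 ^ (k + 1) * ρ by ring] at h2
          have := Q.v_pos (2 ^ (k + 1) * ρ) (by positivity)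
          gcongr
      _ = 4 * C * N * (ρ ^ d)⁻¹ * ((2 ^ k) ^ d)⁻¹ := by
          rw [mul_pow (2 ^ k) ρ d]; field_simp; ring
      _ ≤ _ := by
          have : ((2 ^ k : ℝ) ^ d)⁻¹ ≤ (1 / 2) ^ k := by
            rw [one_div, inv_pow]
            gcongr
            exact le_self_pow₀ (one_le_pow₀ (by norm_num)) hd
          gcongr
  refine (lintegral_iUnion_geom (by positivity) (by norm_num) (by norm_num) hgeo).trans
    (ofReal_le_ofReal (le_of_eq ?_))
  ring

/-- The jump kernel integrated against a function controlled by `v` of the distance. -/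
lemma near_conv (d : ℕ) : ∃ C : ℝ, 1 ≤ C ∧ ∀ {e : ℝ} (_ : 0 < e) {F : Rd d → ℝ}
    (_ : BddMeas F) (_ : ∀ x, 0 ≤ F x) (x : Rd d) {q M : ℝ} (_ : 0 < q) (_ : 0 ≤ M)
    {S : Set (Rd d)} (_ : MeasurableSet S) (_ : ∀ y ∈ S, q ≤ dist y x)
    (_ : ∀ᵐ y, y ∈ S → F y ≤ M * Q.v (4 * max (dist y x) (2 * √e))),
    ∫ z, S.indicator F (x + z) * Q.J e z ≤ C * M / Q.v q := by
  obtain ⟨C₁, hC₁, htail⟩ := Q.J_tail d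
  obtain ⟨C₂, hC₂, hv⟩ := Q.lintegral_v_tail
  have hK := Q.one_le_K
  refine ⟨32 * Q.K + C₂ * C₁, by nlinarith, fun {e} he {F} hF hF0 x {q M} hq hM {S} hS hSq hFv => ?_⟩
  have hJ := Q.J_good (d := d) he
  have hr : 0 < √e := sqrt_pos.2 he
  have hvq := Q.v_pos q hq
  have hnn : ∀ z, 0 ≤ S.indicator F (x + z) * Q.J e z := fun z =>
    mul_nonneg (indicator_nonneg (fun y _ => hF0 y) _) (hJ.nonneg z)
  have hint := hJ.integrable_shift (hF.indicator hS) x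
  have hsh : ∀ᵐ z, x + z ∈ S → F (x + z) ≤ M * Q.v (4 * max ‖z‖ (2 * √e)) := by
    filter_upwards [(measurePreserving_add_left volume x).quasiMeasurePreserving.ae hFv] with z hz
    simpa [dist_eq_norm] using hz
  set N : Set (Rd d) := {z | ‖z‖ < 2 * √e} with hN
  have hNm : MeasurableSet N := measurableSet_lt measurable_norm measurable_const
  set T : Set (Rd d) := {z | max q (2 * √e) ≤ ‖z‖} with hT
  have hTm : MeasurableSet T := measurableSet_le measurable_const measurable_norm
  have hm0 : 0 < max q (2 * √e) := lt_max_of_lt_left hq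
  have hvm := Q.v_pos _ hm0
  have hsum : ∫⁻ z, ofReal (S.indicator F (x + z) * Q.J e z)
      ≤ (∫⁻ z in N, ofReal (S.indicator F (x + z) * Q.J e z))
        + ∫⁻ z in T, ofReal (S.indicator F (x + z) * Q.J e z) := by
    refine le_trans ?_ (lintegral_union_le _ N T)
    rw [← lintegral_indicator (hNm.union hTm)]
    refine lintegral_mono fun z => ?_
    by_cases hz : z ∈ N ∪ T
    · rw [indicator_of_mem hz]
    · rw [indicator_of_notMem hz]
      by_cases hzS : x + z ∈ S
      · have h1 := hSq _ hzS
        rw [dist_eq_norm, add_sub_cancel_left] at h1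
        refine absurd ?_ hz
        by_cases h2 : ‖z‖ < 2 * √e
        · exact Or.inl h2
        · exact Or.inr (max_le h1 (not_lt.1 h2))
      · rw [indicator_of_notMem hzS, zero_mul, ENNReal.ofReal_zero]
  have e1 : ∫⁻ z in N, ofReal (S.indicator F (x + z) * Q.J e z)
      ≤ ofReal (32 * Q.K * M / Q.v q) := by
    by_cases hqr : q < 2 * √e
    · have hve := Q.v_pos _ hr
      have h8 := Q.lin 8 _ (by norm_num) hr
      have h2 := Q.lin 2 _ (by norm_num) hr
      have hmq := Q.mono q _ hq hqr.le
      calc _ ≤ ∫⁻ z in N, ofReal ((8 * M * Q.v (√e)) * Q.J e z) := by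
            refine lintegral_mono_ae ?_
            filter_upwards [ae_restrict_mem hNm, ae_restrict_of_ae hsh] with z hzN hz
            refine ofReal_le_ofReal
              (mul_le_mul_of_nonneg_right ?_ (hJ.nonneg z))
            by_cases hzS : x + z ∈ S
            · rw [indicator_of_mem hzS]
              refine (hz hzS).trans ?_
              rw [max_eq_right (le_of_lt hzN), show 4 * (2 * √e) = 8 * √e by ring]
              nlinarith
            · rw [indicator_of_notMem hzS]; positivity
        _ ≤ ∫⁻ z, ofReal ((8 * M * Q.v (√e)) * Q.J e z) := setLIntegral_le_lintegral _ _
        _ = ofReal ((8 * M * Q.v (√e)) * (Q.μ e).real univ) := by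
            rw [← ofReal_integral_eq_lintegral_ofReal (hJ.int.const_mul _)
              (Eventually.of_forall fun z => mul_nonneg (by positivity) (hJ.nonneg z)),
              integral_const_mul, Q.mass_J he]
        _ ≤ _ := by
            refine ofReal_le_ofReal ?_
            calc _ ≤ (8 * M * Q.v (√e)) * (Q.K / Q.v (√e) ^ 2) := by
                  gcongr; exact Q.mass_le he
              _ = 16 * Q.K * M / (2 * Q.v (√e)) := by field_simp; ring
              _ ≤ 16 * Q.K * M / Q.v q := by gcongr; linarith
              _ ≤ _ := by gcongr; linarith
    · have hz : ∀ z ∈ N, ofReal (S.indicator F (x + z) * Q.J e z) = 0 := by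
        intro z hzN
        have : x + z ∉ S := fun h => by
          have h1 := hSq _ h
          rw [dist_eq_norm, add_sub_cancel_left] at h1
          have h2 : ‖z‖ < 2 * √e := hzN
          linarith
        rw [indicator_of_notMem this, zero_mul, ENNReal.ofReal_zero]
      rw [setLIntegral_congr_fun hNm hz]
      simp
  have e2 : ∫⁻ z in T, ofReal (S.indicator F (x + z) * Q.J e z)
      ≤ ofReal (C₂ * C₁ * M / Q.v q) := by
    set Mm : Measure (Rd d) := volume.withDensity fun z => ofReal (Q.J e z) with hMm
    have hJm : Measurable fun z : Rd d => ofReal (Q.J e z) := hJ.meas.ennreal_ofReal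
    have h1 := hv Mm (fun z => ‖z‖) measurable_norm C₁ (by linarith) (fun s hs => by
      have hsm : MeasurableSet {z : Rd d | s ≤ ‖z‖} :=
        measurableSet_le measurable_const measurable_norm
      rw [hMm, withDensity_apply _ hsm, ← ofReal_integral_eq_lintegral_ofReal
        hJ.int.integrableOn (Eventually.of_forall hJ.nonneg)]
      exact ofReal_le_ofReal (htail e he s hs)) (max q (2 * √e)) hm0
    calc _ ≤ ∫⁻ z in T, ofReal M * (ofReal (Q.J e z) * ofReal (Q.v (4 * ‖z‖))) := by
          refine lintegral_mono_ae ?_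
          filter_upwards [ae_restrict_mem hTm, ae_restrict_of_ae hsh] with z hzT hz
          have hz0 : 0 < ‖z‖ := hm0.trans_le hzT
          have hv4 := Q.v_pos (4 * ‖z‖) (by positivity)
          rw [← ofReal_mul (hJ.nonneg z), ← ofReal_mul hM]
          refine ofReal_le_ofReal ?_
          have hle : S.indicator F (x + z) ≤ M * Q.v (4 * ‖z‖) := by
            by_cases hzS : x + z ∈ S
            · rw [indicator_of_mem hzS]
              have := hz hzS
              rwa [max_eq_left ((le_max_right _ _).trans hzT)] at this
            · rw [indicator_of_notMem hzS]; positivity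
          have := mul_le_mul_of_nonneg_right hle (hJ.nonneg z)
          linarith
      _ = ofReal M * ∫⁻ z in T, ofReal (Q.J e z) * ofReal (Q.v (4 * ‖z‖)) :=
          lintegral_const_mul' _ _ ENNReal.ofReal_ne_top
      _ = ofReal M * ∫⁻ z in T, ofReal (Q.v (4 * ‖z‖)) ∂Mm := by
          rw [hMm, setLIntegral_withDensity_eq_setLIntegral_mul_non_measurable _ hJm
            _ hTm (Eventually.of_forall fun _ => ofReal_lt_top)]
          rfl
      _ ≤ ofReal M * ofReal (C₂ * C₁ / Q.v (max q (2 * √e))) := by gcongr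
      _ ≤ _ := by
          rw [← ofReal_mul hM]
          refine ofReal_le_ofReal ?_
          have := Q.mono q _ hq (le_max_left q (2 * √e))
          calc _ = C₂ * C₁ * M / Q.v (max q (2 * √e)) := by ring
            _ ≤ _ := by gcongr
  rw [integral_eq_lintegral_of_nonneg_ae (Eventually.of_forall hnn) hint.1]
  refine ENNReal.toReal_le_of_le_ofReal (by positivity) ((hsum.trans (add_le_add e1 e2)).trans ?_)
  rw [← ofReal_add (by positivity) (by positivity)]
  exact ofReal_le_ofReal (le_of_eq (by ring))

/-- Bounded functions integrated against the tail of the jump kernel. -/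
lemma bdd_conv (d : ℕ) : ∃ C : ℝ, 1 ≤ C ∧ ∀ {e : ℝ} (_ : 0 < e) {F : Rd d → ℝ}
    (_ : BddMeas F) (_ : ∀ x, 0 ≤ F x) (x : Rd d) {ρ M : ℝ} (_ : 0 < ρ)
    (_ : ∀ y, F y ≤ M) {S : Set (Rd d)} (_ : MeasurableSet S) (_ : ∀ y ∈ S, ρ ≤ dist y x),
    ∫ z, S.indicator F (x + z) * Q.J e z ≤ C * M / Q.v ρ ^ 2 := by
  obtain ⟨C, hC, htail⟩ := Q.J_tail d
  refine ⟨C, hC, fun {e} he {F} hF hF0 x {ρ M} hρ hFM {S} hS hSρ => ?_⟩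
  have hJ := Q.J_good (d := d) he
  have hM : 0 ≤ M := (hF0 x).trans (hFM x)
  have hTm : MeasurableSet {z : Rd d | ρ ≤ ‖z‖} :=
    measurableSet_le measurable_const measurable_norm
  calc ∫ z, S.indicator F (x + z) * Q.J e z
      ≤ ∫ z, {z : Rd d | ρ ≤ ‖z‖}.indicator (fun z => M * Q.J e z) z := by
        refine integral_mono (hJ.integrable_shift (hF.indicator hS) x)
          ((hJ.int.const_mul M).indicator hTm) fun z => ?_
        dsimp only
        by_cases hzS : x + z ∈ S
        · have h1 := hSρ _ hzS
          rw [dist_eq_norm, add_sub_cancel_left] at h1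
          rw [indicator_of_mem hzS, indicator_of_mem (show z ∈ {z : Rd d | ρ ≤ ‖z‖} from h1)]
          exact mul_le_mul_of_nonneg_right (hFM _) (hJ.nonneg z)
        · rw [indicator_of_notMem hzS, zero_mul]
          exact indicator_nonneg (fun z _ => mul_nonneg hM (hJ.nonneg z)) _
    _ = M * ∫ z in {z : Rd d | ρ ≤ ‖z‖}, Q.J e z := by
        rw [integral_indicator hTm, integral_const_mul]
    _ ≤ M * (C / Q.v ρ ^ 2) := by gcongr; exact htail e he ρ hρ
    _ = _ := by ring

end Core

/-- A bounded measurable set with a uniform exterior ball condition of radius `s`. -/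
structure Dom (s L : ℝ) (Ω : Set (Rd d)) : Prop where
  meas : MeasurableSet Ω
  sub : Ω ⊆ ball 0 L
  ext : ∀ x ∈ Ω, ∀ p ∉ Ω, ∀ R, 0 < R → R ≤ s →
    ∃ c, (∀ y ∈ ball c R, y ∉ Ω) ∧ dist x c ≤ R + dist x p

namespace Core
variable (Q : Core)

lemma isGreen_le (hd : 0 < d) (L : ℝ) : ∃ C₀ e₀ : ℝ, 1 ≤ C₀ ∧ 0 < e₀ ∧ ∀ {e : ℝ} (_ : 0 < e)
    (_ : e ≤ e₀) {Ω : Set (Rd d)} (_ : MeasurableSet Ω) (_ : Ω ⊆ ball 0 L) {f u : Rd d → ℝ}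
    (_ : Q.IsGreen e Ω f u) {F : ℝ} (_ : 0 ≤ F) (_ : ∀ x, f x ≤ F), ∀ x, u x ≤ C₀ * F := by
  obtain ⟨C₀, e₀, hC₀, he₀, h⟩ := Q.exists_isGreen hd L
  obtain ⟨c, e₁, hc, he₁, hesc⟩ := Q.esc_bounded hd L
  refine ⟨C₀, min e₀ e₁, hC₀, lt_min he₀ he₁, fun {e} he hee {Ω} hΩ hL {f u} hu {F} hF hfF x => ?_⟩
  obtain ⟨u', hu', hb⟩ := h he (hee.trans (min_le_left _ _)) hΩ hL (BddMeas.const F)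
    (fun _ => hF) (fun _ => le_rfl)
  refine le_trans ?_ (hb x)
  refine (Q.J_good he).comparison hu.bm hu'.bm hΩ le_rfl hc (fun y hy => ?_) (fun y hy => ?_)
    (fun y hy => ?_) x
  · rw [zero_add]; exact hesc he (hee.trans (min_le_right _ _)) hΩ hL y hy
  · rw [hu.off y hy, hu'.off y hy]
  · rw [hu.eqn y hy, hu'.eqn y hy]; simpa using hfF y

/-- `boundary_decay` for sets with the uniform exterior ball condition, with local hypotheses. -/
lemma local_decay (hd : d ≠ 0) {s : ℝ} (hs : 0 < s) (L : ℝ) : ∃ C r₂ : ℝ, 1 ≤ C ∧ 0 < r₂ ∧ r₂ ≤ 1 ∧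
    ∀ {e : ℝ} (_ : 0 < e) {Ω : Set (Rd d)} (_ : Dom s L Ω) {w : Rd d → ℝ} (_ : BddMeas w)
    (_ : ∀ x, 0 ≤ w x) (_ : ∀ x ∉ Ω, w x = 0) {R : ℝ} (_ : 0 < R) (_ : R ≤ r₂) {x p : Rd d}
    (_ : p ∉ Ω) {ρ₀ : ℝ} (_ : 0 < ρ₀) (_ : dist x p ≤ ρ₀) (_ : ρ₀ ≤ R) (_ : e < ρ₀ ^ 2)
    {A τ M : ℝ} (_ : 0 ≤ A) (_ : 0 ≤ τ) (_ : 0 ≤ M)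
    (_ : ∀ y ∈ Ω, y ∈ ball x (5 * R) → Lop (Q.J e) w y ≤ A)
    (_ : ∀ᵐ y, y ∈ ball x (5 * R) → w y ≤ M)
    (_ : ∀ y ∈ ball x (4 * R), ∀ S : Set (Rd d), MeasurableSet S → (∀ y' ∈ S, R ≤ dist y' y) →
      ∫ z, S.indicator w (y + z) * Q.J e z ≤ τ),
    min (w x) M ≤ C * (Q.v R * Q.v ρ₀) * (A + τ + M / Q.v R ^ 2) := by
  obtain ⟨C, r₁, hC, hr₁, hr₁1, -, h⟩ := Q.boundary_decay hd
  refine ⟨C, min r₁ s, hC, lt_min hr₁ hs, (min_le_left _ _).trans hr₁1, ?_⟩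
  intro e he Ω hΩ w hw hw0 hoff R hR hRr x p hp ρ₀ hρ₀ hxp hρR heρ A τ M hA hτ hM hLop hae htail
  have hvR := Q.v_pos R hR
  have hvρ := Q.v_pos ρ₀ hρ₀
  by_cases hx : x ∈ Ω
  · obtain ⟨c, hc, hxc⟩ := hΩ.ext x hx p hp R hR (hRr.trans (min_le_right _ _))
    have hxc2 : dist x c ≤ 2 * R := by linarith
    refine h he hR (hRr.trans (min_le_left _ _)) hΩ.meas hc hw hw0 hoff hA hτ hM
      (fun y hy hyc => hLop y hy ?_) ?_ (fun y hy => htail y ?_ _ measurableSet_ball.compl ?_)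
      hρ₀ heρ hρR x (by linarith)
    · rw [mem_ball] at hyc ⊢
      have := dist_triangle_right y x c
      linarith
    · filter_upwards [hae] with y hy hyc
      refine hy ?_
      rw [mem_ball] at hyc ⊢
      have := dist_triangle_right y x c
      linarith
    · rw [mem_ball] at hy ⊢
      have := dist_triangle_right y x c
      linarith
    · intro y' hy'
      have h1 : 3 * R ≤ dist y' c := by simpa using hy'
      rw [mem_ball] at hy
      have := dist_triangle y' y c
      linarith
  · rw [hoff x hx]
    exact (min_le_left _ _).trans (by positivity)

lemma v_le_min {r₂ : ℝ} (hr₂ : 0 < r₂) {R : ℝ} (hR : 0 < R) (hr₂1 : r₂ ≤ 1) :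
    Q.v R ≤ Q.v 1 / Q.v r₂ * Q.v (min R r₂) := by
  have h1 := Q.mono r₂ 1 hr₂ hr₂1
  have h2 := Q.v_pos r₂ hr₂
  have h3 := Q.v_pos R hR
  rcases le_total R r₂ with h | h
  · rw [min_eq_left h]
    exact le_mul_of_one_le_left h3.le ((one_le_div h2).2 h1)
  · rw [min_eq_right h, div_mul_cancel₀ _ h2.ne']
    exact Q.v_le_one hR

/-- Boundary decay of a bounded function at a given length scale `R₀`. -/
lemma global_decay (hd : d ≠ 0) {s : ℝ} (hs : 0 < s) (L : ℝ) : ∃ C : ℝ, 1 ≤ C ∧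
    ∀ {e : ℝ} (_ : 0 < e) {Ω : Set (Rd d)} (_ : Dom s L Ω) {w : Rd d → ℝ} (_ : BddMeas w)
    (_ : ∀ x, 0 ≤ w x) (_ : ∀ x ∉ Ω, w x = 0) {M : ℝ} (_ : ∀ y, w y ≤ M) {R₀ : ℝ} (_ : 0 < R₀)
    (_ : ∀ y ∈ Ω, Lop (Q.J e) w y ≤ M / Q.v R₀ ^ 2) {x p : Rd d} (_ : p ∉ Ω) {ρ₀ : ℝ}
    (_ : 0 < ρ₀) (_ : dist x p ≤ ρ₀) (_ : e < ρ₀ ^ 2), w x ≤ C * M * Q.v ρ₀ / Q.v R₀ := by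
  obtain ⟨C, r₂, hC, hr₂, hr₂1, h⟩ := Q.local_decay hd hs L
  obtain ⟨C₂, hC₂, htail⟩ := Q.bdd_conv d
  set κ := Q.v 1 / Q.v r₂ with hκ
  have hv2 := Q.v_pos r₂ hr₂
  have hκ1 : 1 ≤ κ := (one_le_div hv2).2 (Q.mono r₂ 1 hr₂ hr₂1)
  refine ⟨C * (2 + C₂) * κ, by nlinarith [mul_le_mul hC hκ1 zero_le_one (by linarith)], ?_⟩
  intro e he Ω hΩ w hw hw0 hoff M hwM R₀ hR₀ hLop x p hp ρ₀ hρ₀ hxp heρ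
  have hM : 0 ≤ M := (hw0 x).trans (hwM x)
  set R := min R₀ r₂ with hR
  have hR0 : 0 < R := lt_min hR₀ hr₂
  have hvR := Q.v_pos R hR0
  have hvR₀ := Q.v_pos R₀ hR₀
  have hvρ := Q.v_pos ρ₀ hρ₀
  have hRle := Q.mono R R₀ hR0 (min_le_left _ _)
  have hmin : Q.v R₀ ≤ κ * Q.v R := Q.v_le_min hr₂ hR₀ hr₂1
  have key : M * Q.v ρ₀ / Q.v R ≤ κ * (M * Q.v ρ₀ / Q.v R₀) := by
    rw [div_le_iff₀ hvR]
    calc M * Q.v ρ₀ = M * Q.v ρ₀ / Q.v R₀ * Q.v R₀ := by field_simp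
      _ ≤ M * Q.v ρ₀ / Q.v R₀ * (κ * Q.v R) := by gcongr
      _ = _ := by ring
  have hnn : 0 ≤ M * Q.v ρ₀ / Q.v R := by positivity
  suffices hh : w x ≤ C * (2 + C₂) * (M * Q.v ρ₀ / Q.v R) by
    calc w x ≤ C * (2 + C₂) * (M * Q.v ρ₀ / Q.v R) := hh
      _ ≤ C * (2 + C₂) * (κ * (M * Q.v ρ₀ / Q.v R₀)) := by gcongr
      _ = _ := by ring
  by_cases hρR : ρ₀ ≤ R
  · have h1 := h he hΩ hw hw0 hoff hR0 (min_le_right _ _) hp hρ₀ hxp hρR heρ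
      (A := M / Q.v R₀ ^ 2) (τ := C₂ * M / Q.v R ^ 2) (M := M) (by positivity) (by positivity) hM
      (fun y hy _ => hLop y hy) (Eventually.of_forall fun y _ => hwM y)
      (fun y _ S hS hSR => htail he hw hw0 y hR0 hwM hS hSR)
    rw [min_eq_left (hwM x)] at h1
    refine h1.trans ?_
    calc _ ≤ C * (Q.v R * Q.v ρ₀) * (M / Q.v R ^ 2 + C₂ * M / Q.v R ^ 2 + M / Q.v R ^ 2) := by
          gcongr
      _ = _ := by field_simp; ring
  · calc w x ≤ M := hwM x
      _ ≤ M * Q.v ρ₀ / Q.v R := by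
          rw [le_div_iff₀ hvR]
          gcongr
          exact Q.mono _ _ hR0 (not_le.1 hρR).le
      _ ≤ _ := le_mul_of_one_le_left hnn (by nlinarith)

lemma sq_le_v_sq {ρ : ℝ} (hρ : 0 < ρ) (hρ1 : ρ ≤ 1) (hd : 2 ≤ d) :
    ρ ^ d ≤ Q.v ρ ^ 2 / Q.v 1 ^ 2 := by
  have h := Q.lin (1 / ρ) ρ (by rw [le_div_iff₀ hρ]; linarith) hρ
  rw [one_div_mul_cancel hρ.ne'] at h
  have h1 := Q.v_pos 1 one_pos
  have h2 := Q.v_pos ρ hρ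
  have h3 : ρ ≤ Q.v ρ / Q.v 1 := by
    rw [le_div_iff₀ h1]
    calc ρ * Q.v 1 ≤ ρ * (1 / ρ * Q.v ρ) := by gcongr
      _ = _ := by field_simp
  calc ρ ^ d ≤ ρ ^ 2 := pow_le_pow_of_le_one hρ.le hρ1 hd
    _ ≤ (Q.v ρ / Q.v 1) ^ 2 := by gcongr
    _ = _ := by rw [div_pow]

/-- Total mass of the potential of a set. -/
lemma integral_green_indicator (hd : 0 < d) (L : ℝ) : ∃ C₀ e₀ : ℝ, 1 ≤ C₀ ∧ 0 < e₀ ∧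
    ∀ {e : ℝ} (_ : 0 < e) (_ : e ≤ e₀) {Ω : Set (Rd d)} (_ : MeasurableSet Ω) (_ : Ω ⊆ ball 0 L)
    {B : Set (Rd d)} (_ : MeasurableSet B) (_ : volume B ≠ ∞) {G : Rd d → ℝ}
    (_ : Q.IsGreen e Ω (B.indicator fun _ => 1) G), ∫ x, G x ≤ C₀ * volume.real B := by
  obtain ⟨C₀, e₀, hC₀, he₀, h⟩ := Q.exists_isGreen hd L
  refine ⟨C₀, e₀, hC₀, he₀, fun {e} he hee {Ω} hΩ hL {B} hB hBf {G} hG => ?_⟩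
  obtain ⟨u, hu, hub⟩ := h he hee hΩ hL (BddMeas.const 1) (fun _ => zero_le_one) (fun _ => le_rfl)
  have hsymm := hG.symm hu he hL
  simp only [one_mul] at hsymm
  rw [hsymm]
  have : (fun x => B.indicator (fun _ => (1:ℝ)) x * u x) = B.indicator u := by
    ext x; by_cases hx : x ∈ B <;> simp [hx]
  rw [this, integral_indicator hB]
  exact setIntegral_le_const hu.bm hB hBf (fun x _ => by simpa using hub x)

/-- The potential of a ball. -/
lemma green_ball (hd : 2 ≤ d) (L : ℝ) : ∃ C e₀ : ℝ, 1 ≤ C ∧ 0 < e₀ ∧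
    ∀ {e : ℝ} (_ : 0 < e) (_ : e ≤ e₀) {Ω : Set (Rd d)} (_ : MeasurableSet Ω) (_ : Ω ⊆ ball 0 L)
    {y : Rd d} {ρ : ℝ} (_ : 0 < ρ) (_ : e < ρ ^ 2) {G : Rd d → ℝ}
    (_ : Q.IsGreen e Ω ((ball y ρ).indicator fun _ => 1) G) (x : Rd d), G x ≤ C * Q.v ρ ^ 2 := by
  obtain ⟨C₀, e₀, hC₀, he₀, hint⟩ := Q.integral_green_indicator (by omega : 0 < d) L
  obtain ⟨C₁, e₁, hC₁, he₁, hle⟩ := Q.isGreen_le (by omega : 0 < d) L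
  obtain ⟨C₂, ρ₁, hC₂, hρ₁, hρ₁s, hpot⟩ := Q.potential_bound hd
  obtain ⟨C₃, hC₃, hflow⟩ := flow_indicator_near d
  set β := volume.real (ball (0 : Rd d) 1) with hβ
  have hβ0 : 0 < β := unitBall_pos d
  have hv1 := Q.v_pos 1 one_pos
  have hvρ₁ := Q.v_pos ρ₁ hρ₁
  refine ⟨max 1 (max (C₂ * (C₃ * (β + 1) + C₀ * β / Q.v 1 ^ 2)) (C₁ / Q.v ρ₁ ^ 2)), min e₀ e₁,
    le_max_left _ _, lt_min he₀ he₁, fun {e} he hee {Ω} hΩ hL {y ρ} hρ heρ {G} hG x => ?_⟩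
  have hvρ := Q.v_pos ρ hρ
  have hB := measurableSet_ball (x := y) (ε := ρ)
  have hBf : volume (ball y ρ) ≠ ∞ := measure_ball_lt_top.ne
  have h01 : ∀ x, (ball y ρ).indicator (fun _ => (1:ℝ)) x ≤ 1 := fun x =>
    indicator_le_self' (fun _ _ => zero_le_one) x
  rcases le_total ρ ρ₁ with h | h
  · have hρ1 : ρ ≤ 1 := h.trans (hρ₁s.trans Q.s₀_le)
    have hvol : volume.real (ball y ρ) = ρ ^ d * β := volume_real_ball y hρ
    have h1 := hpot he hG.bm ((BddMeas.const 1).indicator hB) hG.nonneg (hG.integrable hL)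
      (hG.Lop_le he (fun x => indicator_nonneg (fun _ _ => zero_le_one) x)) x hρ heρ h
      (H := C₃ * (volume.real (ball y ρ) + ρ ^ d)) (by positivity)
      (fun s hs => hflow hB hBf x hρ hs)
    have h2 := hint he (hee.trans (min_le_left _ _)) hΩ hL hB hBf hG
    have h3 := Q.sq_le_v_sq hρ hρ1 hd
    refine h1.trans ?_
    calc _ ≤ C₂ * (C₃ * (ρ ^ d * β + ρ ^ d) * Q.pot d ρ + C₀ * (β * (Q.v ρ ^ 2 / Q.v 1 ^ 2))) := by
          rw [hvol] at h2 ⊢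
          gcongr
          refine h2.trans ?_
          rw [mul_comm (ρ ^ d) β]
          gcongr
      _ = (C₂ * (C₃ * (β + 1) + C₀ * β / Q.v 1 ^ 2)) * Q.v ρ ^ 2 := by
          unfold pot; field_simp
      _ ≤ _ := by
          gcongr
          exact (le_max_left _ _).trans (le_max_right _ _)
  · have h1 := hle he (hee.trans (min_le_right _ _)) hΩ hL hG zero_le_one h01 x
    have h2 := Q.mono ρ₁ ρ hρ₁ h
    calc G x ≤ C₁ / Q.v ρ₁ ^ 2 * Q.v ρ₁ ^ 2 := by rw [div_mul_cancel₀ _ (by positivity)]; linarith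
      _ ≤ _ := by
          gcongr
          exact (le_max_right _ _).trans (le_max_right _ _)

/-- The potential of a ball near the boundary. -/
lemma green_ball_decay (hd : 2 ≤ d) {s : ℝ} (hs : 0 < s) (L : ℝ) : ∃ C e₀ : ℝ, 1 ≤ C ∧ 0 < e₀ ∧
    ∀ {e : ℝ} (_ : 0 < e) (_ : e ≤ e₀) {Ω : Set (Rd d)} (_ : Dom s L Ω)
    {y : Rd d} {ρ : ℝ} (_ : 0 < ρ) (_ : e < ρ ^ 2) {G : Rd d → ℝ}
    (_ : Q.IsGreen e Ω ((ball y ρ).indicator fun _ => 1) G) {x p : Rd d} (_ : p ∉ Ω) {ρ₀ : ℝ}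
    (_ : 0 < ρ₀) (_ : dist x p ≤ ρ₀) (_ : e < ρ₀ ^ 2), G x ≤ C * Q.v ρ₀ * Q.v ρ := by
  obtain ⟨C, e₀, hC, he₀, h⟩ := Q.green_ball hd L
  obtain ⟨C₂, hC₂, h₂⟩ := Q.global_decay (by omega : d ≠ 0) hs L
  refine ⟨C₂ * C, e₀, by nlinarith, he₀, ?_⟩
  intro e he hee Ω hΩ y ρ hρ heρ G hG x p hp ρ₀ hρ₀ hxp heρ₀
  have hvρ := Q.v_pos ρ hρ
  refine (h₂ he hΩ hG.bm hG.nonneg hG.off (h he hee hΩ.meas hΩ.sub hρ heρ hG) hρ ?_ hp hρ₀ hxp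
    heρ₀).trans (le_of_eq ?_)
  · intro y' hy'
    rw [hG.eqn y' hy', mul_div_assoc, div_self (by positivity), mul_one]
    exact (indicator_le_self' (fun _ _ => zero_le_one) _).trans hC
  · field_simp

end Core

namespace Core
variable (Q : Core)

/-- The potential of a set away from it. -/
lemma green_far (hd : 2 ≤ d) (L : ℝ) : ∃ C e₀ r₂ : ℝ, 1 ≤ C ∧ 0 < e₀ ∧ 0 < r₂ ∧ r₂ ≤ 1 ∧
    ∀ {e : ℝ} (_ : 0 < e) (_ : e ≤ e₀) {Ω : Set (Rd d)} (_ : MeasurableSet Ω) (_ : Ω ⊆ ball 0 L)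
    {B : Set (Rd d)} (_ : MeasurableSet B) (_ : volume B ≠ ∞) {G : Rd d → ℝ}
    (_ : Q.IsGreen e Ω (B.indicator fun _ => 1) G) (x : Rd d) {ρ : ℝ} (_ : 0 < ρ) (_ : e < ρ ^ 2)
    (_ : ρ ≤ r₂) (_ : ∀ y ∈ B, ρ ≤ dist y x), G x ≤ C * volume.real B * Q.pot d ρ := by
  obtain ⟨C₀, e₀, hC₀, he₀, hint⟩ := Q.integral_green_indicator (by omega : 0 < d) L
  obtain ⟨C₂, ρ₁, hC₂, hρ₁, hρ₁s, hpot⟩ := Q.potential_bound hd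
  obtain ⟨C₃, hC₃, hflow⟩ := flow_indicator_far d
  have hp1 : 0 < Q.pot d 1 := Q.pot_pos one_pos
  refine ⟨C₂ * (C₃ + C₀ / Q.pot d 1), e₀, ρ₁, ?_, he₀, hρ₁, hρ₁s.trans Q.s₀_le, ?_⟩
  · have : 0 < C₀ / Q.pot d 1 := by positivity
    nlinarith
  intro e he hee Ω hΩ hL B hB hBf G hG x ρ hρ heρ hρρ hfar
  have h1 := hpot he hG.bm ((BddMeas.const 1).indicator hB) hG.nonneg (hG.integrable hL)
      (hG.Lop_le he (fun x => indicator_nonneg (fun _ _ => zero_le_one) x)) x hρ heρ hρρ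
      (H := C₃ * volume.real B) (by positivity) (fun s hs => hflow hB hBf x hρ hfar hs)
  have h2 := hint he hee hΩ hL hB hBf hG
  have h3 := Q.pot_anti hd hρ (hρρ.trans (hρ₁s.trans Q.s₀_le))
  refine h1.trans ?_
  calc _ ≤ C₂ * (C₃ * volume.real B * Q.pot d ρ + C₀ * volume.real B * (Q.pot d ρ / Q.pot d 1)) := by
        gcongr
        refine h2.trans (le_mul_of_one_le_right (by positivity) ((one_le_div hp1).2 h3))
    _ = _ := by field_simp

lemma setIntegral_green (hd : 2 ≤ d) (L : ℝ) : ∃ e₀ : ℝ, 0 < e₀ ∧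
    ∀ {e : ℝ} (_ : 0 < e) (_ : e ≤ e₀) {Ω : Set (Rd d)} (_ : MeasurableSet Ω) (_ : Ω ⊆ ball 0 L)
    {f u : Rd d → ℝ} (_ : Q.IsGreen e Ω f u) {B : Set (Rd d)} (_ : MeasurableSet B),
    ∃ G, Q.IsGreen e Ω (B.indicator fun _ => 1) G ∧ ∫ x in B, u x = ∫ x, f x * G x := by
  obtain ⟨C₀, e₀, hC₀, he₀, h⟩ := Q.exists_isGreen (by omega : 0 < d) L
  refine ⟨e₀, he₀, fun {e} he hee {Ω} hΩ hL {f u} hu {B} hB => ?_⟩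
  obtain ⟨G, hG, -⟩ := h he hee hΩ hL ((BddMeas.const 1).indicator hB)
    (fun x => indicator_nonneg (fun _ _ => zero_le_one) x)
    (fun x => indicator_le_self' (fun _ _ => zero_le_one) x)
  refine ⟨G, hG, ?_⟩
  have := hu.symm hG he hL
  rw [← this, ← integral_indicator hB]
  congr 1
  ext x
  by_cases hx : x ∈ B <;> simp [hx]

/-- The potential of a set away from it, near the boundary. -/
lemma green_far_decay (hd : 2 ≤ d) {s : ℝ} (hs : 0 < s) (L : ℝ) : ∃ C e₀ r₂ : ℝ,
    1 ≤ C ∧ 0 < e₀ ∧ 0 < r₂ ∧ r₂ ≤ 1 ∧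
    ∀ {e : ℝ} (_ : 0 < e) (_ : e ≤ e₀) {Ω : Set (Rd d)} (_ : Dom s L Ω)
    {B : Set (Rd d)} (_ : MeasurableSet B) (_ : volume B ≠ ∞) {G : Rd d → ℝ}
    (_ : Q.IsGreen e Ω (B.indicator fun _ => 1) G) {x p : Rd d} (_ : p ∉ Ω) {ρ₀ : ℝ}
    (_ : 0 < ρ₀) (_ : dist x p ≤ ρ₀) (_ : e < ρ₀ ^ 2) {ρ : ℝ} (_ : 0 < ρ) (_ : e < (ρ / 2) ^ 2)
    (_ : ρ ≤ r₂) (_ : ∀ y ∈ B, ρ ≤ dist y x),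
    G x ≤ C * volume.real B * ((ρ ^ d)⁻¹ * (Q.v ρ₀ * Q.v ρ)) := by
  have hd0 : d ≠ 0 := by omega
  obtain ⟨C₁, e₁, r₁, hC₁, he₁, hr₁, hr₁1, hfar⟩ := Q.green_far hd L
  obtain ⟨C₂, e₂, hC₂, he₂, hball⟩ := Q.green_ball hd L
  obtain ⟨C₃, r₃, hC₃, hr₃, hr₃1, hloc⟩ := Q.local_decay hd0 hs L
  obtain ⟨C₄, hC₄, htail⟩ := Q.tail_conv hd0
  obtain ⟨e₅, he₅, hset⟩ := Q.setIntegral_green hd L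
  refine ⟨10 * C₁ + C₃ * (C₄ * C₂ * 10 ^ d + C₁ * 2 ^ d * 100), min e₁ (min e₂ e₅), min r₁ r₃,
    ?_, lt_min he₁ (lt_min he₂ he₅), lt_min hr₁ hr₃, (min_le_left _ _).trans hr₁1, ?_⟩
  · have : 0 < C₃ * (C₄ * C₂ * 10 ^ d + C₁ * 2 ^ d * 100) := by positivity
    linarith
  intro e he hee Ω hΩ B hB hBf G hG x p hp ρ₀ hρ₀ hxp heρ₀ ρ hρ heρ hρr hBx
  have hee₁ := hee.trans (min_le_left _ _)
  have hee₂ := hee.trans ((min_le_right _ _).trans (min_le_left _ _))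
  have hee₅ := hee.trans ((min_le_right _ _).trans (min_le_right _ _))
  have hvρ := Q.v_pos ρ hρ
  have hvρ₀ := Q.v_pos ρ₀ hρ₀
  set R := ρ / 10 with hR
  have hR0 : 0 < R := by positivity
  have hvR := Q.v_pos R hR0
  have hvR10 : Q.v ρ ≤ 10 * Q.v R := by
    have := Q.lin 10 R (by norm_num) hR0
    rwa [hR, mul_div_cancel₀ _ (by norm_num)] at this
  set T := volume.real B with hT
  have hT0 : 0 ≤ T := measureReal_nonneg
  have hcommon : 0 ≤ T * ((ρ ^ d)⁻¹ * (Q.v ρ₀ * Q.v ρ)) := by positivity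
  by_cases hρR : ρ₀ ≤ R
  · have hnear : ∀ y ∈ ball x (5 * R), G y ≤ C₁ * T * Q.pot d (ρ / 2) := by
      intro y hy
      refine hfar he hee₁ hΩ.meas hΩ.sub hB hBf hG y (by positivity) heρ
        (by linarith [hρr.trans (min_le_left r₁ r₃)]) fun y' hy' => ?_
      rw [mem_ball] at hy
      have := dist_triangle y' y x
      have := hBx y' hy'
      linarith
    have hpot2 : Q.pot d (ρ / 2) ≤ 2 ^ d * ((ρ ^ d)⁻¹ * Q.v ρ ^ 2) := by
      have := Q.mono (ρ / 2) ρ (by positivity) (by linarith)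
      have h0 := Q.v_pos (ρ / 2) (by positivity)
      unfold pot
      calc _ ≤ ((ρ / 2) ^ d)⁻¹ * Q.v ρ ^ 2 := by gcongr
        _ = _ := by rw [div_pow, inv_div]; ring
    have hpp := Q.pot_pos (d := d) (r := ρ / 2) (by positivity)
    have hG1 := hnear x (mem_ball_self (by positivity))
    have h1 := hloc he hΩ hG.bm hG.nonneg hG.off hR0
      (by linarith [hρr.trans (min_le_right r₁ r₃)]) hp hρ₀ hxp hρR heρ₀ (A := 0)
      (τ := C₄ * (C₂ * T) * (R ^ d)⁻¹) (M := C₁ * T * Q.pot d (ρ / 2)) le_rfl (by positivity)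
      (by positivity)
      (fun y hy hyx => by
        rw [hG.eqn y hy, indicator_of_notMem]
        intro hyB
        have := hBx y hyB
        rw [mem_ball] at hyx
        linarith)
      (Eventually.of_forall hnear)
      (fun y hy S hS hSR => htail he hG.bm hG.nonneg y hR0 (by positivity)
        (fun r hr => by
          have hr0 : 0 < r := hR0.trans_le hr
          obtain ⟨G', hG', hGi⟩ := hset he hee₅ hΩ.meas hΩ.sub hG (B := ball y r) measurableSet_ball
          rw [hGi]
          have he' : e < r ^ 2 := heρ₀.trans_le (by gcongr; linarith)
          have hb := hball he hee₂ hΩ.meas hΩ.sub hr0 he' hG'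
          have : (fun x => B.indicator (fun _ => (1:ℝ)) x * G' x) = B.indicator G' := by
            ext x; by_cases hx : x ∈ B <;> simp [hx]
          rw [this, integral_indicator hB]
          refine (setIntegral_le_const hG'.bm hB hBf fun x _ => hb x).trans (le_of_eq ?_)
          ring) hS hSR)
    rw [min_eq_left hG1] at h1
    refine h1.trans ?_
    have hvRρ := Q.mono R ρ hR0 (by linarith)
    calc _ ≤ C₃ * (Q.v R * Q.v ρ₀) * (0 + C₄ * (C₂ * T) * (R ^ d)⁻¹
            + C₁ * T * (2 ^ d * ((ρ ^ d)⁻¹ * (10 * Q.v R) ^ 2)) / Q.v R ^ 2) := by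
          gcongr
          refine hpot2.trans ?_
          gcongr
      _ = C₃ * (C₄ * C₂ * 10 ^ d + C₁ * 2 ^ d * 100) * (T * ((ρ ^ d)⁻¹ * (Q.v ρ₀ * Q.v R))) := by
          have hRd : (R ^ d)⁻¹ = 10 ^ d * (ρ ^ d)⁻¹ := by rw [hR, div_pow, inv_div]; ring
          rw [hRd]
          clear_value R
          field_simp
          ring
      _ ≤ (10 * C₁ + C₃ * (C₄ * C₂ * 10 ^ d + C₁ * 2 ^ d * 100))
            * (T * ((ρ ^ d)⁻¹ * (Q.v ρ₀ * Q.v ρ))) := by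
          gcongr
          linarith
      _ = _ := by ring
  · have h1 := hfar he hee₁ hΩ.meas hΩ.sub hB hBf hG x hρ
      (heρ.trans (by gcongr; linarith)) (hρr.trans (min_le_left _ _)) hBx
    have h2 := Q.mono R ρ₀ hR0 (not_le.1 hρR).le
    refine h1.trans ?_
    calc C₁ * T * Q.pot d ρ = C₁ * (T * ((ρ ^ d)⁻¹ * (Q.v ρ * Q.v ρ))) := by unfold pot; ring
      _ ≤ C₁ * (T * ((ρ ^ d)⁻¹ * ((10 * Q.v ρ₀) * Q.v ρ))) := by gcongr; linarith
      _ = (10 * C₁) * (T * ((ρ ^ d)⁻¹ * (Q.v ρ₀ * Q.v ρ))) := by ring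
      _ ≤ (10 * C₁ + C₃ * (C₄ * C₂ * 10 ^ d + C₁ * 2 ^ d * 100))
            * (T * ((ρ ^ d)⁻¹ * (Q.v ρ₀ * Q.v ρ))) := by
          gcongr
          have : 0 ≤ C₃ * (C₄ * C₂ * 10 ^ d + C₁ * 2 ^ d * 100) := by positivity
          linarith
      _ = _ := by ring

/-- A mollified pole: a probability density concentrated near `z`. -/
structure Pole (z : Rd d) (ε : ℝ) (σ : Rd d → ℝ) : Prop where
  bm : BddMeas σ
  nonneg : ∀ x, 0 ≤ σ x
  supp : ∀ x, ε < dist x z → σ x = 0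
  int : Integrable σ
  mass : ∫ x, σ x = 1

lemma Pole.integral_le {z : Rd d} {ε : ℝ} {σ : Rd d → ℝ} (hσ : Pole z ε σ) {G : Rd d → ℝ}
    (hG : BddMeas G) {M : ℝ} (h : ∀ x, dist x z ≤ ε → G x ≤ M) : ∫ x, σ x * G x ≤ M := by
  calc ∫ x, σ x * G x ≤ ∫ x, M * σ x := by
        refine integral_mono ((hG.mul_integrable hσ.int).congr (ae_of_all _ fun x => mul_comm _ _))
          (hσ.int.const_mul M) fun x => ?_
        dsimp only
        by_cases hx : dist x z ≤ ε
        · rw [mul_comm]; exact mul_le_mul_of_nonneg_right (h x hx) (hσ.nonneg x)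
        · rw [hσ.supp x (not_le.1 hx)]; simp
    _ = M := by rw [integral_const_mul, hσ.mass, mul_one]

/-- Pointwise bound for the Green function with a mollified pole. -/
lemma pole_ae (hd : 2 ≤ d) {s : ℝ} (hs : 0 < s) (L : ℝ) : ∃ C e₀ r₂ : ℝ,
    1 ≤ C ∧ 0 < e₀ ∧ 0 < r₂ ∧ r₂ ≤ 1 ∧
    ∀ {e : ℝ} (_ : 0 < e) (_ : e ≤ e₀) {Ω : Set (Rd d)} (_ : Dom s L Ω) {z p : Rd d} {ε : ℝ}
    {σ g : Rd d → ℝ} (_ : Pole z ε σ) (_ : Q.IsGreen e Ω σ g) (_ : p ∉ Ω) {ρ₀ : ℝ} (_ : 0 < ρ₀)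
    (_ : ε + dist z p ≤ ρ₀) (_ : e < ρ₀ ^ 2) {ρ : ℝ} (_ : 0 < ρ) (_ : ε ≤ ρ / 2)
    (_ : e < (ρ / 4) ^ 2) (_ : ρ ≤ r₂),
    ∀ᵐ y, ρ ≤ dist y z → g y ≤ C * ((ρ ^ d)⁻¹ * (Q.v ρ₀ * Q.v ρ)) := by
  obtain ⟨C₁, e₁, r₁, hC₁, he₁, hr₁, hr₁1, hfar⟩ := Q.green_far_decay hd hs L
  obtain ⟨e₅, he₅, hset⟩ := Q.setIntegral_green hd L
  refine ⟨C₁ * 2 ^ d, min e₁ e₅, r₁, one_le_mul_of_one_le_of_one_le hC₁ (one_le_pow₀ (by norm_num)),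
    lt_min he₁ he₅, hr₁, hr₁1, ?_⟩
  intro e he hee Ω hΩ z p ε σ g hσ hg hp ρ₀ hρ₀ hzp heρ₀ ρ hρ hερ heρ hρr
  have hvρ := Q.v_pos ρ hρ
  have hvρ₀ := Q.v_pos ρ₀ hρ₀
  set lam := C₁ * 2 ^ d * ((ρ ^ d)⁻¹ * (Q.v ρ₀ * Q.v ρ)) with hlam
  have hlam0 : 0 ≤ lam := by positivity
  set S : Set (Rd d) := {y | ρ ≤ dist y z} ∩ ball 0 L with hS
  have hSm : MeasurableSet S :=
    (measurableSet_le measurable_const (measurable_id.dist measurable_const)).inter measurableSet_ball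
  have hSf : volume S ≠ ∞ := ((measure_mono inter_subset_right).trans_lt measure_ball_lt_top).ne
  have hint : ∀ B, MeasurableSet B → volume B ≠ ∞ → (∀ y ∈ B, ρ ≤ dist y z) →
      ∫ x in B, g x ≤ lam * volume.real B := by
    intro B hB hBf hBz
    obtain ⟨G, hG, hGi⟩ := hset he (hee.trans (min_le_right _ _)) hΩ.meas hΩ.sub hg hB
    rw [hGi]
    refine hσ.integral_le hG.bm fun x hx => ?_
    refine (hfar he (hee.trans (min_le_left _ _)) hΩ hB hBf hG hp hρ₀ ?_ heρ₀
      (ρ := ρ / 2) (by positivity) (by convert heρ using 1; ring) (by linarith) ?_).trans ?_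
    · linarith [dist_triangle x z p]
    · intro y hy
      have := hBz y hy
      have := dist_triangle y x z
      linarith
    · have := Q.mono (ρ / 2) ρ (by positivity) (by linarith)
      calc _ ≤ C₁ * volume.real B * (((ρ / 2) ^ d)⁻¹ * (Q.v ρ₀ * Q.v ρ)) := by gcongr
        _ = _ := by rw [hlam, div_pow, inv_div]; ring
  have hae : g ≤ᵐ[volume.restrict S] fun _ => lam := by
    refine ae_le_of_forall_setIntegral_le (hg.integrable hΩ.sub).integrableOn
      (integrableOn_const hSf) fun B hB _ => ?_
    rw [Measure.restrict_restrict hB]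
    have hBS : volume (B ∩ S) ≠ ∞ := ((measure_mono inter_subset_right).trans_lt hSf.lt_top).ne
    rw [setIntegral_const, smul_eq_mul, mul_comm]
    exact hint _ (hB.inter hSm) hBS fun y hy => hy.2.1
  rw [EventuallyLE, ae_restrict_iff' hSm] at hae
  filter_upwards [hae] with y hy hyz
  by_cases hyL : y ∈ ball (0 : Rd d) L
  · exact hy ⟨hyz, hyL⟩
  · rw [hg.off y fun h => hyL (hΩ.sub h)]; exact hlam0

/-- Mass on balls of the Green function with a mollified pole. -/
lemma pole_mass (hd : 2 ≤ d) {s : ℝ} (hs : 0 < s) (L : ℝ) : ∃ C e₀ : ℝ, 1 ≤ C ∧ 0 < e₀ ∧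
    ∀ {e : ℝ} (_ : 0 < e) (_ : e ≤ e₀) {Ω : Set (Rd d)} (_ : Dom s L Ω) {z p : Rd d} {ε : ℝ}
    {σ g : Rd d → ℝ} (_ : Pole z ε σ) (_ : Q.IsGreen e Ω σ g) (_ : p ∉ Ω) {ρ₀ : ℝ} (_ : 0 < ρ₀)
    (_ : ε + dist z p ≤ ρ₀) (_ : e < ρ₀ ^ 2) (y : Rd d) {r : ℝ} (_ : 0 < r) (_ : e < r ^ 2),
    ∫ x in ball y r, g x ≤ C * Q.v ρ₀ * Q.v r := by
  obtain ⟨C₁, e₁, hC₁, he₁, hball⟩ := Q.green_ball_decay hd hs L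
  obtain ⟨e₅, he₅, hset⟩ := Q.setIntegral_green hd L
  refine ⟨C₁, min e₁ e₅, hC₁, lt_min he₁ he₅, ?_⟩
  intro e he hee Ω hΩ z p ε σ g hσ hg hp ρ₀ hρ₀ hzp heρ₀ y r hr her
  obtain ⟨G, hG, hGi⟩ := hset he (hee.trans (min_le_right _ _)) hΩ.meas hΩ.sub hg (B := ball y r)
    measurableSet_ball
  rw [hGi]
  exact hσ.integral_le hG.bm fun x hx => hball he (hee.trans (min_le_left _ _)) hΩ hr her hG hp hρ₀
    (by linarith [dist_triangle x z p]) heρ₀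

end Core

namespace Core
variable (Q : Core)

set_option maxHeartbeats 1000000 in
/-- The Poisson kernel of the complement, with a mollified pole near the boundary. -/
lemma pole_kernel (hd : 2 ≤ d) {s : ℝ} (hs : 0 < s) (L : ℝ) {k₀ L' : ℝ} (hk₀ : 1 ≤ k₀)
    (hL' : 1 ≤ L') : ∃ C e₀ C₆ : ℝ, 1 ≤ C ∧ 0 < e₀ ∧ 1 ≤ C₆ ∧
    ∀ {e : ℝ} (_ : 0 < e) (_ : e ≤ e₀) {Ω : Set (Rd d)} (_ : Dom s L Ω) {z p : Rd d} {ε : ℝ}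
    {σ g : Rd d → ℝ} (_ : Pole z ε σ) (_ : Q.IsGreen e Ω σ g) (_ : p ∉ Ω) {ρ₀ : ℝ} (_ : 0 < ρ₀)
    (_ : ε + dist z p ≤ ρ₀) (_ : e < ρ₀ ^ 2) {ρ : ℝ} (_ : 0 < ρ) (_ : ρ ≤ L') (_ : ε ≤ ρ / C₆)
    (_ : e < (ρ / C₆) ^ 2) {x : Rd d} (_ : x ∉ Ω) (_ : ρ ≤ dist x z) {q : ℝ} (_ : 0 < q)
    (_ : q ≤ k₀ * ρ) (_ : ∀ y ∈ ball x q, y ∉ Ω),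
    convJ (Q.J e) g x ≤ C * ((ρ ^ d)⁻¹ * Q.v ρ₀ / Q.v q) := by
  have hd0 : d ≠ 0 := by omega
  obtain ⟨C₁, e₁, r₁, hC₁, he₁, hr₁, hr₁1, hae⟩ := Q.pole_ae hd hs L
  obtain ⟨C₂, e₂, hC₂, he₂, hmass⟩ := Q.pole_mass hd hs L
  obtain ⟨C₃, r₃, hC₃, hr₃, hr₃1, hloc⟩ := Q.local_decay hd0 hs L
  obtain ⟨C₄, hC₄, htail⟩ := Q.tail_conv hd0
  obtain ⟨C₇, hC₇, hnear⟩ := Q.near_conv d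
  set m := min r₁ r₃ with hm
  have hm0 : 0 < m := lt_min hr₁ hr₃
  have hm1 : m ≤ 1 := (min_le_left _ _).trans hr₁1
  set κ := m / L' with hκ
  have hκ0 : 0 < κ := by positivity
  have hκ1 : κ ≤ 1 := by rw [hκ, div_le_one (by linarith)]; linarith
  set D := 20 / κ with hD
  have hD20 : 20 ≤ D := by rw [hD, le_div_iff₀ hκ0]; linarith
  set N₁ := C₃ * (C₄ * C₂ + 10 * C₁) with hN₁
  have hN₁0 : 0 < N₁ := by positivity
  refine ⟨max 1 ((C₇ * N₁ + C₄ * C₂ * (k₀ * D)) * D ^ d), min e₁ e₂, 2 * D, le_max_left _ _,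
    lt_min he₁ he₂, by linarith, ?_⟩
  intro e he hee Ω hΩ z p ε σ g hσ hg hp ρ₀ hρ₀ hzp heρ₀ ρ hρ hρL hερ heρ x hx hxz q hq hqρ hxq
  have hJ := Q.J_good (d := d) he
  have hee₁ := hee.trans (min_le_left _ _)
  have hee₂ := hee.trans (min_le_right _ _)
  set R := ρ / D with hR
  have hD0 : 0 < D := by linarith
  have hR0 : 0 < R := by positivity
  have hRm : 20 * R ≤ m := by
    rw [hR, hD, hκ]
    field_simp
    exact hρL
  have hRρ : 20 * R ≤ ρ := by
    rw [hR, mul_div_assoc', div_le_iff₀ hD0]; nlinarith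
  have hRD : R * D = ρ := by rw [hR]; field_simp
  have hhalf : ρ / (2 * D) = R / 2 := by rw [hR]; field_simp
  rw [hhalf] at hερ heρ
  have hse : 2 * √e < R := by
    have h1 : √e < R / 2 := (Real.sqrt_lt' (by positivity)).2 heρ
    linarith
  have hse0 : 0 < √e := sqrt_pos.2 he
  have hvρ₀ := Q.v_pos ρ₀ hρ₀
  have hvR := Q.v_pos R hR0
  have hvq := Q.v_pos q hq
  set I := (R ^ d)⁻¹ * Q.v ρ₀ with hI
  have hI0 : 0 < I := by positivity
  have hNmass : ∀ y r, R ≤ r → ∫ x in ball y r, g x ≤ C₂ * Q.v ρ₀ / Q.v R * Q.v r ^ 2 := by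
    intro y r hr
    have hr0 : 0 < r := hR0.trans_le hr
    have hvr := Q.mono R r hR0 hr
    have hvr0 := Q.v_pos r hr0
    refine (hmass he hee₂ hΩ hσ hg hp hρ₀ hzp heρ₀ y hr0
      (heρ.trans_le (by gcongr; linarith))).trans ?_
    calc C₂ * Q.v ρ₀ * Q.v r = C₂ * Q.v ρ₀ / Q.v R * (Q.v R * Q.v r) := by field_simp
      _ ≤ C₂ * Q.v ρ₀ / Q.v R * (Q.v r * Q.v r) := by gcongr
      _ = _ := by ring
  have htau : ∀ y S, MeasurableSet S → (∀ y' ∈ S, R ≤ dist y' y) →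
      ∫ z, S.indicator g (y + z) * Q.J e z ≤ C₄ * C₂ * I / Q.v R := by
    intro y S hS hSR
    refine (htail he hg.bm hg.nonneg y hR0 (by positivity) (hNmass y) hS hSR).trans (le_of_eq ?_)
    rw [hI]; ring
  have haeM := hae he hee₁ hΩ hσ hg hp hρ₀ hzp heρ₀ (ρ := 10 * R) (by positivity) (by linarith)
    (heρ.trans_le (by nlinarith)) (by linarith [min_le_left r₁ r₃])
  set M := C₁ * (((10 * R) ^ d)⁻¹ * (Q.v ρ₀ * Q.v (10 * R))) with hM
  have hv10 := Q.lin 10 R (by norm_num) hR0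
  have hv10' := Q.v_pos (10 * R) (by positivity)
  have hMle : M ≤ 10 * C₁ * I * Q.v R := by
    calc M ≤ C₁ * ((R ^ d)⁻¹ * (Q.v ρ₀ * (10 * Q.v R))) := by
          rw [hM]; gcongr; linarith
      _ = _ := by rw [hI]; ring
  have hptw : ∀ᵐ y, y ∈ ball x R → g y ≤ N₁ * I * Q.v (4 * max (dist y x) (2 * √e)) := by
    filter_upwards [haeM] with y hy hyx
    rw [mem_ball] at hyx
    have hfar : ∀ y', dist y' y < 5 * R → 10 * R ≤ dist y' z := fun y' h' => by
      have h1 := dist_triangle x y z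
      have h2 := dist_triangle y y' z
      rw [dist_comm x y] at h1
      rw [dist_comm y y'] at h2
      linarith
    set ρ₁ := max (dist y x) (2 * √e) with hρ₁
    have hρ₁0 : 0 < ρ₁ := lt_max_of_lt_right (by positivity)
    have hvρ₁ := Q.v_pos ρ₁ hρ₁0
    have hgM : g y ≤ M := hy (hfar y (by rw [dist_self]; positivity))
    have h1 := hloc he hΩ hg.bm hg.nonneg hg.off hR0 (by linarith [min_le_right r₁ r₃]) hx hρ₁0
      (le_max_left _ _) (max_le hyx.le hse.le)
      (lt_of_lt_of_le (by rw [mul_pow, sq_sqrt he.le]; linarith :  e < (2 * √e) ^ 2)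
        (by gcongr; exact le_max_right _ _))
      (A := 0) (τ := C₄ * C₂ * I / Q.v R) (M := M) le_rfl (by positivity) (by positivity)
      (fun y' hy' hyy => by
        rw [hg.eqn y' hy', hσ.supp]
        have := hfar y' hyy
        linarith)
      (by filter_upwards [haeM] with y' hy' hyy using hy' (hfar y' hyy))
      (fun y' _ S hS hSR => htau y' S hS hSR)
    rw [min_eq_left hgM] at h1
    calc g y ≤ _ := h1
      _ ≤ C₃ * (Q.v R * Q.v ρ₁) * (0 + C₄ * C₂ * I / Q.v R
            + (10 * C₁ * I * Q.v R) / Q.v R ^ 2) := by gcongr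
      _ = N₁ * I * Q.v ρ₁ := by rw [hN₁]; field_simp; ring
      _ ≤ _ := by
          gcongr
          exact Q.mono _ _ hρ₁0 (by linarith)
  set S₁ : Set (Rd d) := ball x R \ ball x q with hS₁
  have hS₁m : MeasurableSet S₁ := measurableSet_ball.diff measurableSet_ball
  have hsplit : convJ (Q.J e) g x = convJ (Q.J e) (S₁.indicator g) x
      + convJ (Q.J e) ((ball x R)ᶜ.indicator g) x := by
    rw [← hJ.conv_add (hg.bm.indicator hS₁m) (hg.bm.indicator measurableSet_ball.compl)]
    unfold convJ
    congr 1
    ext z'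
    congr 1
    show g (x + z') = S₁.indicator g (x + z') + (ball x R)ᶜ.indicator g (x + z')
    by_cases h1 : x + z' ∈ ball x R
    · rw [indicator_of_notMem (show x + z' ∉ (ball x R)ᶜ from fun h => h h1), add_zero]
      by_cases h2 : x + z' ∈ ball x q
      · rw [indicator_of_notMem (show x + z' ∉ S₁ from fun h => h.2 h2), hg.off _ (hxq _ h2)]
      · rw [indicator_of_mem (show x + z' ∈ S₁ from ⟨h1, h2⟩)]
    · rw [indicator_of_notMem (show x + z' ∉ S₁ from fun h => h1 h.1),
        indicator_of_mem (show x + z' ∈ (ball x R)ᶜ from h1), zero_add]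
  have hb1 : convJ (Q.J e) (S₁.indicator g) x ≤ C₇ * (N₁ * I) / Q.v q := by
    refine hnear he hg.bm hg.nonneg x hq (by positivity) hS₁m (fun y hy => ?_) ?_
    · simpa using hy.2
    · filter_upwards [hptw] with y hy hyS using hy hyS.1
  have hb2 : convJ (Q.J e) ((ball x R)ᶜ.indicator g) x ≤ C₄ * C₂ * I / Q.v R :=
    htau x _ measurableSet_ball.compl fun y hy => by simpa using hy
  have hvqR : Q.v q ≤ k₀ * D * Q.v R := by
    refine (Q.mono q _ hq ?_).trans (Q.lin (k₀ * D) R (by nlinarith) hR0)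
    rw [mul_assoc, mul_comm D R, hRD]
    exact hqρ
  have hinv : 1 / Q.v R ≤ k₀ * D / Q.v q := by
    rw [div_le_div_iff₀ hvR hvq]; linarith
  have hIρ : I = D ^ d * ((ρ ^ d)⁻¹ * Q.v ρ₀) := by
    rw [hI, hR, div_pow, inv_div]; ring
  rw [hsplit]
  calc _ ≤ C₇ * (N₁ * I) / Q.v q + C₄ * C₂ * I * (1 / Q.v R) := by
        rw [mul_one_div]; exact add_le_add hb1 hb2
    _ ≤ C₇ * (N₁ * I) / Q.v q + C₄ * C₂ * I * (k₀ * D / Q.v q) := by gcongr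
    _ = ((C₇ * N₁ + C₄ * C₂ * (k₀ * D)) * D ^ d) * ((ρ ^ d)⁻¹ * Q.v ρ₀ / Q.v q) := by
        rw [hIρ]; ring
    _ ≤ _ := by gcongr; exact le_max_right _ _

end Core

/-- A thin shell around the boundary of `Ω`, degenerating at the origin. -/
structure Shell (Ω : Set (Rd d)) (z : Rd d) (t c C₄ : ℝ) (Sh : Set (Rd d)) (q : Rd d → ℝ) :
    Prop where
  meas : MeasurableSet Sh
  qmeas : Measurable q
  far : ∀ x ∈ Sh, c * max ‖x‖ t ≤ dist x z
  q_nonneg : ∀ x ∈ Sh, 0 ≤ q x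
  q_le : ∀ x ∈ Sh, q x ≤ C₄ * t * max ‖x‖ t
  off : ∀ x ∈ Sh, x ∉ Ω
  q_off : ∀ x ∈ Sh, ∀ y ∈ ball x (q x), y ∉ Ω
  vol : ∀ ρ b, t ≤ ρ → 0 < b →
    volume (Sh ∩ ball 0 ρ ∩ {x | q x ≤ b}) ≤ ofReal (C₄ * ρ ^ (d - 1) * b)

namespace Core
variable (Q : Core)

lemma layer_bound : ∃ C : ℝ, 1 ≤ C ∧ ∀ {A : Set (Rd d)} (_ : MeasurableSet A) {q w κ : Rd d → ℝ}
    (_ : Measurable q) {M X W B : ℝ} (_ : 0 ≤ M) (_ : 0 ≤ X) (_ : 0 ≤ W) (_ : 0 < B)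
    (_ : ∀ x ∈ A, |w x| ≤ M) (_ : ∀ x, 0 ≤ κ x) (_ : ∀ x ∈ A, 0 < q x → κ x ≤ X / Q.v (q x))
    (_ : ∀ x ∈ A, 0 ≤ q x) (_ : ∀ x ∈ A, q x ≤ B)
    (_ : ∀ b, 0 < b → volume (A ∩ {x | q x ≤ b}) ≤ ofReal (W * b)),
    ∫⁻ x in A, ofReal (|w x| * κ x) ≤ ofReal (C * (M * X * W * B / Q.v B)) := by
  set r : ℝ := 2 ^ (Q.a - 1) with hr
  have hr0 : 0 < r := by positivity
  have hr1 : r < 1 := Real.rpow_lt_one_of_one_lt_of_neg (by norm_num) (by linarith [Q.a_lt])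
  have hK := Q.K_pos
  refine ⟨max 1 (Q.K * 2 ^ Q.a / (1 - r)), le_max_left _ _, ?_⟩
  intro A hA q w κ hq M X W B hM hX hW hB hw hκ0 hκ hq0 hqB hvol
  have hvB := Q.v_pos B hB
  set Bk : ℕ → Set (Rd d) := fun k => A ∩ {x | q x ≤ B / 2 ^ k} ∩ {x | B / 2 ^ (k + 1) < q x}
    with hBk
  have hBkm : ∀ k, MeasurableSet (Bk k) := fun k =>
    (hA.inter (measurableSet_le hq measurable_const)).inter (measurableSet_lt measurable_const hq)
  set Z : Set (Rd d) := A ∩ {x | q x ≤ 0}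
  have hZ : volume Z = 0 := by
    have h1 : ∀ b : ℝ, 0 < b → volume Z ≤ ofReal (W * b) := fun b hb =>
      (measure_mono (inter_subset_inter_right A fun x (hx : q x ≤ 0) => hx.trans hb.le)).trans
        (hvol b hb)
    have h2 : Tendsto (fun b : ℝ => ofReal (W * b)) (𝓝[>] 0) (𝓝 (ofReal (W * 0))) :=
      ((ENNReal.continuous_ofReal.comp (continuous_const.mul continuous_id)).tendsto 0).mono_left
        nhdsWithin_le_nhds
    have h3 := ge_of_tendsto h2 (by filter_upwards [self_mem_nhdsWithin] with b hb using h1 b hb)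
    simpa using h3
  have hcov : A ⊆ Z ∪ ⋃ k, Bk k := by
    intro x hx
    by_cases h : q x ≤ 0
    · exact Or.inl ⟨hx, h⟩
    · push Not at h
      obtain ⟨k, h1, h2⟩ := exists_dyadic h (hqB x hx)
      refine Or.inr (mem_iUnion.2 ⟨k, ⟨hx, ?_⟩, ?_⟩)
      · show q x ≤ B / 2 ^ k
        rw [le_div_iff₀ (by positivity)]; linarith
      · show B / 2 ^ (k + 1) < q x
        rw [div_lt_iff₀ (by positivity)]; linarith
  have hbk : ∀ k, ∫⁻ x in Bk k, ofReal (|w x| * κ x)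
      ≤ ofReal ((M * X * W * B / Q.v B * (Q.K * 2 ^ Q.a)) * r ^ k) := by
    intro k
    set ρ := B / 2 ^ (k + 1) with hρ
    have hρ0 : 0 < ρ := by positivity
    have hvρ := Q.v_pos ρ hρ0
    have hup := Q.up (2 ^ (k + 1)) ρ (one_le_two_pow _) hρ0
    rw [show (2:ℝ) ^ (k + 1) * ρ = B by rw [hρ]; field_simp] at hup
    calc _ ≤ ∫⁻ x in Bk k, ofReal (M * (X / Q.v ρ)) := by
          refine setLIntegral_mono' (hBkm k) fun x hx => ofReal_le_ofReal ?_
          have hx2 : ρ < q x := hx.2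
          refine mul_le_mul (hw x hx.1.1) ((hκ x hx.1.1 (hρ0.trans hx2)).trans ?_) (hκ0 x) hM
          gcongr
          exact Q.mono _ _ hρ0 hx2.le
      _ = ofReal (M * (X / Q.v ρ)) * volume (Bk k) := by rw [setLIntegral_const]
      _ ≤ ofReal (M * (X / Q.v ρ)) * ofReal (W * (B / 2 ^ k)) := by
          gcongr
          exact (measure_mono fun x hx => hx.1).trans (hvol _ (by positivity))
      _ = ofReal (M * X * W * B / 2 ^ k * (1 / Q.v ρ)) := by
          rw [← ofReal_mul (by positivity)]; congr 1; field_simp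
      _ ≤ _ := by
          refine ofReal_le_ofReal ?_
          have h2 : ((2:ℝ) ^ (k + 1)) ^ Q.a / 2 ^ k = 2 ^ Q.a * r ^ k := by
            rw [hr, ← rpow_natCast, ← rpow_natCast, ← rpow_natCast,
              ← rpow_mul (by norm_num), ← rpow_mul (by norm_num),
              ← Real.rpow_sub (by norm_num), ← Real.rpow_add (by norm_num)]
            congr 1; push_cast; ring
          have h3 : 1 / Q.v ρ ≤ Q.K * ((2:ℝ) ^ (k + 1)) ^ Q.a / Q.v B := by
            rw [div_le_div_iff₀ hvρ hvB]; linarith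
          calc _ ≤ M * X * W * B / 2 ^ k * (Q.K * ((2:ℝ) ^ (k + 1)) ^ Q.a / Q.v B) := by gcongr
            _ = M * X * W * B / Q.v B * Q.K * (((2:ℝ) ^ (k + 1)) ^ Q.a / 2 ^ k) := by ring
            _ = _ := by rw [h2]; ring
  calc _ ≤ ∫⁻ x in Z ∪ ⋃ k, Bk k, ofReal (|w x| * κ x) := lintegral_mono_set hcov
    _ ≤ (∫⁻ x in Z, ofReal (|w x| * κ x))
        + ∫⁻ x in ⋃ k, Bk k, ofReal (|w x| * κ x) := lintegral_union_le _ _ _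
    _ ≤ 0 + ofReal ((M * X * W * B / Q.v B * (Q.K * 2 ^ Q.a)) / (1 - r)) := by
        gcongr
        · rw [Measure.restrict_eq_zero.2 hZ, lintegral_zero_measure]
        · exact lintegral_iUnion_geom (by positivity) hr0.le hr1 hbk
    _ ≤ _ := by
        rw [zero_add]
        refine ofReal_le_ofReal ?_
        calc _ = Q.K * 2 ^ Q.a / (1 - r) * (M * X * W * B / Q.v B) := by ring
          _ ≤ _ := by gcongr; exact le_max_right _ _

lemma shell_bound (hd : 1 ≤ d) {c C₄ C₅ : ℝ} (hc : 0 < c) (hC₄ : 1 ≤ C₄) (hC₅ : 1 ≤ C₅) :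
    ∃ C : ℝ, 1 ≤ C ∧ ∀ {Ω : Set (Rd d)} {z : Rd d} {t : ℝ} (_ : 0 < t) (_ : t ≤ 1)
    {Sh : Set (Rd d)} {q w κ : Rd d → ℝ} (_ : Shell Ω z t c C₄ Sh q) {M : ℝ} (_ : 0 ≤ M)
    (_ : ∀ x ∈ Sh, |w x| ≤ M * Q.v (C₄ * t * max ‖x‖ t)) (_ : ∀ x, 0 ≤ κ x) {n : ℕ} (_ : 1 ≤ n)
    (_ : ∀ x ∈ Sh, ‖x‖ < 2 ^ n * t)
    (_ : ∀ ρ, c * t ≤ ρ → ρ ≤ c * (2 ^ n * t) → ∀ x ∈ Sh, ρ ≤ dist x z → 0 < q x →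
      q x ≤ 2 * C₄ / c * ρ → κ x ≤ C₅ * ((ρ ^ d)⁻¹ * Q.v (3 * t) / Q.v (q x))),
    ∫⁻ x in Sh, ofReal (|w x| * κ x) ≤ ofReal (C * M * n * (t * Q.v t)) := by
  obtain ⟨C₁, hC₁, hlay⟩ := Q.layer_bound (d := d)
  set C₀ := C₁ * C₅ * (2 / c) ^ d * 3 * C₄ * C₄ with hC₀
  refine ⟨max 1 C₀, le_max_left _ _, ?_⟩
  intro Ω z t ht ht1 Sh q w κ hS M hM hw hκ n hn1 hn hκ2
  have hvt := Q.v_pos t ht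
  set A : ℕ → Set (Rd d) := fun k =>
    Sh ∩ ({x | 2 ^ k * t ≤ max ‖x‖ t} ∩ {x | max ‖x‖ t < 2 ^ (k + 1) * t}) with hA
  have hmm : Measurable fun x : Rd d => max ‖x‖ t := measurable_norm.max measurable_const
  have hAm : ∀ k, MeasurableSet (A k) := fun k => hS.meas.inter
    ((measurableSet_le measurable_const hmm).inter (measurableSet_lt hmm measurable_const))
  have hAk : ∀ k : Fin n, ∫⁻ x in A k, ofReal (|w x| * κ x)
      ≤ ofReal (C₀ * M * (t * Q.v t)) := by
    rintro ⟨k, hk⟩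
    set T := 2 ^ (k + 1) * t with hT
    have hT0 : 0 < T := by positivity
    have htT : t ≤ T := by rw [hT]; nlinarith [one_le_two_pow (k + 1)]
    have hTn : T ≤ 2 ^ n * t := by
      rw [hT]; gcongr
      · norm_num
      · omega
    set ρ := c * T / 2 with hρ
    have hρ0 : 0 < ρ := by positivity
    have hρk : ρ = c * (2 ^ k * t) := by rw [hρ, hT, pow_succ]; ring
    set B := C₄ * t * T with hB
    have hB0 : 0 < B := by positivity
    have hvB := Q.v_pos B hB0
    have hv3 := Q.v_pos (3 * t) (by positivity)
    have hmax : ∀ x ∈ A k, max ‖x‖ t ≤ T := fun x hx => hx.2.2.le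
    have hres := hlay (hAm k) (w := w) hS.qmeas (M := M * Q.v B)
      (X := C₅ * ((ρ ^ d)⁻¹ * Q.v (3 * t))) (W := C₄ * T ^ (d - 1)) (B := B) (by positivity)
      (by positivity) (by positivity) hB0 (fun x hx => (hw x hx.1).trans ?_) hκ
      (fun x hx hqx => ?_) (fun x hx => hS.q_nonneg x hx.1)
      (fun x hx => (hS.q_le x hx.1).trans (by rw [hB]; gcongr; exact hmax x hx))
      (fun b hb => (measure_mono ?_).trans (hS.vol T b htT hb))
    · refine hres.trans (ofReal_le_ofReal ?_)
      have hl := Q.lin 3 t (by norm_num) ht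
      have hTd : T ^ (d - 1) * T = T ^ d := by rw [← pow_succ, Nat.sub_add_cancel hd]
      have hρd : (ρ ^ d)⁻¹ = (2 / c) ^ d * (T ^ d)⁻¹ := by
        rw [hρ, ← inv_pow, ← inv_pow, ← mul_pow]; congr 1; field_simp
      calc _ = C₁ * C₅ * (2 / c) ^ d * Q.v (3 * t) * C₄ * C₄ * M * t * ((T ^ d)⁻¹ *
              (T ^ (d - 1) * T)) * (Q.v B / Q.v B) := by rw [hρd, hB]; ring
        _ = C₁ * C₅ * (2 / c) ^ d * Q.v (3 * t) * C₄ * C₄ * M * t := by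
            rw [hTd, inv_mul_cancel₀ (by positivity), div_self hvB.ne']; ring
        _ ≤ C₁ * C₅ * (2 / c) ^ d * (3 * Q.v t) * C₄ * C₄ * M * t := by gcongr
        _ = _ := by rw [hC₀]; ring
    · gcongr
      refine Q.mono _ _ (by positivity) ?_
      rw [hB]; gcongr; exact hmax x hx
    · refine (hκ2 ρ (by rw [hρk]; gcongr; nlinarith [one_le_two_pow k]) ?_ x hx.1 ?_ hqx ?_).trans
        (le_of_eq (by ring))
      · rw [hρ]; nlinarith
      · refine le_trans ?_ (hS.far x hx.1)
        rw [hρk]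
        have : 2 ^ k * t ≤ max ‖x‖ t := hx.2.1
        gcongr
      · refine (hS.q_le x hx.1).trans ?_
        calc C₄ * t * max ‖x‖ t ≤ C₄ * 1 * T := by gcongr; exact hmax x hx
          _ = _ := by rw [hρ]; field_simp
    · rintro x ⟨hx, hqb⟩
      refine ⟨⟨hx.1, ?_⟩, hqb⟩
      rw [mem_ball_zero_iff]
      exact (le_max_left _ _).trans_lt hx.2.2
  have hcov : Sh ⊆ ⋃ k : Fin n, A k := by
    intro x hx
    obtain ⟨k, h1, h2⟩ := exists_dyadic ht (le_max_right ‖x‖ t)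
    have h3 : (2:ℝ) ^ k * t < 2 ^ n * t := by
      refine h1.trans_lt (max_lt (hn x hx) ?_)
      have : (1:ℝ) < 2 ^ n := one_lt_pow₀ (by norm_num) (by omega)
      nlinarith
    have h4 : (2:ℝ) ^ k < 2 ^ n := lt_of_mul_lt_mul_right h3 ht.le
    exact mem_iUnion.2 ⟨⟨k, (pow_lt_pow_iff_right₀ (by norm_num)).1 h4⟩, hx, h1, h2⟩
  calc _ ≤ ∫⁻ x in ⋃ k : Fin n, A k, ofReal (|w x| * κ x) :=
        lintegral_mono_set hcov
    _ ≤ ∑ k : Fin n, ∫⁻ x in A k, ofReal (|w x| * κ x) := by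
        exact (lintegral_iUnion_le _ _).trans_eq (tsum_fintype _)
    _ ≤ ∑ _k : Fin n, ofReal (C₀ * M * (t * Q.v t)) :=
        Finset.sum_le_sum fun k _ => hAk k
    _ = ofReal (n * (C₀ * M * (t * Q.v t))) := by
        rw [Finset.sum_const, Finset.card_univ, Fintype.card_fin, nsmul_eq_mul,
          ofReal_mul (by positivity : (0:ℝ) ≤ n), ENNReal.ofReal_natCast]
    _ ≤ _ := by
        refine ofReal_le_ofReal ?_
        calc _ = C₀ * M * n * (t * Q.v t) := by ring
          _ ≤ _ := by gcongr; exact le_max_right _ _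

end Core

namespace Core
variable (Q : Core)

/-- Difference of the torsion function at two points symmetric about the corner direction. -/
theorem torsion_difference (hd : 2 ≤ d) {s : ℝ} (hs : 0 < s) {L : ℝ} (hL : 1 ≤ L) {c C₄ : ℝ}
    (hc : 0 < c) (hc1 : c ≤ 1) (hC₄ : 1 ≤ C₄) : ∃ C : ℝ, 1 ≤ C ∧ ∀ {t : ℝ} (_ : 0 < t) (_ : t ≤ 1 / 2),
    ∃ e₁ ε₁ : ℝ, 0 < e₁ ∧ 0 < ε₁ ∧ ∀ {e : ℝ} (_ : 0 < e) (_ : e ≤ e₁) {Ω : Set (Rd d)}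
    {h z : Rd d} (_ : Dom s L Ω) (_ : Dom s L (Ω ∩ {x | x + h ∈ Ω})) (_ : ‖h‖ ≤ 1) {u : Rd d → ℝ}
    (_ : Q.IsGreen e Ω (fun _ => 1) u) (_ : (0 : Rd d) ∉ Ω) (_ : ‖z‖ ≤ 2 * t) {q₁ q₂ : Rd d → ℝ}
    (_ : Shell (Ω ∩ {x | x + h ∈ Ω}) z t c C₄ (Ω ∩ {x | x + h ∉ Ω}) q₁)
    (_ : Shell (Ω ∩ {x | x + h ∈ Ω}) z t c C₄ ({x | x + h ∈ Ω} \ Ω) q₂)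
    (_ : ∀ x ∈ Ω, x + h ∉ Ω → ∃ p ∉ Ω, dist x p ≤ C₄ * t * max ‖x‖ t)
    (_ : ∀ x, x + h ∈ Ω → x ∉ Ω → ∃ p ∉ Ω, dist (x + h) p ≤ C₄ * t * max ‖x‖ t)
    {ε : ℝ} (_ : 0 < ε) (_ : ε ≤ ε₁) {σ : Rd d → ℝ} (_ : Pole z ε σ)
    (_ : ∀ x, dist x z ≤ ε → x ∈ Ω ∧ x + h ∈ Ω) {n : ℕ} (_ : 1 ≤ n) (_ : L + 1 ≤ 2 ^ n * t)
    (_ : 2 ^ n * t ≤ 2 * (L + 1)), |∫ x, (u (x + h) - u x) * σ x| ≤ C * n * (t * Q.v t) := by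
  have hd0 : 0 < d := by omega
  obtain ⟨C₀, e₀, hC₀, he₀, hgr⟩ := Q.isGreen_le hd0 L
  obtain ⟨C₀', e₀', hC₀', he₀', hex⟩ := Q.exists_isGreen hd0 L
  obtain ⟨C₂, hC₂, hdec⟩ := Q.global_decay hd0.ne' hs L
  obtain ⟨C₅, e₅, C₆, hC₅, he₅, hC₆, hker⟩ := Q.pole_kernel hd hs L (k₀ := 2 * C₄ / c)
    (L' := 2 * (L + 1)) (by rw [le_div_iff₀ hc]; linarith) (by linarith)
  obtain ⟨C₇, hC₇, hsh⟩ := Q.shell_bound (by omega : 1 ≤ d) hc hC₄ hC₅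
  have hv1 := Q.v_pos 1 one_pos
  set M := max C₀ (Q.v 1 ^ 2) with hM
  have hM0 : 0 < M := lt_max_of_lt_left (by linarith)
  set M₁ := C₂ * M / Q.v 1 with hM₁
  refine ⟨max 1 (2 * (C₇ * M₁)), le_max_left _ _, ?_⟩
  intro t ht ht2
  have hvt := Q.v_pos t ht
  have hct : 0 < c * t / C₆ := by positivity
  refine ⟨min (min e₀ (min e₀' e₅)) (min (t ^ 4 / 2) ((c * t / C₆) ^ 2 / 2)), min t (c * t / C₆),
    by positivity, by positivity, ?_⟩
  intro e he hee Ω h z hΩ hΩ' hh u hu h0 hz q₁ q₂ hS₁ hS₂ hp₁ hp₂ ε hε hεε σ hσ hσΩ n hn hnL hnL'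
  simp only [le_min_iff] at hee hεε
  obtain ⟨⟨hee₀, hee₀', hee₅⟩, het, hec⟩ := hee
  have het' : e < t ^ 4 := by have : 0 < t ^ 4 := by positivity
                              linarith
  have hec' : e < (c * t / C₆) ^ 2 := by have : 0 < (c * t / C₆) ^ 2 := by positivity
                                         linarith
  set Ω' := Ω ∩ {x | x + h ∈ Ω} with hΩ'def
  have hJ := Q.J_good (d := d) he
  set w : Rd d → ℝ := fun x => u (x + h) - u x with hw
  have hwb : BddMeas w := (hu.bm.comp (measurable_add_const h)).sub hu.bm
  obtain ⟨F, hF⟩ := hσ.bm.2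
  obtain ⟨g, hg, -⟩ := hex he hee₀' hΩ'.meas hΩ'.sub hσ.bm hσ.nonneg (F := F)
    (fun x => (le_abs_self _).trans (hF x))
  have hgi := hg.integrable hΩ'.sub
  set κ := convJ (Q.J e) g with hκ
  have hκ0 : ∀ x, 0 ≤ κ x := hJ.conv_nonneg hg.nonneg
  have hLw : ∀ x ∈ Ω', Lop (Q.J e) w x = 0 := fun x hx => by
    rw [hw, hJ.Lop_sub (hu.bm.comp (measurable_add_const h)) hu.bm, GoodKer.Lop_translate,
      hu.eqn _ hx.2, hu.eqn _ hx.1, sub_self]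
  have hσ0 : ∀ x ∉ Ω', σ x = 0 := fun x hx => hσ.supp x (by
    by_contra hcon
    exact hx (hσΩ x (not_lt.1 hcon)))
  -- the pairing
  have hpair : ∫ x, w x * σ x = ∫ x in Ω'ᶜ, w x * κ x := by
    have h1 := hJ.integral_mul_Lop hwb hgi
    have h2 : ∫ x, g x * Lop (Q.J e) w x = 0 := by
      refine integral_eq_zero_of_ae (Eventually.of_forall fun x => ?_)
      by_cases hx : x ∈ Ω'
      · simp [hLw x hx]
      · simp [hg.off x hx]
    rw [h2] at h1
    have h3 : ∀ x, w x * Lop (Q.J e) g x = w x * σ x - Ω'ᶜ.indicator (fun x => w x * κ x) x := by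
      intro x
      by_cases hx : x ∈ Ω'
      · rw [hg.eqn x hx, indicator_of_notMem (not_not.2 hx : x ∉ Ω'ᶜ), sub_zero]
      · rw [indicator_of_mem hx, hσ0 x hx, Lop, hg.off x hx]; ring
    have h4 : Integrable fun x => w x * σ x := hwb.mul_integrable hσ.int
    have h5 : Integrable fun x => Ω'ᶜ.indicator (fun x => w x * κ x) x :=
      (hwb.mul_integrable (hJ.conv_integrable hgi)).indicator hΩ'.meas.compl
    simp_rw [h3] at h1
    rw [integral_sub h4 h5, integral_indicator hΩ'.meas.compl] at h1
    linarith
  have hdecay : ∀ x p, p ∉ Ω → ∀ ρ, t ≤ ρ → dist x p ≤ C₄ * t * ρ →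
      |u x| ≤ M₁ * Q.v (C₄ * t * ρ) := by
    intro x p hp ρ hρ hxp
    rw [abs_of_nonneg (hu.nonneg x)]
    have hlow : t * t ≤ C₄ * t * ρ := by
      calc t * t ≤ 1 * t * ρ := by rw [one_mul]; gcongr
        _ ≤ _ := by have := ht.le.trans hρ
                    gcongr
    have := hdec he hΩ hu.bm hu.nonneg hu.off (M := M) (fun y => (hgr he hee₀ hΩ.meas hΩ.sub hu
        zero_le_one (fun _ => le_rfl) y).trans (by rw [mul_one]; exact le_max_left _ _))
      one_pos (fun y hy => by
        rw [hu.eqn y hy, one_le_div (by positivity)]; exact le_max_right _ _) hp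
      (ρ₀ := C₄ * t * ρ) (lt_of_lt_of_le (by positivity) hlow) hxp
      (lt_of_lt_of_le het' (by
        calc t ^ 4 = (t * t) ^ 2 := by ring
          _ ≤ _ := by gcongr))
    refine this.trans (le_of_eq ?_)
    rw [hM₁]; ring
  have hκk : ∀ q Sh, Shell Ω' z t c C₄ Sh q → ∀ ρ, c * t ≤ ρ → ρ ≤ c * (2 ^ n * t) → ∀ x ∈ Sh,
      ρ ≤ dist x z → 0 < q x → q x ≤ 2 * C₄ / c * ρ →
        κ x ≤ C₅ * ((ρ ^ d)⁻¹ * Q.v (3 * t) / Q.v (q x)) := by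
    intro q Sh hSh ρ hρ hρn x hx hxz hqx hqρ
    have hρ0 : 0 < ρ := lt_of_lt_of_le (by positivity) hρ
    have hcC : c * t / C₆ ≤ ρ / C₆ := by gcongr
    refine hker he hee₅ hΩ' hσ hg (p := 0) (fun h => h0 h.1) (ρ₀ := 3 * t) (by positivity) ?_ ?_
      hρ0 ?_ (hεε.2.trans hcC) (hec'.trans_le (by gcongr)) (hSh.off x hx) hxz hqx hqρ
      (hSh.q_off x hx)
    · rw [dist_zero_right]; linarith [hεε.1]
    · refine het'.trans_le ?_
      have h1 : t ^ 2 ≤ 1 := by nlinarith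
      nlinarith [sq_nonneg t]
    · exact hρn.trans (by nlinarith)
  have hnorm : ∀ x, x ∈ Ω ∨ x + h ∈ Ω → ‖x‖ < 2 ^ n * t := by
    rintro x (hx | hx)
    · have := hΩ.sub hx
      rw [mem_ball_zero_iff] at this
      linarith
    · have := hΩ.sub hx
      rw [mem_ball_zero_iff] at this
      have h1 := norm_sub_le (x + h) h
      rw [add_sub_cancel_right] at h1
      linarith
  have hb₁ := hsh ht (by linarith) hS₁ (w := w) (κ := κ) (M := M₁) (by positivity) (fun x hx => by
      obtain ⟨p, hp, hxp⟩ := hp₁ x hx.1 hx.2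
      have := hdecay x p hp _ (le_max_right ‖x‖ t) hxp
      show |u (x + h) - u x| ≤ _
      rwa [hu.off _ hx.2, zero_sub, abs_neg]) hκ0 hn (fun x hx => hnorm x (Or.inl hx.1))
    (hκk _ _ hS₁)
  have hb₂ := hsh ht (by linarith) hS₂ (w := w) (κ := κ) (M := M₁) (by positivity) (fun x hx => by
      obtain ⟨p, hp, hxp⟩ := hp₂ x hx.1 hx.2
      have := hdecay (x + h) p hp _ (le_max_right ‖x‖ t) hxp
      show |u (x + h) - u x| ≤ _
      rwa [hu.off _ hx.2, sub_zero]) hκ0 hn (fun x hx => hnorm x (Or.inr hx.1))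
    (hκk _ _ hS₂)
  set B := C₇ * M₁ * n * (t * Q.v t) with hB
  have hB0 : 0 ≤ B := by positivity
  rw [hpair]
  have hfin : ∫⁻ x in Ω'ᶜ, ofReal ‖w x * κ x‖ ≤ ofReal (2 * B) := by
    have e1 : ∀ x, ofReal ‖w x * κ x‖ = ofReal (|w x| * κ x) := fun x => by
      rw [norm_mul, norm_eq_abs, norm_eq_abs, abs_of_nonneg (hκ0 x)]
    simp_rw [e1]
    set S := Ω ∩ {x | x + h ∉ Ω} ∪ {x | x + h ∈ Ω} \ Ω with hSdef
    calc _ = ∫⁻ x, Ω'ᶜ.indicator (fun x => ofReal (|w x| * κ x)) x :=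
          (lintegral_indicator hΩ'.meas.compl _).symm
      _ ≤ ∫⁻ x, S.indicator (fun x => ofReal (|w x| * κ x)) x := by
          refine lintegral_mono fun x => ?_
          by_cases hx : x ∈ S
          · rw [indicator_of_mem hx]
            exact indicator_le_self' (fun _ _ => zero_le) x
          · by_cases hx' : x ∈ Ω'
            · rw [indicator_of_notMem (not_not.2 hx' : x ∉ Ω'ᶜ)]; exact zero_le
            · have h1 : x ∉ Ω := fun h1 => by
                by_cases h2 : x + h ∈ Ω
                · exact hx' ⟨h1, h2⟩
                · exact hx (Or.inl ⟨h1, h2⟩)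
              have h2 : x + h ∉ Ω := fun h2 => hx (Or.inr ⟨h2, h1⟩)
              have h3 : w x = 0 := by rw [hw]; simp [hu.off _ h1, hu.off _ h2]
              rw [indicator_of_mem (show x ∈ Ω'ᶜ from hx'), h3]
              simp
      _ = ∫⁻ x in S, ofReal (|w x| * κ x) :=
          lintegral_indicator (hS₁.meas.union hS₂.meas) _
      _ ≤ _ := lintegral_union_le _ _ _
      _ ≤ ofReal B + ofReal B := add_le_add hb₁ hb₂
      _ = _ := by rw [← ofReal_add hB0 hB0]; ring_nf
  have := (norm_integral_le_lintegral_norm (μ := volume.restrict Ω'ᶜ) fun x => w x * κ x).trans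
    (ENNReal.toReal_le_of_le_ofReal (by positivity) hfin)
  rw [norm_eq_abs] at this
  refine this.trans ?_
  calc 2 * B = 2 * (C₇ * M₁) * n * (t * Q.v t) := by rw [hB]; ring
    _ ≤ _ := by gcongr; exact le_max_right _ _

end Core

namespace PsiSetting
variable (S : PsiSetting d)

lemma Ψ_pos {r : ℝ} (hr : 1 ≤ r) : 0 < S.Ψ r := by
  have h := S.scaling_lower r r hr le_rfl
  have hb := S.hb₁
  refine lt_of_le_of_ne (S.nonneg r (by linarith)) fun h0 => ?_
  rw [← h0, div_self (by linarith), Real.one_rpow, div_zero] at h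
  have : 0 < 1 / S.b₁ := by positivity
  linarith

lemma ae_pos : ∀ᵐ t ∂S.m, 0 < t := by
  rw [ae_iff]
  simpa [not_lt, Iic] using S.m_onIoi

lemma integrable_exp {r : ℝ} (hr : 1 ≤ r) : Integrable (fun t => 1 - exp (-r * t)) S.m := by
  by_contra h
  have h1 := S.levy_rep r (by linarith)
  rw [integral_undef h] at h1
  exact (S.Ψ_pos hr).ne' h1

lemma integrable_exp_of_pos {r : ℝ} (hr : 0 < r) :
    Integrable (fun t => 1 - exp (-r * t)) S.m := by
  rcases le_total 1 r with h | h
  · exact S.integrable_exp h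
  · refine (S.integrable_exp le_rfl).mono' (by fun_prop) ?_
    filter_upwards [S.ae_pos] with t ht
    have h1 : exp (-1 * t) ≤ exp (-r * t) := Real.exp_le_exp.2 (by nlinarith)
    have h2 : exp (-r * t) ≤ 1 := Real.exp_le_one_iff.2 (by nlinarith)
    rw [norm_of_nonneg (by linarith)]
    linarith

lemma Ψ_mono {r R : ℝ} (hr : 0 < r) (hR : r ≤ R) : S.Ψ r ≤ S.Ψ R := by
  rw [S.levy_rep r hr, S.levy_rep R (by linarith)]
  refine integral_mono_ae (S.integrable_exp_of_pos hr)
    (S.integrable_exp_of_pos (hr.trans_le hR)) ?_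
  filter_upwards [S.ae_pos] with t ht
  have : exp (-R * t) ≤ exp (-r * t) := Real.exp_le_exp.2 (by nlinarith)
  show 1 - exp (-r * t) ≤ 1 - exp (-R * t)
  linarith

lemma Ψ_mul_le {r k : ℝ} (hr : 0 < r) (hk : 1 ≤ k) : S.Ψ (k * r) ≤ k * S.Ψ r := by
  have hkr : 0 < k * r := by positivity
  rw [S.levy_rep r hr, S.levy_rep (k * r) hkr, ← integral_const_mul]
  refine integral_mono_ae (S.integrable_exp_of_pos hkr)
    ((S.integrable_exp_of_pos hr).const_mul k) ?_
  filter_upwards [S.ae_pos] with t ht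
  have h1 := one_add_mul_self_le_rpow_one_add (s := exp (-r * t) - 1)
    (by linarith [exp_pos (-r * t)]) hk
  rw [add_sub_cancel, ← Real.exp_mul, show -r * t * k = -(k * r) * t by ring] at h1
  show 1 - exp (-(k * r) * t) ≤ k * (1 - exp (-r * t))
  linarith

/-- The natural scale function of the process. -/
def rate (r : ℝ) : ℝ := (√(S.Ψ (max (r ^ 2)⁻¹ 1)))⁻¹

lemma rate_pos {r : ℝ} : 0 < S.rate r :=
  inv_pos.2 (sqrt_pos.2 (S.Ψ_pos (le_max_right _ _)))

lemma rate_sq (r : ℝ) : 1 / S.rate r ^ 2 = S.Ψ (max (r ^ 2)⁻¹ 1) := by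
  rw [rate, inv_pow, sq_sqrt (S.Ψ_pos (le_max_right _ _)).le, one_div, inv_inv]

/-- Comparison of two values of `rate` from a comparison of `Ψ`. -/
lemma rate_le {r s B : ℝ} (hB : 0 ≤ B)
    (h : S.Ψ (max (s ^ 2)⁻¹ 1) ≤ B ^ 2 * S.Ψ (max (r ^ 2)⁻¹ 1)) : S.rate r ≤ B * S.rate s := by
  have h1 := S.Ψ_pos (le_max_right (r ^ 2)⁻¹ 1)
  have h2 := S.Ψ_pos (le_max_right (s ^ 2)⁻¹ 1)
  have h3 := Real.sqrt_le_sqrt h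
  rw [Real.sqrt_mul (sq_nonneg B), Real.sqrt_sq hB] at h3
  have h4 := sqrt_pos.2 h1
  have h5 := sqrt_pos.2 h2
  rw [rate, rate, ← div_eq_mul_inv, inv_eq_one_div, div_le_div_iff₀ h4 h5]
  linarith

lemma arg_le {k r : ℝ} (hk : 1 ≤ k) (hr : 0 < r) :
    max (r ^ 2)⁻¹ 1 ≤ k ^ 2 * max ((k * r) ^ 2)⁻¹ 1 := by
  have hk2 : 1 ≤ k ^ 2 := one_le_pow₀ hk
  refine max_le ?_ ?_
  · calc (r ^ 2)⁻¹ = k ^ 2 * ((k * r) ^ 2)⁻¹ := by rw [mul_pow, mul_inv]; field_simp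
      _ ≤ _ := by gcongr; exact le_max_left _ _
  · calc (1:ℝ) ≤ k ^ 2 * 1 := by linarith
      _ ≤ _ := by gcongr; exact le_max_right _ _

lemma arg_anti {r s : ℝ} (hr : 0 < r) (hs : r ≤ s) : max (s ^ 2)⁻¹ 1 ≤ max (r ^ 2)⁻¹ 1 :=
  max_le_max (by gcongr) le_rfl

lemma min_le_exp {x : ℝ} (hx : 0 < x) : min 1 x ≤ 2 * (1 - exp (-x)) := by
  have h1 : exp (-x) ≤ 1 / (1 + x) := by
    rw [Real.exp_neg, ← one_div]
    exact one_div_le_one_div_of_le (by linarith) (by linarith [Real.add_one_le_exp x])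
  rcases le_total x 1 with h | h
  · rw [min_eq_right h]
    have : 1 / (1 + x) ≤ 1 - x / 2 := by
      rw [div_le_iff₀ (by linarith)]; nlinarith
    linarith
  · rw [min_eq_left h]
    have : 1 / (1 + x) ≤ 1 / 2 := one_div_le_one_div_of_le (by norm_num) (by linarith)
    linarith

/-- The scale constant in the lower tail bound. -/
def κ : ℝ := (3 * S.b₁) ^ (1 / (1 - S.a₂))

lemma κ_spec : 1 ≤ S.κ ∧ S.κ ^ (1 - S.a₂) = 3 * S.b₁ := by
  have hb := S.hb₁
  have ha := S.ha₂
  refine ⟨Real.one_le_rpow (by linarith) (by positivity [sub_pos.2 ha]), ?_⟩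
  rw [κ, ← rpow_mul (by linarith), one_div, inv_mul_cancel₀ (by linarith), Real.rpow_one]

/-- The analytic core attached to a Bernstein function with weak scaling. -/
def core : Core where
  m := S.m
  v := S.rate
  K := max 2 (max S.b₁ S.κ)
  a := S.a₂
  b := S.a₁
  s₀ := 1 / S.κ
  m_nonpos := S.m_onIoi
  one_le_K := le_max_of_le_left (by norm_num)
  a_lt := S.ha₂
  b_pos := S.ha₁
  s₀_pos := by have := S.κ_spec.1; positivity
  s₀_le := by
    have := S.κ_spec.1
    rw [div_le_one (by linarith)]; exact this
  v_pos := fun _ _ => S.rate_pos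
  mono := fun r s hr hs => by
    have := S.rate_le (r := r) (s := s) zero_le_one (by
      rw [one_pow, one_mul]
      exact S.Ψ_mono (zero_lt_one.trans_le (le_max_right _ _)) (arg_anti hr hs))
    linarith
  lin := fun k r hk hr => S.rate_le (by linarith) (by
    refine (S.Ψ_mono (zero_lt_one.trans_le (le_max_right _ _)) (arg_le hk hr)).trans ?_
    exact S.Ψ_mul_le (zero_lt_one.trans_le (le_max_right _ _)) (one_le_pow₀ hk))
  up := fun k r hk hr => by
    have hb := S.hb₁
    have hk0 : 0 < k := by linarith
    have hkr : r ≤ k * r := by nlinarith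
    have h1 : (1:ℝ) ≤ max ((k * r) ^ 2)⁻¹ 1 := le_max_right _ _
    have hp := S.Ψ_pos h1
    refine S.rate_le (by positivity) ?_
    have h2 := S.scaling_upper _ _ h1 (arg_anti hr hkr)
    rw [div_le_iff₀ hp] at h2
    refine h2.trans ?_
    gcongr
    have h3 : max (r ^ 2)⁻¹ 1 / max ((k * r) ^ 2)⁻¹ 1 ≤ k ^ 2 := by
      rw [div_le_iff₀ (by linarith)]; exact arg_le hk hr
    have hKb : S.b₁ ≤ max 2 (max S.b₁ S.κ) := (le_max_left _ _).trans (le_max_right _ _)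
    calc S.b₁ * (max (r ^ 2)⁻¹ 1 / max ((k * r) ^ 2)⁻¹ 1) ^ S.a₂ ≤ S.b₁ * (k ^ 2) ^ S.a₂ := by
          gcongr
          exact S.ha₁.le.trans S.ha₁₂
      _ = S.b₁ * (k ^ S.a₂) ^ 2 := by
          rw [← rpow_natCast k 2, ← rpow_mul hk0.le, ← rpow_natCast (k ^ S.a₂) 2,
            ← rpow_mul hk0.le, mul_comm ((2:ℕ):ℝ)]
      _ ≤ (max 2 (max S.b₁ S.κ)) ^ 2 * (k ^ S.a₂) ^ 2 := by
          gcongr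
          nlinarith
      _ = _ := by ring
  low := fun k r hk hr hkr => by
    have hb := S.hb₁
    have hk0 : 0 < k := by linarith
    have hrk : r ≤ k * r := by nlinarith
    have h1 : (1:ℝ) ≤ max ((k * r) ^ 2)⁻¹ 1 := le_max_right _ _
    have hp := S.Ψ_pos h1
    have h2 := S.scaling_lower _ _ h1 (arg_anti hr hrk)
    rw [le_div_iff₀ hp] at h2
    have e1 : max ((k * r) ^ 2)⁻¹ 1 = ((k * r) ^ 2)⁻¹ :=
      max_eq_left ((one_le_inv₀ (by positivity)).2 (pow_le_one₀ (by positivity) hkr))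
    have e2 : max (r ^ 2)⁻¹ 1 = (r ^ 2)⁻¹ :=
      max_eq_left ((one_le_inv₀ (by positivity)).2 (pow_le_one₀ (by positivity) (hrk.trans hkr)))
    have h3 : max (r ^ 2)⁻¹ 1 / max ((k * r) ^ 2)⁻¹ 1 = k ^ 2 := by
      rw [e1, e2]; field_simp
    have h4 : ((k:ℝ) ^ 2) ^ S.a₁ = (k ^ S.a₁) ^ 2 := by
      rw [← rpow_natCast k 2, ← rpow_mul hk0.le, ← rpow_natCast (k ^ S.a₁) 2,
        ← rpow_mul hk0.le, mul_comm ((2:ℕ):ℝ)]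
    rw [h3, h4] at h2
    have hKb : S.b₁ ≤ max 2 (max S.b₁ S.κ) := (le_max_left _ _).trans (le_max_right _ _)
    have hka : 0 < k ^ S.a₁ := by positivity
    have hKp : 0 < max 2 (max S.b₁ S.κ) := by linarith
    have := S.rate_le (r := r) (s := k * r) (B := max 2 (max S.b₁ S.κ) / k ^ S.a₁)
      (by positivity) (by
        have h5 : S.Ψ (max ((k * r) ^ 2)⁻¹ 1) ≤ S.b₁ / (k ^ S.a₁) ^ 2 * S.Ψ (max (r ^ 2)⁻¹ 1) := by
          calc _ = S.b₁ / (k ^ S.a₁) ^ 2 * (1 / S.b₁ * (k ^ S.a₁) ^ 2 *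
                S.Ψ (max ((k * r) ^ 2)⁻¹ 1)) := by field_simp
            _ ≤ _ := by gcongr
        refine h5.trans ?_
        rw [div_pow]
        have := S.Ψ_pos (le_max_right (r ^ 2)⁻¹ 1)
        gcongr
        nlinarith)
    rw [div_mul_eq_mul_div, le_div_iff₀ hka] at this
    linarith
  const := fun r hr => by
    have : (r ^ 2)⁻¹ ≤ 1 := inv_le_one_of_one_le₀ (one_le_pow₀ hr)
    simp only [rate]
    rw [max_eq_right this]; norm_num
  tail := fun s hs => by
    have h1 : (1:ℝ) ≤ max (s ^ 2)⁻¹ 1 := le_max_right _ _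
    set l := max (s ^ 2)⁻¹ 1 with hl
    have h2 : ofReal (2 * S.Ψ l) = ∫⁻ t, ofReal (2 * (1 - exp (-l * t))) ∂S.m := by
      rw [← ofReal_integral_eq_lintegral_ofReal ((S.integrable_exp h1).const_mul 2),
        integral_const_mul, S.levy_rep l (by linarith)]
      filter_upwards [S.ae_pos] with t ht
      have : exp (-l * t) ≤ 1 := Real.exp_le_one_iff.2 (by nlinarith)
      show (0:ℝ) ≤ 2 * (1 - exp (-l * t))
      linarith
    calc ∫⁻ t, ofReal (min 1 (t / s ^ 2)) ∂S.m
        ≤ ∫⁻ t, ofReal (2 * (1 - exp (-l * t))) ∂S.m := by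
          refine lintegral_mono_ae ?_
          filter_upwards [S.ae_pos] with t ht
          refine ofReal_le_ofReal ?_
          have h3 := min_le_exp (x := l * t) (by nlinarith)
          rw [← neg_mul] at h3
          refine le_trans (min_le_min le_rfl ?_) h3
          rw [div_eq_inv_mul]
          gcongr
          exact le_max_left _ _
      _ = ofReal (2 * S.Ψ l) := h2.symm
      _ ≤ _ := by
          refine ofReal_le_ofReal ?_
          rw [div_eq_mul_one_div, S.rate_sq]
          have := S.Ψ_pos h1
          gcongr
          exact le_max_left _ _
  tail_low := fun s hs hss => by
    obtain ⟨hκ1, hκ⟩ := S.κ_spec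
    have hb := S.hb₁
    have hκ0 : 0 < S.κ := by linarith
    have hs2 : s ^ 2 ≤ 1 / S.κ := by
      calc s ^ 2 ≤ (1 / S.κ) ^ 2 := by gcongr
        _ = 1 / S.κ * (1 / S.κ) := by ring
        _ ≤ 1 / S.κ * 1 := by
            gcongr
            rw [div_le_one hκ0]; exact hκ1
        _ = _ := by ring
    set Λ := (s ^ 2)⁻¹ / S.κ with hΛ
    have hΛ1 : 1 ≤ Λ := by
      rw [hΛ, le_div_iff₀ hκ0, one_mul, ← one_div, le_div_iff₀ (by positivity)]
      rw [le_div_iff₀ hκ0] at hs2; linarith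
    have hl : max (s ^ 2)⁻¹ 1 = S.κ * Λ := by
      rw [show S.κ * Λ = (s ^ 2)⁻¹ by rw [hΛ]; field_simp]
      refine max_eq_left ((one_le_inv₀ (by positivity)).2 (hs2.trans ?_))
      rw [div_le_one hκ0]; exact hκ1
    have hkΛ : Λ ≤ S.κ * Λ := by nlinarith
    have hΨ := S.Ψ_pos (hΛ1.trans hkΛ)
    have hup := S.scaling_upper Λ (S.κ * Λ) hΛ1 hkΛ
    rw [div_le_iff₀ (S.Ψ_pos hΛ1), mul_div_assoc, div_self (by linarith), mul_one] at hup
    have hspl : ofReal (S.Ψ Λ) ≤ ofReal (2 / S.κ * S.Ψ (S.κ * Λ))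
        + S.m (Ici (s ^ 2)) := by
      have hint := S.integrable_exp (hΛ1.trans hkΛ)
      rw [S.levy_rep Λ (by linarith), S.levy_rep (S.κ * Λ) (by linarith), ← integral_const_mul,
        ofReal_integral_eq_lintegral_ofReal (S.integrable_exp hΛ1),
        ofReal_integral_eq_lintegral_ofReal (hint.const_mul _),
        ← lintegral_indicator_one measurableSet_Ici, ← lintegral_add_left']
      · refine lintegral_mono_ae ?_
        filter_upwards [S.ae_pos] with t ht
        by_cases h : s ^ 2 ≤ t
        · rw [indicator_of_mem (show t ∈ Ici (s ^ 2) from h)]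
          refine le_add_left ?_
          rw [Pi.one_apply, ENNReal.ofReal_le_one]
          linarith [exp_pos (-Λ * t)]
        · rw [indicator_of_notMem (show t ∉ Ici (s ^ 2) from h), add_zero]
          refine ofReal_le_ofReal ?_
          push Not at h
          have h1 : S.κ * Λ * t ≤ 1 := by
            rw [show S.κ * Λ = (s ^ 2)⁻¹ by rw [hΛ]; field_simp, inv_mul_le_iff₀ (by positivity)]
            linarith
          have h2 := min_le_exp (x := S.κ * Λ * t) (by positivity)
          rw [min_eq_right h1, ← neg_mul] at h2
          have h3 := Real.add_one_le_exp (-Λ * t)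
          calc 1 - exp (-Λ * t) ≤ 1 / S.κ * (S.κ * Λ * t) := by
                rw [show 1 / S.κ * (S.κ * Λ * t) = Λ * t by field_simp]; linarith
            _ ≤ 1 / S.κ * (2 * (1 - exp (-(S.κ * Λ) * t))) := by gcongr
            _ = _ := by ring
      · exact (hint.const_mul _).aemeasurable.ennreal_ofReal
      all_goals
        filter_upwards [S.ae_pos] with t ht
        simp only [Pi.zero_apply]
      · have : exp (-(S.κ * Λ) * t) ≤ 1 := Real.exp_le_one_iff.2 (by
          have : 0 < S.κ * Λ * t := by positivity
          linarith)
        have : 0 < 2 / S.κ := by positivity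
        nlinarith
      · have : exp (-Λ * t) ≤ 1 := Real.exp_le_one_iff.2 (by nlinarith)
        linarith
    have h5 : ofReal (S.Ψ Λ) - ofReal (2 / S.κ * S.Ψ (S.κ * Λ))
        ≤ S.m (Ici (s ^ 2)) := tsub_le_iff_left.2 hspl
    rw [← ENNReal.ofReal_sub _ (by positivity)] at h5
    refine le_trans (ofReal_le_ofReal ?_) h5
    have h6 : S.κ = S.κ ^ S.a₂ * (3 * S.b₁) := by
      rw [← hκ, ← Real.rpow_add hκ0]; norm_num
    have h7 : 3 / S.κ * S.Ψ (S.κ * Λ) ≤ S.Ψ Λ := by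
      rw [div_mul_eq_mul_div, div_le_iff₀ hκ0]
      have hp : 0 < S.κ ^ S.a₂ := by positivity
      calc 3 * S.Ψ (S.κ * Λ) ≤ 3 * (S.b₁ * S.κ ^ S.a₂ * S.Ψ Λ) := by gcongr
        _ = S.Ψ Λ * (S.κ ^ S.a₂ * (3 * S.b₁)) := by ring
        _ = _ := by rw [← h6]
    have h8 : 1 / (max 2 (max S.b₁ S.κ) * S.rate s ^ 2) ≤ 1 / S.κ * S.Ψ (S.κ * Λ) := by
      have : 1 / (max 2 (max S.b₁ S.κ) * S.rate s ^ 2)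
          = 1 / max 2 (max S.b₁ S.κ) * (1 / S.rate s ^ 2) := by rw [one_div_mul_one_div]
      rw [this, S.rate_sq, hl]
      gcongr
      exact (le_max_right _ _).trans (le_max_right _ _)
    have : 3 / S.κ * S.Ψ (S.κ * Λ) = 2 / S.κ * S.Ψ (S.κ * Λ) + 1 / S.κ * S.Ψ (S.κ * Λ) := by ring
    linarith

end PsiSetting

lemma taylor_C2 {f : Rd d → ℝ} {y₀ : Rd d} (hf : ContDiffAt ℝ 2 f y₀) :
    ∃ M r : ℝ, 1 ≤ M ∧ 0 < r ∧ ∀ x ∈ ball y₀ r, ∀ y ∈ ball y₀ r,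
      ‖fderiv ℝ f x - fderiv ℝ f y‖ ≤ M * ‖x - y‖ ∧
      |f x - f y - fderiv ℝ f y (x - y)| ≤ M * ‖x - y‖ ^ 2 := by
  have h1 : ContDiffAt ℝ 1 (fderiv ℝ f) y₀ := hf.fderiv_right (by norm_num)
  obtain ⟨K, T, hT, hK⟩ := h1.exists_lipschitzOnWith
  have h2 : ∀ᶠ y in 𝓝 y₀, ContDiffAt ℝ 2 f y := hf.eventually (by simp)
  obtain ⟨r, hr, hb⟩ := Metric.eventually_nhds_iff_ball.1 (h2.and hT)
  have hd : ∀ x ∈ ball y₀ r, DifferentiableAt ℝ f x := fun x hx =>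
    (hb x hx).1.differentiableAt (by norm_num)
  have hL : ∀ x ∈ ball y₀ r, ∀ y ∈ ball y₀ r,
      ‖fderiv ℝ f x - fderiv ℝ f y‖ ≤ (K + 1) * ‖x - y‖ := fun x hx y hy => by
    have := hK.dist_le_mul x (hb x hx).2 y (hb y hy).2
    rw [dist_eq_norm, dist_eq_norm] at this
    nlinarith [norm_nonneg (x - y)]
  refine ⟨K + 1, r, by simp, hr, fun x hx y hy => ⟨hL x hx y hy, ?_⟩⟩
  have hs : segment ℝ y x ⊆ ball y₀ r := (convex_ball y₀ r).segment_subset hy hx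
  have := (convex_segment y x).norm_image_sub_le_of_norm_fderiv_le' (𝕜 := ℝ) (f := f)
    (φ := fderiv ℝ f y) (C := (K + 1) * ‖x - y‖) (fun w hw => hd w (hs hw))
    (fun w hw => (hL w (hs hw) y hy).trans ?_) (left_mem_segment ℝ y x) (right_mem_segment ℝ y x)
  · rw [norm_eq_abs] at this
    calc _ ≤ _ := this
      _ = _ := by ring
  · gcongr
    rw [segment_eq_image'] at hw
    obtain ⟨θ, h0, rfl⟩ := hw
    rw [add_sub_cancel_left, norm_smul, norm_of_nonneg h0.1]
    exact mul_le_of_le_one_left (norm_nonneg _) h0.2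

/-- A preconnected set meeting both `D` and its complement meets the frontier. -/
lemma exists_frontier_of_preconnected {A D : Set (Rd d)} (hA : IsPreconnected A) {x p : Rd d}
    (hxA : x ∈ A) (hx : x ∈ interior D) (hpA : p ∈ A) (hp : p ∉ D) : ∃ y ∈ A, y ∈ frontier D := by
  by_contra! h
  by_cases hpc : p ∈ closure D
  · exact h p hpA ⟨hpc, fun h' => hp (interior_subset h')⟩
  obtain ⟨w, -, hw1, hw2⟩ := hA (interior D) (closure D)ᶜ isOpen_interior
    isClosed_closure.isOpen_compl (fun y hy => by
      by_cases hc : y ∈ closure D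
      · by_cases hi : y ∈ interior D
        · exact Or.inl hi
        · exact (h y hy ⟨hc, hi⟩).elim
      · exact Or.inr hc) ⟨x, hxA, hx⟩ ⟨p, hpA, hpc⟩
  exact hw2 (subset_closure (interior_subset hw1))

structure LocalDef (D : Set (Rd d)) (y₀ : Rd d) (f : Rd d → ℝ) (M m r : ℝ) : Prop where
  M_pos : 1 ≤ M
  m_pos : 0 < m
  r_pos : 0 < r
  mem : ∀ y ∈ ball y₀ r, y ∈ D ↔ f y < 0
  fr : ∀ y ∈ ball y₀ r, y ∈ frontier D → f y = 0
  lip : ∀ x ∈ ball y₀ r, ∀ y ∈ ball y₀ r, ‖fderiv ℝ f x - fderiv ℝ f y‖ ≤ M * ‖x - y‖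
  taylor : ∀ x ∈ ball y₀ r, ∀ y ∈ ball y₀ r,
    |f x - f y - fderiv ℝ f y (x - y)| ≤ M * ‖x - y‖ ^ 2
  lower : ∀ x ∈ ball y₀ r, m ≤ ‖fderiv ℝ f x‖

lemma exists_localDef {D : Set (Rd d)} (hDo : IsOpen D) (hC2 : HasC2Boundary D) {y₀ : Rd d}
    (h : y₀ ∈ frontier D) : ∃ f M m r, LocalDef D y₀ f M m r := by
  obtain ⟨U, f, hU, hy, hf, hne, hD⟩ := hC2 y₀ h
  have hf0 : ContDiffAt ℝ 2 f y₀ := hf.contDiffAt (hU.mem_nhds hy)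
  obtain ⟨M, r, hM, hr, H⟩ := taylor_C2 hf0
  obtain ⟨r₁, hr₁, hb⟩ := Metric.isOpen_iff.1 hU y₀ hy
  set m := ‖fderiv ℝ f y₀‖ with hm
  have hm0 : 0 < m := norm_pos_iff.2 (hne y₀ hy)
  set R := min (min r r₁) (m / (2 * M))
  have hR : 0 < R := by positivity
  have hRr : ball y₀ R ⊆ ball y₀ r := ball_subset_ball ((min_le_left _ _).trans (min_le_left _ _))
  have hRU : ball y₀ R ⊆ U :=
    (ball_subset_ball ((min_le_left _ _).trans (min_le_right _ _))).trans hb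
  have hmem : ∀ y ∈ ball y₀ R, y ∈ D ↔ f y < 0 := fun y hyR => by
    have : y ∈ D ∩ U ↔ y ∈ {y ∈ U | f y < 0} := by rw [hD]
    simpa [hRU hyR] using this
  refine ⟨f, M, m / 2, R, hM, by positivity, hR, hmem, fun y hyR hfr => ?_,
    fun x hx y hy => (H x (hRr hx) y (hRr hy)).1, fun x hx y hy => (H x (hRr hx) y (hRr hy)).2,
    fun x hx => ?_⟩
  · have hyD : y ∉ D := fun hD' => by
      rw [frontier, hDo.interior_eq] at hfr
      exact hfr.2 hD'
    refine le_antisymm ?_ (not_lt.1 fun hl => hyD ((hmem y hyR).2 hl))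
    by_contra! hpos
    have hc : ContinuousAt f y := hf.continuousOn.continuousAt (hU.mem_nhds (hRU hyR))
    have h3 : ∀ᶠ w in 𝓝 y, 0 < f w ∧ w ∈ ball y₀ R :=
      (hc.eventually (lt_mem_nhds hpos)).and (isOpen_ball.mem_nhds hyR)
    obtain ⟨w, hw, hwD⟩ := (mem_closure_iff_frequently.1 hfr.1).and_eventually h3 |>.exists
    exact absurd ((hmem w hwD.2).1 hw) (not_lt.2 hwD.1.le)
  · have h4 := (H x (hRr hx) y₀ (mem_ball_self hr)).1
    have h5 : ‖x - y₀‖ ≤ m / (2 * M) := by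
      rw [← dist_eq_norm]; exact (mem_ball.1 hx).le.trans (min_le_right _ _)
    have h6 : M * ‖x - y₀‖ ≤ m / 2 := by
      calc _ ≤ M * (m / (2 * M)) := by gcongr
        _ = _ := by field_simp
    have h7 := norm_sub_norm_le (fderiv ℝ f y₀) (fderiv ℝ f x)
    rw [norm_sub_rev] at h7
    linarith

/-- A unit vector along the gradient. -/
lemma exists_unit_grad (ℓ : Rd d →L[ℝ] ℝ) (h : 0 < ‖ℓ‖) :
    ∃ n : Rd d, ‖n‖ = 1 ∧ ∀ v, ℓ v = ‖ℓ‖ * ⟪n, v⟫ := by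
  refine ⟨‖ℓ‖⁻¹ • (InnerProductSpace.toDual ℝ (Rd d)).symm ℓ, ?_, fun v => ?_⟩
  · rw [norm_smul, LinearIsometryEquiv.norm_map, norm_inv, norm_norm, inv_mul_cancel₀ h.ne']
  · rw [real_inner_smul_left, InnerProductSpace.toDual_symm_apply]
    field_simp

namespace LocalDef
variable {D : Set (Rd d)} {y₀ : Rd d} {f : Rd d → ℝ} {M m r : ℝ}

lemma ext_ball (H : LocalDef D y₀ f M m r) : ∃ s > 0, ∀ y ∈ ball y₀ (r / 2), y ∈ frontier D →
    ∃ n : Rd d, ‖n‖ = 1 ∧ ∀ R, 0 < R → R ≤ s → ∀ x ∈ ball (y + R • n) R, x ∉ D := by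
  have hM := H.M_pos
  have hm := H.m_pos
  have hr := H.r_pos
  refine ⟨min (r / 4) (m / (2 * M)), by positivity, fun y hy hfr => ?_⟩
  have hyr : y ∈ ball y₀ r := ball_subset_ball (by linarith) hy
  obtain ⟨n, hn, hl⟩ := exists_unit_grad (fderiv ℝ f y) (hm.trans_le (H.lower y hyr))
  refine ⟨n, hn, fun R hR hRs x hx => ?_⟩
  have hR1 : R ≤ r / 4 := hRs.trans (min_le_left _ _)
  have hR2 : R ≤ m / (2 * M) := hRs.trans (min_le_right _ _)
  rw [mem_ball, dist_eq_norm, ← sub_sub] at hx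
  have hx1 : ‖x - y‖ < 2 * R := by
    have := norm_sub_norm_le (x - y) (R • n)
    rw [norm_smul, hn, norm_of_nonneg hR.le] at this
    linarith
  have hxr : x ∈ ball y₀ r := by
    rw [mem_ball] at hy ⊢
    have := dist_triangle x y y₀
    rw [dist_eq_norm x y] at this
    linarith
  have h1 := H.taylor x hxr y hyr
  rw [H.fr y hyr hfr, hl, sub_zero, abs_le] at h1
  rw [H.mem x hxr, not_lt]
  have h2 : ‖x - y - R • n‖ ^ 2 < R ^ 2 := by gcongr
  rw [norm_sub_sq_real, real_inner_smul_right, norm_smul, hn, norm_of_nonneg hR.le,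
    real_inner_comm] at h2
  have h3 : ‖x - y‖ ^ 2 < 2 * R * ⟪n, x - y⟫ := by nlinarith
  have h4 := H.lower y hyr
  have h5 : R * (2 * M) ≤ m := (le_div_iff₀ (by positivity)).1 hR2
  have hi : 0 < ⟪n, x - y⟫ := by
    by_contra! h; nlinarith [sq_nonneg ‖x - y‖]
  have h6 : M * ‖x - y‖ ^ 2 ≤ m * ⟪n, x - y⟫ := by
    calc M * ‖x - y‖ ^ 2 ≤ M * (2 * R * ⟪n, x - y⟫) := by gcongr
      _ = R * (2 * M) * ⟪n, x - y⟫ := by ring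
      _ ≤ _ := by gcongr
  nlinarith

lemma cone (H : LocalDef D y₀ f M m r) (hy₀ : y₀ ∉ D) : ∃ n : Rd d, ‖n‖ = 1 ∧ ∃ r' > 0,
    ∀ x ∈ D ∩ ball y₀ r', ∀ s, 0 ≤ s → s ≤ r' →
      infDist x Dᶜ + s / 2 ≤ infDist (x + s • n) Dᶜ := by
  have hM := H.M_pos
  have hm := H.m_pos
  have hr := H.r_pos
  have hy₀r := mem_ball_self (x := y₀) hr
  have hg := H.lower y₀ hy₀r
  set G := ‖fderiv ℝ f y₀‖
  obtain ⟨n, hn, hl⟩ := exists_unit_grad (fderiv ℝ f y₀) (hm.trans_le hg)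
  refine ⟨-n, by simpa using hn, min (r / 4) (m / (32 * M)), by positivity, fun x hx s hs hsr => ?_⟩
  set r' := min (r / 4) (m / (32 * M))
  have hr1 : r' ≤ r / 4 := min_le_left _ _
  have hr2 : r' * (32 * M) ≤ m := (le_div_iff₀ (by positivity)).1 (min_le_right _ _)
  have hδ : infDist x Dᶜ < r' := (infDist_le_dist_of_mem hy₀).trans_lt (mem_ball.1 hx.2)
  have hδ0 : 0 ≤ infDist x Dᶜ := infDist_nonneg
  set δ := infDist x Dᶜ
  rcases hs.eq_or_lt with rfl | hs
  · simp [δ]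
  refine (le_infDist ⟨y₀, hy₀⟩).2 fun w hw => ?_
  by_contra! hlt
  apply hw
  set a := w - (x + s • -n) with ha
  have han : ‖a‖ < δ + s / 2 := by rwa [ha, ← dist_eq_norm, dist_comm]
  set θ := δ / (δ + s / 2) with hθ
  have hden : 0 < δ + s / 2 := by positivity
  have hθ0 : 0 ≤ θ := by positivity
  have hx' : x + θ • a ∈ D := by
    rcases hδ0.eq_or_lt with h0 | h0
    · have : θ = 0 := by rw [hθ, ← h0]; simp
      simpa [this] using hx.1
    by_contra hc
    have := infDist_le_dist_of_mem (x := x) (s := Dᶜ) hc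
    rw [dist_eq_norm, sub_add_cancel_left, norm_neg, norm_smul, norm_of_nonneg hθ0] at this
    have h2 : θ * ‖a‖ < θ * (δ + s / 2) := by gcongr
    rw [hθ, div_mul_cancel₀ _ hden.ne'] at h2
    linarith
  have h1θ : 1 - θ = (s / 2) / (δ + s / 2) := by rw [hθ]; field_simp; ring
  have hv : ‖(1 - θ) • a‖ ≤ s / 2 := by
    rw [norm_smul, h1θ, norm_of_nonneg (by positivity), div_mul_eq_mul_div,
      div_le_iff₀ hden]
    gcongr
  have hθa : ‖θ • a‖ ≤ δ := by
    rw [norm_smul, norm_of_nonneg hθ0, hθ, div_mul_eq_mul_div, div_le_iff₀ hden]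
    gcongr
  have hx'0 : ‖x + θ • a - y₀‖ < 2 * r' := by
    have : x + θ • a - y₀ = (x - y₀) + θ • a := by abel
    rw [this]
    have h1 := mem_ball.1 hx.2
    rw [dist_eq_norm] at h1
    linarith [norm_add_le (x - y₀) (θ • a)]
  have hwx : w - (x + θ • a) = s • -n + (1 - θ) • a := by
    rw [sub_smul, one_smul, ha]; abel
  have hwn : ‖w - (x + θ • a)‖ ≤ 3 / 2 * s := by
    rw [hwx]
    have := norm_add_le (s • -n) ((1 - θ) • a)
    rw [norm_smul, norm_neg, hn, norm_of_nonneg hs.le] at this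
    linarith
  have hxr : x + θ • a ∈ ball y₀ r := by rw [mem_ball, dist_eq_norm]; linarith
  have hw0 : ‖w - y₀‖ < 4 * r' := by
    have := norm_add_le (w - (x + θ • a)) (x + θ • a - y₀)
    rw [sub_add_sub_cancel] at this
    linarith
  have hwr : w ∈ ball y₀ r := by rw [mem_ball, dist_eq_norm]; linarith
  rw [H.mem w hwr]
  have hfx := (H.mem _ hxr).1 hx'
  have hT := H.taylor w hwr _ hxr
  have hL := H.lip _ hxr y₀ hy₀r
  have e1 : fderiv ℝ f y₀ (w - (x + θ • a)) ≤ -(G * (s / 2)) := by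
    rw [hl, hwx, inner_add_right, real_inner_smul_right, inner_neg_right,
      real_inner_self_eq_norm_sq, hn]
    have := (abs_le.1 (abs_real_inner_le_norm n ((1 - θ) • a))).2
    rw [hn, one_mul] at this
    have hG : 0 ≤ G := norm_nonneg _
    nlinarith
  have e2 : |(fderiv ℝ f (x + θ • a) - fderiv ℝ f y₀) (w - (x + θ • a))|
      ≤ (M * (2 * r')) * (3 / 2 * s) := by
    rw [← norm_eq_abs]
    refine (ContinuousLinearMap.le_opNorm _ _).trans ?_
    gcongr
    exact hL.trans (by gcongr)
  rw [sub_apply] at e2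
  have e3 : M * ‖w - (x + θ • a)‖ ^ 2 ≤ M * ((3 / 2 * s) * (3 / 2 * r')) := by
    rw [sq]; gcongr; linarith
  have e4 : G * s ≥ m * s := by gcongr
  have e5 : M * r' * s * 32 ≤ m * s := by nlinarith
  have := (abs_le.1 hT).2
  have := (abs_le.1 e2).2
  nlinarith

end LocalDef

lemma exists_ext_ball {D : Set (Rd d)} (hDo : IsOpen D) (hDb : Bornology.IsBounded D)
    (hC2 : HasC2Boundary D) : ∃ s > 0, ∀ x ∈ D, ∀ p ∉ D, ∀ R, 0 < R → R ≤ s →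
      ∃ c, (∀ y ∈ ball c R, y ∉ D) ∧ dist x c ≤ R + dist x p := by
  have hcpt : IsCompact (frontier D) :=
    Metric.isCompact_of_isClosed_isBounded isClosed_frontier
      (hDb.closure.subset frontier_subset_closure)
  have key : ∃ s > 0, ∀ y ∈ frontier D, y ∈ frontier D → ∃ n : Rd d, ‖n‖ = 1 ∧
      ∀ R, 0 < R → R ≤ s → ∀ x ∈ ball (y + R • n) R, x ∉ D := by
    refine hcpt.induction_on (p := fun F => ∃ s > 0, ∀ y ∈ F, y ∈ frontier D → ∃ n : Rd d,
      ‖n‖ = 1 ∧ ∀ R, 0 < R → R ≤ s → ∀ x ∈ ball (y + R • n) R, x ∉ D) ⟨1, one_pos, by simp⟩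
      (fun F G hFG ⟨s, hs, h⟩ => ⟨s, hs, fun y hy => h y (hFG hy)⟩) ?_ fun y₀ hy₀ => ?_
    · rintro F G ⟨s, hs, h⟩ ⟨s', hs', h'⟩
      refine ⟨min s s', lt_min hs hs', fun y hy hfr => ?_⟩
      rcases hy with hy | hy
      · obtain ⟨n, hn, hb⟩ := h y hy hfr
        exact ⟨n, hn, fun R hR hRs => hb R hR (hRs.trans (min_le_left _ _))⟩
      · obtain ⟨n, hn, hb⟩ := h' y hy hfr
        exact ⟨n, hn, fun R hR hRs => hb R hR (hRs.trans (min_le_right _ _))⟩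
    · obtain ⟨f, M, m, r, H⟩ := exists_localDef hDo hC2 hy₀
      exact ⟨ball y₀ (r / 2), mem_nhdsWithin_of_mem_nhds (ball_mem_nhds _ (half_pos H.r_pos)),
        H.ext_ball⟩
  obtain ⟨s, hs, h⟩ := key
  refine ⟨s, hs, fun x hx p hp R hR hRs => ?_⟩
  obtain ⟨y, hy, hfr⟩ := exists_frontier_of_preconnected (convex_segment x p).isPreconnected
    (left_mem_segment ℝ x p) (by rwa [hDo.interior_eq]) (right_mem_segment ℝ x p) hp
  obtain ⟨n, hn, hb⟩ := h y hfr hfr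
  refine ⟨y + R • n, hb R hR hRs, ?_⟩
  have h1 : dist x y ≤ dist x p := by
    have := dist_add_dist_of_mem_segment hy
    linarith [dist_nonneg (x := y) (y := p)]
  have h2 : dist y (y + R • n) = R := by
    rw [dist_self_add_right, norm_smul, hn, norm_of_nonneg hR.le, mul_one]
  linarith [dist_triangle x y (y + R • n)]

/-- The points of `D` at distance more than `η` from the complement. -/
def shrink (D : Set (Rd d)) (η : ℝ) : Set (Rd d) := {x | η < infDist x Dᶜ}

lemma mem_shrink {D : Set (Rd d)} {η : ℝ} {x : Rd d} : x ∈ shrink D η ↔ η < infDist x Dᶜ := Iff.rfl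

lemma notMem_shrink {D : Set (Rd d)} {η : ℝ} {x : Rd d} :
    x ∉ shrink D η ↔ infDist x Dᶜ ≤ η := by
  rw [mem_shrink, not_lt]

lemma isOpen_shrink (D : Set (Rd d)) (η : ℝ) : IsOpen (shrink D η) :=
  isOpen_lt continuous_const (continuous_infDist_pt _)

lemma shrink_subset {D : Set (Rd d)} {η : ℝ} (hη : 0 ≤ η) : shrink D η ⊆ D := fun x hx => by
  by_contra h
  have := mem_shrink.1 hx
  rw [infDist_zero_of_mem (show x ∈ Dᶜ from h)] at this
  linarith

lemma exists_nearest {D : Set (Rd d)} (hDo : IsOpen D) (hne : Dᶜ.Nonempty) (x : Rd d) :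
    ∃ y ∉ D, infDist x Dᶜ = dist x y :=
  hDo.isClosed_compl.exists_infDist_eq_dist hne x

/-- Moving towards the nearest point of the complement. -/
lemma exists_exit {D : Set (Rd d)} (hDo : IsOpen D) (hne : Dᶜ.Nonempty) {η : ℝ} (hη : 0 < η)
    {x : Rd d} (hx : x ∈ shrink D η) : ∃ p ∉ shrink D η, dist x p ≤ infDist x Dᶜ - η := by
  obtain ⟨y, hy, hxy⟩ := exists_nearest hDo hne x
  have hx' := mem_shrink.1 hx
  rw [hxy] at hx' ⊢
  have hd0 : 0 < dist x y := hη.trans hx'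
  refine ⟨AffineMap.lineMap x y ((dist x y - η) / dist x y), notMem_shrink.2 ?_, ?_⟩
  · refine (infDist_le_dist_of_mem hy).trans ?_
    rw [dist_lineMap_right, norm_of_nonneg]
    · field_simp; linarith
    · rw [sub_nonneg, div_le_one hd0]; linarith
  · rw [dist_left_lineMap, norm_of_nonneg (div_nonneg (by linarith) hd0.le),
      div_mul_cancel₀ _ hd0.ne']

lemma Dom.inter_shift {s L : ℝ} {Ω : Set (Rd d)} (h : Dom s L Ω) (a : Rd d) :
    Dom s L (Ω ∩ {x | x + a ∈ Ω}) where
  meas := h.meas.inter (h.meas.preimage (measurable_add_const a))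
  sub := inter_subset_left.trans h.sub
  ext x hx p hp R hR hRs := by
    by_cases hp1 : p ∈ Ω
    · have hp2 : p + a ∉ Ω := fun h2 => hp ⟨hp1, h2⟩
      obtain ⟨c, hc, hcd⟩ := h.ext (x + a) hx.2 (p + a) hp2 R hR hRs
      refine ⟨c - a, fun y hy hyΩ => hc (y + a) ?_ hyΩ.2, ?_⟩
      · rw [mem_ball, dist_eq_norm] at hy ⊢
        rwa [show y + a - c = y - (c - a) by abel]
      · have : dist x (c - a) = dist (x + a) c := by
          rw [dist_eq_norm, dist_eq_norm]; congr 1; abel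
        rw [this]
        simpa using hcd
    · obtain ⟨c, hc, hcd⟩ := h.ext x hx.1 p hp1 R hR hRs
      exact ⟨c, fun y hy hyΩ => hc y hy hyΩ.1, hcd⟩

lemma exists_dom_shrink {D : Set (Rd d)} (hDo : IsOpen D) (hDb : Bornology.IsBounded D)
    (hne : Dᶜ.Nonempty) (hC2 : HasC2Boundary D) : ∃ s L : ℝ, 0 < s ∧ 1 ≤ L ∧ ∀ η, 0 < η →
      Dom s L (shrink D η) := by
  obtain ⟨s, hs, h⟩ := exists_ext_ball hDo hDb hC2
  obtain ⟨L, hL⟩ := hDb.subset_ball 0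
  refine ⟨s, max L 1, hs, le_max_right _ _, fun η hη => ⟨(isOpen_shrink D η).measurableSet,
    (shrink_subset hη.le).trans (hL.trans (ball_subset_ball (le_max_left _ _))), ?_⟩⟩
  intro x hx p hp R hR hRs
  obtain ⟨p', hp', hp'η⟩ : ∃ p' ∈ segment ℝ x p, infDist p' Dᶜ = η := by
    have h1 := (convex_segment x p).isPreconnected.intermediate_value
      (right_mem_segment ℝ x p) (left_mem_segment ℝ x p)
      (continuous_infDist_pt Dᶜ).continuousOn
    exact h1 ⟨notMem_shrink.1 hp, (mem_shrink.1 hx).le⟩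
  have hp'D : p' ∈ D := by
    by_contra h
    rw [infDist_zero_of_mem (show p' ∈ Dᶜ from h)] at hp'η
    exact hη.ne hp'η
  obtain ⟨y, hy, hyd⟩ := exists_nearest hDo hne p'
  obtain ⟨c₀, hc₀, hcd⟩ := h p' hp'D y hy s hs le_rfl
  rw [← hyd, hp'η] at hcd
  have hsη : 0 < s + η := by positivity
  have hball : ∀ w ∈ ball c₀ (s + η), w ∉ shrink D η := by
    intro w hw
    rw [mem_ball] at hw
    rw [notMem_shrink]
    rcases lt_or_ge (dist w c₀) s with h1 | h1
    · rw [infDist_zero_of_mem (show w ∈ Dᶜ from hc₀ w h1)]; exact hη.le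
    · refine le_of_forall_pos_le_add fun κ hκ => ?_
      set k := min κ s / 2
      have hk : 0 < k := by positivity
      have hks : k < s := by
        have := min_le_right κ s; simp only [k]; linarith
      have hkκ : k < κ := by
        have := min_le_left κ s; simp only [k]; linarith
      have hw0 : 0 < dist w c₀ := hs.trans_le h1
      have hq : AffineMap.lineMap c₀ w ((s - k) / dist w c₀) ∉ D := by
        apply hc₀
        rw [mem_ball, dist_lineMap_left, norm_of_nonneg (by apply div_nonneg <;> linarith),
          dist_comm c₀ w, div_mul_cancel₀ _ hw0.ne']
        linarith
      refine (infDist_le_dist_of_mem (x := w) (s := Dᶜ) hq).trans ?_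
      rw [dist_right_lineMap, dist_comm c₀ w, norm_of_nonneg]
      · field_simp; linarith
      · rw [sub_nonneg, div_le_one hw0]; linarith
  set θ := R / (s + η)
  have hθ0 : 0 ≤ θ := by positivity
  have hθ1 : θ ≤ 1 := by rw [div_le_one hsη]; linarith
  have hθs : θ * (s + η) = R := div_mul_cancel₀ _ hsη.ne'
  refine ⟨AffineMap.lineMap p' c₀ θ, fun w hw => hball w ?_, ?_⟩
  · rw [mem_ball] at hw ⊢
    have h1 := dist_triangle w (AffineMap.lineMap p' c₀ θ) c₀
    rw [dist_lineMap_right, norm_of_nonneg (by linarith)] at h1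
    nlinarith
  · have h1 := dist_triangle x p' (AffineMap.lineMap p' c₀ θ)
    rw [dist_left_lineMap, norm_of_nonneg hθ0] at h1
    have h2 := dist_add_dist_of_mem_segment hp'
    nlinarith [dist_nonneg (x := p') (y := p)]

/-- The points off `shrink D η` within distance `b` of it. -/
def collar (D : Set (Rd d)) (η b : ℝ) : Set (Rd d) :=
  {w | w ∉ shrink D η ∧ infDist w (shrink D η) ≤ b}

lemma measurableSet_collar (D : Set (Rd d)) (η b : ℝ) : MeasurableSet (collar D η b) :=
  (isOpen_shrink D η).measurableSet.compl.inter
    (isClosed_le (continuous_infDist_pt _) continuous_const).measurableSet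

lemma volume_real_ball_le {B : Set (Rd d)} {R : ℝ} (hR : 0 < R) (hB : B ⊆ ball 0 R) :
    volume.real B ≤ R ^ d * volume.real (ball (0 : Rd d) 1) := by
  rw [← volume_real_ball 0 hR]
  exact measureReal_mono hB measure_ball_lt_top.ne

/-- Volume bound by packing disjoint translates. -/
lemma volume_le_of_translates {B : Set (Rd d)} (hB : MeasurableSet B) {R a b : ℝ} (hR : 0 < R)
    (haR : a ≤ R) (hb : 0 < b) (hBR : B ⊆ ball 0 R) {n : Rd d} (hn : ‖n‖ = 1)
    (hdis : ∀ w ∈ B, ∀ k : ℕ, 1 ≤ k → 8 * b * k ≤ a → w + (8 * b * k) • n ∉ B) :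
    a * volume.real B ≤ 8 * b * ((2 * R) ^ d * volume.real (ball (0 : Rd d) 1)) := by
  set N := ⌈a / (8 * b)⌉₊
  have hk : ∀ k : ℕ, k < N → 8 * b * k ≤ a := fun k hk => by
    have := Nat.lt_ceil.1 hk
    rw [lt_div_iff₀ (by positivity)] at this
    linarith
  let S : ℕ → Set (Rd d) := fun k => (fun w => w + -((8 * b * k) • n)) ⁻¹' B
  have hS : ∀ k, MeasurableSet (S k) := fun k => hB.preimage (measurable_add_const _)
  have hvol : ∀ k, volume.real (S k) = volume.real B := fun k => by
    rw [Measure.real, Measure.real, measure_preimage_add_right]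
  have hd : Set.PairwiseDisjoint (↑(Finset.range N)) S := by
    have main : ∀ i j : ℕ, i < j → j < N → Disjoint (S i) (S j) := fun i j hij hj => by
      rw [Set.disjoint_left]
      intro w hi hj'
      refine hdis _ hj' (j - i) (by omega) ?_ ?_
      · exact hk _ (by omega)
      · have : w + -((8 * b * j) • n) + (8 * b * ((j - i : ℕ) : ℝ)) • n = w + -((8 * b * i) • n) := by
          rw [Nat.cast_sub hij.le]; module
        rw [this]; exact hi
    intro i hi j hj hij
    simp only [Finset.coe_range, mem_Iio] at hi hj
    rcases lt_or_gt_of_ne hij with h | h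
    · exact main i j h hj
    · exact (main j i h hi).symm
  have hsub : (⋃ k ∈ Finset.range N, S k) ⊆ ball 0 (2 * R) := by
    refine iUnion₂_subset fun k hkN w hw => ?_
    have h1 := mem_ball_zero_iff.1 (hBR hw)
    have h2 := hk k (Finset.mem_range.1 hkN)
    have h3 := norm_add_le (w + -((8 * b * k) • n)) ((8 * b * k) • n)
    rw [neg_add_cancel_right, norm_smul, hn, norm_of_nonneg (by positivity)] at h3
    rw [mem_ball_zero_iff]
    linarith
  have hfin : ∀ k ∈ Finset.range N, volume (S k) ≠ ⊤ := fun k hkN =>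
    ((measure_mono ((subset_biUnion_of_mem (u := S) hkN).trans hsub)).trans_lt
      measure_ball_lt_top).ne
  have h1 := measureReal_biUnion_finset hd (fun k _ => hS k) hfin
  have h2 := volume_real_ball_le (by positivity) hsub
  rw [h1, Finset.sum_congr rfl fun k _ => hvol k, Finset.sum_const, Finset.card_range,
    nsmul_eq_mul] at h2
  have h3 : a / (8 * b) ≤ N := Nat.le_ceil _
  rw [div_le_iff₀ (by positivity)] at h3
  calc a * volume.real B ≤ (N * (8 * b)) * volume.real B := by gcongr
    _ = 8 * b * (N * volume.real B) := by ring
    _ ≤ _ := by gcongr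

lemma collar_volume {D : Set (Rd d)} (hd : 0 < d) (hDo : IsOpen D) (hDb : Bornology.IsBounded D)
    (hne : Dᶜ.Nonempty) (hC2 : HasC2Boundary D) {L : ℝ} (hL : 0 < L) : ∃ C ρ : ℝ, 0 ≤ C ∧ 0 < ρ ∧
    ∀ η b R, 0 < η → η < ρ → 0 < b → 0 < R → R ≤ L → (shrink D η).Nonempty →
      volume.real (collar D η b ∩ ball 0 R) ≤ C * R ^ (d - 1) * b := by
  have hcpt : IsCompact (frontier D) :=
    Metric.isCompact_of_isClosed_isBounded isClosed_frontier
      (hDb.closure.subset frontier_subset_closure)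
  set V₁ := volume.real (ball (0 : Rd d) 1)
  have hV₁ : 0 < V₁ := unitBall_pos d
  have hRd : ∀ R : ℝ, R ^ d = R ^ (d - 1) * R := fun R => by
    rw [← pow_succ, Nat.sub_add_cancel hd]
  have hfin : ∀ (B : Set (Rd d)) R, volume (B ∩ ball 0 R) ≠ ⊤ := fun B R =>
    ((measure_mono inter_subset_right).trans_lt measure_ball_lt_top).ne
  have key : ∃ C ρ : ℝ, 0 ≤ C ∧ 0 < ρ ∧ ∀ η b R, 0 < η → 0 < b → b < ρ → 0 < R → R ≤ L →
      (shrink D η).Nonempty →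
      volume.real (thickening ρ (frontier D) ∩ collar D η b ∩ ball 0 R) ≤ C * R ^ (d - 1) * b := by
    refine hcpt.induction_on (p := fun F => ∃ C ρ : ℝ, 0 ≤ C ∧ 0 < ρ ∧ ∀ η b R, 0 < η → 0 < b →
      b < ρ → 0 < R → R ≤ L → (shrink D η).Nonempty →
      volume.real (thickening ρ F ∩ collar D η b ∩ ball 0 R) ≤ C * R ^ (d - 1) * b)
      ⟨0, 1, le_rfl, one_pos, by simp⟩ ?_ ?_ fun y₀ hy₀ => ?_
    · rintro F G hFG ⟨C, ρ, hC, hρ, h⟩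
      refine ⟨C, ρ, hC, hρ, fun η b R hη hb hbρ hR hRL hn =>
        (measureReal_mono ?_ (hfin _ _)).trans (h η b R hη hb hbρ hR hRL hn)⟩
      gcongr
      exact thickening_subset_of_subset _ hFG
    · rintro F G ⟨C, ρ, hC, hρ, h⟩ ⟨C', ρ', hC', hρ', h'⟩
      refine ⟨C + C', min ρ ρ', by positivity, by positivity,
        fun η b R hη hb hbρ hR hRL hn => ?_⟩
      have e1 := h η b R hη hb (hbρ.trans_le (min_le_left _ _)) hR hRL hn
      have e2 := h' η b R hη hb (hbρ.trans_le (min_le_right _ _)) hR hRL hn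
      calc volume.real (thickening (min ρ ρ') (F ∪ G) ∩ collar D η b ∩ ball 0 R)
          ≤ volume.real ((thickening ρ F ∩ collar D η b ∩ ball 0 R) ∪
            (thickening ρ' G ∩ collar D η b ∩ ball 0 R)) := by
            rw [← union_inter_distrib_right, ← union_inter_distrib_right]
            refine measureReal_mono ?_ (hfin _ _)
            gcongr
            rw [thickening_union]
            exact union_subset_union (thickening_mono (min_le_left _ _) _)
              (thickening_mono (min_le_right _ _) _)
        _ ≤ _ := measureReal_union_le _ _
        _ ≤ _ := by linarith
    · have hy₀D : y₀ ∉ D := fun h => by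
        rw [frontier, hDo.interior_eq] at hy₀; exact hy₀.2 h
      obtain ⟨f, M, m, r₀, H⟩ := exists_localDef hDo hC2 hy₀
      obtain ⟨n, hn, r, hr, hcone⟩ := H.cone hy₀D
      set κ := min 1 (r / L)
      have hκ : 0 < κ := by positivity
      refine ⟨ball y₀ (r / 2), mem_nhdsWithin_of_mem_nhds (ball_mem_nhds _ (half_pos hr)),
        8 * 2 ^ d * V₁ / κ, r / 8, by positivity, by positivity,
        fun η b R hη hb hbρ hR hRL hnΩ => ?_⟩
      set a := κ * R
      have ha : 0 < a := by positivity
      have haR : a ≤ R := mul_le_of_le_one_left hR.le (min_le_left _ _)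
      have har : a ≤ r := by
        calc a ≤ (r / L) * L := by
              simp only [a]; gcongr; exact min_le_right _ _
          _ = r := by field_simp
      have := volume_le_of_translates
        (((isOpen_thickening.measurableSet.inter (measurableSet_collar D η b)).inter
          measurableSet_ball)) hR haR hb
        (B := thickening (r / 8) (ball y₀ (r / 2)) ∩ collar D η b ∩ ball 0 R)
        inter_subset_right hn ?_
      · rw [← mul_le_mul_iff_right₀ ha]
        refine this.trans (le_of_eq ?_)
        simp only [a]
        rw [mul_pow, hRd R]
        field_simp
        rfl
      · rintro w ⟨⟨hw1, hw2⟩, hw3⟩ k hk hka ⟨⟨-, hw4⟩, -⟩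
        apply hw4.1
        obtain ⟨x, hx, hwx⟩ := (infDist_lt_iff hnΩ).1 (hw2.2.trans_lt (by linarith : b < 2 * b))
        obtain ⟨w', hw', hww'⟩ := mem_thickening_iff.1 hw1
        have hxb : x ∈ ball y₀ r := by
          rw [mem_ball] at hw' ⊢
          have t1 := dist_triangle x w y₀
          have t2 := dist_triangle w w' y₀
          rw [dist_comm] at hwx
          linarith
        have hc := hcone x ⟨shrink_subset hη.le hx, hxb⟩ (8 * b * k) (by positivity)
          (hka.trans har)
        have hk1 : (1 : ℝ) ≤ k := by exact_mod_cast hk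
        have hl := infDist_le_infDist_add_dist (s := Dᶜ) (x := x + (8 * b * k) • n)
          (y := w + (8 * b * k) • n)
        rw [dist_add_right, dist_comm] at hl
        have := mem_shrink.1 hx
        rw [mem_shrink]
        nlinarith
  obtain ⟨C, ρ, hC, hρ, h⟩ := key
  refine ⟨C + 4 * L * V₁ / ρ, ρ / 4, by positivity, by positivity,
    fun η b R hη hηρ hb hR hRL hn => ?_⟩
  rcases lt_or_ge b (ρ / 4) with hbρ | hbρ
  · have hsub : collar D η b ∩ ball 0 R ⊆
        thickening ρ (frontier D) ∩ collar D η b ∩ ball 0 R := by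
      rintro w ⟨hw1, hw2⟩
      refine ⟨⟨?_, hw1⟩, hw2⟩
      obtain ⟨x, hx, hwx⟩ := (infDist_lt_iff hn).1 (hw1.2.trans_lt (by linarith : b < 2 * b))
      have hxD := shrink_subset hη.le hx
      rw [mem_thickening_iff]
      by_cases hwD : w ∈ D
      · obtain ⟨y, hy, hwy⟩ := exists_nearest hDo hne w
        obtain ⟨v, hv, hvf⟩ := exists_frontier_of_preconnected
          (convex_segment w y).isPreconnected (left_mem_segment ℝ w y)
          (by rwa [hDo.interior_eq]) (right_mem_segment ℝ w y) hy
        refine ⟨v, hvf, ?_⟩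
        have h1 := dist_add_dist_of_mem_segment hv
        have h2 := notMem_shrink.1 hw1.1
        linarith [dist_nonneg (x := v) (y := y)]
      · obtain ⟨v, hv, hvf⟩ := exists_frontier_of_preconnected
          (convex_segment x w).isPreconnected (left_mem_segment ℝ x w)
          (by rwa [hDo.interior_eq]) (right_mem_segment ℝ x w) hwD
        refine ⟨v, hvf, ?_⟩
        have h1 := dist_add_dist_of_mem_segment hv
        rw [dist_comm v w, dist_comm x w] at h1
        linarith [dist_nonneg (x := x) (y := v)]
    refine (measureReal_mono hsub (hfin _ _)).trans
      ((h η b R hη hb (by linarith) hR hRL hn).trans ?_)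
    gcongr
    exact le_add_of_nonneg_right (by positivity)
  · refine (volume_real_ball_le hR inter_subset_right).trans ?_
    rw [hRd R]
    calc R ^ (d - 1) * R * V₁ ≤ R ^ (d - 1) * L * V₁ := by gcongr
      _ = (4 * L * V₁ / ρ) * R ^ (d - 1) * (ρ / 4) := by field_simp
      _ ≤ (C + 4 * L * V₁ / ρ) * R ^ (d - 1) * b := by
        gcongr
        exact le_add_of_nonneg_left hC

/-- Quantitative form of a `C²` extension of the distance function near the boundary point `0`,
with gradient `e₂`, together with an interior cone direction `n`. -/
structure CornerData (D : Set (Rd d)) (e₂ n : Rd d) (φ : Rd d → ℝ) (M r : ℝ) : Prop where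
  M_pos : 1 ≤ M
  r_pos : 0 < r
  norm_n : ‖n‖ = 1
  notMem : (0 : Rd d) ∉ D
  cont : ContinuousOn φ (ball 0 r)
  eq_dist : ∀ y ∈ ball (0 : Rd d) r, y ∈ D → φ y = infDist y Dᶜ
  zero : φ 0 = 0
  grad : ∀ v, fderiv ℝ φ 0 v = ⟪e₂, v⟫
  lip : ∀ x ∈ ball (0 : Rd d) r, ∀ y ∈ ball (0 : Rd d) r,
    ‖fderiv ℝ φ x - fderiv ℝ φ y‖ ≤ M * ‖x - y‖
  taylor : ∀ x ∈ ball (0 : Rd d) r, ∀ y ∈ ball (0 : Rd d) r,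
    |φ x - φ y - fderiv ℝ φ y (x - y)| ≤ M * ‖x - y‖ ^ 2
  cone : ∀ x ∈ D ∩ ball 0 r, ∀ s, 0 ≤ s → s ≤ r → infDist x Dᶜ + s / 2 ≤ infDist (x + s • n) Dᶜ

lemma exists_cornerData {D : Set (Rd d)} (hDo : IsOpen D) (hC2 : HasC2Boundary D)
    (h0 : (0 : Rd d) ∈ frontier D) {e₂ : Rd d}
    (hgeom : ∃ U ∈ nhds (0 : Rd d), ∃ φ : Rd d → ℝ, ContDiffOn ℝ 2 φ U ∧
      (∀ y ∈ U ∩ D, φ y = Metric.infDist y Dᶜ) ∧ φ 0 = 0 ∧ gradient φ 0 = e₂) :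
    ∃ n φ M r, CornerData D e₂ n φ M r := by
  obtain ⟨U, hU, φ, hφ, hdist, hφ0, hgrad⟩ := hgeom
  have h0D : (0 : Rd d) ∉ D := fun h => by
    rw [frontier, hDo.interior_eq] at h0; exact h0.2 h
  obtain ⟨f, M₀, m, r₀, H⟩ := exists_localDef hDo hC2 h0
  obtain ⟨n, hn, r₁, hr₁, hcone⟩ := H.cone h0D
  obtain ⟨M, r₂, hM, hr₂, hT⟩ := taylor_C2 (hφ.contDiffAt hU)
  obtain ⟨r₃, hr₃, hb⟩ := Metric.mem_nhds_iff.1 hU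
  set r := min r₁ (min r₂ r₃)
  have hr1 : r ≤ r₁ := min_le_left _ _
  have hr2 : ball (0 : Rd d) r ⊆ ball 0 r₂ :=
    ball_subset_ball ((min_le_right _ _).trans (min_le_left _ _))
  have hr3 : ball (0 : Rd d) r ⊆ U :=
    (ball_subset_ball ((min_le_right _ _).trans (min_le_right _ _))).trans hb
  refine ⟨n, φ, M, r, hM, by positivity, hn, h0D, hφ.continuousOn.mono hr3,
    fun y hy hyD => hdist y ⟨hr3 hy, hyD⟩, hφ0, fun v => ?_,
    fun x hx y hy => (hT x (hr2 hx) y (hr2 hy)).1, fun x hx y hy => (hT x (hr2 hx) y (hr2 hy)).2,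
    fun x hx s hs hsr => hcone x ⟨hx.1, ball_subset_ball hr1 hx.2⟩ s hs (hsr.trans hr1)⟩
  rw [← hgrad, gradient, InnerProductSpace.toDual_symm_apply]

namespace CornerData
variable {D : Set (Rd d)} {e₂ n : Rd d} {φ : Rd d → ℝ} {M r : ℝ}

lemma cone_zero (H : CornerData D e₂ n φ M r) (h0 : (0 : Rd d) ∈ frontier D) {s : ℝ} (hs : 0 ≤ s)
    (hsr : s ≤ r) : s / 2 ≤ infDist (s • n) Dᶜ := by
  refine le_of_forall_pos_le_add fun κ hκ => ?_
  obtain ⟨x, hx, hx0⟩ := Metric.mem_closure_iff.1 h0.1 (min κ r) (lt_min hκ H.r_pos)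
  rw [dist_comm] at hx0
  have h1 := H.cone x ⟨hx, hx0.trans_le (min_le_right _ _)⟩ s hs hsr
  have h2 := infDist_le_infDist_add_dist (s := Dᶜ) (x := x + s • n) (y := s • n)
  have h3 : dist (x + s • n) (s • n) = dist x 0 := by simp
  rw [h3] at h2
  have h4 := hx0.trans_le (min_le_left κ r)
  linarith [infDist_nonneg (x := x) (s := Dᶜ)]

lemma inner_cone (H : CornerData D e₂ n φ M r) (h0 : (0 : Rd d) ∈ frontier D) :
    3 / 8 ≤ ⟪e₂, n⟫ := by
  have hM := H.M_pos
  have hr := H.r_pos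
  set s := min (r / 2) (1 / (8 * M))
  have hs : 0 < s := by positivity
  have hsr : s ≤ r / 2 := min_le_left _ _
  have hsM : s * (8 * M) ≤ 1 := (le_div_iff₀ (by positivity)).1 (min_le_right _ _)
  have h1 := H.cone_zero h0 hs.le (by linarith)
  have hns : ‖s • n‖ = s := by rw [norm_smul, H.norm_n, norm_of_nonneg hs.le, mul_one]
  have hball : s • n ∈ ball (0 : Rd d) r := by rw [mem_ball_zero_iff]; linarith
  have hmem : s • n ∈ D := by
    by_contra h
    rw [infDist_zero_of_mem (show s • n ∈ Dᶜ from h)] at h1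
    linarith
  rw [← H.eq_dist _ hball hmem] at h1
  have h2 := H.taylor _ hball 0 (mem_ball_self hr)
  rw [H.zero, sub_zero, sub_zero, H.grad, hns, real_inner_smul_right] at h2
  have h3 := (abs_le.1 h2).2
  have h4 : s * (3 / 8) ≤ s * ⟪e₂, n⟫ := by nlinarith
  exact le_of_mul_le_mul_left h4 hs

lemma zero_of_frontier (H : CornerData D e₂ n φ M r) (hDo : IsOpen D) {y : Rd d}
    (hy : y ∈ ball (0 : Rd d) r) (hfr : y ∈ frontier D) : φ y = 0 := by
  have hyD : y ∉ D := fun h => by rw [frontier, hDo.interior_eq] at hfr; exact hfr.2 h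
  have : (𝓝[D] y).NeBot := mem_closure_iff_nhdsWithin_neBot.1 hfr.1
  have h1 : Tendsto φ (𝓝[D] y) (𝓝 (φ y)) :=
    ((H.cont.continuousAt (isOpen_ball.mem_nhds hy)).tendsto).mono_left nhdsWithin_le_nhds
  have h2 : Tendsto (fun x => infDist x Dᶜ) (𝓝[D] y) (𝓝 (infDist y Dᶜ)) :=
    (continuous_infDist_pt _).continuousAt.tendsto.mono_left nhdsWithin_le_nhds
  rw [infDist_zero_of_mem (show y ∈ Dᶜ from hyD)] at h2
  refine tendsto_nhds_unique h1 (h2.congr' ?_)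
  filter_upwards [self_mem_nhdsWithin, mem_nhdsWithin_of_mem_nhds (isOpen_ball.mem_nhds hy)]
    with x hx hxb
  exact (H.eq_dist x hxb hx).symm

/-- Points leaving `0` in a direction `w` with `⟪e₂, w⟫ = 1` are deep inside `D`. -/
lemma depth (H : CornerData D e₂ n φ M r) (hDo : IsOpen D) (h0 : (0 : Rd d) ∈ frontier D) :
    ∃ t₀ > 0, ∀ t, 0 < t → t ≤ t₀ → ∀ w, ‖w‖ ≤ 2 → ⟪e₂, w⟫ = 1 →
      t / 4 ≤ infDist (t • w) Dᶜ := by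
  have hM := H.M_pos
  have hr := H.r_pos
  refine ⟨min (r / 4) (1 / (32 * M)), by positivity, fun t ht ht₀ w hw hew => ?_⟩
  have htr : t ≤ r / 4 := ht₀.trans (min_le_left _ _)
  have htM : t * (32 * M) ≤ 1 := (le_div_iff₀ (by positivity)).1 (ht₀.trans (min_le_right _ _))
  have hseg : ∀ y ∈ segment ℝ (t • n) (t • w), y ∈ ball (0 : Rd d) r ∧ t / 4 ≤ φ y := by
    rintro y ⟨a, b, ha, hb, hab, rfl⟩
    have hn : ‖a • t • n + b • t • w‖ ≤ 2 * t := by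
      refine (norm_add_le _ _).trans ?_
      rw [norm_smul, norm_smul, norm_smul, norm_smul, H.norm_n, norm_of_nonneg ha,
        norm_of_nonneg hb, norm_of_nonneg ht.le]
      nlinarith [mul_nonneg hb ht.le, mul_nonneg ha ht.le, mul_le_mul_of_nonneg_left hw
        (mul_nonneg hb ht.le)]
    have hball : a • t • n + b • t • w ∈ ball (0 : Rd d) r := by
      rw [mem_ball_zero_iff]; linarith
    refine ⟨hball, ?_⟩
    have h2 := H.taylor _ hball 0 (mem_ball_self hr)
    rw [H.zero, sub_zero, sub_zero, H.grad, inner_add_right] at h2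
    simp only [real_inner_smul_right] at h2
    rw [hew] at h2
    have h3 := (abs_le.1 h2).1
    have h4 := H.inner_cone h0
    have h5 : M * ‖a • t • n + b • t • w‖ ^ 2 ≤ M * (2 * t) ^ 2 := by gcongr
    have h6 : a * t * (3 / 8) ≤ a * t * ⟪e₂, n⟫ := by gcongr
    have h7 : M * (2 * t) ^ 2 ≤ t / 8 := by nlinarith
    have h8 : a * t + b * t = t := by rw [← add_mul, hab, one_mul]
    have h9 : 0 ≤ b * t := by positivity
    nlinarith
  have hnD : t • n ∈ D := by
    by_contra h
    have := H.cone_zero h0 ht.le (by linarith)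
    rw [infDist_zero_of_mem (show t • n ∈ Dᶜ from h)] at this
    linarith
  have hwD : t • w ∈ D := by
    by_contra h
    obtain ⟨y, hy, hfr⟩ := exists_frontier_of_preconnected
      (convex_segment (t • n) (t • w)).isPreconnected (left_mem_segment ℝ _ _)
      (by rwa [hDo.interior_eq]) (right_mem_segment ℝ _ _) h
    have := (hseg y hy).2
    rw [H.zero_of_frontier hDo (hseg y hy).1 hfr] at this
    linarith
  have := hseg _ (right_mem_segment ℝ (t • n) (t • w))
  rw [← H.eq_dist _ this.1 hwD]
  exact this.2

lemma exit_depth (H : CornerData D e₂ n φ M r) {η t : ℝ} (hη : 0 < η) {h y : Rd d}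
    (hh : ‖h‖ ≤ 2 * t) (heh : ⟪e₂, h⟫ = 0) (hyr : ‖y‖ + 2 * t < r) (hy : y ∈ shrink D η)
    (hyh : y + h ∉ shrink D η) : infDist y Dᶜ - η ≤ 6 * M * t * max ‖y‖ t := by
  have hM := H.M_pos
  have hr := H.r_pos
  have ht : 0 ≤ t := by linarith [norm_nonneg h]
  obtain ⟨q, hq, hqη⟩ : ∃ q ∈ segment ℝ y (y + h), infDist q Dᶜ = η := by
    have h1 := (convex_segment y (y + h)).isPreconnected.intermediate_value
      (right_mem_segment ℝ y _) (left_mem_segment ℝ y _) (continuous_infDist_pt Dᶜ).continuousOn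
    exact h1 ⟨notMem_shrink.1 hyh, (mem_shrink.1 hy).le⟩
  have hqD : q ∈ D := by
    by_contra h
    rw [infDist_zero_of_mem (show q ∈ Dᶜ from h)] at hqη
    exact hη.ne hqη
  have hyD := shrink_subset hη.le hy
  rw [segment_eq_image'] at hq
  obtain ⟨θ, hθ, rfl⟩ := hq
  simp only [add_sub_cancel_left] at hqη hqD
  have hθh : ‖θ • h‖ ≤ 2 * t := by
    rw [norm_smul, norm_of_nonneg hθ.1]
    exact (mul_le_of_le_one_left (norm_nonneg _) hθ.2).trans hh
  have hyb : y ∈ ball (0 : Rd d) r := by rw [mem_ball_zero_iff]; linarith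
  have hqb : y + θ • h ∈ ball (0 : Rd d) r := by
    rw [mem_ball_zero_iff]; linarith [norm_add_le y (θ • h)]
  have h1 := H.taylor _ hqb y hyb
  rw [add_sub_cancel_left, H.eq_dist _ hqb hqD, H.eq_dist _ hyb hyD, hqη] at h1
  have h2 := (fderiv ℝ φ y - fderiv ℝ φ 0).le_opNorm (θ • h)
  have h3 := H.lip y hyb 0 (mem_ball_self hr)
  rw [sub_apply, H.grad, real_inner_smul_right, heh, mul_zero, sub_zero,
    norm_eq_abs] at h2
  rw [sub_zero] at h3
  have h4 : ‖fderiv ℝ φ y - fderiv ℝ φ 0‖ * ‖θ • h‖ ≤ (M * max ‖y‖ t) * (2 * t) := by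
    gcongr
    exact h3.trans (by gcongr; exact le_max_left _ _)
  have h5 : M * ‖θ • h‖ ^ 2 ≤ M * (2 * t * (2 * max ‖y‖ t)) := by
    rw [sq]; gcongr; exact hθh.trans (by gcongr; exact le_max_right _ _)
  have h6 := (abs_le.1 h1).1
  have h7 := (abs_le.1 (h2.trans h4)).1
  nlinarith

/-- Tangential shifts of size `t` cross the boundary within depth `O(t · max |y| t)`. -/
lemma exists_shift_bound (H : CornerData D e₂ n φ M r) (hDo : IsOpen D) :
    ∃ K t₀ : ℝ, 1 ≤ K ∧ 0 < t₀ ∧ ∀ t, 0 < t → t ≤ t₀ → ∀ η, 0 < η → ∀ h : Rd d, ‖h‖ ≤ 2 * t →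
      ⟪e₂, h⟫ = 0 → ∀ y ∈ shrink D η, y + h ∉ shrink D η →
      (∃ p ∉ shrink D η, dist y p ≤ K * t * max ‖y‖ t) ∧
      infDist (y + h) (shrink D η) ≤ K * t * max ‖y‖ t := by
  have hM := H.M_pos
  have hr := H.r_pos
  have hne : Dᶜ.Nonempty := ⟨0, H.notMem⟩
  refine ⟨24 * M + 16 / r, min (min (r / 8) 1) (1 / (96 * M * (1 + r))), by
    have : 0 < 16 / r := by positivity
    linarith, by positivity,
    fun t ht ht₀ η hη h hh heh y hy hyh => ?_⟩
  have htr : t ≤ r / 8 := ht₀.trans ((min_le_left _ _).trans (min_le_left _ _))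
  have htM : t * (96 * M * (1 + r)) ≤ 1 :=
    (le_div_iff₀ (by positivity)).1 (ht₀.trans (min_le_right _ _))
  have hX : 0 < max ‖y‖ t := ht.trans_le (le_max_right _ _)
  have hdist : dist y (y + h) ≤ 2 * t := by rwa [dist_self_add_right]
  set X := max ‖y‖ t
  rcases lt_or_ge ‖y‖ (r / 8) with hyr | hyr
  · have hXr : X ≤ r / 8 := max_le hyr.le htr
    have hbase := H.exit_depth hη hh heh (by linarith) hy hyh
    constructor
    · obtain ⟨p, hp, hpd⟩ := exists_exit hDo hne hη hy
      refine ⟨p, hp, hpd.trans (hbase.trans ?_)⟩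
      gcongr
      have : 0 < 16 / r := by positivity
      linarith
    · have hyD := shrink_subset hη.le hy
      set s := 24 * M * t * X with hs
      have hs0 : 0 < s := by positivity
      have htM1 : t * (96 * M) ≤ 1 := by
        have : 0 ≤ t * (96 * M) * r := by positivity
        nlinarith
      have hsX : s ≤ X / 4 := by
        calc s = (t * (96 * M)) * (X / 4) := by rw [hs]; ring
          _ ≤ 1 * (X / 4) := by gcongr
          _ = _ := one_mul _
      have hyb : y ∈ ball (0 : Rd d) r := by rw [mem_ball_zero_iff]; linarith
      have hcone := H.cone y ⟨hyD, hyb⟩ s hs0.le (by linarith)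
      have hyη := mem_shrink.1 hy
      have hns : ‖s • n‖ = s := by rw [norm_smul, H.norm_n, norm_of_nonneg hs0.le, mul_one]
      have hys : ‖y + s • n‖ ≤ ‖y‖ + s := (norm_add_le _ _).trans (by rw [hns])
      have hmem : y + s • n + h ∈ shrink D η := by
        by_contra hcon
        have := H.exit_depth hη hh heh (y := y + s • n) (by linarith)
          (mem_shrink.2 (by linarith)) hcon
        have h2 : max ‖y + s • n‖ t ≤ X + s :=
          max_le (hys.trans (by gcongr; exact le_max_left _ _))
            (le_trans (show t ≤ X from le_max_right _ _) (by linarith))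
        have h3 : 6 * M * t * max ‖y + s • n‖ t ≤ 6 * M * t * (X + s) := by gcongr
        have h4 : 6 * M * t * s ≤ s / 16 := by nlinarith
        have h5 : 6 * M * t * X = s / 4 := by rw [hs]; ring
        nlinarith
      refine (infDist_le_dist_of_mem hmem).trans ?_
      have : dist (y + h) (y + s • n + h) = s := by
        rw [add_right_comm, dist_self_add_right, hns]
      rw [this, hs]
      gcongr
      have : 0 < 16 / r := by positivity
      linarith
  · have hb : 2 * t ≤ (24 * M + 16 / r) * t * X := by
      have h1 : r / 8 ≤ X := hyr.trans (le_max_left _ _)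
      have h2 : 16 / r * t * (r / 8) ≤ 16 / r * t * X := by gcongr
      have h3 : 16 / r * t * (r / 8) = 2 * t := by field_simp; norm_num
      have h4 : 0 ≤ 24 * M * t * X := by positivity
      nlinarith
    exact ⟨⟨y + h, hyh, hdist.trans hb⟩, (infDist_le_dist_of_mem hy).trans
      (by rw [dist_comm]; exact hdist.trans hb)⟩

end CornerData

lemma corner_geometry (hd : 2 ≤ d) {D : Set (Rd d)} (hDo : IsOpen D)
    (hDb : Bornology.IsBounded D) (hC2 : HasC2Boundary D) (h0 : (0 : Rd d) ∈ frontier D)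
    {e₁ e₂ : Rd d} (he₁ : ‖e₁‖ = 1) (he₂ : ‖e₂‖ = 1) (he : ⟪e₂, e₁⟫ = 0)
    (hgeom : ∃ U ∈ nhds (0 : Rd d), ∃ φ : Rd d → ℝ, ContDiffOn ℝ 2 φ U ∧
      (∀ y ∈ U ∩ D, φ y = Metric.infDist y Dᶜ) ∧ φ 0 = 0 ∧ gradient φ 0 = e₂) :
    ∃ s L c C₄ t₀ : ℝ, 0 < s ∧ 1 ≤ L ∧ 0 < c ∧ c ≤ 1 ∧ 1 ≤ C₄ ∧ 0 < t₀ ∧ D ⊆ ball 0 L ∧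
      ∀ t, 0 < t → t ≤ t₀ → ∃ η₀ > 0, ∀ η, 0 < η → η < η₀ →
      ∀ Ω, Ω = shrink D η → ∀ h, h = (2 * t) • e₁ → ∀ z, z = t • (e₂ - e₁) →
        Dom s L Ω ∧
        Shell (Ω ∩ {x | x + h ∈ Ω}) z t c C₄ (Ω ∩ {x | x + h ∉ Ω}) (fun x => infDist (x + h) Ω) ∧
        Shell (Ω ∩ {x | x + h ∈ Ω}) z t c C₄ ({x | x + h ∈ Ω} \ Ω) (fun x => infDist x Ω) ∧
        (∀ x ∈ Ω, x + h ∉ Ω → ∃ p ∉ Ω, dist x p ≤ C₄ * t * max ‖x‖ t) ∧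
        (∀ x, x + h ∈ Ω → x ∉ Ω → ∃ p ∉ Ω, dist (x + h) p ≤ C₄ * t * max ‖x‖ t) ∧
        ∀ x, dist x z ≤ c * t → x ∈ Ω ∧ x + h ∈ Ω := by
  obtain ⟨n, φ, M, r, H⟩ := exists_cornerData hDo hC2 h0 hgeom
  have hne : Dᶜ.Nonempty := ⟨0, H.notMem⟩
  obtain ⟨t₁, ht₁, hdepth⟩ := H.depth hDo h0
  obtain ⟨K, t₂, hK, ht₂, hshift⟩ := H.exists_shift_bound hDo
  obtain ⟨s, L₀, hs, hL₀, hdom₀⟩ := exists_dom_shrink hDo hDb hne hC2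
  obtain ⟨L₁, hL₁⟩ := hDb.subset_ball 0
  set L := max L₀ L₁
  have hL : 1 ≤ L := hL₀.trans (le_max_left _ _)
  have hdom : ∀ η, 0 < η → Dom s L (shrink D η) := fun η hη =>
    ⟨(hdom₀ η hη).meas, (hdom₀ η hη).sub.trans (ball_subset_ball (le_max_left _ _)),
      (hdom₀ η hη).ext⟩
  obtain ⟨C, ρ₀, hC, hρ₀, hvol⟩ := collar_volume (by omega) hDo hDb hne hC2
    (L := L + 1) (by linarith)
  have hp3 : 0 ≤ C * 3 ^ (d - 1) := by positivity
  set C₄ := 3 * K + C * 3 ^ (d - 1) with hC₄def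
  have hKC : K ≤ C₄ := by linarith
  have h3KC : 3 * K ≤ C₄ := by linarith
  refine ⟨s, L, 1 / 32, C₄, min (min t₁ t₂) (1 / 2), hs, hL, by norm_num, by norm_num,
    by linarith, by positivity, hL₁.trans (ball_subset_ball (le_max_right _ _)),
    fun t ht ht₀ => ⟨min ρ₀ (t / 8), by positivity, ?_⟩⟩
  rintro η hη hη₀ Ω hΩ h hh z hz
  have htt₁ : t ≤ t₁ := ht₀.trans ((min_le_left _ _).trans (min_le_left _ _))
  have htt₂ : t ≤ t₂ := ht₀.trans ((min_le_left _ _).trans (min_le_right _ _))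
  have hthalf : t ≤ 1 / 2 := ht₀.trans (min_le_right _ _)
  have hηρ : η < ρ₀ := hη₀.trans_le (min_le_left _ _)
  have hηt : η < t / 8 := hη₀.trans_le (min_le_right _ _)
  have hnh : ‖h‖ = 2 * t := by
    rw [hh, norm_smul, he₁, norm_of_nonneg (by positivity), mul_one]
  have heh : ⟪e₂, h⟫ = 0 := by rw [hh, real_inner_smul_right, he, mul_zero]
  have h22 : ⟪e₂, e₂⟫ = 1 := by rw [real_inner_self_eq_norm_sq, he₂]; norm_num
  have hz1 : ‖e₂ - e₁‖ ≤ 2 := (norm_sub_le _ _).trans (by rw [he₁, he₂]; norm_num)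
  have hz2 : ‖e₂ + e₁‖ ≤ 2 := (norm_add_le _ _).trans (by rw [he₁, he₂]; norm_num)
  have hzd : t / 4 ≤ infDist z Dᶜ := by
    rw [hz]; exact hdepth t ht htt₁ _ hz1 (by rw [inner_sub_right, h22, he, sub_zero])
  have hzh : z + h = t • (e₂ + e₁) := by rw [hz, hh]; module
  have hzhd : t / 4 ≤ infDist (z + h) Dᶜ := by
    rw [hzh]; exact hdepth t ht htt₁ _ hz2 (by rw [inner_add_right, h22, he, add_zero])
  have hzn : ‖z‖ ≤ 2 * t := by
    rw [hz, norm_smul, norm_of_nonneg ht.le]; nlinarith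
  have hdeep : ∀ x, dist x z ≤ 1 / 8 * t → x ∈ Ω ∧ x + h ∈ Ω := by
    intro x hx
    rw [dist_comm] at hx
    have e1 := infDist_le_infDist_add_dist (s := Dᶜ) (x := z) (y := x)
    have e2 := infDist_le_infDist_add_dist (s := Dᶜ) (x := z + h) (y := x + h)
    rw [dist_add_right] at e2
    rw [hΩ, mem_shrink, mem_shrink]
    constructor <;> linarith
  have hΩne : Ω.Nonempty := ⟨z, (hdeep z (by rw [dist_self]; positivity)).1⟩
  have hfar : ∀ x, x ∉ Ω ∩ {x | x + h ∈ Ω} → 1 / 32 * max ‖x‖ t ≤ dist x z := by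
    intro x hx
    have h1 : 1 / 8 * t < dist x z := by
      by_contra! hcon
      exact hx (hdeep x hcon)
    have h2 : ‖x‖ ≤ dist x z + ‖z‖ := by
      rw [dist_eq_norm]; simpa using norm_add_le (x - z) z
    rcases le_total ‖x‖ (4 * t) with h3 | h3
    · have : max ‖x‖ t ≤ 4 * t := max_le h3 (by linarith)
      linarith
    · have : max ‖x‖ t ≤ ‖x‖ := max_le le_rfl (by linarith)
      linarith
  have hD := hdom η hη
  rw [← hΩ] at hD
  have hopen : IsOpen Ω := hΩ ▸ isOpen_shrink D η
  have hA : MeasurableSet {x | x + h ∈ Ω} := hD.meas.preimage (measurable_add_const h)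
  have hmax : ∀ x : Rd d, max ‖x + h‖ t ≤ 3 * max ‖x‖ t := fun x => by
    have := norm_add_le x h
    have e1 := le_max_left ‖x‖ t
    have e2 := le_max_right ‖x‖ t
    exact max_le (by linarith) (by linarith)
  have hsh := hshift t ht htt₂ η hη
  rw [← hΩ] at hsh
  have hsh1 := hsh h hnh.le heh
  have hsh2 : ∀ x, x + h ∈ Ω → x ∉ Ω → (∃ p ∉ Ω, dist (x + h) p ≤ C₄ * t * max ‖x‖ t) ∧
      infDist x Ω ≤ C₄ * t * max ‖x‖ t := fun x hx1 hx2 => by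
    have := hsh (-h) (by rw [norm_neg, hnh]) (by rw [inner_neg_right, heh, neg_zero]) (x + h) hx1
      (by rwa [add_neg_cancel_right])
    rw [add_neg_cancel_right] at this
    have hb : K * t * max ‖x + h‖ t ≤ C₄ * t * max ‖x‖ t := by
      calc K * t * max ‖x + h‖ t ≤ K * t * (3 * max ‖x‖ t) := by gcongr; exact hmax x
        _ = (3 * K) * t * max ‖x‖ t := by ring
        _ ≤ _ := by gcongr
    obtain ⟨⟨p, hp, hpd⟩, hi⟩ := this
    exact ⟨⟨p, hp, hpd.trans hb⟩, hi.trans hb⟩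
  have hcol : ∀ ρ b, t ≤ ρ → 0 < b → volume (collar D η b ∩ ball 0 (min (3 * ρ) (L + 1))) ≤
      ofReal (C₄ * ρ ^ (d - 1) * b) := by
    intro ρ b hρ hb
    have hρ0 : 0 < ρ := ht.trans_le hρ
    have hR : 0 < min (3 * ρ) (L + 1) := by positivity
    rw [← ofReal_measureReal (h := ((measure_mono inter_subset_right).trans_lt
      measure_ball_lt_top).ne)]
    refine ofReal_le_ofReal ((hvol η b _ hη hηρ hb hR (min_le_right _ _)
      (hΩ ▸ hΩne)).trans ?_)
    calc C * min (3 * ρ) (L + 1) ^ (d - 1) * b ≤ C * (3 * ρ) ^ (d - 1) * b := by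
          gcongr; exact min_le_left _ _
      _ = (C * 3 ^ (d - 1)) * ρ ^ (d - 1) * b := by rw [mul_pow]; ring
      _ ≤ _ := by gcongr; linarith
  refine ⟨hD, ⟨hD.meas.inter hA.compl, ?_, fun x hx => hfar x fun h' => hx.2 h'.2,
    fun x _ => infDist_nonneg, fun x hx => (hsh1 x hx.1 hx.2).2.trans (by gcongr),
    fun x hx h' => hx.2 h'.2, ?_, ?_⟩, ⟨hA.diff hD.meas, ?_, fun x hx => hfar x fun h' => hx.2 h'.1,
    fun x _ => infDist_nonneg, fun x hx => (hsh2 x hx.1 hx.2).2, fun x hx h' => hx.2 h'.1,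
    ?_, ?_⟩, fun x hx hx' => ?_, fun x hx hx' => (hsh2 x hx hx').1,
    fun x hx => hdeep x (hx.trans (by nlinarith))⟩
  · exact ((continuous_infDist_pt Ω).comp (continuous_add_const h)).measurable
  · intro x _ y hy hyΩ
    have h1 := infDist_le_dist_of_mem (x := x + h) (s := Ω) (y := y + h) hyΩ.2
    rw [mem_ball, dist_comm] at hy
    rw [dist_add_right] at h1
    exact absurd hy (not_lt.2 h1)
  · intro ρ b hρ hb
    refine le_trans ?_ (hcol ρ b hρ hb)
    rw [← measure_preimage_add_right volume h (collar D η b ∩ _)]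
    refine measure_mono ?_
    rintro x ⟨⟨⟨hx1, hx2⟩, hx3⟩, hx4⟩
    have e1 := norm_add_le x h
    have e2 := mem_ball_zero_iff.1 hx3
    have e3 := mem_ball_zero_iff.1 (hD.sub hx1)
    refine ⟨⟨?_, ?_⟩, ?_⟩
    · rw [← hΩ]; exact hx2
    · rw [← hΩ]; exact hx4
    · rw [mem_ball_zero_iff]
      exact lt_min (by linarith) (by linarith)
  · exact (continuous_infDist_pt Ω).measurable
  · intro x _ y hy hyΩ
    have h1 := infDist_le_dist_of_mem (x := x) hyΩ.1
    rw [mem_ball, dist_comm] at hy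
    exact absurd hy (not_lt.2 h1)
  · intro ρ b hρ hb
    refine le_trans (measure_mono ?_) (hcol ρ b hρ hb)
    rintro x ⟨⟨⟨hx1, hx2⟩, hx3⟩, hx4⟩
    have e1 : ‖x‖ ≤ ‖x + h‖ + ‖h‖ := by simpa using norm_sub_le (x + h) h
    have e2 := mem_ball_zero_iff.1 hx3
    have e3 := mem_ball_zero_iff.1 (hD.sub hx1)
    refine ⟨⟨?_, ?_⟩, ?_⟩
    · rw [← hΩ]; exact hx2
    · rw [← hΩ]; exact hx4
    · rw [mem_ball_zero_iff]
      exact lt_min (by linarith) (by linarith)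
  · obtain ⟨p, hp, hpd⟩ := (hsh1 x hx hx').1
    exact ⟨p, hp, hpd.trans (by gcongr)⟩

lemma integrableOn_log_div : IntegrableOn (fun y : ℝ => |log y| / (1 + y ^ 2)) (Ioi 0) := by
  have hmeas : Measurable (fun y : ℝ => |log y| / (1 + y ^ 2)) := by fun_prop
  rw [← Ioc_union_Ioi_eq_Ioi zero_le_one]
  refine IntegrableOn.union ?_ ?_
  · have h1 : IntegrableOn log (Ioc 0 1) := by
      have := intervalIntegral.intervalIntegrable_log' (a := 0) (b := 1)
      rwa [intervalIntegrable_iff_integrableOn_Ioc_of_le zero_le_one] at this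
    refine h1.norm.mono' hmeas.aestronglyMeasurable (ae_of_all _ fun y => ?_)
    rw [norm_of_nonneg (by positivity)]
    exact div_le_self (abs_nonneg _) (by nlinarith [sq_nonneg y])
  · have h1 : IntegrableOn (fun y : ℝ => 2 * y ^ (-(3 / 2) : ℝ)) (Ioi 1) :=
      (integrableOn_Ioi_rpow_of_lt (by norm_num) one_pos).const_mul 2
    refine h1.mono' hmeas.aestronglyMeasurable ?_
    filter_upwards [ae_restrict_mem measurableSet_Ioi] with y hy
    have hy1 : 1 < y := hy
    rw [norm_of_nonneg (by positivity), abs_of_nonneg (Real.log_nonneg hy1.le),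
      div_le_iff₀ (by positivity)]
    have h2 := Real.log_le_rpow_div (by linarith : 0 ≤ y) (ε := 1 / 2) (by norm_num)
    have h3 : y ^ (-(3 / 2) : ℝ) * y ^ 2 = y ^ (1 / 2 : ℝ) := by
      rw [← rpow_natCast, ← Real.rpow_add (by linarith)]; norm_num
    have h4 : 0 ≤ y ^ (-(3 / 2) : ℝ) := by positivity
    nlinarith

namespace PsiSetting
variable (S : PsiSetting d)

lemma Ψ_pos_of_pos {r : ℝ} (hr : 0 < r) : 0 < S.Ψ r := by
  rcases le_total 1 r with h | h
  · exact S.Ψ_pos h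
  · have h1 := S.Ψ_mul_le hr ((one_le_inv₀ hr).2 h)
    rw [inv_mul_cancel₀ hr.ne'] at h1
    have h2 := S.Ψ_pos le_rfl
    by_contra! h3
    have : r⁻¹ * S.Ψ r ≤ 0 := mul_nonpos_of_nonneg_of_nonpos (by positivity) h3
    linarith

lemma log_Ψ_mul {r k : ℝ} (hr : 0 < r) (hk : 1 ≤ k) :
    log (S.Ψ r) ≤ log (S.Ψ (k * r)) ∧
      log (S.Ψ (k * r)) ≤ log k + log (S.Ψ r) := by
  have hkr : 0 < k * r := by positivity
  refine ⟨Real.log_le_log (S.Ψ_pos_of_pos hr) (S.Ψ_mono hr (by nlinarith)), ?_⟩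
  rw [← Real.log_mul (by linarith) (S.Ψ_pos_of_pos hr).ne']
  exact Real.log_le_log (S.Ψ_pos_of_pos hkr) (S.Ψ_mul_le hr hk)

lemma abs_log_Ψ_sub {s y : ℝ} (hs : 0 < s) (hy : 0 < y) :
    |log (S.Ψ (s * y)) - log (S.Ψ s)| ≤ |log y| := by
  rcases le_total 1 y with h | h
  · have := S.log_Ψ_mul hs h
    rw [mul_comm s y, abs_of_nonneg (by linarith), abs_of_nonneg (Real.log_nonneg h)]
    linarith
  · have := S.log_Ψ_mul (mul_pos hs hy) ((one_le_inv₀ hy).2 h)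
    rw [show y⁻¹ * (s * y) = s by field_simp, Real.log_inv] at this
    rw [abs_of_nonpos (by linarith), abs_of_nonpos (Real.log_nonpos hy.le h)]
    linarith

lemma integrableOn_inv : IntegrableOn (fun y : ℝ => 1 / (1 + y ^ 2)) (Ioi 0) := by
  simp only [one_div]
  exact integrable_inv_one_add_sq.integrableOn

lemma integral_inv : ∫ y in Ioi (0 : ℝ), 1 / (1 + y ^ 2) = π / 2 := by
  simp only [one_div]
  simp

lemma integrableOn_log_Ψ {s : ℝ} (hs : 0 < s) :
    IntegrableOn (fun y => log (S.Ψ (s * y)) / (1 + y ^ 2)) (Ioi 0) := by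
  have hc : ContinuousOn (fun y => log (S.Ψ (s * y)) / (1 + y ^ 2)) (Ioi 0) := by
    refine ContinuousOn.div ?_ (by fun_prop) fun y _ => by positivity
    refine ContinuousOn.log ?_ fun y hy => (S.Ψ_pos_of_pos (mul_pos hs hy)).ne'
    exact S.smooth.continuousOn.comp (by fun_prop) fun y hy => mul_pos hs hy
  refine ((integrableOn_inv.const_mul |log (S.Ψ s)|).add integrableOn_log_div).mono'
    (hc.aestronglyMeasurable measurableSet_Ioi) ?_
  filter_upwards [ae_restrict_mem measurableSet_Ioi] with y hy
  have h1 := S.abs_log_Ψ_sub hs hy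
  have h2 : |log (S.Ψ (s * y))| ≤ |log (S.Ψ s)| + |log y| := by
    have := abs_sub_abs_le_abs_sub (log (S.Ψ (s * y))) (log (S.Ψ s))
    linarith
  rw [norm_div, norm_eq_abs, norm_of_nonneg (by positivity : (0:ℝ) ≤ 1 + y ^ 2)]
  show _ ≤ |log (S.Ψ s)| * (1 / (1 + y ^ 2)) + |log y| / (1 + y ^ 2)
  rw [mul_one_div, ← add_div]
  gcongr

/-- The Laplace exponent of the ladder height process. -/
def ladder (s : ℝ) : ℝ :=
  exp ((1 / π) * ∫ y in Ioi (0 : ℝ), log (S.Ψ (s * y)) / (1 + y ^ 2))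

lemma ladder_mul_le {s k : ℝ} (hs : 0 < s) (hk : 1 ≤ k) :
    S.ladder (k * s) ≤ √k * S.ladder s := by
  have hks : 0 < k * s := by positivity
  have h1 : ∫ y in Ioi (0 : ℝ), log (S.Ψ (k * s * y)) / (1 + y ^ 2) ≤
      ∫ y in Ioi (0 : ℝ), (log k * (1 / (1 + y ^ 2)) +
        log (S.Ψ (s * y)) / (1 + y ^ 2)) := by
    refine setIntegral_mono_on (S.integrableOn_log_Ψ hks)
      ((integrableOn_inv.const_mul _).add (S.integrableOn_log_Ψ hs)) measurableSet_Ioi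
      fun y hy => ?_
    rw [mul_one_div, ← add_div, mul_assoc]
    gcongr
    exact (S.log_Ψ_mul (mul_pos hs hy) hk).2
  rw [integral_add (integrableOn_inv.const_mul _) (S.integrableOn_log_Ψ hs),
    integral_const_mul, integral_inv] at h1
  have h2 : √k = exp (log k / 2) := by
    rw [Real.sqrt_eq_rpow, Real.rpow_def_of_pos (by linarith)]; ring_nf
  rw [ladder, ladder, h2, ← Real.exp_add, Real.exp_le_exp]
  have hpi := Real.pi_pos
  calc _ ≤ 1 / π * _ := mul_le_mul_of_nonneg_left h1 (by positivity)
    _ = _ := by field_simp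

lemma exists_ladder_le : ∃ C > 0, ∀ s, 0 < s → S.ladder s ≤ C * √(S.Ψ s) := by
  refine ⟨exp ((1 / π) * ∫ y in Ioi (0 : ℝ), |log y| / (1 + y ^ 2)),
    exp_pos _, fun s hs => ?_⟩
  have h1 : ∫ y in Ioi (0 : ℝ), log (S.Ψ (s * y)) / (1 + y ^ 2) ≤
      ∫ y in Ioi (0 : ℝ), (log (S.Ψ s) * (1 / (1 + y ^ 2)) +
        |log y| / (1 + y ^ 2)) := by
    refine setIntegral_mono_on (S.integrableOn_log_Ψ hs)
      ((integrableOn_inv.const_mul _).add integrableOn_log_div) measurableSet_Ioi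
      fun y hy => ?_
    rw [mul_one_div, ← add_div]
    gcongr
    linarith [(abs_le.1 (S.abs_log_Ψ_sub hs hy)).2]
  rw [integral_add (integrableOn_inv.const_mul _) integrableOn_log_div,
    integral_const_mul, integral_inv] at h1
  have h2 : √(S.Ψ s) = exp (log (S.Ψ s) / 2) := by
    rw [Real.sqrt_eq_rpow, Real.rpow_def_of_pos (S.Ψ_pos_of_pos hs)]; ring_nf
  rw [ladder, h2, ← Real.exp_add, Real.exp_le_exp]
  have hpi := Real.pi_pos
  calc _ ≤ 1 / π * _ := mul_le_mul_of_nonneg_left h1 (by positivity)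
    _ = _ := by field_simp; ring

lemma renewal_ge {V : ℝ → ℝ} (hV : IsRenewal S.Ψ V) :
    ∃ c > 0, ∀ t, 0 < t → c / √(S.Ψ t⁻¹) ≤ V t := by
  obtain ⟨C, hC, hlad⟩ := S.exists_ladder_le
  have hexp : exp (-8) < 1 / 27 := by
    have h1 : exp (-8) = (exp 8)⁻¹ := Real.exp_neg 8
    have h2 : (2:ℝ) ^ 8 ≤ exp 8 := by
      have := Real.exp_one_gt_d9
      calc (2:ℝ) ^ 8 ≤ exp 1 ^ 8 := by gcongr; linarith
        _ = exp 8 := by rw [← Real.exp_nat_mul]; norm_num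
    rw [h1, inv_lt_comm₀ (by positivity) (by norm_num)]
    norm_num at h2 ⊢
    linarith
  have hlap : ∀ s, 0 < s → (∫ x in Ioi (0 : ℝ), V x * exp (-s * x)) =
      1 / (s * S.ladder s) := hV.laplace
  have hint : ∀ s, 0 < s → IntegrableOn (fun x => V x * exp (-s * x)) (Ioi 0) := by
    intro s hs
    by_contra h
    have h1 := hlap s hs
    rw [integral_undef h] at h1
    have : 0 < 1 / (s * S.ladder s) := by
      have : 0 < S.ladder s := exp_pos _
      positivity
    linarith
  refine ⟨9 * (1 / 27 - exp (-8)) / C, by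
    have : 0 < 1 / 27 - exp (-8) := by linarith
    positivity, fun t ht => ?_⟩
  have hti : 0 < t⁻¹ := inv_pos.2 ht
  set P := S.ladder t⁻¹ with hP
  have hP0 : 0 < P := exp_pos _
  have h9 : S.ladder (9 * t⁻¹) ≤ 3 * P := by
    have := S.ladder_mul_le hti (k := 9) (by norm_num)
    rwa [show √(9:ℝ) = 3 by rw [show (9:ℝ) = 3 ^ 2 by norm_num]; simp] at this
  have hL9 : 0 < S.ladder (9 * t⁻¹) := exp_pos _
  have e1 : t / (27 * P) ≤ ∫ x in Ioi (0 : ℝ), V x * exp (-(9 * t⁻¹) * x) := by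
    rw [hlap _ (by positivity), div_le_div_iff₀ (by positivity) (by positivity)]
    calc t * (9 * t⁻¹ * S.ladder (9 * t⁻¹)) = 9 * S.ladder (9 * t⁻¹) := by field_simp
      _ ≤ 1 * (27 * P) := by linarith
  have hexpint : IntegrableOn (fun x => exp (-(9 * t⁻¹) * x)) (Ioi 0) := by
    have := exp_neg_integrableOn_Ioi 0 (b := 9 * t⁻¹) (by positivity)
    exact this
  have hexpval : ∫ x in Ioi (0 : ℝ), exp (-(9 * t⁻¹) * x) = t / 9 := by
    rw [integral_exp_mul_Ioi (by simp [ht])]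
    simp
    field_simp
  have e2 : ∫ x in Ioi (0 : ℝ), V x * exp (-(9 * t⁻¹) * x) ≤
      ∫ x in Ioi (0 : ℝ), (V t * exp (-(9 * t⁻¹) * x) +
        exp (-8) * (V x * exp (-t⁻¹ * x))) := by
    refine setIntegral_mono_on (hint _ (by positivity))
      ((hexpint.const_mul _).add ((hint _ hti).const_mul _)) measurableSet_Ioi fun x hx => ?_
    have hVx := hV.nonneg x
    rcases le_total x t with h | h
    · have h1 : V x ≤ V t := hV.mono.monotoneOn hx ht h
      have h2 : V x * exp (-(9 * t⁻¹) * x) ≤ V t * exp (-(9 * t⁻¹) * x) := by gcongr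
      have h3 : 0 ≤ exp (-8) * (V x * exp (-t⁻¹ * x)) := by positivity
      linarith
    · have h1 : 1 ≤ t⁻¹ * x := by rw [← div_eq_inv_mul, one_le_div ht]; exact h
      have h2 : exp (-(9 * t⁻¹) * x) ≤ exp (-8) * exp (-t⁻¹ * x) := by
        rw [← Real.exp_add, Real.exp_le_exp]; linarith
      have h3 : V x * exp (-(9 * t⁻¹) * x) ≤
        V x * (exp (-8) * exp (-t⁻¹ * x)) := by gcongr
      have h4 : 0 ≤ V t * exp (-(9 * t⁻¹) * x) :=
        mul_nonneg (hV.nonneg t) (exp_pos _).le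
      linarith
  rw [integral_add (hexpint.const_mul _) ((hint _ hti).const_mul _), integral_const_mul,
    integral_const_mul, hexpval, hlap _ hti, ← hP] at e2
  have e3 : 9 * (1 / 27 - exp (-8)) / P ≤ V t := by
    have h1 := e1.trans e2
    rw [div_le_iff₀ hP0]
    have h2 : t / (27 * P) = (t / P) * (1 / 27) := by field_simp
    have h3 : 1 / (t⁻¹ * P) = t / P := by field_simp
    rw [h2, h3] at h1
    have h4 : (t / P) * (9 * (1 / 27 - exp (-8))) ≤ (t / P) * (V t * P) := by
      have : (t / P) * (V t * P) = V t * t := by field_simp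
      rw [this]; linarith
    exact le_of_mul_le_mul_left h4 (by positivity)
  refine le_trans ?_ e3
  rw [div_div]
  gcongr
  exact hlad _ hti

end PsiSetting

namespace Core

variable (Q : Core)

lemma sigmaFinite_m : SigmaFinite Q.m := by
  refine ⟨⟨⟨fun n => Iic 0 ∪ Ioi (1 / ((n : ℝ) + 1)), fun _ => trivial, fun n => ?_, ?_⟩⟩⟩
  · refine (measure_union_le _ _).trans_lt ?_
    rw [Q.m_nonpos, zero_add]
    exact Q.finite_Ioi (by positivity)
  · refine eq_univ_of_forall fun t => mem_iUnion.2 ?_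
    rcases le_or_gt t 0 with h | h
    · exact ⟨0, Or.inl h⟩
    · obtain ⟨n, hn⟩ := exists_nat_one_div_lt h
      exact ⟨n, Or.inr hn⟩

lemma ae_pos_m : ∀ᵐ t ∂Q.m, 0 < t := by
  rw [ae_iff]
  simpa [not_lt, Iic] using Q.m_nonpos

lemma integrable_min_m : Integrable (fun t => min 1 t) Q.m := by
  refine ⟨by fun_prop, ?_⟩
  have h := (Q.tail 1 one_pos).trans_lt ofReal_lt_top
  refine lt_of_le_of_lt (lintegral_mono_ae ?_) h
  filter_upwards [Q.ae_pos_m] with t ht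
  rw [one_pow, div_one, Real.enorm_of_nonneg (by positivity)]

/-- The contribution of the small jumps to the jump kernel. -/
def smallJ (e : ℝ) (z : Rd d) : ℝ := ∫ t in Iic e, heat t z ∂Q.m

/-- Fubini bound for the second moment of the small jumps. -/
lemma smallJ_lintegral (d : ℕ) : ∃ C : ℝ, 1 ≤ C ∧ ∀ e : ℝ,
    ∫⁻ z : Rd d, ofReal (min 1 (‖z‖ ^ 2)) * ∫⁻ t in Iic e, ofReal (heat t z) ∂Q.m ≤
      ofReal (C * ∫ t in Iic e, min 1 t ∂Q.m) := by
  obtain ⟨C, hC1, hC⟩ := heat_moment d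
  have := Q.sigmaFinite_m
  refine ⟨C, hC1, fun e => ?_⟩
  have hpos : ∀ᵐ t ∂(Q.m.restrict (Iic e)), 0 < t := ae_restrict_of_ae Q.ae_pos_m
  have hmh : Measurable fun p : ℝ × Rd d => ofReal (heat p.1 p.2) :=
    heat_measurable.ennreal_ofReal
  have hmm : Measurable fun z : Rd d => ofReal (min 1 (‖z‖ ^ 2)) := by fun_prop
  calc _ = ∫⁻ z : Rd d, ∫⁻ t in Iic e, ofReal (min 1 (‖z‖ ^ 2)) *
        ofReal (heat t z) ∂Q.m := by
        congr 1; ext z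
        rw [lintegral_const_mul]
        exact hmh.comp (measurable_id.prodMk measurable_const)
    _ = ∫⁻ t in Iic e, (∫⁻ z : Rd d, ofReal (min 1 (‖z‖ ^ 2)) *
        ofReal (heat t z)) ∂Q.m := by
        refine lintegral_lintegral_swap ?_
        exact ((hmm.comp measurable_fst).mul (hmh.comp measurable_swap)).aemeasurable
    _ ≤ ∫⁻ t in Iic e, ofReal (C * min 1 t) ∂Q.m := by
        refine lintegral_mono_ae ?_
        filter_upwards [hpos] with t ht
        have h := hC t ht 1 one_pos
        simp only [one_pow, div_one] at h
        refine le_trans (le_of_eq ?_) (ofReal_le_ofReal h)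
        have hb : BddMeas fun z : Rd d => min 1 (‖z‖ ^ 2) :=
          ⟨by fun_prop, 1, fun z => by
            rw [abs_of_nonneg (by positivity)]; exact min_le_left _ _⟩
        rw [ofReal_integral_eq_lintegral_ofReal (hb.mul_integrable (heat_integrable ht))
          (Eventually.of_forall fun z => mul_nonneg (by positivity) (heat_pos ht z).le)]
        congr 1; ext z
        rw [ofReal_mul (by positivity)]
    _ = _ := by
        rw [← integral_const_mul, ofReal_integral_eq_lintegral_ofReal]
        · exact (Q.integrable_min_m.const_mul C).restrict
        · filter_upwards [hpos] with t ht
          simp only [Pi.zero_apply]; positivity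

lemma small_moment {τ : ℝ} (hτ : 0 < τ) : ∃ e₀ : ℝ, 0 < e₀ ∧ ∀ e, e ≤ e₀ →
    ∫ t in Iic e, min 1 t ∂Q.m ≤ τ := by
  have h := tendsto_setIntegral_of_antitone (μ := Q.m) (f := fun t => min 1 t)
    (s := fun n : ℕ => Iic (1 / ((n : ℝ) + 1))) (fun n => measurableSet_Iic)
    (fun n k hnk => Iic_subset_Iic.2 (by
      have : (n : ℝ) ≤ k := by exact_mod_cast hnk
      gcongr)) ⟨0, Q.integrable_min_m.integrableOn⟩
  have h0 : ∫ t in ⋂ n : ℕ, Iic (1 / ((n : ℝ) + 1)), min 1 t ∂Q.m = 0 := by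
    refine setIntegral_measure_zero _ (measure_mono_null (fun t ht => ?_) Q.m_nonpos)
    by_contra hc
    obtain ⟨n, hn⟩ := exists_nat_one_div_lt (not_le.1 (show ¬ t ≤ 0 from hc))
    exact absurd (mem_iInter.1 ht n) (not_le.2 hn)
  rw [h0] at h
  obtain ⟨n, hn⟩ := (h.eventually_le_const hτ).exists
  refine ⟨1 / ((n : ℝ) + 1), by positivity, fun e he => le_trans ?_ hn⟩
  refine setIntegral_mono_set Q.integrable_min_m.integrableOn ?_
    (Iic_subset_Iic.2 he).eventuallyLE
  filter_upwards [ae_restrict_of_ae Q.ae_pos_m] with t ht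
  simp only [Pi.zero_apply]; positivity

/-- Replacing the full jump kernel by the truncated one. -/
lemma kernel_approx (d : ℕ) {τ : ℝ} (hτ : 0 < τ) : ∃ e₀ : ℝ, 0 < e₀ ∧ ∀ e, 0 < e → e ≤ e₀ →
    ∀ F : Rd d → ℝ, Measurable F → ∀ A : ℝ, 0 ≤ A → (∀ z, |F z| ≤ A * min 1 (‖z‖ ^ 2)) →
      |(∫ z, F z * (∫ t, heat t z ∂Q.m)) - ∫ z, F z * Q.J e z| ≤ A * τ := by
  obtain ⟨C, hC1, hC⟩ := Q.smallJ_lintegral d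
  obtain ⟨e₀, he₀, hsm⟩ := Q.small_moment (τ := τ / C) (by positivity)
  have := Q.sigmaFinite_m
  refine ⟨e₀, he₀, fun e he hee F hF A hA hFA => ?_⟩
  have hpos : ∀ᵐ t ∂(Q.m.restrict (Iic e)), 0 < t := ae_restrict_of_ae Q.ae_pos_m
  have hmz : ∀ z : Rd d, Measurable fun t => heat t z := fun z =>
    heat_measurable.comp (measurable_id.prodMk measurable_const)
  set X : Rd d → ℝ≥0∞ := fun z => ∫⁻ t in Iic e, ofReal (heat t z) ∂Q.m with hX
  have hXm : Measurable X := Measurable.lintegral_prod_left heat_measurable.ennreal_ofReal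
  have hI : ∫⁻ z : Rd d, ofReal (min 1 (‖z‖ ^ 2)) * X z ≤ ofReal τ := by
    refine (hC e).trans (ofReal_le_ofReal ?_)
    calc C * ∫ t in Iic e, min 1 t ∂Q.m ≤ C * (τ / C) := by gcongr; exact hsm e hee
      _ = τ := by field_simp
  have hk : ∀ z : Rd d, Q.smallJ e z = (X z).toReal := fun z => by
    rw [smallJ, integral_eq_lintegral_of_nonneg_ae]
    · filter_upwards [hpos] with t ht using (heat_pos ht z).le
    · exact (hmz z).aestronglyMeasurable
  have hkm : Measurable (Q.smallJ e : Rd d → ℝ) := by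
    rw [show (Q.smallJ e : Rd d → ℝ) = fun z => (X z).toReal from funext hk]
    exact hXm.ennreal_toReal
  have hfin : ∀ᵐ z : Rd d, ofReal (min 1 (‖z‖ ^ 2)) * X z < ∞ := by
    refine ae_lt_top ?_ (hI.trans_lt ofReal_lt_top).ne
    exact Measurable.mul (by fun_prop) hXm
  have hsplit : ∀ᵐ z : Rd d, F z * (∫ t, heat t z ∂Q.m) = F z * Q.J e z + F z * Q.smallJ e z := by
    filter_upwards [hfin] with z hz
    by_cases h0 : z = 0
    · have : F z = 0 := by
        have := hFA z
        simpa [h0] using this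
      simp [this]
    have hXz : X z < ∞ := by
      refine lt_top_iff_ne_top.2 fun h => ?_
      have hp : 0 < ‖z‖ := norm_pos_iff.2 h0
      rw [h, ENNReal.mul_top] at hz
      · exact lt_irrefl _ hz
      · exact (ENNReal.ofReal_pos.2 (by positivity)).ne'
    have hi1 : IntegrableOn (fun t => heat t z) (Iic e) Q.m := by
      refine ⟨(hmz z).aestronglyMeasurable, lt_of_le_of_lt (lintegral_mono_ae ?_) hXz⟩
      filter_upwards [hpos] with t ht
      rw [Real.enorm_of_nonneg (heat_pos ht z).le]
    have hi2 : IntegrableOn (fun t => heat t z) (Ioi e) Q.m := Q.heat_integrable_μ he z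
    rw [← mul_add]
    congr 1
    have hu := setIntegral_union (μ := Q.m) (Iic_disjoint_Ioi (le_refl e)) measurableSet_Ioi hi1 hi2
    rw [Iic_union_Ioi, setIntegral_univ] at hu
    rw [hu, add_comm]; rfl
  have hbd : ∫⁻ z : Rd d, ‖F z * Q.smallJ e z‖ₑ ≤ ofReal (A * τ) := by
    calc _ ≤ ∫⁻ z : Rd d, ofReal A * (ofReal (min 1 (‖z‖ ^ 2)) * X z) := by
          refine lintegral_mono fun z => ?_
          simp only
          rw [enorm_mul, ← mul_assoc, ← ofReal_mul hA]
          refine mul_le_mul' ?_ ?_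
          · rw [Real.enorm_eq_ofReal_abs]; exact ofReal_le_ofReal (hFA z)
          · rw [hk z, Real.enorm_of_nonneg ENNReal.toReal_nonneg]; exact ENNReal.ofReal_toReal_le
      _ = ofReal A * ∫⁻ z : Rd d, (ofReal (min 1 (‖z‖ ^ 2)) * X z) := by
          rw [lintegral_const_mul]
          exact Measurable.mul (by fun_prop) hXm
      _ ≤ _ := by rw [ofReal_mul hA]; gcongr
  have hFk : Integrable fun z => F z * Q.smallJ e z :=
    ⟨(hF.mul hkm).aestronglyMeasurable, hbd.trans_lt ofReal_lt_top⟩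
  have hFb : BddMeas F := ⟨hF, A, fun z => (hFA z).trans (by
    have : min 1 (‖z‖ ^ 2) ≤ 1 := min_le_left _ _
    nlinarith)⟩
  have hFJ : Integrable fun z => F z * Q.J e z := hFb.mul_integrable (Q.J_good he).int
  rw [integral_congr_ae hsplit, integral_add hFJ hFk, add_sub_cancel_left]
  rw [← norm_eq_abs, ← ENNReal.ofReal_le_ofReal_iff (by positivity), ofReal_norm]
  exact (enorm_integral_le_lintegral_enorm _).trans hbd

end Core

/-- A second-order expansion of `φ` at `x` with gradient `g`. -/
def Quad (φ : Rd d → ℝ) (x g : Rd d) (A : ℝ) : Prop :=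
  ∀ z, |φ (x + z) - φ x - ⟪g, z⟫| ≤ A * ‖z‖ ^ 2

lemma Quad.gradient_eq {φ : Rd d → ℝ} {x g : Rd d} {A : ℝ} (h : Quad φ x g A) :
    gradient φ x = g := by
  refine HasGradientAt.gradient ?_
  rw [hasGradientAt_iff_hasFDerivAt, hasFDerivAt_iff_isLittleO_nhds_zero]
  have h1 : (fun z : Rd d => φ (x + z) - φ x - (InnerProductSpace.toDual ℝ (Rd d)) g z)
      =O[𝓝 0] fun z => ‖z‖ ^ 2 := by
    refine IsBigO.of_bound A (Eventually.of_forall fun z => ?_)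
    rw [norm_eq_abs, norm_of_nonneg (by positivity)]
    simpa using h z
  refine h1.trans_isLittleO ?_
  exact isLittleO_norm_pow_id one_lt_two

lemma psiOp_approx (S : PsiSetting d) {τ : ℝ} (hτ : 0 < τ) : ∃ e₀ : ℝ, 0 < e₀ ∧
    ∀ e, 0 < e → e ≤ e₀ → ∀ φ : Rd d → ℝ, BddMeas φ → ∀ x g A B, 0 ≤ A → 0 ≤ B → Quad φ x g A →
      (∀ y, |φ y - φ x| ≤ B) →
      |psiOp S φ x - Lop (S.core.J e) φ x| ≤ (A + B) * τ := by
  obtain ⟨e₀, he₀, H⟩ := S.core.kernel_approx d hτ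
  refine ⟨e₀, he₀, fun e he hee φ hφ x g A B hA hB hq hosc => ?_⟩
  set F : Rd d → ℝ := fun z => φ x - φ (x + z) + (if ‖z‖ ≤ 1 then ⟪z, g⟫ else 0) with hF
  have hitem : Measurable fun z : Rd d => (if ‖z‖ ≤ 1 then ⟪z, g⟫ else 0 : ℝ) :=
    Measurable.ite (measurableSet_le measurable_norm measurable_const) (by fun_prop)
      measurable_const
  have hFm : Measurable F :=
    (measurable_const.sub (hφ.1.comp (by fun_prop))).add hitem
  have hFA : ∀ z, |F z| ≤ (A + B) * min 1 (‖z‖ ^ 2) := by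
    intro z
    by_cases hz : ‖z‖ ≤ 1
    · have h1 : ‖z‖ ^ 2 ≤ 1 := pow_le_one₀ (norm_nonneg _) hz
      have h2 := hq z
      simp only [hF, if_pos hz, min_eq_right h1]
      rw [real_inner_comm, ← abs_neg,
        show -(φ x - φ (x + z) + ⟪g, z⟫) = φ (x + z) - φ x - ⟪g, z⟫ by ring]
      have : 0 ≤ B * ‖z‖ ^ 2 := by positivity
      linarith
    · have h1 : 1 ≤ ‖z‖ ^ 2 := one_le_pow₀ (not_le.1 hz).le
      have h2 := hosc (x + z)
      simp only [hF, if_neg hz, min_eq_left h1, add_zero]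
      rw [abs_sub_comm]
      linarith
  have h := H e he hee F hFm (A + B) (by positivity) hFA
  have e1 : psiOp S φ x = ∫ z, F z * (∫ t, heat t z ∂S.core.m) := by
    rw [psiOp, hq.gradient_eq]; rfl
  have hJ := S.core.J_good (d := d) he
  have hit : BddMeas fun z : Rd d => (if ‖z‖ ≤ 1 then ⟪z, g⟫ else 0 : ℝ) := by
    refine ⟨hitem, ‖g‖, fun z => ?_⟩
    dsimp only
    split_ifs with hz
    · refine (abs_real_inner_le_norm _ _).trans ?_
      nlinarith [norm_nonneg g]
    · simp
  have hodd : ∫ z : Rd d, (if ‖z‖ ≤ 1 then ⟪z, g⟫ else 0 : ℝ) * S.core.J e z = 0 := by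
    have h1 := integral_neg_eq_self
      (fun z : Rd d => (if ‖z‖ ≤ 1 then ⟪z, g⟫ else 0 : ℝ) * S.core.J e z) volume
    have h2 : (fun z : Rd d => (if ‖-z‖ ≤ 1 then ⟪-z, g⟫ else 0 : ℝ) * S.core.J e (-z)) =
        fun z => -((if ‖z‖ ≤ 1 then ⟪z, g⟫ else 0 : ℝ) * S.core.J e z) := by
      ext z
      rw [hJ.even, norm_neg, inner_neg_left]
      split_ifs <;> ring
    rw [h2, integral_neg] at h1
    linarith
  have e2 : ∫ z, F z * S.core.J e z = Lop (S.core.J e) φ x := by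
    have i1 : Integrable fun z : Rd d => φ x * S.core.J e z := hJ.int.const_mul _
    have i2 := hJ.integrable_shift hφ x
    have i3 := hit.mul_integrable hJ.int
    calc ∫ z, F z * S.core.J e z = ∫ z, ((φ x * S.core.J e z - φ (x + z) * S.core.J e z) +
          (if ‖z‖ ≤ 1 then ⟪z, g⟫ else 0 : ℝ) * S.core.J e z) := by
          congr 1; ext z; simp only [hF]; ring
      _ = _ := by
          rw [integral_add (f := fun z => φ x * S.core.J e z - φ (x + z) * S.core.J e z)
            (i1.sub i2) i3, hodd, integral_sub i1 i2, integral_const_mul, Lop, convJ]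
          ring
  rwa [e1, ← e2]

/-- A smooth radially decreasing probability density supported in a ball. -/
structure Mollifier (ε : ℝ) (ρ : Rd d → ℝ) : Prop where
  good : GoodKer ρ
  smooth : ContDiff ℝ 2 ρ
  mass : ∫ z, ρ z = 1
  supp : ∀ z, ε ≤ ‖z‖ → ρ z = 0

lemma exists_mollifier {ε : ℝ} (hε : 0 < ε) : ∃ ρ : Rd d → ℝ, Mollifier ε ρ := by
  set f : Rd d → ℝ := fun z => expNegInvGlue (ε ^ 2 - ‖z‖ ^ 2) with hf
  have hfs : ContDiff ℝ 2 f := by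
    have h1 : ContDiff ℝ 2 expNegInvGlue := expNegInvGlue.contDiff (n := 2)
    exact h1.comp (contDiff_const.sub (contDiff_norm_sq ℝ))
  have h0 : ∀ z, ε ≤ ‖z‖ → f z = 0 := fun z hz =>
    expNegInvGlue.zero_of_nonpos (by nlinarith [norm_nonneg z])
  have hfn : ∀ z, 0 ≤ f z := fun z => expNegInvGlue.nonneg _
  have hsupp : HasCompactSupport f := by
    refine HasCompactSupport.intro (isCompact_closedBall (0 : Rd d) ε) fun z hz => h0 z ?_
    rw [mem_closedBall, dist_zero_right, not_le] at hz
    exact hz.le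
  have hint : Integrable f := hfs.continuous.integrable_of_hasCompactSupport hsupp
  have hpos : 0 < ∫ z, f z := by
    refine hfs.continuous.integral_pos_of_hasCompactSupport_nonneg_nonzero (x := 0) hsupp hfn ?_
    have : 0 < f 0 := expNegInvGlue.pos_of_pos (by simp; positivity)
    exact this.ne'
  refine ⟨fun z => (∫ z, f z)⁻¹ * f z, ⟨⟨fun z => ?_, ?_, hint.const_mul _, fun x y h => ?_⟩, ?_, ?_,
    fun z hz => by simp only [h0 z hz, mul_zero]⟩⟩
  · exact mul_nonneg (inv_nonneg.2 hpos.le) (hfn z)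
  · exact (hfs.continuous.const_mul _).measurable
  · refine mul_le_mul_of_nonneg_left (expNegInvGlue.monotone ?_) (inv_nonneg.2 hpos.le)
    gcongr
  · exact contDiff_const.mul hfs
  · rw [integral_const_mul]; exact inv_mul_cancel₀ hpos.ne'

namespace Mollifier

variable {ε : ℝ} {ρ : Rd d → ℝ}

lemma compact (hρ : Mollifier ε ρ) : HasCompactSupport ρ := by
  refine HasCompactSupport.intro (isCompact_closedBall (0 : Rd d) ε) fun z hz => hρ.supp z ?_
  rw [mem_closedBall, dist_zero_right, not_le] at hz
  exact hz.le

lemma quad (hρ : Mollifier ε ρ) : ∃ (G : Rd d → Rd d) (M A : ℝ), Continuous G ∧ 0 ≤ A ∧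
    (∀ y, ‖G y‖ ≤ M) ∧ ∀ y, Quad ρ y (G y) A := by
  have hd1 : ContDiff ℝ 1 (fderiv ℝ ρ) := hρ.smooth.fderiv_right (by norm_num)
  have hcs : HasCompactSupport (fderiv ℝ ρ) := hρ.compact.fderiv ℝ
  obtain ⟨C, hC⟩ := hd1.lipschitzWith_of_hasCompactSupport hcs (by norm_num)
  obtain ⟨M, hM⟩ := hd1.continuous.bounded_above_of_compact_support hcs
  refine ⟨gradient ρ, M, C, ?_, C.2, fun y => ?_, fun y z => ?_⟩
  · exact (InnerProductSpace.toDual ℝ (Rd d)).symm.continuous.comp hd1.continuous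
  · rw [gradient, LinearIsometryEquiv.norm_map]; exact hM y
  · have h := (convex_closedBall y ‖z‖).norm_image_sub_le_of_norm_hasFDerivWithin_le'
      (f := ρ) (f' := fderiv ℝ ρ) (φ := fderiv ℝ ρ y) (C := C * ‖z‖) (x := y) (y := y + z)
      (fun x _ => (hρ.smooth.differentiable (by norm_num) x).hasFDerivAt.hasFDerivWithinAt)
      (fun x hx => by
        rw [← dist_eq_norm]
        refine (hC.dist_le_mul x y).trans ?_
        have := mem_closedBall.1 hx
        gcongr)
      (mem_closedBall_self (norm_nonneg z)) (by simp)
    rw [add_sub_cancel_left, norm_eq_abs] at h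
    rw [gradient, InnerProductSpace.toDual_symm_apply]
    calc _ ≤ (C : ℝ) * ‖z‖ * ‖z‖ := h
      _ = _ := by ring

lemma conv_eq (ρ u : Rd d → ℝ) (x : Rd d) : convJ ρ u x = ∫ y, u y * ρ (y - x) := by
  rw [convJ, ← integral_add_left_eq_self (fun y => u y * ρ (y - x)) x]
  simp

lemma pole (hρ : Mollifier ε ρ) (z : Rd d) : Core.Pole z ε (fun x => ρ (x - z)) := by
  obtain ⟨M, hM⟩ := hρ.smooth.continuous.bounded_above_of_compact_support hρ.compact
  refine ⟨⟨hρ.good.meas.comp (by fun_prop), M, fun x => ?_⟩, fun x => hρ.good.nonneg _,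
    fun x hx => hρ.supp _ ?_, hρ.good.int.comp_sub_right z, ?_⟩
  · rw [← norm_eq_abs]; exact hM _
  · rw [dist_eq_norm] at hx; exact hx.le
  · rw [integral_sub_right_eq_self (fun x => ρ x) z]; exact hρ.mass

lemma conv_contDiff (hρ : Mollifier ε ρ) {u : Rd d → ℝ} (hu : Integrable u) :
    ContDiff ℝ 2 (convJ ρ u) := by
  have h := hρ.compact.contDiff_convolution_left (ContinuousLinearMap.lsmul ℝ ℝ) (n := 2)
    hρ.smooth hu.locallyIntegrable
  refine (congrArg (ContDiff ℝ 2) (funext fun x => ?_)).mpr h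
  rw [convolution_def, convJ, ← integral_neg_eq_self]
  congr 1; ext z
  rw [hρ.good.even]
  simp [sub_eq_add_neg, mul_comm]

/-- Mollified functions have uniform second-order expansions. -/
lemma conv_quad (hρ : Mollifier ε ρ) (L C₀ : ℝ) : ∃ A : ℝ, 0 ≤ A ∧ ∀ u : Rd d → ℝ,
    BddMeas u → (∀ x, 0 ≤ u x) → (∀ x, u x ≤ C₀) → (∀ x ∉ ball (0 : Rd d) L, u x = 0) →
      ∀ x, ∃ g, Quad (convJ ρ u) x g A := by
  obtain ⟨G, M, A, hG, hA, hM, hq⟩ := hρ.quad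
  set B : ℝ := ∫ _ in ball (0 : Rd d) L, |C₀|
  refine ⟨A * B, mul_nonneg hA (integral_nonneg fun _ => abs_nonneg _), fun u hu hn hC hs x => ?_⟩
  have hcI : IntegrableOn (fun _ : Rd d => |C₀|) (ball 0 L) :=
    integrableOn_const (measure_ball_lt_top.ne)
  have hui : Integrable u := by
    rw [← integrableOn_iff_integrable_of_support_subset (s := ball (0 : Rd d) L)
      (fun y hy => by by_contra h; exact hy (hs y h))]
    refine hcI.mono' hu.1.aestronglyMeasurable (Eventually.of_forall fun y => ?_)
    rw [norm_of_nonneg (hn y)]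
    exact (hC y).trans (le_abs_self _)
  have hub : ∫ y, u y ≤ B := by
    rw [← setIntegral_eq_integral_of_forall_compl_eq_zero hs]
    exact setIntegral_mono hui.integrableOn hcI fun y => (hC y).trans (le_abs_self _)
  have hGi : Integrable fun y => u y • G (y - x) := by
    refine (hui.const_mul M).mono' ?_ (Eventually.of_forall fun y => ?_)
    · exact hu.1.aestronglyMeasurable.smul (hG.comp (by fun_prop)).aestronglyMeasurable
    · rw [norm_smul, norm_of_nonneg (hn y), mul_comm]
      exact mul_le_mul_of_nonneg_right (hM _) (hn y)
  have hρi : ∀ a, Integrable fun y => u y * ρ (y - a) := fun a =>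
    hu.mul_integrable (hρ.good.int.comp_sub_right a)
  refine ⟨-∫ y, u y • G (y - x), fun z => ?_⟩
  have e1 : convJ ρ u (x + z) - convJ ρ u x - ⟪-∫ y, u y • G (y - x), z⟫ =
      ∫ y, u y * (ρ (y - x + -z) - ρ (y - x) - ⟪G (y - x), -z⟫) := by
    rw [conv_eq, conv_eq, inner_neg_left, real_inner_comm, ← integral_inner hGi,
      ← integral_sub (hρi _) (hρi _), sub_neg_eq_add,
      ← integral_add (f := fun y => u y * ρ (y - (x + z)) - u y * ρ (y - x))
        ((hρi _).sub (hρi _)) (hGi.const_inner z)]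
    congr 1; ext y
    rw [show y - (x + z) = y - x + -z by abel, inner_neg_right, inner_smul_right, real_inner_comm]
    ring
  rw [e1, ← norm_eq_abs]
  calc _ ≤ ∫ y, u y * (A * ‖z‖ ^ 2) := by
        refine norm_integral_le_of_norm_le (hui.mul_const _) (Eventually.of_forall fun y => ?_)
        rw [norm_mul, norm_of_nonneg (hn y), norm_eq_abs]
        have h := hq (y - x) (-z)
        rw [norm_neg] at h
        exact mul_le_mul_of_nonneg_left h (hn y)
    _ = (∫ y, u y) * (A * ‖z‖ ^ 2) := integral_mul_const _ _
    _ ≤ B * (A * ‖z‖ ^ 2) := by gcongr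
    _ = _ := by ring

lemma Lop_conv (hρ : Mollifier ε ρ) {J : Rd d → ℝ} (hJ : GoodKer J) {u : Rd d → ℝ} (hu : BddMeas u)
    (x : Rd d) : Lop J (convJ ρ u) x = convJ ρ (Lop J u) x := by
  have e : convJ ρ (Lop J u) x = (∫ z, J z) * convJ ρ u x - convJ ρ (convJ J u) x := by
    rw [← GoodKer.conv_const_mul, ← hρ.good.conv_sub (hu.const_mul _) (hJ.conv_bddMeas hu)]
    rfl
  rw [e, hρ.good.conv_comm hJ hu, Lop]

lemma conv_congr (hρ : Mollifier ε ρ) {f g : Rd d → ℝ} {x : Rd d}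
    (h : ∀ y ∈ ball x ε, f y = g y) : convJ ρ f x = convJ ρ g x := by
  unfold convJ
  congr 1; ext z
  rcases lt_or_ge ‖z‖ ε with hz | hz
  · rw [h (x + z) (by simpa using hz)]
  · rw [hρ.supp z hz, mul_zero, mul_zero]

lemma conv_const' (hρ : Mollifier ε ρ) (c : ℝ) (x : Rd d) : convJ ρ (fun _ => c) x = c := by
  rw [GoodKer.conv_const, hρ.mass, one_mul]

end Mollifier

/-- A smooth bounded function with a strict minimum at the origin. -/
def well (z : Rd d) : ℝ := ‖z‖ ^ 2 / (1 + ‖z‖ ^ 2)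

lemma well_contDiff : ContDiff ℝ 2 (well : Rd d → ℝ) :=
  (contDiff_norm_sq ℝ).div (contDiff_const.add (contDiff_norm_sq ℝ)) fun z => by positivity

lemma well_nonneg (z : Rd d) : 0 ≤ well z := by unfold well; positivity

lemma well_le_one (z : Rd d) : well z ≤ 1 := by
  unfold well; rw [div_le_one (by positivity)]; linarith

lemma well_le_sq (z : Rd d) : well z ≤ ‖z‖ ^ 2 := by
  unfold well; exact div_le_self (by positivity) (by nlinarith [sq_nonneg ‖z‖])

lemma well_zero : well (0 : Rd d) = 0 := by simp [well]

lemma well_pos {z : Rd d} (hz : z ≠ 0) : 0 < well z := by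
  have := norm_pos_iff.2 hz
  unfold well; positivity

/-- The test function built from a smooth function by a multiple of `well`. -/
def testFn (W : Rd d → ℝ) (x : Rd d) (θ k α : ℝ) (y : Rd d) : ℝ := θ * W y + k + α * well (y - x)

section
variable {W : Rd d → ℝ} {C₀ : ℝ}

lemma testFn_testAt (hW : ContDiff ℝ 2 W) (h0 : ∀ y, 0 ≤ W y) (h1 : ∀ y, W y ≤ C₀) (x : Rd d)
    (θ k α : ℝ) : TestAt x (testFn W x θ k α) := by
  have hs : ContDiff ℝ 2 (testFn W x θ k α) :=
    ((contDiff_const.mul hW).add contDiff_const).add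
      (contDiff_const.mul (well_contDiff.comp (contDiff_id.sub contDiff_const)))
  refine ⟨⟨|θ| * C₀ + |k| + |α|, fun y => ?_⟩, hs.continuous, univ, univ_mem, hs.contDiffOn⟩
  refine (abs_add_le _ _).trans (add_le_add ((abs_add_le _ _).trans (add_le_add ?_ le_rfl)) ?_)
  · rw [abs_mul, abs_of_nonneg (h0 y)]
    exact mul_le_mul_of_nonneg_left (h1 y) (abs_nonneg _)
  · rw [abs_mul, abs_of_nonneg (well_nonneg _)]
    exact mul_le_of_le_one_right (abs_nonneg _) (well_le_one _)

lemma testFn_value (S : PsiSetting d) {e τ : ℝ} (he : 0 < e)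
    (H : ∀ φ : Rd d → ℝ, BddMeas φ → ∀ x g A B, 0 ≤ A → 0 ≤ B → Quad φ x g A →
      (∀ y, |φ y - φ x| ≤ B) → |psiOp S φ x - Lop (S.core.J e) φ x| ≤ (A + B) * τ)
    (hW : ContDiff ℝ 2 W) (h0 : ∀ y, 0 ≤ W y) (h1 : ∀ y, W y ≤ C₀) {x g : Rd d} {A : ℝ}
    (hA : 0 ≤ A) (hC : 0 ≤ C₀) (hq : Quad W x g A) {θ k α : ℝ} (hθ : 0 ≤ θ) (hθ2 : θ ≤ 2)
    (hα : |α| ≤ 1) :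
    |psiOp S (testFn W x θ k α) x - θ * Lop (S.core.J e) W x| ≤
      (2 * A + 1 + (2 * C₀ + 1)) * τ + |α| * ∫ z : Rd d, S.core.J e z := by
  have hJ := S.core.J_good (d := d) he
  have ht := testFn_testAt hW h0 h1 x θ k α
  have hWb : BddMeas W := ⟨hW.continuous.measurable, C₀, fun y => by
    rw [abs_of_nonneg (h0 y)]; exact h1 y⟩
  have hwb : BddMeas fun y : Rd d => well (y - x) :=
    ⟨(well_contDiff.continuous.comp (by fun_prop)).measurable, 1, fun y => by
      rw [abs_of_nonneg (well_nonneg _)]; exact well_le_one _⟩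
  have hb : BddMeas (testFn W x θ k α) := ⟨ht.2.1.measurable, ht.1⟩
  have hx : testFn W x θ k α x = θ * W x + k := by simp [testFn, well_zero]
  have hval := H _ hb x (θ • g) (2 * A + 1) (2 * C₀ + 1) (by positivity) (by positivity)
    (fun z => by
      rw [hx, testFn, add_sub_cancel_left, inner_smul_left]
      simp only [conj_trivial]
      rw [show θ * W (x + z) + k + α * well z - (θ * W x + k) - θ * ⟪g, z⟫ =
        θ * (W (x + z) - W x - ⟪g, z⟫) + α * well z by ring]
      have e1 : |θ * (W (x + z) - W x - ⟪g, z⟫)| ≤ 2 * (A * ‖z‖ ^ 2) := by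
        rw [abs_mul, abs_of_nonneg hθ]
        exact mul_le_mul hθ2 (hq z) (abs_nonneg _) (by norm_num)
      have e2 : |α * well z| ≤ 1 * ‖z‖ ^ 2 := by
        rw [abs_mul, abs_of_nonneg (well_nonneg z)]
        exact mul_le_mul hα (well_le_sq z) (well_nonneg z) (by norm_num)
      calc _ ≤ _ := abs_add_le _ _
        _ ≤ 2 * (A * ‖z‖ ^ 2) + 1 * ‖z‖ ^ 2 := add_le_add e1 e2
        _ = _ := by ring)
    (fun y => by
      rw [hx, testFn, show θ * W y + k + α * well (y - x) - (θ * W x + k) =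
        θ * (W y - W x) + α * well (y - x) by ring]
      have e1 : |θ * (W y - W x)| ≤ 2 * C₀ := by
        rw [abs_mul, abs_of_nonneg hθ]
        refine mul_le_mul hθ2 ?_ (abs_nonneg _) (by norm_num)
        rw [abs_le]
        constructor <;> linarith [h0 x, h0 y, h1 x, h1 y]
      have e2 : |α * well (y - x)| ≤ 1 := by
        rw [abs_mul, abs_of_nonneg (well_nonneg _)]
        exact mul_le_one₀ hα (well_nonneg _) (well_le_one _)
      exact (abs_add_le _ _).trans (add_le_add e1 e2))
  have e3 : Lop (S.core.J e) (testFn W x θ k α) x =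
      θ * Lop (S.core.J e) W x - α * convJ (S.core.J e) (fun y => well (y - x)) x := by
    unfold testFn
    rw [hJ.Lop_add ((hWb.const_mul θ).add (BddMeas.const k)) (hwb.const_mul α),
      hJ.Lop_add (hWb.const_mul θ) (BddMeas.const k), GoodKer.Lop_const_mul,
      GoodKer.Lop_const_mul, Lop, Lop, Lop, GoodKer.conv_const, sub_self, sub_self, well_zero]
    ring
  have e4 : |convJ (S.core.J e) (fun y => well (y - x)) x| ≤ ∫ z : Rd d, S.core.J e z := by
    rw [abs_of_nonneg (hJ.conv_nonneg (fun y => well_nonneg _) x)]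
    have := hJ.conv_mono hwb (BddMeas.const 1) (fun y => well_le_one _) x
    rwa [GoodKer.conv_const, mul_one] at this
  rw [e3] at hval
  calc _ = |(psiOp S (testFn W x θ k α) x - (θ * Lop (S.core.J e) W x -
        α * convJ (S.core.J e) (fun y => well (y - x)) x)) -
        α * convJ (S.core.J e) (fun y => well (y - x)) x| := by congr 1; ring
    _ ≤ _ := abs_sub _ _
    _ ≤ _ := by
      rw [abs_mul]
      exact add_le_add hval (mul_le_mul_of_nonneg_left e4 (abs_nonneg _))

end

/-- A continuous function supported in `D` is small near the boundary of `D`. -/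
lemma small_near_boundary {D : Set (Rd d)} (hDo : IsOpen D) (hDb : Bornology.IsBounded D)
    (hne : Dᶜ.Nonempty) {u : Rd d → ℝ} (hu : Continuous u) (hext : ∀ x ∉ D, u x = 0) {ω : ℝ} (hω : 0 < ω) :
    ∃ δ > 0, ∀ x ∉ shrink D δ, |u x| ≤ ω := by
  have hK : IsCompact {x | ω ≤ |u x|} := by
    refine isCompact_of_isClosed_isBounded (isClosed_le continuous_const hu.abs) ?_
    refine hDb.subset fun x hx => ?_
    by_contra h
    have : ω ≤ |u x| := hx
    rw [hext x h, abs_zero] at this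
    linarith
  have hKD : {x | ω ≤ |u x|} ⊆ D := fun x hx => by
    by_contra h
    have : ω ≤ |u x| := hx
    rw [hext x h, abs_zero] at this
    linarith
  obtain ⟨δ, hδ, hth⟩ := hK.exists_thickening_subset_open hDo hKD
  refine ⟨δ / 2, by positivity, fun x hx => ?_⟩
  by_contra hc
  have hx' := notMem_shrink.1 hx
  obtain ⟨y, hy, hyx⟩ := (infDist_lt_iff hne).1 (lt_of_le_of_lt hx' (half_lt_self hδ))
  refine hy (hth (mem_thickening_iff.2 ⟨x, (not_le.1 hc).le, ?_⟩))
  rwa [dist_comm]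

/-- Existence of a maximum point for a continuous function nonpositive off a bounded set. -/
lemma exists_max_point {D : Set (Rd d)} (hDb : Bornology.IsBounded D) {g : Rd d → ℝ}
    (hg : Continuous g) (hoff : ∀ x ∉ D, g x ≤ 0) {x₀ : Rd d} (h0 : 0 < g x₀) :
    ∃ x ∈ D, g x₀ ≤ g x ∧ ∀ y, g y ≤ g x := by
  have hx₀ : x₀ ∈ closure D := subset_closure (by
    by_contra h; exact absurd (hoff x₀ h) (not_le.2 h0))
  obtain ⟨x, hx, hmax⟩ := hDb.isCompact_closure.exists_isMaxOn ⟨x₀, hx₀⟩ hg.continuousOn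
  have h1 : g x₀ ≤ g x := hmax hx₀
  have hxD : x ∈ D := by
    by_contra h; exact absurd (hoff x h) (not_le.2 (h0.trans_le h1))
  refine ⟨x, hxD, h1, fun y => ?_⟩
  by_cases hy : y ∈ D
  · exact hmax (subset_closure hy)
  · exact (hoff y hy).trans (h0.trans_le h1).le

/-- Viscosity solutions are uniform limits of mollified Green potentials. -/
theorem viscosity_approx (hd : 0 < d) (S : PsiSetting d) {D : Set (Rd d)} (hDo : IsOpen D)
    (hDb : Bornology.IsBounded D) (hne : Dᶜ.Nonempty) {L : ℝ} (hL : D ⊆ ball 0 L) {u : Rd d → ℝ}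
    (hsol : IsSol S D (fun _ => 0) (fun _ => 1) u) (hext : ∀ x ∉ D, u x = 0) {τ : ℝ} (hτ : 0 < τ) :
    ∃ δ > 0, ∀ η ε, 0 < ε → ε < η → η + ε ≤ δ → ∀ ρ, Mollifier ε ρ → ∃ e₀ > 0, ∀ e, 0 < e → e ≤ e₀ →
      ∀ w, S.core.IsGreen e (shrink D η) (fun _ => 1) w → ∀ x, |u x - convJ ρ w x| ≤ τ := by
  obtain ⟨⟨husc, hsub⟩, hlsc, hsup⟩ := hsol
  have hu : Continuous u := continuous_iff_lower_upperSemicontinuous.2 ⟨hlsc, husc⟩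
  obtain ⟨C₀, e₁, hC₀, he₁, hgl⟩ := S.core.isGreen_le hd L
  obtain ⟨δ, hδ, hsm⟩ := small_near_boundary hDo hDb hne hu hext (half_pos hτ)
  refine ⟨δ, hδ, fun η ε hε hεη hηε ρ hρ => ?_⟩
  obtain ⟨A, hA, hquad⟩ := hρ.conv_quad L C₀
  set κ : ℝ := min (1 / 2) (τ / (2 * C₀)) with hκ
  have hC0 : 0 < C₀ := by linarith
  have hκ0 : 0 < κ := lt_min (by norm_num) (by positivity)
  have hκ1 : κ ≤ 1 / 2 := min_le_left _ _
  have hκτ : κ * C₀ ≤ τ / 2 := by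
    calc κ * C₀ ≤ τ / (2 * C₀) * C₀ := by gcongr; exact min_le_right _ _
      _ = τ / 2 := by field_simp
  set B : ℝ := 2 * A + 1 + (2 * C₀ + 1) with hB
  have hB0 : 0 < B := by positivity
  obtain ⟨e₂, he₂, happ⟩ := psiOp_approx S (τ := κ / (4 * B)) (by positivity)
  refine ⟨min e₁ e₂, lt_min he₁ he₂, fun e he hee w hw => ?_⟩
  have hJ := S.core.J_good (d := d) he
  have hsD : shrink D η ⊆ D := shrink_subset (by linarith)
  have hwC : ∀ x, w x ≤ C₀ := fun x => by
    have := hgl he (hee.trans (min_le_left _ _)) (isOpen_shrink D η).measurableSet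
      (hsD.trans hL) hw zero_le_one (fun _ => le_rfl) x
    linarith
  have hwL : ∀ x ∉ ball (0 : Rd d) L, w x = 0 := fun x hx => hw.off x fun h => hx (hL (hsD h))
  have hquad' := hquad w hw.bm hw.nonneg hwC hwL
  set W := convJ ρ w with hWdef
  have hWs : ContDiff ℝ 2 W := hρ.conv_contDiff (hw.integrable (hsD.trans hL))
  have hW0 : ∀ y, 0 ≤ W y := hρ.good.conv_nonneg hw.nonneg
  have hW1 : ∀ y, W y ≤ C₀ := fun y => by
    have := hρ.good.conv_mono hw.bm (BddMeas.const C₀) hwC y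
    rwa [hρ.conv_const'] at this
  have hWoff : ∀ x ∉ D, W x = 0 := fun x hx => by
    rw [hWdef, hρ.conv_congr (g := fun _ => 0) fun y hy => hw.off y fun h => ?_, hρ.conv_const']
    have h1 : infDist y Dᶜ ≤ dist y x := infDist_le_dist_of_mem hx
    have h2 := mem_ball.1 hy
    have h3 := mem_shrink.1 h
    linarith
  have hLle : ∀ x, Lop (S.core.J e) W x ≤ 1 := fun x => by
    rw [hρ.Lop_conv hJ hw.bm]
    have := hρ.good.conv_mono (hJ.Lop_bddMeas hw.bm) (BddMeas.const 1)
      (hw.Lop_le he fun _ => zero_le_one) x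
    rwa [hρ.conv_const'] at this
  have hLeq : ∀ x ∈ shrink D (η + ε), Lop (S.core.J e) W x = 1 := fun x hx => by
    rw [hρ.Lop_conv hJ hw.bm, hρ.conv_congr (g := fun _ => 1) fun y hy => hw.eqn y ?_,
      hρ.conv_const']
    have h1 : infDist x Dᶜ ≤ infDist y Dᶜ + dist x y := infDist_le_infDist_add_dist
    have h2 := mem_ball'.1 hy
    have h3 := mem_shrink.1 hx
    exact mem_shrink.2 (by linarith)
  set m : ℝ := ∫ z : Rd d, S.core.J e z with hm
  have hm0 : 0 ≤ m := hJ.mass_nonneg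
  set α : ℝ := min 1 (κ / (4 * (m + 1))) with hα
  have hα0 : 0 < α := lt_min one_pos (by positivity)
  have hαm : α * m ≤ κ / 4 := by
    calc α * m ≤ κ / (4 * (m + 1)) * (m + 1) := by
          gcongr
          · exact min_le_right _ _
          · linarith
      _ = κ / 4 := by field_simp
  have hval : ∀ x θ k a, 0 ≤ θ → θ ≤ 2 → |a| = α →
      |psiOp S (testFn W x θ k a) x - θ * Lop (S.core.J e) W x| ≤ κ / 2 := by
    intro x θ k a h1 h2 ha
    obtain ⟨g, hg⟩ := hquad' x
    refine (testFn_value S he (happ e he (hee.trans (min_le_right _ _))) hWs hW0 hW1 hA hC0.le hg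
      h1 h2 (by rw [ha]; exact min_le_left _ _)).trans ?_
    rw [ha, ← hB, ← hm]
    have : B * (κ / (4 * B)) = κ / 4 := by field_simp
    linarith
  have upper : ∀ x, u x - (1 + κ) * W x ≤ τ / 2 := by
    by_contra! hc
    obtain ⟨x₀, hx₀⟩ := hc
    obtain ⟨x, hxD, hgx, hmax⟩ := exists_max_point hDb (g := fun x => u x - (1 + κ) * W x)
      (hu.sub (hWs.continuous.const_mul _)) (fun y hy => by
        simp only [hext y hy, hWoff y hy]; simp) (x₀ := x₀) (by linarith)
    have hxs : x ∈ shrink D (η + ε) := by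
      by_contra h
      have h1 := hsm x fun h' => h (mem_shrink.2 (lt_of_le_of_lt hηε (mem_shrink.1 h')))
      have h2 := mul_nonneg (by linarith : 0 ≤ 1 + κ) (hW0 x)
      linarith [le_abs_self (u x)]
    have h1 := hsub x hxD (testFn W x (1 + κ) (u x - (1 + κ) * W x) α)
      (testFn_testAt hWs hW0 hW1 _ _ _ _) (by simp [testFn, well_zero]) fun y hy => by
        have := mul_pos hα0 (well_pos (sub_ne_zero.2 hy))
        have := hmax y
        unfold testFn
        linarith
    have h2 := (abs_le.1 (hval x (1 + κ) (u x - (1 + κ) * W x) α (by linarith) (by linarith)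
      (abs_of_pos hα0))).1
    rw [hLeq x hxs] at h2
    simp only [zero_mul, add_zero] at h1
    linarith
  have lower : ∀ x, (1 - κ) * W x - u x ≤ τ / 2 := by
    by_contra! hc
    obtain ⟨x₀, hx₀⟩ := hc
    obtain ⟨x, hxD, hgx, hmax⟩ := exists_max_point hDb (g := fun x => (1 - κ) * W x - u x)
      ((hWs.continuous.const_mul _).sub hu) (fun y hy => by
        simp only [hext y hy, hWoff y hy]; simp) (x₀ := x₀) (by linarith)
    have h1 := hsup x hxD (testFn W x (1 - κ) (u x - (1 - κ) * W x) (-α))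
      (testFn_testAt hWs hW0 hW1 _ _ _ _) (by simp [testFn, well_zero]) fun y hy => by
        have := mul_pos hα0 (well_pos (sub_ne_zero.2 hy))
        have := hmax y
        unfold testFn
        linarith
    have h2 := (abs_le.1 (hval x (1 - κ) (u x - (1 - κ) * W x) (-α) (by linarith) (by linarith)
      (by rw [abs_neg, abs_of_pos hα0]))).2
    have h3 := mul_le_mul_of_nonneg_left (hLle x) (by linarith : 0 ≤ 1 - κ)
    simp only [zero_mul, add_zero] at h1
    linarith
  intro x
  have h1 := upper x
  have h2 := lower x
  have h3 : κ * W x ≤ τ / 2 := (mul_le_mul_of_nonneg_left (hW1 x) hκ0.le).trans hκτ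
  rw [abs_le]
  constructor <;> linarith

/-- The difference of the solution at the two mirrored points next to the corner. -/
theorem solution_difference (hd : 2 ≤ d) (S : PsiSetting d) {D : Set (Rd d)} (hDo : IsOpen D)
    (hDb : Bornology.IsBounded D) (hC2 : HasC2Boundary D) {u : Rd d → ℝ}
    (hsol : IsSol S D (fun _ => 0) (fun _ => 1) u) (hext : ∀ x ∉ D, u x = 0)
    (h0 : (0 : Rd d) ∈ frontier D) {e₁ e₂ : Rd d} (he₁ : ‖e₁‖ = 1) (he₂ : ‖e₂‖ = 1)
    (he : ⟪e₂, e₁⟫ = 0)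
    (hgeom : ∃ U ∈ nhds (0 : Rd d), ∃ φ : Rd d → ℝ, ContDiffOn ℝ 2 φ U ∧
      (∀ y ∈ U ∩ D, φ y = Metric.infDist y Dᶜ) ∧ φ 0 = 0 ∧ gradient φ 0 = e₂) :
    ∃ C L t₀ : ℝ, 1 ≤ C ∧ 1 ≤ L ∧ 0 < t₀ ∧ ∀ t, 0 < t → t ≤ t₀ → ∀ n : ℕ, 1 ≤ n →
      L + 1 ≤ 2 ^ n * t → 2 ^ n * t ≤ 2 * (L + 1) →
        |u (t • (e₂ - e₁)) - u (t • (e₂ - e₁) + (2 * t) • e₁)| ≤ C * n * (t * S.rate t) := by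
  have hd0 : 0 < d := by omega
  obtain ⟨s, L, c, C₄, t₀, hs, hL, hc, hc1, hC₄, ht₀, hDL, hg⟩ :=
    corner_geometry hd hDo hDb hC2 h0 he₁ he₂ he hgeom
  obtain ⟨C, hC, htor⟩ := S.core.torsion_difference hd hs hL hc hc1 hC₄
  obtain ⟨_, e₃, _, he₃, hex⟩ := S.core.exists_isGreen hd0 L
  have h0D : (0 : Rd d) ∉ D := by
    rw [hDo.frontier_eq] at h0; exact h0.2
  have hne : Dᶜ.Nonempty := ⟨0, h0D⟩
  refine ⟨C, L, min t₀ (1 / 2), hC, hL, by positivity, fun t ht htt n hn hn1 hn2 => ?_⟩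
  have ht2 : t ≤ 1 / 2 := htt.trans (min_le_right _ _)
  obtain ⟨η₀, hη₀, hg⟩ := hg t ht (htt.trans (min_le_left _ _))
  obtain ⟨e₄, ε₁, he₄, hε₁, htor⟩ := htor ht ht2
  refine le_of_forall_pos_le_add fun τ hτ => ?_
  obtain ⟨δ, hδ, happ⟩ := viscosity_approx hd0 S hDo hDb hne hDL hsol hext (half_pos hτ)
  set η := min (η₀ / 2) (δ / 2) with hη
  have hη0 : 0 < η := by positivity
  set ε := min (η / 2) (min ε₁ (c * t)) with hε
  have hε0 : 0 < ε := by positivity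
  have hεη : ε ≤ η / 2 := min_le_left _ _
  have hηδ : η ≤ δ / 2 := min_le_right _ _
  obtain ⟨hdom, hs1, hs2, hp1, hp2, hball⟩ :=
    hg η hη0 (lt_of_le_of_lt (min_le_left _ _) (half_lt_self hη₀)) _ rfl _ rfl _ rfl
  obtain ⟨ρ, hρ⟩ := exists_mollifier (d := d) hε0
  obtain ⟨e₅, he₅, happ⟩ := happ η ε hε0 (by linarith) (by linarith) ρ hρ
  set e := min e₃ (min e₄ e₅)
  have he0 : 0 < e := by positivity
  obtain ⟨w, hw, -⟩ := hex he0 (min_le_left _ _) hdom.meas hdom.sub (BddMeas.const 1)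
    (fun _ => zero_le_one) (fun _ => le_rfl)
  set h := (2 * t) • e₁ with hh
  set z := t • (e₂ - e₁) with hz
  have hhn : ‖h‖ ≤ 1 := by
    rw [hh, norm_smul, he₁, norm_of_nonneg (by positivity)]; linarith
  have hzn : ‖z‖ ≤ 2 * t := by
    rw [hz, norm_smul, norm_of_nonneg ht.le]
    have := norm_sub_le e₂ e₁
    rw [he₁, he₂] at this
    nlinarith
  have happ := happ e he0 ((min_le_right _ _).trans (min_le_right _ _)) w hw
  have hmain := htor he0 ((min_le_right _ _).trans (min_le_left _ _)) hdom (hdom.inter_shift h) hhn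
    hw (fun h' => h0D (shrink_subset hη0.le h')) hzn hs1 hs2 hp1 hp2 hε0
    ((min_le_right _ _).trans (min_le_left _ _)) (hρ.pole z)
    (fun x hx => hball x (hx.trans ((min_le_right _ _).trans (min_le_right _ _)))) hn hn1 hn2
  have hi1 : Integrable fun x => w (x + h) * ρ (x - z) :=
    (hw.bm.comp (T := fun x => x + h) (by fun_prop)).mul_integrable (hρ.pole z).int
  have hi2 : Integrable fun x => w x * ρ (x - z) := hw.bm.mul_integrable (hρ.pole z).int
  have hint : ∫ x, (w (x + h) - w x) * ρ (x - z) = convJ ρ w (z + h) - convJ ρ w z := by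
    simp only [sub_mul]
    rw [integral_sub hi1 hi2, Mollifier.conv_eq _ _ z, Mollifier.conv_eq _ _ (z + h),
      ← integral_add_right_eq_self (fun y => w y * ρ (y - (z + h))) h]
    simp only [add_sub_add_right_eq_sub]
  rw [hint] at hmain
  have h1 := abs_le.1 (happ z)
  have h2 := abs_le.1 (happ (z + h))
  have h3 := abs_le.1 hmain
  change _ ≤ C * n * (t * S.core.v t) + τ
  rw [abs_le]
  constructor <;> linarith [h1.1, h1.2, h2.1, h2.2, h3.1, h3.2]

namespace PsiSetting

variable (S : PsiSetting d)

/-- The scale function is smaller than the renewal function by a power. -/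
lemma rate_le_renewal {V : ℝ → ℝ} (hV : IsRenewal S.Ψ V) :
    ∃ C > 0, ∀ t, 0 < t → t ≤ 1 → S.rate t ≤ C * (t ^ (S.a₁ / 2) * V t) := by
  obtain ⟨c, hc, hge⟩ := S.renewal_ge hV
  have hb : 0 < S.b₁ := by linarith [S.hb₁]
  refine ⟨√S.b₁ / c, by positivity, fun t ht ht1 => ?_⟩
  have hr : 1 ≤ t⁻¹ := (one_le_inv₀ ht).2 ht1
  have hR : t⁻¹ ≤ (t ^ 2)⁻¹ := inv_anti₀ (by positivity) (by nlinarith)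
  have hpr := S.Ψ_pos hr
  have hpR := S.Ψ_pos (hr.trans hR)
  have h1 := S.scaling_lower _ _ hr hR
  rw [show (t ^ 2)⁻¹ / t⁻¹ = t⁻¹ by field_simp, Real.inv_rpow ht.le, le_div_iff₀ hpr] at h1
  have hta : 0 < t ^ S.a₁ := Real.rpow_pos_of_pos ht _
  have h2 : S.Ψ t⁻¹ ≤ S.b₁ * t ^ S.a₁ * S.Ψ (t ^ 2)⁻¹ := by
    calc S.Ψ t⁻¹ = S.b₁ * t ^ S.a₁ * (1 / S.b₁ * (t ^ S.a₁)⁻¹ * S.Ψ t⁻¹) := by field_simp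
      _ ≤ _ := by gcongr
  have hhalf : √(t ^ S.a₁) = t ^ (S.a₁ / 2) := by
    rw [Real.sqrt_eq_rpow, ← rpow_mul ht.le]; congr 1; ring
  have h3 := Real.sqrt_le_sqrt h2
  rw [Real.sqrt_mul (by positivity), Real.sqrt_mul hb.le, hhalf] at h3
  have h4 := hge t ht
  have h5 := sqrt_pos.2 hpr
  have h6 := sqrt_pos.2 hpR
  rw [rate, max_eq_left (hr.trans hR)]
  calc (√(S.Ψ (t ^ 2)⁻¹))⁻¹ ≤ √S.b₁ * t ^ (S.a₁ / 2) / √(S.Ψ t⁻¹) := by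
        rw [inv_eq_one_div, div_le_div_iff₀ h6 h5, one_mul]; exact h3
    _ = √S.b₁ / c * (t ^ (S.a₁ / 2) * (c / √(S.Ψ t⁻¹))) := by field_simp
    _ ≤ _ := by gcongr

end PsiSetting

/-- The number of dyadic scales between `t` and a fixed size grows logarithmically. -/
lemma exists_dyadic_log {B t : ℝ} (ht : 0 < t) (htB : t < B) :
    ∃ n : ℕ, 1 ≤ n ∧ B ≤ 2 ^ n * t ∧ 2 ^ n * t ≤ 2 * B ∧
      (n : ℝ) ≤ (log (2 * B) - log t) / log 2 := by
  have hB : 0 < B := ht.trans htB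
  have hex : ∃ n : ℕ, B ≤ 2 ^ n * t := by
    obtain ⟨n, hn⟩ := pow_unbounded_of_one_lt (B / t) (one_lt_two (α := ℝ))
    exact ⟨n, by rw [div_lt_iff₀ ht] at hn; exact hn.le⟩
  classical
  have hn1 := Nat.find_spec hex
  set n := Nat.find hex with hn
  have hpos : 1 ≤ n := by
    by_contra h
    rw [show n = 0 by omega, pow_zero, one_mul] at hn1
    linarith
  have hup : 2 ^ n * t ≤ 2 * B := by
    have h := Nat.find_min hex (m := n - 1) (by omega)
    obtain ⟨k, hk⟩ : ∃ k, n = k + 1 := ⟨n - 1, by omega⟩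
    rw [hk, Nat.add_sub_cancel, not_le] at h
    rw [hk, pow_succ]
    linarith
  refine ⟨n, hpos, hn1, hup, ?_⟩
  have hl2 : 0 < log 2 := Real.log_pos one_lt_two
  rw [le_div_iff₀ hl2, le_sub_iff_add_le, ← Real.log_pow, ← Real.log_mul (by positivity) ht.ne']
  exact Real.log_le_log (by positivity) hup

/-- Logarithms are dominated by powers at the origin. -/
lemma tendsto_log_mul_power (A B : ℝ) {β : ℝ} (hβ : 0 < β) :
    Tendsto (fun t : ℝ => A * ((B - log t) * t ^ β)) (𝓝[>] 0) (𝓝 0) := by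
  have h1 := tendsto_log_mul_rpow_nhdsGT_zero hβ
  have h2 : Tendsto (fun t : ℝ => t ^ β) (𝓝[>] 0) (𝓝 0) := by
    have := (Real.continuousAt_rpow_const 0 β (Or.inr hβ.le)).tendsto
    rw [Real.zero_rpow hβ.ne'] at this
    exact this.mono_left nhdsWithin_le_nhds
  have h3 := ((h2.const_mul B).sub h1).const_mul A
  simp only [mul_zero, sub_zero] at h3
  refine h3.congr fun t => ?_
  ring

end

/-- **Lemma 3.5** (decay at a corner point on the symmetry hyperplane): in
Situation 2 of the moving plane method for the overdetermined problem
`Ψ(−Δ)u = 1` in `D`, `u = 0` outside, `tr_V u = c` on `∂D`, normalized so that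
`0 ∈ ∂D`, the hyperplane `{x₁ = 0}` is orthogonal to `∂D` at `0` and `e₂` is
the interior unit normal there (encoded through a C² extension of the distance
function `δ_D` near `0` with gradient `e₂` at `0`), the antisymmetric function
`v = u − u∘R` satisfies `v(tη̄) = o(V(t)·t)` as `t → 0⁺`, where
`η̄ = e₂ − e₁`. -/
theorem corner_point_decay
    {d : ℕ} (hd : 2 ≤ d) (S : PsiSetting d) (hker : S.kernelCond)
    (V : ℝ → ℝ) (hV : IsRenewal S.Ψ V)
    (D : Set (Rd d)) (hDo : IsOpen D) (hDb : Bornology.IsBounded D)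
    (hC2 : HasC2Boundary D)
    (u : Rd d → ℝ) (hsol : IsSol S D (fun _ => 0) (fun _ => 1) u)
    (hext : ∀ x ∉ D, u x = 0)
    (c : ℝ) (htr : ∀ x ∈ frontier D, HasVTrace V D u x c)
    (e₁ e₂ : Rd d)
    (he₁ : e₁ = EuclideanSpace.single (⟨0, by omega⟩ : Fin d) (1 : ℝ))
    (he₂ : e₂ = EuclideanSpace.single (⟨1, by omega⟩ : Fin d) (1 : ℝ))
    (h0 : (0 : Rd d) ∈ frontier D)
    (hgeom : ∃ U ∈ nhds (0 : Rd d), ∃ φ : Rd d → ℝ, ContDiffOn ℝ 2 φ U ∧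
      (∀ y ∈ U ∩ D, φ y = Metric.infDist y Dᶜ) ∧ φ 0 = 0 ∧
      gradient φ 0 = e₂) :
    (fun t : ℝ => u (t • (e₂ - e₁)) - u (reflAt e₁ 0 (t • (e₂ - e₁))))
      =o[nhdsWithin 0 (Set.Ioi 0)] (fun t : ℝ => V t * t) := by
  have hn₁ : ‖e₁‖ = 1 := by rw [he₁]; simp
  have hn₂ : ‖e₂‖ = 1 := by rw [he₂]; simp
  have hin : ⟪e₂, e₁⟫ = (0 : ℝ) := by
    rw [he₁, he₂]; simp [EuclideanSpace.inner_single_left]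
  obtain ⟨C, L, t₀, hC, hL, ht₀, hdiff⟩ :=
    solution_difference hd S hDo hDb hC2 hsol hext h0 hn₁ hn₂ hin hgeom
  obtain ⟨C', hC', hrate⟩ := S.rate_le_renewal hV
  have hl2 : 0 < Real.log 2 := Real.log_pos one_lt_two
  have hlim := tendsto_log_mul_power (C * C' / Real.log 2) (Real.log (2 * (L + 1)))
    (half_pos S.ha₁)
  refine isLittleO_iff.2 fun κ hκ => ?_
  filter_upwards [hlim.eventually_le_const hκ, self_mem_nhdsWithin,
    mem_nhdsWithin_of_mem_nhds (Iio_mem_nhds ht₀),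
    mem_nhdsWithin_of_mem_nhds (Iio_mem_nhds one_pos)] with t hsmall ht htt ht1
  replace ht : 0 < t := ht
  replace htt : t < t₀ := htt
  replace ht1 : t < 1 := ht1
  obtain ⟨n, hn, hn1, hn2, hnlog⟩ := exists_dyadic_log (B := L + 1) ht (by linarith)
  have hVt := hV.nonneg t
  have hβ : 0 < t ^ (S.a₁ / 2) := Real.rpow_pos_of_pos ht _
  have hrefl : reflAt e₁ 0 (t • (e₂ - e₁)) = t • (e₂ - e₁) + (2 * t) • e₁ := by
    have : ⟪t • (e₂ - e₁), e₁⟫ = -t := by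
      rw [inner_smul_left, inner_sub_left, hin, real_inner_self_eq_norm_sq, hn₁]
      simp
    rw [reflAt, this, mul_zero, sub_zero, sub_eq_add_neg, ← neg_smul]
    congr 2; ring
  rw [hrefl, Real.norm_eq_abs, Real.norm_of_nonneg (mul_nonneg hVt ht.le)]
  calc _ ≤ C * n * (t * S.rate t) := hdiff t ht htt.le n hn hn1 hn2
    _ ≤ C * ((Real.log (2 * (L + 1)) - Real.log t) / Real.log 2) *
        (t * (C' * (t ^ (S.a₁ / 2) * V t))) := by
        have hr := hrate t ht ht1.le
        have hC0 : 0 ≤ C * ((Real.log (2 * (L + 1)) - Real.log t) / Real.log 2) :=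
          mul_nonneg (by positivity) ((Nat.cast_nonneg n).trans hnlog)
        have hrp := S.rate_pos (r := t)
        gcongr
    _ = C * C' / Real.log 2 * ((Real.log (2 * (L + 1)) - Real.log t) * t ^ (S.a₁ / 2)) *
        (V t * t) := by ring
    _ ≤ _ := mul_le_mul_of_nonneg_right hsmall (mul_nonneg hVt ht.le)
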